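/- Fix 1 ≤ p < 2, ε ∈ (0,1), and 0 < T ≤ 1/4. Set C₀ = 2¹², γ = min{4/(3p) − 2/3, 2ε/3, 1/24}, σ = γ/16, b = 4C₀/σ, β = 1/b³, α = β/16, and for a sufficiently large integer a, λ_q = ⌈a^{b^q}⌉, τ_q = T λ_q^{−15}, δ_q = λ₂^{3β} λ_q^{−2β}. Let (v⁽¹⁾,b⁽¹⁾), (v⁽²⁾,b⁽²⁾) be smooth solutions of the MHD system on [0,1]×𝕋³ with mean-free data, and suppose (v_q,b_q,p_q,ℛ_q,ℳ_q) is a smooth solution of the relaxed MHD system on [0,1]×𝕋³ with ℛ_q symmetric trace-free, ℳ_q skew-symmetric, satisfying: ‖(v_q,b_q)‖_{L²_{t,x}} + ‖(v_q,b_q)‖_{L^p_tL^∞_x} + ‖(v_q,b_q)‖_{L¹_tC^{1−ε}_x} ≤ Σ_{i=1}^q δ_i^{1/2}; ‖(v_q,b_q)‖_{L^∞_tH³_x} ≤ λ_q⁶; ‖(ℛ_q,ℳ_q)‖_{L^∞_tH³_x} ≤ λ_q⁶; ‖(ℛ_q,ℳ_q)‖_{L¹_{t,x}} ≤ δ_{q+1}λ_q^{−6α};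 and (v_q,b_q) ≡ (v⁽¹⁾,b⁽¹⁾) on [0, 2T+2τ_q], (v_q,b_q) ≡ (v⁽²⁾,b⁽²⁾) on [3T−τ_q, 1]. Then there exists a smooth solution (v_{q+1},b_{q+1},p_{q+1},ℛ_{q+1},ℳ_{q+1}) of the relaxed MHD system with the same initial data, satisfying all the above estimates with q replaced by q+1, and ‖(v_{q+1}−v_q, b_{q+1}−b_q)‖_{L²_{t,x}} + ‖(v_{q+1}−v_q, b_{q+1}−b_q)‖_{L^p_tL^∞_x} + ‖(v_{q+1}−v_q, b_{q+1}−b_q)‖_{L¹_tC^{1−ε}_x} ≤ δ_{q+1}^{1/2}. -/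

import Mathlib

open MeasureTheory Real Set ENNReal

noncomputable section

abbrev V3 := Fin 3 → ℝ
abbrev Mat3 := Fin 3 → Fin 3 → ℝ

/-- A fundamental domain for the torus `𝕋³ = ℝ³/ℤ³`. -/
def cube : Set V3 := Set.Icc 0 1

/-- Lebesgue measure on the torus. -/
def μc : Measure V3 := volume.restrict cube

/-- Lebesgue measure on the time interval `[0,1]`. -/
def μT : Measure ℝ := volume.restrict (Icc (0:ℝ) 1)

/-- `ℤ³`-periodicity: a function on `ℝ³` descends to the torus. -/
def SpacePeriodic {E : Type*} (f : V3 → E) : Prop :=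
  ∀ (x : V3) (n : Fin 3 → ℤ), f (x + fun i => (n i : ℝ)) = f x

/-- Partial derivative `∂ᵢ f`. -/
def pd (i : Fin 3) (f : V3 → ℝ) (x : V3) : ℝ := fderiv ℝ f x (Pi.single i 1)

/-- Iterated partial derivative along a list of directions. -/
def pdList : List (Fin 3) → (V3 → ℝ) → V3 → ℝ
  | [], f => f
  | i :: l, f => pd i (pdList l f)

/-- Laplacian `Δ f`. -/
def lap (f : V3 → ℝ) (x : V3) : ℝ := ∑ i, pd i (pd i f) x

/-- Divergence of a vector field. -/
def divV (v : V3 → V3) (x : V3) : ℝ := ∑ i, pd i (fun y => v y i) x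

/-- Tensor product of vectors: `(u ⊗ w)_{ij} = u_j w_i`. -/
def tens (u w : V3) : Mat3 := fun i j => u j * w i

/-- Divergence of a matrix field: `(div M)_i = ∂_j M_{ji}`. -/
def divM (M : V3 → Mat3) (x : V3) (i : Fin 3) : ℝ := ∑ j, pd j (fun y => M y j i) x

/-- Joint smoothness of a time-dependent field. -/
def SmoothTS {E : Type*} [NormedAddCommGroup E] [NormedSpace ℝ E] (u : ℝ → V3 → E) : Prop :=
  ContDiff ℝ (⊤ : ℕ∞) (fun q : ℝ × V3 => u q.1 q.2)

/-- Time derivative of a time-dependent vector field, componentwise. -/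
def tder (u : ℝ → V3 → V3) (t : ℝ) (x : V3) (i : Fin 3) : ℝ := deriv (fun s => u s x i) t

/-- The relaxed MHD system with Reynolds stress `R` and magnetic stress `M`. -/
def IsRelaxedMHDOn (S : Set ℝ) (v b : ℝ → V3 → V3) (p : ℝ → V3 → ℝ)
    (R M : ℝ → V3 → Mat3) : Prop :=
  ∀ t ∈ S, ∀ x : V3,
    (∀ i, tder v t x i - lap (fun y => v t y i) x
        + divM (fun y => tens (v t y) (v t y)) x i + pd i (p t) x
        = divM (fun y => tens (b t y) (b t y)) x i + divM (R t) x i) ∧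
    (∀ i, tder b t x i - lap (fun y => b t y i) x
        + divM (fun y => tens (v t y) (b t y)) x i
        = divM (fun y => tens (b t y) (v t y)) x i + divM (M t) x i) ∧
    divV (v t) x = 0 ∧ divV (b t) x = 0

/-- The MHD system (the relaxed system with vanishing stresses). -/
def IsMHDOn (S : Set ℝ) (v b : ℝ → V3 → V3) (p : ℝ → V3 → ℝ) : Prop :=
  ∀ t ∈ S, ∀ x : V3,
    (∀ i, tder v t x i - lap (fun y => v t y i) x
        + divM (fun y => tens (v t y) (v t y)) x i + pd i (p t) x
        = divM (fun y => tens (b t y) (b t y)) x i) ∧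
    (∀ i, tder b t x i - lap (fun y => b t y i) x
        + divM (fun y => tens (v t y) (b t y)) x i
        = divM (fun y => tens (b t y) (v t y)) x i) ∧
    divV (v t) x = 0 ∧ divV (b t) x = 0

/-- A smooth (strong) solution of the MHD system on the time set `S`. -/
def IsSmoothMHDOn (S : Set ℝ) (v b : ℝ → V3 → V3) (p : ℝ → V3 → ℝ) : Prop :=
  SmoothTS v ∧ SmoothTS b ∧ SmoothTS p ∧
  (∀ t, SpacePeriodic (v t) ∧ SpacePeriodic (b t) ∧ SpacePeriodic (p t)) ∧
  IsMHDOn S v b p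

/-- A smooth solution of the relaxed MHD system on `[0,1]`, with symmetric trace-free
Reynolds stress and skew-symmetric magnetic stress. -/
def IsSmoothRelaxed (v b : ℝ → V3 → V3) (p : ℝ → V3 → ℝ) (R M : ℝ → V3 → Mat3) : Prop :=
  SmoothTS v ∧ SmoothTS b ∧ SmoothTS p ∧ SmoothTS R ∧ SmoothTS M ∧
  (∀ t, SpacePeriodic (v t) ∧ SpacePeriodic (b t) ∧ SpacePeriodic (p t) ∧
    SpacePeriodic (R t) ∧ SpacePeriodic (M t)) ∧
  IsRelaxedMHDOn (Icc (0:ℝ) 1) v b p R M ∧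
  (∀ t x, (∀ i j, R t x i j = R t x j i) ∧ (∑ i, R t x i i) = 0) ∧
  (∀ t x, ∀ i j, M t x i j = - M t x j i)

/-- The `L^∞(𝕋³)` norm. -/
def LinfN {E : Type*} [NormedAddCommGroup E] (f : V3 → E) : ℝ := (eLpNorm f ⊤ μc).toReal

/-- The space-time `L²` norm on `[0,1] × 𝕋³`. -/
def nL2tx (u : ℝ → V3 → V3) : ℝ :=
  (eLpNorm (fun q : ℝ × V3 => u q.1 q.2) 2 (μT.prod μc)).toReal

/-- The `L^p_t L^∞_x` norm on `[0,1] × 𝕋³`. -/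
def nLpLinf (p : ℝ) (u : ℝ → V3 → V3) : ℝ :=
  (eLpNorm (fun t => LinfN (u t)) (ENNReal.ofReal p) μT).toReal

/-- The Hölder norm `‖f‖_{C^a} = ‖f‖_{L^∞} + sup_{x≠y} |f(x)−f(y)|/|x−y|^a`. -/
def holderNorm (a : ℝ) (f : V3 → V3) : ℝ :=
  (⨆ x : V3, ‖f x‖) +
    ⨆ q : V3 × V3, if q.1 = q.2 then 0 else ‖f q.1 - f q.2‖ / ‖q.1 - q.2‖ ^ a

/-- The `L¹_t C^{1−ε}_x` norm on `[0,1] × 𝕋³`. -/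
def nL1C (ε : ℝ) (u : ℝ → V3 → V3) : ℝ := ∫ t in Icc (0:ℝ) 1, holderNorm (1 - ε) (u t)

/-- The squared `H³(𝕋³)` norm of a scalar function. -/
def H3sq (f : V3 → ℝ) : ℝ :=
  ∑ n ∈ Finset.range 4, ∑ α : Fin n → Fin 3, ∫ x in cube, (pdList (List.ofFn α) f x) ^ 2

/-- The `H³(𝕋³)` norm of a vector field. -/
def H3v (v : V3 → V3) : ℝ := Real.sqrt (∑ i, H3sq (fun x => v x i))

/-- The `H³(𝕋³)` norm of a matrix field. -/
def H3m (R : V3 → Mat3) : ℝ := Real.sqrt (∑ i, ∑ j, H3sq (fun x => R x i j))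

/-- The `L^∞_t H³_x` norm of a vector field on `[0,1] × 𝕋³`. -/
def nLinfH3v (u : ℝ → V3 → V3) : ℝ := ⨆ t : Icc (0:ℝ) 1, H3v (u t)

/-- The `L^∞_t H³_x` norm of a matrix field on `[0,1] × 𝕋³`. -/
def nLinfH3m (u : ℝ → V3 → Mat3) : ℝ := ⨆ t : Icc (0:ℝ) 1, H3m (u t)

/-- The space-time `L¹` norm of a matrix field on `[0,1] × 𝕋³`. -/
def nL1tx (u : ℝ → V3 → Mat3) : ℝ := ∫ t in Icc (0:ℝ) 1, ∫ x in cube, ‖u t x‖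

/-! Parameters of the convex integration scheme. -/

def C₀ : ℝ := 2 ^ (12 : ℕ)

/-- `γ = min{4/(3p) − 2/3, 2ε/3, 1/24}`. -/
def gamP (p ε : ℝ) : ℝ := min (4 / (3 * p) - 2 / 3) (min (2 * ε / 3) (1 / 24))

/-- `σ = γ/16`. -/
def sigP (p ε : ℝ) : ℝ := gamP p ε / 16

/-- `b = 4C₀/σ`. -/
def bP (p ε : ℝ) : ℝ := 4 * C₀ / sigP p ε

/-- `β = 1/b³`. -/
def betP (p ε : ℝ) : ℝ := 1 / (bP p ε) ^ (3 : ℕ)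

/-- `α = β/16`. -/
def alpP (p ε : ℝ) : ℝ := betP p ε / 16

/-- `λ_q = ⌈a^{b^q}⌉`. -/
def lamP (a : ℕ) (p ε : ℝ) (q : ℕ) : ℝ := (⌈(a : ℝ) ^ ((bP p ε) ^ q)⌉ : ℤ)

/-- `τ_q = T λ_q^{−15}`. -/
def tauP (T : ℝ) (a : ℕ) (p ε : ℝ) (q : ℕ) : ℝ := T * lamP a p ε q ^ (-(15 : ℝ))

/-- `δ_q = λ₂^{3β} λ_q^{−2β}`. -/
def delP (a : ℕ) (p ε : ℝ) (q : ℕ) : ℝ :=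
  lamP a p ε 2 ^ (3 * betP p ε) * lamP a p ε q ^ (-(2 * betP p ε))

/-- The inductive estimates (3.4)–(3.6) at level `q`. -/
def IterEst (p ε : ℝ) (a : ℕ) (q : ℕ)
    (v b : ℝ → V3 → V3) (R M : ℝ → V3 → Mat3) : Prop :=
  (nL2tx v + nL2tx b) + (nLpLinf p v + nLpLinf p b) + (nL1C ε v + nL1C ε b)
      ≤ ∑ i ∈ Finset.Icc 1 q, Real.sqrt (delP a p ε i) ∧
  nLinfH3v v + nLinfH3v b ≤ lamP a p ε q ^ (6 : ℝ) ∧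
  nLinfH3m R + nLinfH3m M ≤ lamP a p ε q ^ (6 : ℝ) ∧
  nL1tx R + nL1tx M ≤ delP a p ε (q + 1) * lamP a p ε q ^ (-(6 * alpP p ε))

/-- Directional space-time derivative. -/
def dirD (e : ℝ × V3) (f : ℝ → V3 → ℝ) (t : ℝ) (x : V3) : ℝ :=
  fderiv ℝ (fun q : ℝ × V3 => f q.1 q.2) (t, x) e

lemma SmoothTS.dirD {f : ℝ → V3 → ℝ} (hf : SmoothTS f) (e : ℝ × V3) : SmoothTS (dirD e f) := by
  have : ContDiff ℝ (⊤ : ℕ∞) (fderiv ℝ (fun q : ℝ × V3 => f q.1 q.2)) :=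
    ContDiff.fderiv_right hf (by simp)
  exact this.clm_apply contDiff_const

lemma SmoothTS.differentiableAt {f : ℝ → V3 → ℝ} (hf : SmoothTS f) (q : ℝ × V3) :
    DifferentiableAt ℝ (fun q : ℝ × V3 => f q.1 q.2) q :=
  (ContDiff.differentiable hf (by simp)) q

lemma SmoothTS.space {f : ℝ → V3 → ℝ} (hf : SmoothTS f) (t : ℝ) :
    ContDiff ℝ (⊤ : ℕ∞) (f t) :=
  ContDiff.comp (g := fun q : ℝ × V3 => f q.1 q.2) (f := fun x => (t, x)) hf (by fun_prop)

lemma SmoothTS.time {f : ℝ → V3 → ℝ} (hf : SmoothTS f) (x : V3) :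
    ContDiff ℝ (⊤ : ℕ∞) (fun t => f t x) :=
  ContDiff.comp (g := fun q : ℝ × V3 => f q.1 q.2) (f := fun t => (t, x)) hf (by fun_prop)

lemma dirD_space {f : ℝ → V3 → ℝ} (hf : SmoothTS f) (i : Fin 3) (t : ℝ) (x : V3) :
    dirD (0, Pi.single i 1) f t x = pd i (f t) x := by
  have h := (hf.differentiableAt (t, x)).hasFDerivAt
  have h2 : HasFDerivAt (fun x : V3 => ((t, x) : ℝ × V3))
    (ContinuousLinearMap.inr ℝ ℝ V3) x := hasFDerivAt_prodMk_right t x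
  have h3 := h.comp x h2
  have h4 : fderiv ℝ (f t) x = _ := h3.fderiv
  simp [dirD, pd, h4]

lemma dirD_time {f : ℝ → V3 → ℝ} (hf : SmoothTS f) (t : ℝ) (x : V3) :
    dirD (1, 0) f t x = deriv (fun s => f s x) t := by
  have h := (hf.differentiableAt (t, x)).hasFDerivAt
  have h2 : HasFDerivAt (fun t : ℝ => ((t, x) : ℝ × V3))
    (ContinuousLinearMap.inl ℝ ℝ V3) t := hasFDerivAt_prodMk_left t x
  have h3 := h.comp t h2
  have h4 : HasDerivAt (fun s => f s x) _ t := h3.hasDerivAt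
  rw [h4.deriv]; simp [dirD]

lemma SpacePeriodic.fderiv {f : ℝ → V3 → ℝ} (hf : ∀ t, SpacePeriodic (f t)) (e : ℝ × V3) :
    ∀ t, SpacePeriodic (dirD e f t) := by
  intro t x n
  have h : (fun q : ℝ × V3 => f q.1 q.2) =
      fun q : ℝ × V3 => (fun q : ℝ × V3 => f q.1 q.2) (q + (0, fun i => (n i : ℝ))) := by
    funext q; simp [hf q.1 q.2 n]
  have h2 := fderiv_comp_add_right (𝕜 := ℝ) (f := fun q : ℝ × V3 => f q.1 q.2) (x := (t, x))
    ((0, fun i => (n i : ℝ)) : ℝ × V3)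
  rw [← h] at h2
  simp only [dirD]
  rw [h2]; simp

/-- The algebra of smooth space-periodic scalar space-time fields. -/
def fldAlg : Subalgebra ℝ (ℝ → V3 → ℝ) where
  carrier := {f | SmoothTS f ∧ ∀ t, SpacePeriodic (f t)}
  mul_mem' {f g} hf hg := ⟨ContDiff.mul hf.1 hg.1, fun t x n => by
    simp [hf.2 t x n, hg.2 t x n]⟩
  add_mem' {f g} hf hg := ⟨ContDiff.add hf.1 hg.1, fun t x n => by
    simp [hf.2 t x n, hg.2 t x n]⟩
  algebraMap_mem' r := ⟨contDiff_const (c := r), fun t x n => rfl⟩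

/-- The type of smooth space-periodic scalar space-time fields. -/
abbrev Fld : Type := ↥fldAlg

namespace Fld

instance : CoeFun Fld (fun _ => ℝ → V3 → ℝ) := ⟨Subtype.val⟩

lemma smooth (f : Fld) : SmoothTS f.1 := f.2.1
lemma per (f : Fld) (t : ℝ) : SpacePeriodic (f.1 t) := f.2.2 t

@[ext] lemma ext {f g : Fld} (h : ∀ t x, f t x = g t x) : f = g :=
  Subtype.ext (funext fun t => funext fun x => h t x)

@[simp] lemma add_apply (f g : Fld) (t : ℝ) (x : V3) : (f + g) t x = f t x + g t x := rfl
@[simp] lemma mul_apply (f g : Fld) (t : ℝ) (x : V3) : (f * g) t x = f t x * g t x := rfl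
@[simp] lemma sub_apply (f g : Fld) (t : ℝ) (x : V3) : (f - g) t x = f t x - g t x := rfl
@[simp] lemma neg_apply (f : Fld) (t : ℝ) (x : V3) : (-f) t x = - f t x := rfl
@[simp] lemma zero_apply (t : ℝ) (x : V3) : (0 : Fld) t x = 0 := rfl
@[simp] lemma one_apply (t : ℝ) (x : V3) : (1 : Fld) t x = 1 := rfl
@[simp] lemma smul_apply (c : ℝ) (f : Fld) (t : ℝ) (x : V3) : (c • f) t x = c * f t x := rfl
@[simp] lemma pow_apply (f : Fld) (k : ℕ) (t : ℝ) (x : V3) : (f ^ k) t x = f t x ^ k := rfl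
@[simp] lemma sum_apply {ι : Type*} (s : Finset ι) (f : ι → Fld) (t : ℝ) (x : V3) :
    (∑ i ∈ s, f i) t x = ∑ i ∈ s, f i t x := by
  classical
  induction s using Finset.induction_on with
  | empty => simp
  | insert a s ha ih => rw [Finset.sum_insert ha, Finset.sum_insert ha, add_apply, ih]

lemma cont (f : Fld) : Continuous (fun q : ℝ × V3 => f q.1 q.2) := ContDiff.continuous f.smooth
lemma cont_space (f : Fld) (t : ℝ) : Continuous (f t) := (f.smooth.space t).continuous
lemma cont_time (f : Fld) (x : V3) : Continuous (fun t => f t x) := (f.smooth.time x).continuous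

/-- Directional derivative as a derivation. -/
def dd (e : ℝ × V3) : Derivation ℝ Fld Fld :=
  Derivation.mk'
    { toFun := fun f => ⟨dirD e f.1, f.smooth.dirD e, SpacePeriodic.fderiv f.2.2 e⟩
      map_add' := fun f g => by
        ext t x
        show dirD e (f + g).1 t x = dirD e f.1 t x + dirD e g.1 t x
        unfold dirD
        have := fderiv_add (f.smooth.differentiableAt (t, x)) (g.smooth.differentiableAt (t, x))
        exact congrArg (fun L => L e) this
      map_smul' := fun c f => by
        ext t x
        show dirD e (c • f).1 t x = c * dirD e f.1 t x
        unfold dirD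
        have := fderiv_const_smul (f.smooth.differentiableAt (t, x)) c
        exact congrArg (fun L => L e) this }
    (fun f g => by
      ext t x
      show dirD e (f * g).1 t x = f t x * dirD e g.1 t x + g t x * dirD e f.1 t x
      unfold dirD
      have := fderiv_mul (f.smooth.differentiableAt (t, x)) (g.smooth.differentiableAt (t, x))
      exact congrArg (fun L => L e) this)

lemma dd_apply (e : ℝ × V3) (f : Fld) (t : ℝ) (x : V3) : dd e f t x = dirD e f.1 t x := rfl

lemma dd_comm (e e' : ℝ × V3) (f : Fld) : dd e (dd e' f) = dd e' (dd e f) := by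
  ext t x
  simp only [dd_apply]
  have key : ∀ a b : ℝ × V3, dirD a (dd b f).1 t x =
      fderiv ℝ (fderiv ℝ (fun q : ℝ × V3 => f q.1 q.2)) (t, x) a b := by
    intro a b
    have h1 : ContDiff ℝ (⊤ : ℕ∞) (fderiv ℝ (fun q : ℝ × V3 => f q.1 q.2)) :=
      ContDiff.fderiv_right f.smooth (by simp)
    have h2 : DifferentiableAt ℝ (fderiv ℝ (fun q : ℝ × V3 => f q.1 q.2)) (t, x) :=
      (h1.differentiable (by simp)) _
    show fderiv ℝ (fun q : ℝ × V3 => fderiv ℝ (fun q : ℝ × V3 => f q.1 q.2) q b) (t, x) a = _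
    rw [fderiv_clm_apply h2 (differentiableAt_const b)]
    simp
  rw [key, key]
  have hs : IsSymmSndFDerivAt ℝ (fun q : ℝ × V3 => f q.1 q.2) (t, x) :=
    ContDiffAt.isSymmSndFDerivAt (n := 2)
      (ContDiff.contDiffAt (contDiff_infty.1 f.smooth 2)) (by simp)
  exact hs _ _

/-- Space derivative. -/
def D (i : Fin 3) : Derivation ℝ Fld Fld := dd (0, Pi.single i 1)
/-- Time derivative. -/
def Dt : Derivation ℝ Fld Fld := dd (1, 0)

lemma D_comm (i j : Fin 3) (f : Fld) : D i (D j f) = D j (D i f) := dd_comm _ _ f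
lemma D_Dt (i : Fin 3) (f : Fld) : Dt (D i f) = D i (Dt f) := dd_comm _ _ f

lemma D_apply (i : Fin 3) (f : Fld) (t : ℝ) (x : V3) : D i f t x = pd i (f t) x :=
  dirD_space f.smooth i t x
lemma D_fun (i : Fin 3) (f : Fld) (t : ℝ) : (D i f) t = pd i (f t) :=
  funext fun x => D_apply i f t x
lemma Dt_apply (f : Fld) (t : ℝ) (x : V3) : Dt f t x = deriv (fun s => f s x) t :=
  dirD_time f.smooth t x

lemma hasDerivAt_time (f : Fld) (t : ℝ) (x : V3) :
    HasDerivAt (fun s => f s x) (Dt f t x) t := by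
  rw [Dt_apply]
  exact ((f.smooth.time x).differentiable (by simp) t).hasDerivAt

/-- The Laplacian. -/
def Lap : Fld →ₗ[ℝ] Fld := ∑ i, (D i).toLinearMap ∘ₗ (D i).toLinearMap

lemma Lap_eq (f : Fld) : Lap f = ∑ i, D i (D i f) := by
  simp [Lap, LinearMap.sum_apply]

lemma Lap_apply (f : Fld) (t : ℝ) (x : V3) : Lap f t x = lap (f t) x := by
  simp only [Lap_eq, lap, sum_apply, D_apply, D_fun]

lemma D_Lap (i : Fin 3) (f : Fld) : D i (Lap f) = Lap (D i f) := by
  simp only [Lap_eq, map_sum]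
  refine Finset.sum_congr rfl fun j _ => ?_
  rw [D_comm i j, D_comm i j]

/-- The heat operator. -/
def Heat : Fld →ₗ[ℝ] Fld := Dt.toLinearMap - Lap

lemma Heat_eq (f : Fld) : Heat f = Dt f - Lap f := rfl

lemma D_Heat (i : Fin 3) (f : Fld) : D i (Heat f) = Heat (D i f) := by
  simp only [Heat_eq, map_sub, D_Lap, D_Dt]

/-- A field depending on time only. -/
def tf (g : ℝ → ℝ) (hg : ContDiff ℝ (⊤ : ℕ∞) g) : Fld :=
  ⟨fun t _ => g t, hg.comp contDiff_fst, fun _ _ _ => rfl⟩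

@[simp] lemma tf_apply (g : ℝ → ℝ) (hg) (t : ℝ) (x : V3) : tf g hg t x = g t := rfl

@[simp] lemma D_tf (i : Fin 3) (g : ℝ → ℝ) (hg) : D i (tf g hg) = 0 := by
  ext t x
  rw [D_apply]
  show fderiv ℝ (fun _ : V3 => g t) x _ = 0
  simp

lemma Dt_tf (g : ℝ → ℝ) (hg) (t : ℝ) (x : V3) : Dt (tf g hg) t x = deriv g t := by
  rw [Dt_apply]; rfl

/-- A field depending on the coordinate `x_l` only. -/
def xf (l : Fin 3) (f : ℝ → ℝ) (hf : ContDiff ℝ (⊤ : ℕ∞) f) (hp : Function.Periodic f 1) : Fld :=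
  ⟨fun _ x => f (x l), hf.comp ((contDiff_apply ℝ ℝ l).comp contDiff_snd), fun _ x n => by
    simpa using hp.int_mul (n l) (x l)⟩

@[simp] lemma xf_apply (l : Fin 3) (f : ℝ → ℝ) (hf hp) (t : ℝ) (x : V3) :
    xf l f hf hp t x = f (x l) := rfl

lemma pd_coord (i l : Fin 3) (f : ℝ → ℝ) (x : V3) (hf : DifferentiableAt ℝ f (x l)) :
    pd i (fun x : V3 => f (x l)) x = if i = l then deriv f (x l) else 0 := by
  have h : HasFDerivAt (fun x : V3 => f (x l)) (deriv f (x l) • ContinuousLinearMap.proj (R := ℝ)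
      (φ := fun _ : Fin 3 => ℝ) l) x :=
    hf.hasDerivAt.comp_hasFDerivAt x (ContinuousLinearMap.proj (R := ℝ)
      (φ := fun _ : Fin 3 => ℝ) l).hasFDerivAt
  simp only [pd, h.fderiv]
  by_cases hil : i = l
  · subst hil; simp
  · simp [hil, Ne.symm hil]

lemma D_xf_apply (i l : Fin 3) (f : ℝ → ℝ) (hf hp) (t : ℝ) (x : V3) :
    D i (xf l f hf hp) t x = if i = l then deriv f (x l) else 0 := by
  rw [D_apply]
  exact pd_coord i l f x (hf.differentiable (by simp) _)

@[simp] lemma Dt_xf (l : Fin 3) (f : ℝ → ℝ) (hf hp) : Dt (xf l f hf hp) = 0 := by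
  ext t x
  rw [Dt_apply]
  show deriv (fun _ => f (x l)) t = 0
  simp

/-- The linear forced Stokes-type system for Elsasser variables `u, z` with flux `F`. -/
def Lin (S : Set ℝ) (u z : Fin 3 → Fld) (p : Fld) (F : Fin 3 → Fin 3 → Fld) : Prop :=
  ∀ t ∈ S, ∀ x : V3,
    (∀ i, (Heat (u i) + D i p - ∑ j, D j (F j i)) t x = 0) ∧
    (∀ i, (Heat (z i) + D i p - ∑ j, D j (F i j)) t x = 0) ∧
    (∑ i, D i (u i)) t x = 0 ∧ (∑ i, D i (z i)) t x = 0

lemma Lin.of_eq {S : Set ℝ} {u z : Fin 3 → Fld} {p : Fld} {F : Fin 3 → Fin 3 → Fld}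
    (h1 : ∀ i, Heat (u i) + D i p = ∑ j, D j (F j i))
    (h2 : ∀ i, Heat (z i) + D i p = ∑ j, D j (F i j))
    (h3 : ∑ i, D i (u i) = 0) (h4 : ∑ i, D i (z i) = 0) : Lin S u z p F := by
  intro t _ x
  refine ⟨fun i => ?_, fun i => ?_, ?_, ?_⟩
  · rw [h1, sub_self]; rfl
  · rw [h2, sub_self]; rfl
  · rw [h3]; rfl
  · rw [h4]; rfl

lemma Lin.add {S : Set ℝ} {u z u' z' : Fin 3 → Fld} {p p' : Fld} {F F' : Fin 3 → Fin 3 → Fld}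
    (h : Lin S u z p F) (h' : Lin S u' z' p' F') : Lin S (u + u') (z + z') (p + p') (F + F') := by
  intro t ht x
  obtain ⟨a1, a2, a3, a4⟩ := h t ht x
  obtain ⟨b1, b2, b3, b4⟩ := h' t ht x
  refine ⟨fun i => ?_, fun i => ?_, ?_, ?_⟩
  · have := congrArg₂ (· + ·) (a1 i) (b1 i)
    simp only [Pi.add_apply, map_add, Finset.sum_add_distrib, sub_apply, add_apply] at this ⊢
    linarith
  · have := congrArg₂ (· + ·) (a2 i) (b2 i)
    simp only [Pi.add_apply, map_add, Finset.sum_add_distrib, sub_apply, add_apply] at this ⊢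
    linarith
  · simp only [Pi.add_apply, map_add, Finset.sum_add_distrib, add_apply, a3, b3, add_zero]
  · simp only [Pi.add_apply, map_add, Finset.sum_add_distrib, add_apply, a4, b4, add_zero]

lemma Lin.zero {S : Set ℝ} : Lin S 0 0 0 0 := by
  apply Lin.of_eq <;> simp

lemma Lin.sum {S : Set ℝ} {ι : Type*} (s : Finset ι) {u z : ι → Fin 3 → Fld} {p : ι → Fld}
    {F : ι → Fin 3 → Fin 3 → Fld} (h : ∀ c ∈ s, Lin S (u c) (z c) (p c) (F c)) :
    Lin S (∑ c ∈ s, u c) (∑ c ∈ s, z c) (∑ c ∈ s, p c) (∑ c ∈ s, F c) := by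
  classical
  induction s using Finset.induction_on with
  | empty => simpa using Lin.zero
  | insert a s ha ih =>
    simp only [Finset.sum_insert ha]
    exact (h a (Finset.mem_insert_self a s)).add
      (ih fun c hc => h c (Finset.mem_insert_of_mem hc))

/-- Shear-type divergence free vector field with potential `H`. -/
def shear (i l : Fin 3) (H : Fld) (k : Fin 3) : Fld :=
  (if k = i then D l (D l H) else 0) - (if k = l then D i (D l H) else 0)

/-- Flux potential of the shear field. -/
def shearT (i l : Fin 3) (P : Fld) (a b : Fin 3) : Fld :=
  if a = l then (if b = i then D l P else 0) - (if b = l then D i P else 0) else 0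

lemma D_ite (j : Fin 3) (c : Prop) [Decidable c] (f : Fld) :
    D j (if c then f else 0) = if c then D j f else 0 := by split_ifs <;> simp

lemma Heat_ite (c : Prop) [Decidable c] (f : Fld) :
    Heat (if c then f else 0) = if c then Heat f else 0 := by split_ifs <;> simp

lemma shear_div (i l : Fin 3) (H : Fld) : ∑ k, D k (shear i l H k) = 0 := by
  simp only [shear, map_sub, D_ite, Finset.sum_sub_distrib, Finset.sum_ite_eq', Finset.mem_univ,
    if_true]
  rw [D_comm i l, D_comm i l, sub_self]

lemma shear_heat (i l : Fin 3) (H : Fld) (k : Fin 3) :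
    Heat (shear i l H k) = ∑ j, D j (shearT i l (Heat H) j k) := by
  simp only [shear, shearT, map_sub, D_ite, Heat_ite, Finset.sum_ite_eq', Finset.mem_univ,
    if_true, D_Heat]
  rw [D_comm i l]

lemma shearT_row (i l : Fin 3) (P : Fld) (k : Fin 3) :
    ∑ j, D j (shearT i l P k j) = 0 := by
  by_cases h : k = l
  · simp only [shearT, h, if_true, map_sub, D_ite, Finset.sum_sub_distrib, Finset.sum_ite_eq',
      Finset.mem_univ]
    rw [D_comm i l, sub_self]
  · simp [shearT, h]

lemma lin_shear_u (S : Set ℝ) (i l : Fin 3) (H : Fld) :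
    Lin S (shear i l H) 0 0 (shearT i l (Heat H)) := by
  apply Lin.of_eq
  · intro k; simp [shear_heat]
  · intro k; simp [shearT_row]
  · exact shear_div i l H
  · simp

lemma lin_shear_z (S : Set ℝ) (i l : Fin 3) (H : Fld) :
    Lin S 0 (shear i l H) 0 (fun a b => shearT i l (Heat H) b a) := by
  apply Lin.of_eq
  · intro k; simp [shearT_row]
  · intro k; simp [shear_heat]
  · simp
  · exact shear_div i l H

/-- Divergence-free in both indices flux whose main entry is `∂_l² K`. -/
def nullF (i j l : Fin 3) (K : Fld) (a b : Fin 3) : Fld :=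
  (if a = i then (if b = j then D l (D l K) else 0) else 0)
  - (if a = l then (if b = j then D i (D l K) else 0) else 0)
  - (if a = i then (if b = l then D j (D l K) else 0) else 0)
  + (if a = l then (if b = l then D i (D j K) else 0) else 0)

lemma lin_null (S : Set ℝ) (i j l : Fin 3) (K : Fld) : Lin S 0 0 0 (nullF i j l K) := by
  apply Lin.of_eq
  · intro k
    simp only [nullF, map_sub, map_add, D_ite, Finset.sum_sub_distrib, Finset.sum_add_distrib,
      Finset.sum_ite_eq', Finset.mem_univ, if_true, Pi.zero_apply, map_zero]
    rw [D_comm i l (D l K), D_comm i l K, D_comm j l K, D_comm i l (D j K)]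
    ring
  · intro k
    simp only [nullF, map_sub, map_add, D_ite, Finset.sum_sub_distrib, Finset.sum_add_distrib,
      Finset.sum_ite_eq', Finset.mem_univ, if_true, Pi.zero_apply, map_zero,
      Finset.sum_ite_irrel, Finset.sum_const_zero]
    rw [D_comm j l (D l K), D_comm j l K, D_comm j i (D l K), D_comm j l K, D_comm i l (D j K)]
    by_cases h1 : k = i <;> by_cases h2 : k = l <;> simp [h1, h2]
  · simp
  · simp

/-- Time-corrector field in direction `j` for the block `(i,j)`. -/
def tcX (i j : Fin 3) (Q : Fld) (b : Fin 3) : Fld :=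
  (if b = j then D i (Lap Q) else 0) - D b (D i (D j Q))

/-- Flux potential of the time corrector. -/
def tcS (i j : Fin 3) (P : Fld) (a b : Fin 3) : Fld :=
  (if b = j then D i (D a P) else 0) - (if a = b then D i (D j P) else 0)

lemma tcX_div (i j : Fin 3) (Q : Fld) : ∑ b, D b (tcX i j Q b) = 0 := by
  simp only [tcX, map_sub, D_ite, Finset.sum_sub_distrib, Finset.sum_ite_eq', Finset.mem_univ,
    if_true]
  rw [← Lap_eq, ← D_Lap, ← D_Lap, D_comm, sub_self]

lemma tcS_col (i j : Fin 3) (P : Fld) (b : Fin 3) : ∑ a, D a (tcS i j P a b) = tcX i j P b := by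
  simp only [tcX, tcS, map_sub, D_ite, Finset.sum_sub_distrib, Finset.sum_ite_eq', Finset.mem_univ,
    if_true]
  congr 1
  by_cases h : b = j
  · simp only [h, if_true, Lap_eq, map_sum]
    exact Finset.sum_congr rfl fun a _ => by rw [D_comm a i]
  · simp [h]

lemma tcS_row (i j : Fin 3) (P : Fld) (a : Fin 3) : ∑ b, D b (tcS i j P a b) = 0 := by
  simp only [tcS, map_sub, D_ite, Finset.sum_sub_distrib, Finset.sum_ite_eq', Finset.sum_ite_eq,
    Finset.mem_univ, if_true]
  rw [D_comm i a P, D_comm j a, D_comm j i, sub_self]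

lemma D_mul (i : Fin 3) (f g : Fld) : D i (f * g) = f * D i g + g * D i f := by
  simp [Derivation.leibniz]

lemma D_mul_const (i : Fin 3) {h : Fld} (hh : D i h = 0) (f : Fld) : D i (h * f) = h * D i f := by
  rw [D_mul, hh]; ring

lemma Dt_mul (f g : Fld) : Dt (f * g) = f * Dt g + g * Dt f := by
  simp [Derivation.leibniz]

lemma Lap_mul_const {h : Fld} (hh : ∀ i, D i h = 0) (f : Fld) : Lap (h * f) = h * Lap f := by
  simp only [Lap_eq, D_mul_const _ (hh _), Finset.mul_sum]

lemma Heat_mul_const {h : Fld} (hh : ∀ i, D i h = 0) (f : Fld) :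
    Heat (h * f) = h * Heat f + Dt h * f := by
  rw [Heat_eq, Heat_eq, Lap_mul_const hh, Dt_mul]; ring

lemma tcX_const {h : Fld} (hh : ∀ i, D i h = 0) (i j : Fin 3) (Q : Fld) (b : Fin 3) :
    tcX i j (h * Q) b = h * tcX i j Q b := by
  simp only [tcX, D_mul_const _ (hh _), Lap_mul_const hh, mul_sub, mul_ite, mul_zero]

lemma tcX_Heat (i j : Fin 3) (Q : Fld) (b : Fin 3) :
    tcX i j (Heat Q) b = Heat (tcX i j Q b) := by
  have : Lap (Heat Q) = Heat (Lap Q) := by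
    simp only [Lap_eq, map_sum, D_Heat]
  simp only [tcX, map_sub, Heat_ite, D_Heat, this]

lemma lin_tc (S : Set ℝ) (i j : Fin 3) {h Q s : Fld} (hh : ∀ i, D i h = 0)
    (hs : ∀ i, D i (Lap Q) = - D i s) :
    Lin S (fun b => h * tcX i j Q b) (fun a => h * tcX j i Q a) (Dt h * D i (D j Q))
      (fun a b => -((if a = i then (if b = j then Dt h * s else 0) else 0))
        + tcS i j (h * Heat Q) a b + tcS j i (h * Heat Q) b a) := by
  have hh' : ∀ i, D i (Dt h) = 0 := fun i => by rw [← D_Dt, hh, map_zero]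
  apply Lin.of_eq
  · intro b
    simp only [map_add, map_neg, D_ite, Finset.sum_add_distrib, tcS_col, tcS_row,
      tcX_const hh, tcX_Heat, Heat_mul_const hh, Finset.sum_neg_distrib, Finset.sum_ite_eq',
      Finset.mem_univ, if_true, D_mul_const _ (hh' _)]
    by_cases hb : b = j
    · simp only [tcX, hb, if_true, hs]; ring
    · simp only [tcX, hb, if_false]; ring
  · intro b
    simp only [map_add, map_neg, D_ite, Finset.sum_add_distrib, tcS_col, tcS_row,
      tcX_const hh, tcX_Heat, Heat_mul_const hh, Finset.sum_neg_distrib, Finset.sum_ite_eq',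
      Finset.mem_univ, if_true, D_mul_const _ (hh' _), Finset.sum_ite_irrel,
      Finset.sum_const_zero]
    by_cases hb : b = i
    · simp only [tcX, hb, if_true, hs, D_comm j i]; ring
    · simp only [tcX, hb, if_false, D_comm j i]; ring
  · simp only [D_mul_const _ (hh _), ← Finset.mul_sum, tcX_div, mul_zero]
  · simp only [D_mul_const _ (hh _), ← Finset.mul_sum, tcX_div, mul_zero]

/-- Vector field with given components. -/
def toV (V : Fin 3 → Fld) (t : ℝ) (x : V3) : V3 := fun i => V i t x
/-- Matrix field with given components. -/
def toM (R : Fin 3 → Fin 3 → Fld) (t : ℝ) (x : V3) : Mat3 := fun i j => R i j t x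

lemma toV_smooth (V : Fin 3 → Fld) : SmoothTS (toV V) :=
  contDiff_pi.2 fun i => (V i).smooth
lemma toM_smooth (R : Fin 3 → Fin 3 → Fld) : SmoothTS (toM R) :=
  contDiff_pi.2 fun i => contDiff_pi.2 fun j => (R i j).smooth
lemma toV_per (V : Fin 3 → Fld) (t : ℝ) : SpacePeriodic (toV V t) :=
  fun x n => funext fun i => (V i).per t x n
lemma toM_per (R : Fin 3 → Fin 3 → Fld) (t : ℝ) : SpacePeriodic (toM R t) :=
  fun x n => funext fun i => funext fun j => (R i j).per t x n

/-- Components of a smooth periodic vector field. -/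
def ofV (v : ℝ → V3 → V3) (hs : SmoothTS v) (hp : ∀ t, SpacePeriodic (v t)) (i : Fin 3) : Fld :=
  ⟨fun t x => v t x i, contDiff_pi.1 hs i, fun t x n => congrFun (hp t x n) i⟩
/-- Components of a smooth periodic matrix field. -/
def ofM (R : ℝ → V3 → Mat3) (hs : SmoothTS R) (hp : ∀ t, SpacePeriodic (R t)) (i j : Fin 3) : Fld :=
  ⟨fun t x => R t x i j, contDiff_pi.1 (contDiff_pi.1 hs i) j,
    fun t x n => congrFun (congrFun (hp t x n) i) j⟩

lemma divM_apply (R : Fin 3 → Fin 3 → Fld) (t : ℝ) (x : V3) (i : Fin 3) :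
    divM (toM R t) x i = (∑ j, D j (R j i)) t x := by
  simp only [sum_apply, D_apply]; rfl

lemma divM_tens (U W : Fin 3 → Fld) (t : ℝ) (x : V3) (i : Fin 3) :
    divM (fun y => tens (toV U t y) (toV W t y)) x i = (∑ j, D j (U i * W j)) t x := by
  simp only [sum_apply, D_apply]; rfl

lemma tder_sub_lap (V : Fin 3 → Fld) (t : ℝ) (x : V3) (i : Fin 3) :
    tder (toV V) t x i - lap (fun y => toV V t y i) x = Heat (V i) t x := by
  rw [Heat_eq, sub_apply, Dt_apply, Lap_apply]; rfl

lemma divV_apply (V : Fin 3 → Fld) (t : ℝ) (x : V3) :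
    divV (toV V t) x = (∑ j, D j (V j)) t x := by
  simp only [sum_apply, D_apply]; rfl

lemma relaxed_iff (V B : Fin 3 → Fld) (P : Fld) (R M : Fin 3 → Fin 3 → Fld)
    (hR : ∀ i j, R i j = R j i) (hM : ∀ i j, M i j = - M j i) (S : Set ℝ) :
    IsRelaxedMHDOn S (toV V) (toV B) P.1 (toM R) (toM M) ↔
      Lin S (V + B) (V - B) P (fun i j => R i j + M i j - (V i + B i) * (V j - B j)) := by
  set E1 : Fin 3 → Fld := fun i => Heat (V i) + ∑ j, D j (V i * V j) + D i P
    - ∑ j, D j (B i * B j) - ∑ j, D j (R j i) with hE1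
  set E2 : Fin 3 → Fld := fun i => Heat (B i) + ∑ j, D j (V i * B j)
    - ∑ j, D j (B i * V j) - ∑ j, D j (M j i) with hE2
  have L1 : ∀ i, Heat ((V + B) i) + D i P - ∑ j, D j (R j i + M j i - (V j + B j) * (V i - B i))
      = E1 i + E2 i := by
    intro i
    have : ∀ j, R j i + M j i - (V j + B j) * (V i - B i) =
      R j i + M j i - V i * V j + B i * B j - V i * B j + B i * V j := fun j => by ring
    simp only [hE1, hE2, this, map_add, map_sub, Pi.add_apply, Finset.sum_add_distrib,
      Finset.sum_sub_distrib]
    ring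
  have L2 : ∀ i, Heat ((V - B) i) + D i P - ∑ j, D j (R i j + M i j - (V i + B i) * (V j - B j))
      = E1 i - E2 i := by
    intro i
    have : ∀ j, R i j + M i j - (V i + B i) * (V j - B j) =
      R j i - M j i - V i * V j + B i * B j + V i * B j - B i * V j := fun j => by
        rw [hR i j, hM i j]; ring
    simp only [hE1, hE2, this, map_add, map_sub, Pi.sub_apply, Finset.sum_add_distrib,
      Finset.sum_sub_distrib]
    ring
  have L3 : ∑ i, D i ((V + B) i) = ∑ i, D i (V i) + ∑ i, D i (B i) := by
    simp [Finset.sum_add_distrib]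
  have L4 : ∑ i, D i ((V - B) i) = ∑ i, D i (V i) - ∑ i, D i (B i) := by
    simp
  unfold IsRelaxedMHDOn Lin
  refine forall_congr' fun t => forall_congr' fun _ => forall_congr' fun x => ?_
  simp only [L1, L2, L3, L4, divM_apply, divM_tens, tder_sub_lap, divV_apply]
  have e1 : ∀ i, E1 i t x = Heat (V i) t x + (∑ j, D j (V i * V j)) t x + D i P t x
    - (∑ j, D j (B i * B j)) t x - (∑ j, D j (R j i)) t x := fun i => rfl
  have e2 : ∀ i, E2 i t x = Heat (B i) t x + (∑ j, D j (V i * B j)) t x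
    - (∑ j, D j (B i * V j)) t x - (∑ j, D j (M j i)) t x := fun i => rfl
  have e3 : ∀ i, pd i (P t) x = D i P t x := fun i => (D_apply i P t x).symm
  simp only [e3, add_apply, sub_apply]
  constructor
  · rintro ⟨a, b, c, d⟩
    refine ⟨fun i => ?_, fun i => ?_, ?_, ?_⟩
    · rw [e1, e2]; linarith [a i, b i]
    · rw [e1, e2]; linarith [a i, b i]
    · rw [c, d, add_zero]
    · rw [c, d, sub_zero]
  · rintro ⟨a, b, c, d⟩
    refine ⟨fun i => ?_, fun i => ?_, ?_, ?_⟩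
    · have h1 := a i; have h2 := b i; rw [e1, e2] at h1 h2; linarith
    · have h1 := a i; have h2 := b i; rw [e1, e2] at h1 h2; linarith
    · linarith
    · linarith

lemma eq_zero_of_Ioo (f : Fld) (x : V3) (h : ∀ t ∈ Ioo (0:ℝ) 1, f t x = 0) :
    ∀ t ∈ Icc (0:ℝ) 1, f t x = 0 := by
  have hc : IsClosed {t | f t x = 0} := isClosed_eq (f.cont_time x) continuous_const
  have := closure_minimal (s := Ioo (0:ℝ) 1) (t := {t | f t x = 0}) h hc
  rw [closure_Ioo (by norm_num)] at this
  exact this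

lemma Lin.to_Icc {u z : Fin 3 → Fld} {p : Fld} {F : Fin 3 → Fin 3 → Fld}
    (h : Lin (Ioo 0 1) u z p F) : Lin (Icc 0 1) u z p F := fun t ht x =>
  ⟨fun i => eq_zero_of_Ioo _ x (fun s hs => (h s hs x).1 i) t ht,
   fun i => eq_zero_of_Ioo _ x (fun s hs => (h s hs x).2.1 i) t ht,
   eq_zero_of_Ioo _ x (fun s hs => (h s hs x).2.2.1) t ht,
   eq_zero_of_Ioo _ x (fun s hs => (h s hs x).2.2.2) t ht⟩

/-- Symmetric trace-free part. -/
def symTF (S : Fin 3 → Fin 3 → Fld) (i j : Fin 3) : Fld :=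
  (1/2 : ℝ) • (S i j + S j i) - if i = j then (1/3 : ℝ) • (∑ k, S k k) else 0
/-- Skew part. -/
def skewP (S : Fin 3 → Fin 3 → Fld) (i j : Fin 3) : Fld := (1/2 : ℝ) • (S i j - S j i)

/-- Elsasser solutions give smooth relaxed MHD solutions. -/
lemma relaxed_of_lin (u z : Fin 3 → Fld) (p : Fld) (S : Fin 3 → Fin 3 → Fld)
    (h : Lin (Ioo 0 1) u z p (fun i j => S i j - u i * z j)) :
    ∃ p' : Fld, IsSmoothRelaxed (toV ((1/2:ℝ) • (u + z))) (toV ((1/2:ℝ) • (u - z))) p'.1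
      (toM (symTF S)) (toM (skewP S)) := by
  refine ⟨p - (1/3:ℝ) • ∑ k, S k k, toV_smooth _, toV_smooth _, Fld.smooth _, toM_smooth _,
    toM_smooth _, fun t => ⟨toV_per _ t, toV_per _ t, Fld.per _ t, toM_per _ t, toM_per _ t⟩,
    ?_, ?_, ?_⟩
  · rw [relaxed_iff]
    · apply Lin.to_Icc
      have e1 : (1/2:ℝ) • (u + z) + (1/2:ℝ) • (u - z) = u := by
        rw [← smul_add]; ext i t x; simp; ring
      have e2 : (1/2:ℝ) • (u + z) - (1/2:ℝ) • (u - z) = z := by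
        ext i t x; simp; ring
      rw [e1, e2]
      have e3 : ∀ i, ((1/2:ℝ) • (u + z)) i + ((1/2:ℝ) • (u - z)) i = u i := fun i => congrFun e1 i
      have e4 : ∀ i, ((1/2:ℝ) • (u + z)) i - ((1/2:ℝ) • (u - z)) i = z i := fun i => congrFun e2 i
      simp only [e3, e4]
      have hl : Lin (Ioo 0 1) 0 0 (-((1/3:ℝ) • ∑ k, S k k))
          (fun i j => -(if i = j then (1/3 : ℝ) • (∑ k, S k k) else 0)) := by
        apply Lin.of_eq
        · intro i; simp only [map_neg, D_ite, Finset.sum_neg_distrib]; simp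
        · intro i; simp only [map_neg, D_ite, Finset.sum_neg_distrib]; simp
        · simp
        · simp
      convert h.add hl using 1
      · simp
      · simp
      · rw [sub_eq_add_neg]
      · funext i j
        have : (1/2 : ℝ) • (S i j + S j i) + (1/2 : ℝ) • (S i j - S j i) = S i j := by
          ext t x; simp; ring
        simp only [symTF, skewP, Pi.add_apply]
        linear_combination this
    · intro i j
      simp only [symTF, add_comm (S i j), eq_comm (a := i)]
    · intro i j
      simp only [skewP]; rw [← smul_neg, neg_sub]
  · intro t x
    refine ⟨fun i j => ?_, ?_⟩
    · simp only [toM, symTF, add_comm (S i j), eq_comm (a := i)]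
    · simp only [toM, symTF, sub_apply, smul_apply, add_apply, if_true, Fin.sum_univ_three]
      ring
  · intro t x i j
    simp only [toM, skewP, smul_apply, sub_apply]; ring

/-- Relaxed MHD solutions are Elsasser solutions. -/
lemma lin_of_relaxed {v b : ℝ → V3 → V3} {p : ℝ → V3 → ℝ} {R M : ℝ → V3 → Mat3}
    (h : IsSmoothRelaxed v b p R M) :
    ∃ (V B : Fin 3 → Fld) (P : Fld) (R' M' : Fin 3 → Fin 3 → Fld),
      v = toV V ∧ b = toV B ∧ p = P.1 ∧ R = toM R' ∧ M = toM M' ∧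
      Lin (Icc 0 1) (V + B) (V - B) P
        (fun i j => R' i j + M' i j - (V i + B i) * (V j - B j)) := by
  obtain ⟨hv, hb, hp, hR, hM, hper, heq, hRs, hMs⟩ := h
  refine ⟨ofV v hv fun t => (hper t).1, ofV b hb fun t => (hper t).2.1,
    ⟨p, hp, fun t => (hper t).2.2.1⟩, ofM R hR fun t => (hper t).2.2.2.1,
    ofM M hM fun t => (hper t).2.2.2.2, rfl, rfl, rfl, rfl, rfl, ?_⟩
  rw [← relaxed_iff]
  · exact heq
  · intro i j; ext t x; exact (hRs t x).1 i j
  · intro i j; ext t x; exact hMs t x i j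

/-- MHD solutions are Elsasser solutions without stress. -/
lemma lin_of_mhd {v b : ℝ → V3 → V3} {p : ℝ → V3 → ℝ}
    (h : IsSmoothMHDOn (Icc 0 1) v b p) :
    ∃ (V B : Fin 3 → Fld) (P : Fld), v = toV V ∧ b = toV B ∧
      Lin (Icc 0 1) (V + B) (V - B) P (fun i j => 0 - (V i + B i) * (V j - B j)) := by
  obtain ⟨hv, hb, hp, hper, heq⟩ := h
  have h2 : IsSmoothRelaxed v b p (toM 0) (toM 0) := by
    refine ⟨hv, hb, hp, toM_smooth _, toM_smooth _, fun t => ⟨(hper t).1, (hper t).2.1,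
      (hper t).2.2, toM_per _ t, toM_per _ t⟩, ?_, ?_, ?_⟩
    · intro t ht x
      have h0 : ∀ i, divM (toM 0 t) x i = 0 := fun i => by simp [divM_apply]
      simpa [h0] using heq t ht x
    · intro t x; simp [toM]
    · intro t x; simp [toM]
  obtain ⟨V, B, P, R', M', e1, e2, -, e4, e5, hl⟩ := lin_of_relaxed h2
  refine ⟨V, B, P, e1, e2, ?_⟩
  have h4 : ∀ i j, R' i j = 0 := fun i j => by
    ext t x; exact (congrFun (congrFun (congrFun (congrFun e4 t) x) i) j).symm
  have h5 : ∀ i j, M' i j = 0 := fun i j => by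
    ext t x; exact (congrFun (congrFun (congrFun (congrFun e5 t) x) i) j).symm
  simpa [h4, h5] using hl

end Fld

section Superposition
variable {Y : Type} [NormedAddCommGroup Y] [MeasurableSpace Y] [BorelSpace Y]
  {μ : Measure Y} [IsFiniteMeasureOnCompacts μ]

lemma hasFDerivAt_superpos {E : Type} [NormedAddCommGroup E] [NormedSpace ℝ E]
    {s : Set Y} (hs : IsCompact s) {k : Y → ℝ} (hk : Continuous k) {a : Y → ℝ × V3}
    (ha : Continuous a) {F : ℝ × V3 → E} (hF : ContDiff ℝ 1 F) (q : ℝ × V3) :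
    HasFDerivAt (fun q => ∫ y in s, k y • F (q + a y) ∂μ)
      (∫ y in s, k y • fderiv ℝ F (q + a y) ∂μ) q := by
  have hF' : Continuous (fderiv ℝ F) := hF.continuous_fderiv one_ne_zero
  have hFc : Continuous F := hF.continuous
  obtain ⟨C, hC⟩ := ((isCompact_closedBall q 1).prod hs).bddAbove_image
    (f := fun z : (ℝ × V3) × Y => ‖k z.2 • fderiv ℝ F (z.1 + a z.2)‖)
    (Continuous.continuousOn (by fun_prop))
  have hfin : IsFiniteMeasure (μ.restrict s) := ⟨by
    rw [Measure.restrict_apply_univ]; exact hs.measure_lt_top⟩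
  refine hasFDerivAt_integral_of_dominated_of_fderiv_le (bound := fun _ => C)
    (s := Metric.closedBall q 1)
    (F' := fun q y => k y • fderiv ℝ F (q + a y)) (Metric.closedBall_mem_nhds q one_pos) ?_ ?_ ?_
    ?_ (integrable_const _) ?_
  · exact .of_forall fun q =>
      (Continuous.continuousOn (by fun_prop)).aestronglyMeasurable_of_isCompact hs hs.measurableSet
  · exact (Continuous.continuousOn (by fun_prop)).integrableOn_compact hs
  · exact
      (Continuous.continuousOn (by fun_prop)).aestronglyMeasurable_of_isCompact hs hs.measurableSet
  · filter_upwards [ae_restrict_mem hs.measurableSet] with y hy x hx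
    exact hC ⟨(x, y), ⟨hx, hy⟩, rfl⟩
  · refine .of_forall fun y x _ => ?_
    have h1 : HasFDerivAt F (fderiv ℝ F (x + a y)) (x + a y) :=
      (hF.differentiable one_ne_zero _).hasFDerivAt
    exact ((hasFDerivAt_comp_add_right (a y)).2 h1).const_smul (k y)

lemma contDiff_superpos {s : Set Y} (hs : IsCompact s) {k : Y → ℝ} (hk : Continuous k)
    {a : Y → ℝ × V3} (ha : Continuous a) (n : ℕ) :
    ∀ {E : Type} [NormedAddCommGroup E] [NormedSpace ℝ E] {F : ℝ × V3 → E},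
      ContDiff ℝ (⊤ : ℕ∞) F → ContDiff ℝ n (fun q => ∫ y in s, k y • F (q + a y) ∂μ) := by
  induction n with
  | zero =>
    intro E _ _ F hF
    rw [Nat.cast_zero, contDiff_zero, continuous_iff_continuousAt]
    exact fun q => (hasFDerivAt_superpos hs hk ha (contDiff_infty.1 hF 1) q).continuousAt
  | succ n ih =>
    intro E _ _ F hF
    rw [Nat.cast_succ, contDiff_succ_iff_fderiv]
    refine ⟨fun q => (hasFDerivAt_superpos hs hk ha
      (contDiff_infty.1 hF 1) q).differentiableAt, by simp, ?_⟩
    have : fderiv ℝ (fun q => ∫ y in s, k y • F (q + a y) ∂μ) =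
        fun q => ∫ y in s, k y • fderiv ℝ F (q + a y) ∂μ := funext fun q =>
      (hasFDerivAt_superpos hs hk ha (contDiff_infty.1 hF 1) q).fderiv
    rw [this]
    exact ih (hF.fderiv_right (by simp))

namespace Fld

/-- Weighted average of translates of a field. -/
def superpos {s : Set Y} (hs : IsCompact s) {k : Y → ℝ} (hk : Continuous k)
    {a : Y → ℝ × V3} (ha : Continuous a) (μ : Measure Y) [IsFiniteMeasureOnCompacts μ] :
    Fld →ₗ[ℝ] Fld where
  toFun f := ⟨fun t x => ∫ y in s, k y * f (t + (a y).1) (x + (a y).2) ∂μ,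
    contDiff_infty.2 fun n => contDiff_superpos (μ := μ) hs hk ha n f.smooth,
    fun t x n => by
      refine integral_congr_ae (.of_forall fun y => ?_)
      simp only
      rw [add_right_comm, f.per _ _ n]⟩
  map_add' f g := by
    ext t x
    have hf := f.cont
    have hg := g.cont
    show ∫ y in s, k y * (f (t + (a y).1) (x + (a y).2) + g (t + (a y).1) (x + (a y).2)) ∂μ = _
    simp only [mul_add]
    refine integral_add ?_ ?_
    · exact (Continuous.continuousOn (hk.mul (hf.comp
        (f := fun y => (t + (a y).1, x + (a y).2)) (by fun_prop)))).integrableOn_compact hs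
    · exact (Continuous.continuousOn (hk.mul (hg.comp
        (f := fun y => (t + (a y).1, x + (a y).2)) (by fun_prop)))).integrableOn_compact hs
  map_smul' c f := by
    ext t x
    show ∫ y in s, k y * (c * f (t + (a y).1) (x + (a y).2)) ∂μ =
      c * ∫ y in s, k y * (f (t + (a y).1) (x + (a y).2)) ∂μ
    rw [← integral_const_mul]
    refine integral_congr_ae (.of_forall fun y => ?_)
    simp only; ring

lemma superpos_apply {s : Set Y} (hs : IsCompact s) {k : Y → ℝ} (hk : Continuous k)
    {a : Y → ℝ × V3} (ha : Continuous a) (μ : Measure Y) [IsFiniteMeasureOnCompacts μ] (f : Fld)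
    (t : ℝ) (x : V3) :
    superpos hs hk ha μ f t x = ∫ y in s, k y * f (t + (a y).1) (x + (a y).2) ∂μ := rfl

lemma dd_superpos {s : Set Y} (hs : IsCompact s) {k : Y → ℝ} (hk : Continuous k)
    {a : Y → ℝ × V3} (ha : Continuous a) (μ : Measure Y) [IsFiniteMeasureOnCompacts μ] (f : Fld)
    (e : ℝ × V3) : dd e (superpos hs hk ha μ f) = superpos hs hk ha μ (dd e f) := by
  ext t x
  have h := hasFDerivAt_superpos (μ := μ) hs hk ha (contDiff_infty.1 f.smooth 1) (t, x)
  rw [dd_apply]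
  show fderiv ℝ (fun q : ℝ × V3 => ∫ y in s, k y • f (q + a y).1 (q + a y).2 ∂μ) (t, x) e = _
  rw [h.fderiv, ContinuousLinearMap.integral_apply]
  · rfl
  · have hF' : Continuous (fderiv ℝ (fun q : ℝ × V3 => f q.1 q.2)) :=
      (contDiff_infty.1 f.smooth 1).continuous_fderiv one_ne_zero
    exact (Continuous.continuousOn (by fun_prop)).integrableOn_compact hs

end Fld
end Superposition

namespace Fld
/-! ### Translation invariance on the torus -/

lemma cube_ae_eq : (Set.pi Set.univ fun _ : Fin 3 ↦ Set.Ico (0 : ℝ) 1) =ᵐ[volume] cube := by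
  exact Measure.univ_pi_Ico_ae_eq_Icc (μ := fun _ : Fin 3 => (volume : Measure ℝ))
    (f := fun _ => 0) (g := fun _ => 1)

lemma periodic_span {E : Type*} {f : V3 → E} (hf : SpacePeriodic f)
    (g : (Submodule.span ℤ (Set.range (Pi.basisFun ℝ (Fin 3)))).toAddSubgroup) (x : V3) :
    f (g +ᵥ x) = f x := by
  obtain ⟨g, hg⟩ := g
  have hg' : g ∈ Submodule.span ℤ (Set.range (Pi.basisFun ℝ (Fin 3))) := hg
  rw [Module.Basis.mem_span_iff_repr_mem] at hg'
  have : ∀ i, ∃ n : ℤ, (n : ℝ) = g i := fun i => by simpa using hg' i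
  choose n hn using this
  have e : g = fun i => (n i : ℝ) := funext fun i => (hn i).symm
  show f (g + x) = f x
  rw [add_comm, e, hf]

lemma integral_translate {f : V3 → ℝ} (hf : SpacePeriodic f) (x : V3) :
    ∫ y in cube, f (x + y) = ∫ y in cube, f y := by
  have h0 := ZSpan.isAddFundamentalDomain' (Pi.basisFun ℝ (Fin 3)) (volume : Measure V3)
  rw [ZSpan.fundamentalDomain_pi_basisFun] at h0
  have : Countable (Submodule.span ℤ (Set.range (Pi.basisFun ℝ (Fin 3)))).toAddSubgroup := by
    change Countable (Submodule.span ℤ (Set.range (Pi.basisFun ℝ (Fin 3))))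
    infer_instance
  have h1 := h0.vadd_of_comm x
  have h2 := h0.setIntegral_eq h1 (f := f) (periodic_span hf)
  rw [setIntegral_congr_set cube_ae_eq] at h2
  rw [h2, ← setIntegral_congr_set cube_ae_eq]
  have := (measurePreserving_add_left (volume : Measure V3) x).setIntegral_image_emb
    (measurableEmbedding_addLeft x) f (Set.pi Set.univ fun _ : Fin 3 ↦ Set.Ico (0 : ℝ) 1)
  rw [← this]; rfl

lemma integral_reflect {f : V3 → ℝ} (hf : SpacePeriodic f) (x : V3) :
    ∫ y in cube, f (x - y) = ∫ y in cube, f y := by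
  rw [← integral_translate hf (x - 1)]
  have := (Measure.measurePreserving_sub_left (volume : Measure V3) 1).setIntegral_image_emb
    (MeasurableEquiv.subLeft (1 : V3)).measurableEmbedding (fun y => f (x - 1 + y)) cube
  have himg : (fun y : V3 => 1 - y) '' cube = cube := by
    simp [cube]
  rw [himg] at this
  rw [this]
  refine integral_congr_ae (.of_forall fun y => ?_)
  simp only; congr 1; ring

lemma isCompact_cube : IsCompact cube := isCompact_Icc

lemma volume_cube : (volume : Measure V3) cube = 1 := by
  have : cube = Set.Icc (0 : V3) 1 := rfl
  rw [this, Real.volume_Icc_pi]; simp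

lemma integral_D (i : Fin 3) (f : Fld) (t : ℝ) : ∫ x in cube, D i f t x = 0 := by
  set P := superpos isCompact_cube (k := fun _ => 1) continuous_const
    (a := fun y : V3 => ((0 : ℝ), y)) (by fun_prop) volume with hP
  have h1 : ∀ g : Fld, ∀ t x, P g t x = ∫ y in cube, g t y := fun g t x => by
    rw [← integral_translate (g.per t) x]
    simp [hP, superpos_apply]
  have h2 : D i (P f) = P (D i f) := dd_superpos _ _ _ _ _ _
  have h3 : D i (P f) t 0 = 0 := by
    rw [D_apply]
    have : (P f) t = fun _ => ∫ y in cube, f t y := funext fun x => h1 f t x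
    rw [this]; simp [pd]
  rw [← h1 _ t 0, ← h2, h3]

/-- Space convolution on the torus with the time-zero slice of `k`. -/
def conv (k : Fld) : Fld →ₗ[ℝ] Fld :=
  superpos isCompact_cube (k.cont_space 0) (a := fun y : V3 => ((0 : ℝ), -y)) (by fun_prop) volume

lemma conv_apply (k f : Fld) (t : ℝ) (x : V3) :
    conv k f t x = ∫ y in cube, k 0 y * f t (x - y) := by
  simp [conv, superpos_apply, sub_eq_add_neg]

lemma D_conv (k f : Fld) (i : Fin 3) : D i (conv k f) = conv k (D i f) :=
  dd_superpos _ _ _ _ _ _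
lemma Dt_conv (k f : Fld) : Dt (conv k f) = conv k (Dt f) := dd_superpos _ _ _ _ _ _

lemma integrable_cube {f : V3 → ℝ} (hf : Continuous f) : IntegrableOn f cube :=
  hf.continuousOn.integrableOn_compact isCompact_cube

lemma conv_integrable (k f : Fld) (t : ℝ) (x : V3) :
    IntegrableOn (fun y => k 0 y * f t (x - y)) cube :=
  integrable_cube ((k.cont_space 0).mul ((f.cont_space t).comp (by fun_prop)))

/-- The field `y ↦ f t (x - y)`. -/
def reflAt (f : Fld) (t : ℝ) (x : V3) : Fld :=
  ⟨fun _ y => f t (x - y), (f.smooth.space t).comp (contDiff_const.sub contDiff_snd),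
   fun _ y n => by
    have := f.per t (x - y - fun i => (n i : ℝ)) n
    simp only at this ⊢
    rw [sub_add_cancel] at this
    rw [this, sub_sub]⟩

lemma D_reflAt (f : Fld) (t : ℝ) (x : V3) (i : Fin 3) (s : ℝ) (y : V3) :
    D i (reflAt f t x) s y = - D i f t (x - y) := by
  rw [D_apply, D_apply]
  show fderiv ℝ (fun y => f t (x - y)) y _ = - fderiv ℝ (f t) (x - y) _
  have h1 : HasFDerivAt (f t) (fderiv ℝ (f t) (x - y)) (x - y) :=
    ((f.smooth.space t).differentiable (by simp) _).hasFDerivAt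
  have h2 : HasFDerivAt (fun y : V3 => x - y) (-ContinuousLinearMap.id ℝ V3) y :=
    (hasFDerivAt_id y).const_sub x
  have h3 : HasFDerivAt (fun y => f t (x - y)) _ y := h1.comp y h2
  rw [h3.fderiv]; simp

lemma conv_D (k f : Fld) (i : Fin 3) : conv k (D i f) = conv (D i k) f := by
  ext t x
  rw [conv_apply, conv_apply]
  have h := integral_D i (k * reflAt f t x) 0
  have e : ∀ y, D i (k * reflAt f t x) 0 y
      = D i k 0 y * f t (x - y) - k 0 y * D i f t (x - y) := by
    intro y
    have e2 : reflAt f t x 0 y = f t (x - y) := rfl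
    rw [D_mul, add_apply, mul_apply, mul_apply, D_reflAt, e2]; ring
  simp only [e] at h
  rw [integral_sub (conv_integrable _ _ _ _) (conv_integrable _ _ _ _)] at h
  linarith

lemma conv_add_left (k k' f : Fld) : conv (k + k') f = conv k f + conv k' f := by
  ext t x
  simp only [conv_apply, add_apply, add_mul]
  exact integral_add (conv_integrable _ _ _ _) (conv_integrable _ _ _ _)
lemma conv_neg_left (k f : Fld) : conv (-k) f = - conv k f := by
  ext t x
  simp only [conv_apply, neg_apply, neg_mul, integral_neg]
lemma conv_sub_left (k k' f : Fld) : conv (k - k') f = conv k f - conv k' f := by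
  rw [sub_eq_add_neg, conv_add_left, conv_neg_left, ← sub_eq_add_neg]
lemma conv_zero_left (f : Fld) : conv 0 f = 0 := by
  ext t x; simp [conv_apply]

lemma conv_Lap (k f : Fld) : conv (Lap k) f = Lap (conv k f) := by
  have : Lap (conv k f) = ∑ i, conv (D i (D i k)) f := by
    rw [Lap_eq]
    exact Finset.sum_congr rfl fun i _ => by rw [D_conv, D_conv, conv_D, conv_D]
  rw [this, Lap_eq]
  simp only [Fin.sum_univ_three, conv_add_left]

lemma conv_Heat (k f : Fld) : Heat (conv k f) = conv k (Heat f) := by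
  rw [Heat_eq, Heat_eq, map_sub, Dt_conv, Lap_eq, Lap_eq, map_sum]
  simp only [D_conv]

lemma abs_conv_le (k f : Fld) {M : ℝ} (hM : ∀ y, |k 0 y| ≤ M) (t : ℝ) (x : V3) :
    |conv k f t x| ≤ M * ∫ y in cube, |f t y| := by
  have hM0 : 0 ≤ M := (abs_nonneg _).trans (hM 0)
  rw [conv_apply, ← integral_reflect (f := fun y => |f t y|)
    (fun y n => by simp only; rw [f.per t y n]) x, ← integral_const_mul]
  refine (abs_integral_le_integral_abs).trans ?_
  refine setIntegral_mono_on (conv_integrable _ _ _ _).abs ?_ isCompact_cube.measurableSet ?_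
  · exact integrable_cube (continuous_const.mul
      (((f.cont_space t).comp (by fun_prop)).abs))
  · intro y _
    rw [abs_mul]
    exact mul_le_mul_of_nonneg_right (hM y) (abs_nonneg _)

/-- Forward moving average in time. -/
def mavg (ℓ : ℝ) : Fld →ₗ[ℝ] Fld :=
  superpos (isCompact_Icc : IsCompact (Icc (0:ℝ) 1)) (k := fun _ => 1) continuous_const
    (a := fun r : ℝ => (ℓ * r, (0 : V3))) (by fun_prop) volume

lemma mavg_apply (ℓ : ℝ) (f : Fld) (t : ℝ) (x : V3) :
    mavg ℓ f t x = ∫ r in Icc (0:ℝ) 1, f (t + ℓ * r) x := by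
  simp [mavg, superpos_apply]

lemma D_mavg (ℓ : ℝ) (f : Fld) (i : Fin 3) : D i (mavg ℓ f) = mavg ℓ (D i f) :=
  dd_superpos _ _ _ _ _ _
lemma Dt_mavg (ℓ : ℝ) (f : Fld) : Dt (mavg ℓ f) = mavg ℓ (Dt f) := dd_superpos _ _ _ _ _ _

lemma mavg_Heat (ℓ : ℝ) (f : Fld) : Heat (mavg ℓ f) = mavg ℓ (Heat f) := by
  rw [Heat_eq, Heat_eq, map_sub, Dt_mavg, Lap_eq, Lap_eq, map_sum]
  simp only [D_mavg]

lemma integral_Dt (f : Fld) (s t : ℝ) (x : V3) : ∫ r in s..t, Dt f r x = f t x - f s x :=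
  intervalIntegral.integral_eq_sub_of_hasDerivAt (fun r _ => f.hasDerivAt_time r x)
    (((Dt f).cont_time x).intervalIntegrable _ _)

lemma Dt_mavg_apply {ℓ : ℝ} (hℓ : ℓ ≠ 0) (f : Fld) (t : ℝ) (x : V3) :
    Dt (mavg ℓ f) t x = (f (t + ℓ) x - f t x) / ℓ := by
  rw [Dt_mavg, mavg_apply, integral_Icc_eq_integral_Ioc,
    ← intervalIntegral.integral_of_le zero_le_one,
    intervalIntegral.integral_comp_add_mul (fun r => Dt f r x) hℓ t, integral_Dt]
  simp [div_eq_inv_mul]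

/-- Weighted pointwise bounds for all space derivatives of order at most `k` on the times `J`. -/
def CB (J : Set ℝ) (L : ℝ) : ℕ → (ℝ → V3 → ℝ) → Fld → Prop
  | 0, M, f => ∀ t ∈ J, ∀ x, |f t x| ≤ M t x
  | k + 1, M, f => (∀ t ∈ J, ∀ x, |f t x| ≤ M t x) ∧
      ∀ i, CB J L k (fun t x => L * M t x) (D i f)

/-- Bounds in `L²(𝕋³)` for all space derivatives of order at most `k` on the times `J`. -/
def HB (J : Set ℝ) : ℕ → ℝ → Fld → Prop
  | 0, M, f => ∀ t ∈ J, ∫ x in cube, f t x ^ 2 ≤ M ^ 2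
  | k + 1, M, f => (∀ t ∈ J, ∫ x in cube, f t x ^ 2 ≤ M ^ 2) ∧ ∀ i, HB J k M (D i f)

section CB
variable {J : Set ℝ} {L : ℝ}

lemma CB.bound : ∀ {k : ℕ} {M : ℝ → V3 → ℝ} {f : Fld}, CB J L k M f →
    ∀ t ∈ J, ∀ x, |f t x| ≤ M t x
  | 0, _, _, h => h
  | _ + 1, _, _, h => h.1

lemma CB.D {k : ℕ} {M : ℝ → V3 → ℝ} {f : Fld} (h : CB J L (k + 1) M f) (i : Fin 3) :
    CB J L k (fun t x => L * M t x) (D i f) := h.2 i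

lemma CB.succ {k : ℕ} {M : ℝ → V3 → ℝ} {f : Fld} (h : ∀ t ∈ J, ∀ x, |f t x| ≤ M t x)
    (h2 : ∀ i, CB J L k (fun t x => L * M t x) (Fld.D i f)) : CB J L (k + 1) M f := ⟨h, h2⟩

lemma CB.mono {L' : ℝ} (hL : 0 ≤ L) (hLL : L ≤ L') :
    ∀ {k : ℕ} {M M' : ℝ → V3 → ℝ} {f : Fld}, CB J L k M f →
    (∀ t ∈ J, ∀ x, M t x ≤ M' t x) → CB J L' k M' f
  | 0, _, _, _, h, hM => fun t ht x => (h t ht x).trans (hM t ht x)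
  | k + 1, M, M', f, h, hM => ⟨fun t ht x => (h.1 t ht x).trans (hM t ht x), fun i =>
      (h.2 i).mono hL hLL fun t ht x => by
        have h1 := hM t ht x
        have h2 := (abs_nonneg _).trans (h.1 t ht x)
        exact mul_le_mul hLL h1 h2 (hL.trans hLL)⟩

lemma CB.le (hL : 0 ≤ L) {k : ℕ} {M M' : ℝ → V3 → ℝ} {f : Fld} (h : CB J L k M f)
    (hM : ∀ t ∈ J, ∀ x, M t x ≤ M' t x) : CB J L k M' f := h.mono hL le_rfl hM

lemma CB.pred : ∀ {k : ℕ} {M : ℝ → V3 → ℝ} {f : Fld}, CB J L (k + 1) M f → CB J L k M f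
  | 0, _, _, h => h.1
  | _ + 1, _, _, h => ⟨h.1, fun i => (h.2 i).pred⟩

lemma CB.of_le {k k' : ℕ} (hk : k ≤ k') {M : ℝ → V3 → ℝ} {f : Fld} (h : CB J L k' M f) :
    CB J L k M f := by
  obtain ⟨d, rfl⟩ := Nat.exists_eq_add_of_le hk
  induction d with
  | zero => exact h
  | succ d ih => exact ih (Nat.le_add_right _ _) h.pred

lemma CB.congr {k : ℕ} {M M' : ℝ → V3 → ℝ} {f : Fld} (h : CB J L k M f)
    (hM : ∀ t x, M t x = M' t x) : CB J L k M' f := by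
  have : M = M' := by funext t x; exact hM t x
  rwa [← this]

lemma CB.of_zero : ∀ {k : ℕ} {M : ℝ → V3 → ℝ} (_ : 0 ≤ L) (_ : ∀ t ∈ J, ∀ x, 0 ≤ M t x),
    CB J L k M 0
  | 0, _, _, hM => fun t ht x => by simpa using hM t ht x
  | k + 1, _, hL, hM => ⟨fun t ht x => by simpa using hM t ht x, fun i => by
      rw [map_zero]
      exact CB.of_zero hL fun t ht x => mul_nonneg hL (hM t ht x)⟩

lemma CB.of_indep {k : ℕ} {M : ℝ → V3 → ℝ} {f : Fld} (hL : 0 ≤ L) (hf : ∀ i, Fld.D i f = 0)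
    (h : ∀ t ∈ J, ∀ x, |f t x| ≤ M t x) : CB J L k M f := by
  cases k with
  | zero => exact h
  | succ k => exact ⟨h, fun i => by
      rw [hf i]
      exact CB.of_zero hL fun t ht x => mul_nonneg hL ((abs_nonneg _).trans (h t ht x))⟩

lemma CB.add : ∀ {k : ℕ} {M M' : ℝ → V3 → ℝ} {f g : Fld}, CB J L k M f → CB J L k M' g →
    CB J L k (fun t x => M t x + M' t x) (f + g)
  | 0, _, _, _, _, hf, hg => fun t ht x =>
      (abs_add_le _ _).trans (add_le_add (hf t ht x) (hg t ht x))
  | k + 1, M, M', f, g, hf, hg => ⟨fun t ht x =>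
      (abs_add_le _ _).trans (add_le_add (hf.1 t ht x) (hg.1 t ht x)), fun i => by
      rw [map_add]
      exact ((hf.2 i).add (hg.2 i)).congr fun t x => by ring⟩

lemma CB.neg : ∀ {k : ℕ} {M : ℝ → V3 → ℝ} {f : Fld}, CB J L k M f → CB J L k M (-f)
  | 0, _, _, hf => fun t ht x => by simpa using hf t ht x
  | k + 1, M, f, hf => ⟨fun t ht x => by simpa using hf.1 t ht x, fun i => by
      rw [map_neg]; exact (hf.2 i).neg⟩

lemma CB.sub {k : ℕ} {M M' : ℝ → V3 → ℝ} {f g : Fld} (hf : CB J L k M f) (hg : CB J L k M' g) :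
    CB J L k (fun t x => M t x + M' t x) (f - g) := by
  rw [sub_eq_add_neg]; exact hf.add hg.neg

lemma CB.smul (c : ℝ) : ∀ {k : ℕ} {M : ℝ → V3 → ℝ} {f : Fld}, CB J L k M f →
    CB J L k (fun t x => |c| * M t x) (c • f)
  | 0, _, _, hf => fun t ht x => by
      rw [smul_apply, abs_mul]; exact mul_le_mul_of_nonneg_left (hf t ht x) (abs_nonneg _)
  | k + 1, M, f, hf => ⟨fun t ht x => by
      rw [smul_apply, abs_mul]
      exact mul_le_mul_of_nonneg_left (hf.1 t ht x) (abs_nonneg _), fun i => by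
      rw [(Fld.D i).map_smul]
      exact ((hf.2 i).smul c).congr fun t x => by ring⟩

lemma CB.sum {ι : Type*} (s : Finset ι) {k : ℕ} {M : ι → ℝ → V3 → ℝ} {f : ι → Fld}
    (hL : 0 ≤ L) (h : ∀ c ∈ s, CB J L k (M c) (f c)) :
    CB J L k (fun t x => ∑ c ∈ s, M c t x) (∑ c ∈ s, f c) := by
  classical
  induction s using Finset.induction_on with
  | empty => simpa using CB.of_zero (M := fun _ _ => 0) hL (fun _ _ _ => le_rfl)
  | insert a s ha ih =>
    simp only [Finset.sum_insert ha]
    exact (h a (Finset.mem_insert_self _ _)).add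
      (ih fun c hc => h c (Finset.mem_insert_of_mem hc))

lemma CB.mul (hL : 0 ≤ L) : ∀ {k : ℕ} {M M' : ℝ → V3 → ℝ} {f g : Fld}, CB J L k M f →
    CB J L k M' g → CB J (2 * L) k (fun t x => M t x * M' t x) (f * g)
  | 0, _, _, _, _, hf, hg => fun t ht x => by
      rw [mul_apply, abs_mul]
      exact mul_le_mul (hf t ht x) (hg t ht x) (abs_nonneg _) ((abs_nonneg _).trans (hf t ht x))
  | k + 1, M, M', f, g, hf, hg => ⟨fun t ht x => by
      rw [mul_apply, abs_mul]
      exact mul_le_mul (hf.1 t ht x) (hg.1 t ht x) (abs_nonneg _)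
        ((abs_nonneg _).trans (hf.1 t ht x)), fun i => by
      rw [D_mul]
      exact ((CB.mul hL hf.pred (hg.2 i)).add (CB.mul hL hg.pred (hf.2 i))).congr
        fun t x => by ring⟩

/-- Product with a factor depending on time only; no loss in the weight. -/
lemma CB.mul_indep {k : ℕ} {M : ℝ → V3 → ℝ} {f h : Fld} {a : ℝ → ℝ} (hh : ∀ i, Fld.D i h = 0)
    (ha : ∀ t ∈ J, ∀ x, |h t x| ≤ a t) (hf : CB J L k M f) :
    CB J L k (fun t x => a t * M t x) (h * f) := by
  induction k generalizing M f with
  | zero =>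
      intro t ht x
      rw [mul_apply, abs_mul]
      exact mul_le_mul (ha t ht x) (hf t ht x) (abs_nonneg _) ((abs_nonneg _).trans (ha t ht x))
  | succ k ih =>
    refine ⟨fun t ht x => ?_, fun i => ?_⟩
    · rw [mul_apply, abs_mul]
      exact mul_le_mul (ha t ht x) (hf.1 t ht x) (abs_nonneg _)
        ((abs_nonneg _).trans (ha t ht x))
    · rw [D_mul, hh i, mul_zero, add_zero]
      exact (ih (hf.2 i)).congr fun t x => by ring

lemma CB.of_support {J' : Set ℝ} : ∀ {k : ℕ} {M : ℝ → V3 → ℝ} {f : Fld} (_ : 0 ≤ L)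
    (_ : ∀ t ∈ J', ∀ x, 0 ≤ M t x) (_ : ∀ t ∈ J', t ∉ J → ∀ x, f t x = 0),
    CB J L k M f → CB J' L k M f
  | 0, _, _, _, hM, hf, h => fun t ht x => by
      by_cases htJ : t ∈ J
      · exact h t htJ x
      · rw [hf t ht htJ x, abs_zero]; exact hM t ht x
  | k + 1, _, f, hL, hM, hf, h => ⟨fun t ht x => by
      by_cases htJ : t ∈ J
      · exact h.1 t htJ x
      · rw [hf t ht htJ x, abs_zero]; exact hM t ht x, fun i =>
      (h.2 i).of_support hL (fun t ht x => mul_nonneg hL (hM t ht x)) fun t ht htJ x => by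
        rw [D_apply]
        have : f t = fun _ => 0 := funext fun x => hf t ht htJ x
        rw [this]; simp [pd]⟩

lemma CB.D2 {k : ℕ} {M : ℝ → V3 → ℝ} {f : Fld} (h : CB J L (k + 2) M f) (i j : Fin 3) :
    CB J L k (fun t x => L ^ 2 * M t x) (Fld.D i (Fld.D j f)) :=
  ((h.D j).D i).congr fun t x => by ring

lemma CB.D3 {k : ℕ} {M : ℝ → V3 → ℝ} {f : Fld} (h : CB J L (k + 3) M f) (i j l : Fin 3) :
    CB J L k (fun t x => L ^ 3 * M t x) (Fld.D i (Fld.D j (Fld.D l f))) :=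
  ((h.D2 j l).D i).congr fun t x => by ring

lemma CB.Lap {k : ℕ} {M : ℝ → V3 → ℝ} {f : Fld} (h : CB J L (k + 2) M f) :
    CB J L k (fun t x => 3 * L ^ 2 * M t x) (Lap f) := by
  rw [Lap_eq, Fin.sum_univ_three]
  exact (((h.D2 0 0).add (h.D2 1 1)).add (h.D2 2 2)).congr fun t x => by ring
end CB

section HB
variable {J : Set ℝ}

lemma HB.bound : ∀ {k : ℕ} {M : ℝ} {f : Fld}, HB J k M f →
    ∀ t ∈ J, ∫ x in cube, f t x ^ 2 ≤ M ^ 2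
  | 0, _, _, h => h
  | _ + 1, _, _, h => h.1

lemma HB.pred : ∀ {k : ℕ} {M : ℝ} {f : Fld}, HB J (k + 1) M f → HB J k M f
  | 0, _, _, h => h.1
  | _ + 1, _, _, h => ⟨h.1, fun i => (h.2 i).pred⟩

lemma HB.mono : ∀ {k : ℕ} {M M' : ℝ} {f : Fld}, HB J k M f → 0 ≤ M → M ≤ M' → HB J k M' f
  | 0, _, _, _, h, h0, hM => fun t ht => (h t ht).trans (pow_le_pow_left₀ h0 hM 2)
  | _ + 1, _, _, _, h, h0, hM => ⟨fun t ht => (h.1 t ht).trans (pow_le_pow_left₀ h0 hM 2),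
      fun i => (h.2 i).mono h0 hM⟩

lemma integral_sq_add_le (f g : Fld) (t : ℝ) :
    ∫ x in cube, (f + g) t x ^ 2
      ≤ 2 * (∫ x in cube, f t x ^ 2) + 2 * ∫ x in cube, g t x ^ 2 := by
  rw [← integral_const_mul, ← integral_const_mul, ← integral_add]
  · refine setIntegral_mono_on (integrable_cube ((f + g).cont_space t |>.pow 2))
      (integrable_cube ?_) isCompact_cube.measurableSet fun x _ => ?_
    · exact (continuous_const.mul ((f.cont_space t).pow 2)).add
        (continuous_const.mul ((g.cont_space t).pow 2))
    · rw [add_apply]; nlinarith [sq_nonneg (f t x - g t x)]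
  · exact integrable_cube (continuous_const.mul ((f.cont_space t).pow 2))
  · exact integrable_cube (continuous_const.mul ((g.cont_space t).pow 2))

lemma HB.add : ∀ {k : ℕ} {M M' : ℝ} {f g : Fld}, HB J k M f → HB J k M' g → 0 ≤ M → 0 ≤ M' →
    HB J k (2 * (M + M')) (f + g)
  | 0, M, M', f, g, hf, hg, h0, h0' => fun t ht => by
      refine (integral_sq_add_le f g t).trans ?_
      have := hf t ht
      have := hg t ht
      nlinarith [mul_nonneg h0 h0']
  | k + 1, M, M', f, g, hf, hg, h0, h0' => ⟨fun t ht => by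
      refine (integral_sq_add_le f g t).trans ?_
      have := hf.1 t ht
      have := hg.1 t ht
      nlinarith [mul_nonneg h0 h0'], fun i => by
      rw [map_add]; exact (hf.2 i).add (hg.2 i) h0 h0'⟩

lemma HB.of_zero : ∀ {k : ℕ} {M : ℝ}, HB J k M 0
  | 0, M => fun t _ => by simpa using sq_nonneg M
  | k + 1, M => ⟨fun t _ => by simpa using sq_nonneg M, fun i => by
      rw [map_zero]; exact HB.of_zero⟩

lemma integral_sq_mul_le (f g : Fld) (t : ℝ) {B : ℝ} (hB : ∀ x, |g t x| ≤ B) :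
    ∫ x in cube, (f * g) t x ^ 2 ≤ B ^ 2 * ∫ x in cube, f t x ^ 2 := by
  rw [← integral_const_mul]
  refine setIntegral_mono_on (integrable_cube ((f * g).cont_space t |>.pow 2))
    (integrable_cube (continuous_const.mul ((f.cont_space t).pow 2)))
    isCompact_cube.measurableSet fun x _ => ?_
  rw [mul_apply, mul_pow, mul_comm]
  refine mul_le_mul_of_nonneg_right ?_ (sq_nonneg _)
  rw [← sq_abs (g t x)]
  exact pow_le_pow_left₀ (abs_nonneg _) (hB x) 2

lemma HB.mul_CB : ∀ {k : ℕ} {M B : ℝ} {f g : Fld}, HB J k M f → CB J 1 k (fun _ _ => B) g →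
    0 ≤ M → 0 ≤ B → HB J k (4 ^ k * (M * B)) (f * g)
  | 0, M, B, f, g, hf, hg, h0, h0' => fun t ht => by
      refine (integral_sq_mul_le f g t (hg t ht)).trans ?_
      rw [pow_zero, one_mul, mul_pow, mul_comm]
      exact mul_le_mul_of_nonneg_right (hf t ht) (sq_nonneg _)
  | k + 1, M, B, f, g, hf, hg, h0, h0' => ⟨fun t ht => by
      refine (integral_sq_mul_le f g t (hg.1 t ht)).trans ?_
      rw [mul_pow, mul_pow, ← pow_mul]
      have h1 : (1:ℝ) ≤ 4 ^ ((k + 1) * 2) := one_le_pow₀ (by norm_num)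
      have h2 := mul_le_mul_of_nonneg_right (hf.1 t ht) (sq_nonneg B)
      have h3 : 0 ≤ M ^ 2 * B ^ 2 := by positivity
      nlinarith, fun i => by
      rw [D_mul, mul_comm g, add_comm (f * _)]
      have hgi : CB J 1 k (fun _ _ => B) (D i g) := (hg.2 i).congr fun t x => one_mul _
      have h := ((hf.2 i).mul_CB hg.pred h0 h0').add (hf.pred.mul_CB hgi h0 h0')
        (by positivity) (by positivity)
      rwa [show 2 * (4 ^ k * (M * B) + 4 ^ k * (M * B)) = 4 ^ (k + 1) * (M * B) by ring] at h⟩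

lemma CB.toHB : ∀ {k : ℕ} {B : ℝ} {f : Fld}, CB J 1 k (fun _ _ => B) f → HB J k B f := by
  have key : ∀ {B : ℝ} {f : Fld} {t : ℝ}, (∀ x, |f t x| ≤ B) →
      ∫ x in cube, f t x ^ 2 ≤ B ^ 2 := fun {B f t} h => by
    have := integral_sq_mul_le 1 f t h
    simpa [one_mul, volume_cube, Measure.real] using this
  intro k
  induction k with
  | zero => exact fun h t ht => key (h t ht)
  | succ k ih => exact fun h => ⟨fun t ht => key (h.1 t ht), fun i =>
      ih ((h.2 i).congr fun t x => one_mul _)⟩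

end HB

/-- A weighted constant bound gives an unweighted one. -/
lemma CB.unweight {J : Set ℝ} {L : ℝ} (hL : 1 ≤ L) : ∀ {k : ℕ} {B : ℝ} {f : Fld}, 0 ≤ B →
    CB J L k (fun _ _ => B) f → CB J 1 k (fun _ _ => L ^ k * B) f
  | 0, B, f, _, h => fun t ht x => by simpa using h t ht x
  | k + 1, B, f, h0, h => ⟨fun t ht x => (h.1 t ht x).trans
      (le_mul_of_one_le_left h0 (one_le_pow₀ hL)), fun i =>
      ((h.2 i).unweight hL (by positivity)).congr fun t x => by ring⟩

lemma periodic_cos_int (m : ℤ) : Function.Periodic (fun y : ℝ => cos (2 * π * m * y)) 1 := by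
  intro y
  show cos (2 * π * m * (y + 1)) = cos (2 * π * m * y)
  rw [← cos_add_int_mul_two_pi (2 * π * m * y) m]; ring_nf

lemma periodic_sin_int (m : ℤ) : Function.Periodic (fun y : ℝ => sin (2 * π * m * y)) 1 := by
  intro y
  show sin (2 * π * m * (y + 1)) = sin (2 * π * m * y)
  rw [← sin_add_int_mul_two_pi (2 * π * m * y) m]; ring_nf

/-- The field `cos (2π m x_l)`. -/
def cosF (l : Fin 3) (m : ℤ) : Fld :=
  xf l (fun y => cos (2 * π * m * y)) (by fun_prop) (periodic_cos_int m)

/-- The field `sin (2π m x_l)`. -/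
def sinF (l : Fin 3) (m : ℤ) : Fld :=
  xf l (fun y => sin (2 * π * m * y)) (by fun_prop) (periodic_sin_int m)

lemma D_cosF (i l : Fin 3) (m : ℤ) :
    D i (cosF l m) = if i = l then (-(2 * π * m)) • sinF l m else 0 := by
  ext t x
  rw [cosF, D_xf_apply]
  split_ifs
  · have h : HasDerivAt (fun y => cos (2 * π * m * y)) (-sin (2 * π * m * x l) * (2 * π * m))
      (x l) := by
      simpa using ((hasDerivAt_id (x l)).const_mul (2 * π * (m:ℝ))).cos
    rw [h.deriv]; simp [sinF]; ring
  · rfl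

lemma D_sinF (i l : Fin 3) (m : ℤ) :
    D i (sinF l m) = if i = l then (2 * π * m) • cosF l m else 0 := by
  ext t x
  rw [sinF, D_xf_apply]
  split_ifs
  · have h : HasDerivAt (fun y => sin (2 * π * m * y)) (cos (2 * π * m * x l) * (2 * π * m))
      (x l) := by
      simpa using ((hasDerivAt_id (x l)).const_mul (2 * π * (m:ℝ))).sin
    rw [h.deriv]; simp [cosF]; ring
  · rfl

lemma CB_trig (J : Set ℝ) (l : Fin 3) (m : ℤ) {L : ℝ} (hL : 2 * π * |(m:ℝ)| ≤ L) (k : ℕ) :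
    CB J L k (fun _ _ => 1) (cosF l m) ∧ CB J L k (fun _ _ => 1) (sinF l m) := by
  have hL0 : 0 ≤ L := le_trans (by positivity) hL
  induction k with
  | zero => exact ⟨fun t _ x => abs_cos_le_one _, fun t _ x => abs_sin_le_one _⟩
  | succ k ih =>
    have habs : |2 * π * (m:ℝ)| = 2 * π * |(m:ℝ)| := by
      rw [abs_mul, abs_of_pos (by positivity)]
    refine ⟨⟨fun t _ x => abs_cos_le_one _, fun i => ?_⟩,
      ⟨fun t _ x => abs_sin_le_one _, fun i => ?_⟩⟩
    · rw [D_cosF]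
      split_ifs
      · refine (ih.2.smul _).le hL0 fun t _ x => ?_
        rw [abs_neg, habs]; linarith
      · exact CB.of_zero hL0 fun _ _ _ => by simpa using hL0
    · rw [D_sinF]
      split_ifs
      · refine (ih.1.smul _).le hL0 fun t _ x => ?_
        rw [habs]; linarith
      · exact CB.of_zero hL0 fun _ _ _ => by simpa using hL0

/-- The product of the cosines with frequencies `m`. -/
def cosP (m : Fin 3 → ℤ) : Fld := cosF 0 (m 0) * cosF 1 (m 1) * cosF 2 (m 2)

lemma cosP_apply (m : Fin 3 → ℤ) (t : ℝ) (x : V3) :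
    cosP m t x = ∏ l, cos (2 * π * m l * x l) := by
  rw [Fin.prod_univ_three]; rfl

lemma CB_cosP (J : Set ℝ) (m : Fin 3 → ℤ) {L : ℝ} (hL : ∀ l, 2 * π * |(m l:ℝ)| ≤ L) (k : ℕ) :
    CB J (4 * L) k (fun _ _ => 1) (cosP m) := by
  have hL0 : 0 ≤ L := le_trans (by positivity) (hL 0)
  have h1 := CB.mul hL0 (CB_trig J 0 (m 0) (hL 0) k).1 (CB_trig J 1 (m 1) (hL 1) k).1
  have h2 : CB J (2 * L) k (fun _ _ => 1) (cosF 2 (m 2)) :=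
    (CB_trig J 2 (m 2) (hL 2) k).1.mono hL0 (by linarith) fun _ _ _ => le_rfl
  refine (CB.mul (by positivity) h1 h2).mono (by positivity) (by linarith) fun _ _ _ => by norm_num

lemma Lap_cosP (m : Fin 3 → ℤ) :
    Lap (cosP m) = (-(4 * π ^ 2 * ∑ l, (m l:ℝ) ^ 2)) • cosP m := by
  rw [Lap_eq, Fin.sum_univ_three, Fin.sum_univ_three, cosP]
  simp only [D_mul, D_cosF, D_sinF, map_add, (D _).map_smul, Fin.isValue]
  ext t x
  simp [D_mul, D_cosF, D_sinF]
  ring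

/-- The frequency vector attached to a family of index pairs. -/
def frq {n : ℕ} (P : Fin 3 → Fin n × Fin n) (l : Fin 3) : ℤ := ((P l).1 : ℤ) - ((P l).2 : ℤ)

lemma frq_le {n : ℕ} (P : Fin 3 → Fin n × Fin n) (l : Fin 3) : |(frq P l : ℝ)| ≤ n := by
  have h1 := (P l).1.2
  have h2 := (P l).2.2
  have : |frq P l| ≤ n := by rw [frq, abs_le]; constructor <;> omega
  exact_mod_cast this

/-- The Fejér kernel on the torus. -/
def fejer (n : ℕ) : Fld := ((n:ℝ) ^ 3)⁻¹ • ∑ P : Fin 3 → Fin n × Fin n, cosP (frq P)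

lemma one_le_sum_frq_sq {n : ℕ} {P : Fin 3 → Fin n × Fin n} (h : frq P ≠ 0) :
    (1:ℝ) ≤ ∑ l, (frq P l:ℝ) ^ 2 := by
  obtain ⟨l, hl⟩ := Function.ne_iff.1 h
  have : 1 ≤ (frq P l) ^ 2 := by
    have := Int.one_le_abs (show frq P l ≠ 0 from hl)
    nlinarith [sq_abs (frq P l)]
  have : (1:ℝ) ≤ (frq P l:ℝ) ^ 2 := by exact_mod_cast this
  exact this.trans (Finset.single_le_sum (f := fun l => (frq P l:ℝ) ^ 2)
    (fun _ _ => sq_nonneg _) (Finset.mem_univ l))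

/-- Eigenvalues of the inverse of `-Δ` on the Fejér frequencies. -/
def frqInv {n : ℕ} (P : Fin 3 → Fin n × Fin n) : ℝ :=
  if frq P = 0 then 0 else (4 * π ^ 2 * ∑ l, (frq P l:ℝ) ^ 2)⁻¹

/-- The periodic solution of `ΔG = 1 - K` with `K` the Fejér kernel. -/
def green (n : ℕ) : Fld :=
  ((n:ℝ) ^ 3)⁻¹ • ∑ P : Fin 3 → Fin n × Fin n, frqInv P • cosP (frq P)

lemma CB_sum_cosP (J : Set ℝ) (n k : ℕ) (hn : 1 ≤ n) {c : (Fin 3 → Fin n × Fin n) → ℝ}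
    (hc : ∀ P, |c P| ≤ 1) :
    CB J (26 * n) k (fun _ _ => (n:ℝ) ^ 3) (((n:ℝ) ^ 3)⁻¹ • ∑ P, c P • cosP (frq P)) := by
  have hn' : (1:ℝ) ≤ n := by exact_mod_cast hn
  have h := (CB.sum (J := J) (L := 4 * (2 * π * n)) Finset.univ (k := k)
    (f := fun P => c P • cosP (frq P)) (M := fun _ _ _ => 1) (by positivity)
    fun P _ => ((CB_cosP J (frq P) (L := 2 * π * n)
      (fun l => mul_le_mul_of_nonneg_left (frq_le P l) (by positivity)) k).smul _).le
      (by positivity) fun t _ x => by rw [mul_one]; exact hc P).smul ((n:ℝ) ^ 3)⁻¹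
  refine h.mono (by positivity) (by nlinarith [pi_lt_d2]) fun t _ x => ?_
  have : Fintype.card (Fin 3 → Fin n × Fin n) = n ^ 6 := by simp; ring
  rw [Finset.sum_const, Finset.card_univ, this, abs_of_nonneg (by positivity)]
  simp only [nsmul_eq_mul, mul_one, Nat.cast_pow]
  rw [inv_mul_le_iff₀ (by positivity)]
  exact le_of_eq (by ring)

lemma CB_fejer (J : Set ℝ) (n k : ℕ) (hn : 1 ≤ n) :
    CB J (26 * n) k (fun _ _ => (n:ℝ) ^ 3) (fejer n) := by
  simpa [fejer] using CB_sum_cosP J n k hn (c := fun _ => 1) (by simp)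

lemma abs_frqInv_le {n : ℕ} (P : Fin 3 → Fin n × Fin n) : |frqInv P| ≤ 1 := by
  unfold frqInv
  split_ifs with h
  · simp
  · rw [abs_of_nonneg (by positivity)]
    exact inv_le_one_of_one_le₀ (by nlinarith [pi_gt_three, one_le_sum_frq_sq h])

lemma CB_green (J : Set ℝ) (n k : ℕ) (hn : 1 ≤ n) :
    CB J (26 * n) k (fun _ _ => (n:ℝ) ^ 3) (green n) := CB_sum_cosP J n k hn abs_frqInv_le

lemma sum_frq_zero (n : ℕ) :
    ∑ P : Fin 3 → Fin n × Fin n, (if frq P = 0 then (1:ℝ) else 0) = (n:ℝ) ^ 3 := by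
  have h := Finset.prod_univ_sum (ι := Fin 3) (fun _ => (Finset.univ : Finset (Fin n × Fin n)))
    (fun _ p => if p.1 = p.2 then (1:ℝ) else 0)
  rw [Fintype.piFinset_univ] at h
  have e : ∀ P : Fin 3 → Fin n × Fin n, (if frq P = 0 then (1:ℝ) else 0)
      = ∏ l, if (P l).1 = (P l).2 then (1:ℝ) else 0 := by
    intro P
    rw [Finset.prod_ite_zero]
    simp only [Finset.mem_univ, true_implies, Finset.prod_const_one]
    refine if_congr ?_ rfl rfl
    rw [funext_iff]
    refine forall_congr' fun l => ?_
    simp only [frq, Pi.zero_apply, sub_eq_zero, Nat.cast_inj, Fin.val_inj]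
  simp only [e, ← h]
  rw [Finset.prod_const, Finset.card_univ, Fintype.card_fin]
  congr 1
  rw [Fintype.sum_prod_type]
  simp

lemma Lap_green (n : ℕ) (hn : 1 ≤ n) : Lap (green n) = 1 - fejer n := by
  have hn' : (n:ℝ) ≠ 0 := by positivity
  rw [green, map_smul, map_sum]
  have e : ∀ P : Fin 3 → Fin n × Fin n,
      Lap (frqInv P • cosP (frq P))
        = (if frq P = 0 then (1:ℝ) else 0) • (1 : Fld) - cosP (frq P) := by
    intro P
    rw [map_smul, Lap_cosP, smul_smul, frqInv]
    split_ifs with h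
    · rw [h]; ext t x; simp [cosP_apply]
    · have := one_le_sum_frq_sq h
      rw [mul_neg, inv_mul_cancel₀ (by positivity)]; simp
  simp only [e]
  rw [Finset.sum_sub_distrib, ← Finset.sum_smul, sum_frq_zero, smul_sub, smul_smul,
    inv_mul_cancel₀ (pow_ne_zero 3 hn'), one_smul, fejer]

/-- The one-dimensional Fejér kernel. -/
def fejer1 (n : ℕ) (y : ℝ) : ℝ :=
  (n:ℝ)⁻¹ * ((∑ a : Fin n, cos (2 * π * a * y)) ^ 2 + (∑ a : Fin n, sin (2 * π * a * y)) ^ 2)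

lemma fejer1_eq (n : ℕ) (y : ℝ) :
    fejer1 n y = (n:ℝ)⁻¹ * ∑ p : Fin n × Fin n, cos (2 * π * ((p.1:ℝ) - p.2) * y) := by
  rw [fejer1, sq, sq, Finset.sum_mul_sum, Finset.sum_mul_sum, ← Finset.sum_add_distrib,
    Fintype.sum_prod_type]
  congr 1
  refine Finset.sum_congr rfl fun a _ => ?_
  rw [← Finset.sum_add_distrib]
  refine Finset.sum_congr rfl fun b _ => ?_
  rw [← cos_sub]; ring_nf

lemma fejer_apply (n : ℕ) (t : ℝ) (x : V3) : fejer n t x = ∏ l, fejer1 n (x l) := by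
  simp only [fejer1_eq, Finset.prod_mul_distrib, Finset.prod_univ_sum, Fintype.piFinset_univ]
  rw [Finset.prod_const, Finset.card_univ, Fintype.card_fin, inv_pow, fejer, smul_apply, sum_apply]
  congr 1
  refine Finset.sum_congr rfl fun P _ => ?_
  rw [cosP_apply]
  refine Finset.prod_congr rfl fun l _ => ?_
  simp [frq]

lemma fejer1_nonneg (n : ℕ) (y : ℝ) : 0 ≤ fejer1 n y := by rw [fejer1]; positivity

lemma fejer_nonneg (n : ℕ) (t : ℝ) (x : V3) : 0 ≤ fejer n t x := by
  rw [fejer_apply]; exact Finset.prod_nonneg fun l _ => fejer1_nonneg _ _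

lemma sum_cos_mul_sin (n : ℕ) (y : ℝ) :
    sin (π * y) * ∑ a : Fin n, cos (2 * π * a * y)
      = (sin (π * y) + sin (π * y * (2 * n - 1))) / 2 := by
  rw [Fin.sum_univ_eq_sum_range (fun a : ℕ => cos (2 * π * a * y)), Finset.mul_sum]
  induction n with
  | zero => simp
  | succ n ih =>
    rw [Finset.sum_range_succ, ih]
    have h1 := sin_sub (2 * π * n * y) (π * y)
    have h2 := sin_add (2 * π * n * y) (π * y)
    rw [show π * y * (2 * (n:ℝ) - 1) = 2 * π * n * y - π * y by ring, h1]
    push_cast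
    rw [show π * y * (2 * ((n:ℝ) + 1) - 1) = 2 * π * n * y + π * y by ring, h2]
    ring

lemma sum_sin_mul_sin (n : ℕ) (y : ℝ) :
    sin (π * y) * ∑ a : Fin n, sin (2 * π * a * y)
      = (cos (π * y) - cos (π * y * (2 * n - 1))) / 2 := by
  rw [Fin.sum_univ_eq_sum_range (fun a : ℕ => sin (2 * π * a * y)), Finset.mul_sum]
  induction n with
  | zero => simp
  | succ n ih =>
    rw [Finset.sum_range_succ, ih]
    have h1 := cos_sub (2 * π * n * y) (π * y)
    have h2 := cos_add (2 * π * n * y) (π * y)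
    rw [show π * y * (2 * (n:ℝ) - 1) = 2 * π * n * y - π * y by ring, h1]
    push_cast
    rw [show π * y * (2 * ((n:ℝ) + 1) - 1) = 2 * π * n * y + π * y by ring, h2]
    ring

lemma fejer1_mul_sin_sq (n : ℕ) (y : ℝ) : fejer1 n y * sin (π * y) ^ 2 ≤ 2 / n := by
  have h1 := sum_cos_mul_sin n y
  have h2 := sum_sin_mul_sin n y
  have e : fejer1 n y * sin (π * y) ^ 2 = (n:ℝ)⁻¹ *
      ((sin (π * y) * ∑ a : Fin n, cos (2 * π * a * y)) ^ 2
        + (sin (π * y) * ∑ a : Fin n, sin (2 * π * a * y)) ^ 2) := by rw [fejer1]; ring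
  rw [e, h1, h2, div_eq_mul_inv, mul_comm]
  refine mul_le_mul_of_nonneg_right ?_ (by positivity)
  have a1 := sin_sq_add_cos_sq (π * y)
  have a2 := sin_sq_add_cos_sq (π * y * (2 * n - 1))
  nlinarith [sq_nonneg (sin (π * y) - sin (π * y * (2 * n - 1))),
    sq_nonneg (cos (π * y) + cos (π * y * (2 * n - 1)))]

lemma continuous_fejer1 (n : ℕ) : Continuous (fejer1 n) := by unfold fejer1; fun_prop

lemma integral_cos_int (m : ℤ) : ∫ y in Icc (0:ℝ) 1, cos (2 * π * m * y) = if m = 0 then 1 else 0 := by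
  rw [integral_Icc_eq_integral_Ioc, ← intervalIntegral.integral_of_le zero_le_one]
  split_ifs with h
  · simp [h]
  · have hm : (2 * π * (m:ℝ)) ≠ 0 := by
      have : (m:ℝ) ≠ 0 := by exact_mod_cast h
      positivity
    rw [intervalIntegral.integral_comp_mul_left (fun y => cos y) hm, integral_cos]
    have : sin (2 * π * m) = 0 := by
      rw [show 2 * π * (m:ℝ) = ((2 * m : ℤ) : ℝ) * π by push_cast; ring]
      exact sin_int_mul_pi _
    simp [this]

lemma integral_fejer1 (n : ℕ) (hn : 1 ≤ n) : ∫ y in Icc (0:ℝ) 1, fejer1 n y = 1 := by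
  have hn' : (n:ℝ) ≠ 0 := by positivity
  simp only [fejer1_eq]
  rw [integral_const_mul, integral_finsetSum]
  · have e : ∀ p : Fin n × Fin n, ∫ y in Icc (0:ℝ) 1, cos (2 * π * ((p.1:ℝ) - p.2) * y)
        = if p.1 = p.2 then 1 else 0 := by
      intro p
      have := integral_cos_int ((p.1:ℤ) - p.2)
      push_cast at this
      rw [this]
      refine if_congr ?_ rfl rfl
      rw [sub_eq_zero, Nat.cast_inj, Fin.val_inj]
    simp only [e]
    rw [Fintype.sum_prod_type]
    simp [hn']
  · intro p _
    exact (by fun_prop : Continuous _).continuousOn.integrableOn_compact isCompact_Icc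

lemma restrict_cube_eq : (volume : Measure V3).restrict cube
    = Measure.pi fun _ : Fin 3 => (volume : Measure ℝ).restrict (Icc 0 1) := by
  rw [← Measure.restrict_pi_pi, Set.pi_univ_Icc]
  rfl

lemma integral_cube_prod (f : Fin 3 → ℝ → ℝ) :
    ∫ x in cube, ∏ l, f l (x l) = ∏ l, ∫ y in Icc (0:ℝ) 1, f l y := by
  rw [restrict_cube_eq]
  exact integral_fintype_prod_eq_prod f

lemma integral_fejer (n : ℕ) (hn : 1 ≤ n) (t : ℝ) : ∫ x in cube, fejer n t x = 1 := by
  simp only [fejer_apply, integral_cube_prod, integral_fejer1 n hn, Finset.prod_const_one]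

lemma integral_fejer_sin_sq (n : ℕ) (hn : 1 ≤ n) (t : ℝ) (l : Fin 3) :
    ∫ x in cube, fejer n t x * sin (π * x l) ^ 2 ≤ 2 / n := by
  have e : ∀ x : V3, fejer n t x * sin (π * x l) ^ 2
      = ∏ i, (fun y => if i = l then fejer1 n y * sin (π * y) ^ 2 else fejer1 n y) (x i) := by
    intro x
    have : ∀ i, (fun y => if i = l then fejer1 n y * sin (π * y) ^ 2 else fejer1 n y) (x i)
      = fejer1 n (x i) * if i = l then sin (π * x i) ^ 2 else 1 := by
        intro i; simp only; split_ifs <;> simp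
    simp only [this]
    rw [Finset.prod_mul_distrib, fejer_apply, Finset.prod_ite_eq' Finset.univ l]; simp
  simp only [e]
  rw [integral_cube_prod (fun i y => if i = l then fejer1 n y * sin (π * y) ^ 2 else fejer1 n y)]
  have e2 : ∀ i, (∫ y in Icc (0:ℝ) 1, if i = l then fejer1 n y * sin (π * y) ^ 2 else fejer1 n y)
      = if i = l then ∫ y in Icc (0:ℝ) 1, fejer1 n y * sin (π * y) ^ 2 else 1 := by
    intro i; split_ifs
    · rfl
    · exact integral_fejer1 n hn
  simp only [e2]
  rw [Finset.prod_ite_eq' Finset.univ l]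
  simp only [Finset.mem_univ, if_true]
  calc ∫ y in Icc (0:ℝ) 1, fejer1 n y * sin (π * y) ^ 2
      ≤ ∫ y in Icc (0:ℝ) 1, (2 / n : ℝ) := by
        refine setIntegral_mono_on ?_ ?_ measurableSet_Icc fun y _ => fejer1_mul_sin_sq n y
        · exact (by have := continuous_fejer1 n; fun_prop : Continuous fun y => fejer1 n y * sin (π * y) ^ 2).continuousOn.integrableOn_compact
            isCompact_Icc
        · exact continuous_const.continuousOn.integrableOn_compact isCompact_Icc
    _ = 2 / n := by simp

end Fld

lemma integral_swap_compact {X Y : Type*} [TopologicalSpace X] [TopologicalSpace Y]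
    [MeasurableSpace X] [MeasurableSpace Y] [OpensMeasurableSpace X] [OpensMeasurableSpace Y]
    [T2Space X] [T2Space Y] [SecondCountableTopology X] [SecondCountableTopology Y]
    {μ : Measure X} {ν : Measure Y} [SFinite μ] [SFinite ν] [IsFiniteMeasureOnCompacts μ]
    [IsFiniteMeasureOnCompacts ν] {s : Set X} {t : Set Y} (hs : IsCompact s) (ht : IsCompact t)
    {F : X → Y → ℝ} (hF : Continuous (Function.uncurry F)) :
    ∫ x in s, ∫ y in t, F x y ∂ν ∂μ = ∫ y in t, ∫ x in s, F x y ∂μ ∂ν := by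
  have : IsFiniteMeasure (μ.restrict s) := ⟨by simpa using hs.measure_lt_top⟩
  have : IsFiniteMeasure (ν.restrict t) := ⟨by simpa using ht.measure_lt_top⟩
  refine integral_integral_swap ?_
  obtain ⟨C, hC⟩ := (hs.prod ht).exists_bound_of_continuousOn hF.continuousOn
  refine Integrable.of_bound hF.aestronglyMeasurable C ?_
  rw [Measure.prod_restrict]
  filter_upwards [ae_restrict_mem (hs.measurableSet.prod ht.measurableSet)] with z hz
  exact hC z hz

lemma sq_integral_weight_le {X : Type*} [MeasurableSpace X] {μ : Measure X} {k h : X → ℝ}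
    (hk : ∀ x, 0 ≤ k x) (h1 : Integrable k μ) (h2 : Integrable (fun x => k x * h x) μ)
    (h3 : Integrable (fun x => k x * h x ^ 2) μ) (hk1 : ∫ x, k x ∂μ = 1) :
    (∫ x, k x * h x ∂μ) ^ 2 ≤ ∫ x, k x * h x ^ 2 ∂μ := by
  set c := ∫ x, k x * h x ∂μ with hc
  have h0 : 0 ≤ ∫ x, k x * (h x - c) ^ 2 ∂μ :=
    integral_nonneg fun x => mul_nonneg (hk x) (sq_nonneg _)
  have e : ∀ x, k x * (h x - c) ^ 2 = (k x * h x ^ 2 - (2 * c) * (k x * h x)) + c ^ 2 * k x := by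
    intro x; ring
  simp only [e] at h0
  have hA : Integrable (fun x => k x * h x ^ 2 - (2 * c) * (k x * h x)) μ :=
    h3.sub (h2.const_mul _)
  rw [integral_add hA (h1.const_mul _),
    integral_sub h3 (h2.const_mul _), integral_const_mul, integral_const_mul, hk1, ← hc] at h0
  nlinarith

namespace Fld

lemma abs_integral_mul_le (f g : Fld) (t : ℝ) {A B : ℝ} (hA : 0 < A) (hB : 0 < B)
    (hf : ∫ x in cube, f t x ^ 2 ≤ A ^ 2) (hg : ∫ x in cube, g t x ^ 2 ≤ B ^ 2) :
    ∫ x in cube, |(f * g) t x| ≤ A * B := by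
  have cf := f.cont_space t
  have cg := g.cont_space t
  have h1 : ∫ x in cube, |(f * g) t x|
      ≤ ∫ x in cube, (B / (2 * A) * f t x ^ 2 + A / (2 * B) * g t x ^ 2) := by
    refine setIntegral_mono_on (integrable_cube ((f * g).cont_space t).abs)
      (integrable_cube (by fun_prop)) isCompact_cube.measurableSet fun x _ => ?_
    rw [mul_apply, abs_mul]
    have : B / (2 * A) * f t x ^ 2 + A / (2 * B) * g t x ^ 2
        = ((B * |f t x|) ^ 2 + (A * |g t x|) ^ 2) / (2 * A * B) := by
      rw [mul_pow, mul_pow, sq_abs, sq_abs]; field_simp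
    rw [this, le_div_iff₀ (by positivity)]
    nlinarith [sq_nonneg (B * |f t x| - A * |g t x|)]
  rw [integral_add (integrable_cube (by fun_prop)) (integrable_cube (by fun_prop)),
    integral_const_mul, integral_const_mul] at h1
  refine h1.trans ?_
  calc _ ≤ B / (2 * A) * A ^ 2 + A / (2 * B) * B ^ 2 := by gcongr
    _ = A * B := by field_simp; ring

lemma integral_abs_le_of_sq (f : Fld) (t : ℝ) {A : ℝ} (hA : 0 < A)
    (hf : ∫ x in cube, f t x ^ 2 ≤ A ^ 2) : ∫ x in cube, |f t x| ≤ A := by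
  have := abs_integral_mul_le f 1 t hA one_pos hf (by simp [volume_cube, Measure.real])
  simpa using this

lemma fderiv_eq_sum (f : Fld) (t : ℝ) (y w : V3) :
    fderiv ℝ (f t) y w = ∑ l, w l * D l f t y := by
  have : w = ∑ l, w l • (Pi.single l 1 : V3) := by
    ext j; simp [Finset.sum_apply, Pi.single_apply]
  have h := congrArg (fderiv ℝ (f t) y) this
  rw [h, map_sum]
  refine Finset.sum_congr rfl fun l _ => ?_
  rw [ContinuousLinearMap.map_smul, smul_eq_mul, D_apply]
  rfl

lemma path_eq (f : Fld) (t : ℝ) (x v : V3) :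
    f t x - f t (x - v) = ∫ r in Icc (0:ℝ) 1, ∑ l, v l * D l f t (x - r • v) := by
  have hd : ∀ r : ℝ, HasDerivAt (fun r : ℝ => f t (x - r • v))
      (-∑ l, v l * D l f t (x - r • v)) r := by
    intro r
    have h1 : HasFDerivAt (f t) (fderiv ℝ (f t) (x - r • v)) (x - r • v) :=
      ((f.smooth.space t).differentiable (by simp) _).hasFDerivAt
    have h2 : HasDerivAt (fun r : ℝ => x - r • v) (-v) r := by
      simpa using ((hasDerivAt_id r).smul_const v).const_sub x
    have h3 := h1.comp_hasDerivAt r h2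
    refine h3.congr_deriv ?_
    rw [map_neg, fderiv_eq_sum]
  have hc : Continuous fun r : ℝ => ∑ l, v l * D l f t (x - r • v) :=
    continuous_finsetSum _ fun l _ =>
      continuous_const.mul (((D l f).cont_space t).comp (by fun_prop))
  have h := intervalIntegral.integral_eq_sub_of_hasDerivAt (a := 0) (b := 1) (fun r _ => hd r)
    (hc.neg.intervalIntegrable _ _)
  rw [intervalIntegral.integral_neg, intervalIntegral.integral_of_le zero_le_one,
    ← integral_Icc_eq_integral_Ioc] at h
  simp only [one_smul, zero_smul, sub_zero] at h
  linarith

lemma sq_translate_sub_le (f : Fld) (t : ℝ) (x v : V3) :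
    (f t x - f t (x - v)) ^ 2
      ≤ ∫ r in Icc (0:ℝ) 1, (∑ l, v l * D l f t (x - r • v)) ^ 2 := by
  have c1 : Continuous fun r : ℝ => ∑ l, v l * D l f t (x - r • v) :=
    continuous_finsetSum _ fun l _ =>
      continuous_const.mul (((D l f).cont_space t).comp (by fun_prop))
  rw [path_eq]
  have i1 : ∀ g : ℝ → ℝ, Continuous g → Integrable g (volume.restrict (Icc (0:ℝ) 1)) :=
    fun g hg => hg.continuousOn.integrableOn_compact isCompact_Icc
  have := sq_integral_weight_le (μ := volume.restrict (Icc (0:ℝ) 1)) (k := fun _ => 1)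
    (h := fun r => ∑ l, v l * D l f t (x - r • v)) (fun _ => zero_le_one)
    (i1 _ continuous_const) (i1 _ (continuous_const.mul c1)) (i1 _ (continuous_const.mul (c1.pow 2)))
    (by simp)
  simpa only [one_mul] using this

lemma integral_translate_sq (f : Fld) (t : ℝ) (w : V3) :
    ∫ x in cube, f t (x - w) ^ 2 = ∫ x in cube, f t x ^ 2 := by
  have := integral_translate (f := fun x => f t x ^ 2)
    (fun x n => by simp only; rw [f.per t x n]) (-w)
  rw [← this]
  refine integral_congr_ae (.of_forall fun y => ?_)
  simp only [sub_eq_add_neg, add_comm]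

lemma integral_sq_dir_le (f : Fld) (t : ℝ) (v w : V3) :
    ∫ x in cube, (∑ l, v l * D l f t (x - w)) ^ 2
      ≤ 3 * ∑ l, v l ^ 2 * ∫ x in cube, D l f t x ^ 2 := by
  have cE : ∀ l, Continuous fun x => D l f t (x - w) := fun l =>
    ((D l f).cont_space t).comp (by fun_prop)
  have cS : Continuous fun x => (∑ l, v l * D l f t (x - w)) ^ 2 :=
    (continuous_finsetSum _ fun l _ => continuous_const.mul (cE l)).pow 2
  rw [Finset.mul_sum]
  simp only [← integral_translate_sq _ t w]
  simp only [← integral_const_mul]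
  have hi : ∀ l ∈ (Finset.univ : Finset (Fin 3)),
      IntegrableOn (fun x => 3 * (v l ^ 2 * D l f t (x - w) ^ 2)) cube := fun l _ =>
    integrable_cube (continuous_const.mul (continuous_const.mul ((cE l).pow 2)))
  rw [← integral_finsetSum _ hi]
  refine setIntegral_mono_on (integrable_cube cS) (integrable_cube
    (continuous_finsetSum _ fun l _ => continuous_const.mul
      (continuous_const.mul ((cE l).pow 2)))) isCompact_cube.measurableSet fun x _ => ?_
  simp only [Fin.sum_univ_three]
  have : ∀ a b c : ℝ, (a + b + c) ^ 2 ≤ 3 * a ^ 2 + 3 * b ^ 2 + 3 * c ^ 2 := fun a b c => by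
    nlinarith [sq_nonneg (a - b), sq_nonneg (a - c), sq_nonneg (b - c)]
  refine (this _ _ _).trans (le_of_eq ?_)
  ring

lemma integral_le_of_le_average {g : V3 → ℝ} {F : ℝ → V3 → ℝ} {C : ℝ} (cf : Continuous g)
    (cF : Continuous (Function.uncurry F)) (s1 : ∀ x, g x ≤ ∫ r in Icc (0:ℝ) 1, F r x)
    (s2 : ∀ r, ∫ x in cube, F r x ≤ C) : ∫ x in cube, g x ≤ C := by
  have cI : Continuous fun x => ∫ r in Icc (0:ℝ) 1, F r x :=
    continuous_parametric_integral_of_continuous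
      (f := fun x r => F r x) (cF.comp continuous_swap) isCompact_Icc
  have cJ : Continuous fun r => ∫ x in cube, F r x :=
    continuous_parametric_integral_of_continuous (f := F) cF isCompact_cube
  calc ∫ x in cube, g x
      ≤ ∫ x in cube, ∫ r in Icc (0:ℝ) 1, F r x :=
        setIntegral_mono_on (integrable_cube cf) (integrable_cube cI)
          isCompact_cube.measurableSet fun x _ => s1 x
    _ = ∫ r in Icc (0:ℝ) 1, ∫ x in cube, F r x :=
        (integral_swap_compact isCompact_Icc isCompact_cube cF).symm
    _ ≤ ∫ _ in Icc (0:ℝ) 1, C :=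
        setIntegral_mono_on (cJ.continuousOn.integrableOn_compact isCompact_Icc)
          (continuous_const.continuousOn.integrableOn_compact isCompact_Icc)
          measurableSet_Icc fun r _ => s2 r
    _ = C := by simp

lemma integral_translate_sub_sq (f : Fld) (t : ℝ) (v : V3) :
    ∫ x in cube, (f t x - f t (x - v)) ^ 2 ≤ 3 * ∑ l, v l ^ 2 * ∫ x in cube, D l f t x ^ 2 := by
  refine integral_le_of_le_average (F := fun r x => (∑ l, v l * D l f t (x - r • v)) ^ 2)
    ?_ ?_ (fun x => sq_translate_sub_le f t x v) (fun r => integral_sq_dir_le f t v (r • v))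
  · exact ((f.cont_space t).sub ((f.cont_space t).comp (by fun_prop))).pow 2
  · refine Continuous.pow ?_ 2
    exact continuous_finsetSum (Finset.univ : Finset (Fin 3)) fun l _ =>
      continuous_const.mul (((D l f).cont_space t).comp (g := D l f t)
        (f := fun q : ℝ × V3 => q.2 - q.1 • v) (by fun_prop))

lemma sub_round_sq_le (y : ℝ) : (y - round y) ^ 2 ≤ sin (π * y) ^ 2 := by
  set v := y - round y with hv
  have h1 : |v| ≤ 1 / 2 := abs_sub_round y
  have e : sin (π * y) ^ 2 = sin (π * v) ^ 2 := by
    have : π * y = π * v + (round y : ℤ) * π := by rw [hv]; ring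
    rw [this, sin_add_int_mul_pi, mul_pow]
    rw [← sq_abs ((-1:ℝ) ^ (round y : ℤ)), abs_zpow]; simp
  rw [e, ← sq_abs v, ← sq_abs (sin _)]
  refine pow_le_pow_left₀ (abs_nonneg _) ?_ 2
  have h2 : sin (π * |v|) ≤ |sin (π * v)| := by
    rcases abs_cases v with ⟨h, _⟩ | ⟨h, _⟩ <;> rw [h]
    · exact le_abs_self _
    · rw [mul_neg, sin_neg]; exact neg_le_abs _
  have h3 := mul_le_sin (x := π * |v|) (by positivity) (by nlinarith [pi_pos])
  have h4 : 2 / π * (π * |v|) = 2 * |v| := by field_simp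
  have := abs_nonneg v
  linarith

lemma integral_translate_sub_sq' (f : Fld) (t : ℝ) (y : V3) :
    ∫ x in cube, (f t x - f t (x - y)) ^ 2
      ≤ 3 * ∑ l, sin (π * y l) ^ 2 * ∫ x in cube, D l f t x ^ 2 := by
  set v : V3 := fun l => y l - round (y l) with hv
  have e : ∀ x, f t (x - y) = f t (x - v) := by
    intro x
    rw [← f.per t (x - y) fun l => round (y l)]
    refine congrArg (f t) (funext fun l => ?_)
    simp only [hv, Pi.add_apply, Pi.sub_apply]; ring
  simp only [e]
  refine (integral_translate_sub_sq f t v).trans ?_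
  refine mul_le_mul_of_nonneg_left (Finset.sum_le_sum fun l _ => ?_) (by norm_num)
  exact mul_le_mul_of_nonneg_right (sub_round_sq_le _) (integral_nonneg fun x => sq_nonneg _)

lemma integral_le_of_le_fejer (n : ℕ) {g B : V3 → ℝ} {F : V3 → V3 → ℝ} (cg : Continuous g)
    (cB : Continuous B) (cF : Continuous (Function.uncurry F))
    (s1 : ∀ x, g x ≤ ∫ y in cube, fejer n 0 y * F y x) (s2 : ∀ y, ∫ x in cube, F y x ≤ B y) :
    ∫ x in cube, g x ≤ ∫ y in cube, fejer n 0 y * B y := by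
  have cK : Continuous (fejer n 0) := (fejer n).cont_space 0
  have cG : Continuous (Function.uncurry fun y x => fejer n 0 y * F y x) :=
    (cK.comp continuous_fst).mul cF
  have cI : Continuous fun x => ∫ y in cube, fejer n 0 y * F y x :=
    continuous_parametric_integral_of_continuous
      (f := fun x y => fejer n 0 y * F y x) (cG.comp continuous_swap) isCompact_cube
  have cJ : Continuous fun y => ∫ x in cube, F y x :=
    continuous_parametric_integral_of_continuous (f := F) cF isCompact_cube
  calc ∫ x in cube, g x
      ≤ ∫ x in cube, ∫ y in cube, fejer n 0 y * F y x :=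
        setIntegral_mono_on (integrable_cube cg) (integrable_cube cI)
          isCompact_cube.measurableSet fun x _ => s1 x
    _ = ∫ y in cube, fejer n 0 y * ∫ x in cube, F y x := by
        rw [← integral_swap_compact isCompact_cube isCompact_cube cG]
        simp only [integral_const_mul]
    _ ≤ _ := setIntegral_mono_on (integrable_cube (cK.mul cJ)) (integrable_cube (cK.mul cB))
        isCompact_cube.measurableSet fun y _ =>
          mul_le_mul_of_nonneg_left (s2 y) (fejer_nonneg n 0 y)

lemma sq_integral_fejer_le (n : ℕ) (hn : 1 ≤ n) {h : V3 → ℝ} (c : Continuous h) :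
    (∫ y in cube, fejer n 0 y * h y) ^ 2 ≤ ∫ y in cube, fejer n 0 y * h y ^ 2 := by
  have cK : Continuous (fejer n 0) := (fejer n).cont_space 0
  exact sq_integral_weight_le (fejer_nonneg n 0) (integrable_cube cK) (integrable_cube (cK.mul c))
    (integrable_cube (cK.mul (c.pow 2))) (integral_fejer n hn 0)

lemma integral_conv_sub_sq (n : ℕ) (hn : 1 ≤ n) (f : Fld) (t : ℝ) :
    ∫ x in cube, (f - conv (fejer n) f) t x ^ 2
      ≤ 6 / n * ∑ l, ∫ x in cube, D l f t x ^ 2 := by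
  have cK : Continuous (fejer n 0) := (fejer n).cont_space 0
  have cf := f.cont_space t
  have cF : Continuous (Function.uncurry fun y x => (f t x - f t (x - y)) ^ 2) :=
    ((cf.comp continuous_snd).sub (cf.comp (continuous_snd.sub continuous_fst))).pow 2
  calc ∫ x in cube, (f - conv (fejer n) f) t x ^ 2
      ≤ ∫ y in cube, fejer n 0 y * (3 * ∑ l, sin (π * y l) ^ 2 * ∫ x in cube, D l f t x ^ 2) := by
        refine integral_le_of_le_fejer n (F := fun y x => (f t x - f t (x - y)) ^ 2)
          (((f - conv (fejer n) f).cont_space t).pow 2) (by fun_prop)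
          cF (fun x => ?_) (integral_translate_sub_sq' f t)
        have e : (f - conv (fejer n) f) t x
            = ∫ y in cube, fejer n 0 y * (f t x - f t (x - y)) := by
          simp only [mul_sub]
          rw [integral_sub (integrable_cube (by fun_prop)) (conv_integrable _ _ _ _),
            integral_mul_const, integral_fejer n hn, one_mul, sub_apply, conv_apply]
        rw [e]
        exact sq_integral_fejer_le n hn (continuous_const.sub (cf.comp (by fun_prop)))
    _ = ∑ l, (3 * ∫ x in cube, D l f t x ^ 2) * ∫ y in cube, fejer n 0 y * sin (π * y l) ^ 2 := by
        simp only [← integral_const_mul]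
        rw [← integral_finsetSum _ fun l _ => integrable_cube (by fun_prop)]
        refine integral_congr_ae (.of_forall fun y => ?_)
        simp only [integral_const_mul, Finset.mul_sum]
        exact Finset.sum_congr rfl fun l _ => by ring
    _ ≤ ∑ l, (3 * ∫ x in cube, D l f t x ^ 2) * (2 / n) :=
        Finset.sum_le_sum fun l _ => mul_le_mul_of_nonneg_left (integral_fejer_sin_sq n hn 0 l)
          (mul_nonneg (by norm_num) (integral_nonneg fun x => sq_nonneg _))
    _ = _ := by
        rw [Finset.mul_sum]
        exact Finset.sum_congr rfl fun l _ => by ring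

lemma integral_comp_conv_le (n : ℕ) (hn : 1 ≤ n) (f : Fld) (t : ℝ) {φ : ℝ → ℝ} (hφ : Continuous φ)
    (h : ∀ x, φ (conv (fejer n) f t x) ≤ ∫ y in cube, fejer n 0 y * φ (f t (x - y))) :
    ∫ x in cube, φ (conv (fejer n) f t x) ≤ ∫ x in cube, φ (f t x) := by
  refine (integral_le_of_le_fejer n (B := fun _ => ∫ x in cube, φ (f t x))
    (hφ.comp ((conv (fejer n) f).cont_space t)) continuous_const
    (F := fun y x => φ (f t (x - y)))
    (hφ.comp ((f.cont_space t).comp (continuous_snd.sub continuous_fst))) h fun y => ?_).trans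
    (by rw [integral_mul_const, integral_fejer n hn, one_mul])
  rw [← integral_translate (f := fun x => φ (f t x))
    (fun x n => by simp only; rw [f.per t x n]) (-y)]
  simp only [sub_eq_add_neg, add_comm, le_refl]

lemma integral_conv_sq_le (n : ℕ) (hn : 1 ≤ n) (f : Fld) (t : ℝ) :
    ∫ x in cube, conv (fejer n) f t x ^ 2 ≤ ∫ x in cube, f t x ^ 2 :=
  integral_comp_conv_le n hn f t (φ := fun r => r ^ 2) (by fun_prop) fun x => by
    rw [conv_apply]
    exact sq_integral_fejer_le n hn ((f.cont_space t).comp (by fun_prop))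

lemma integral_abs_conv_le (n : ℕ) (hn : 1 ≤ n) (f : Fld) (t : ℝ) :
    ∫ x in cube, |conv (fejer n) f t x| ≤ ∫ x in cube, |f t x| :=
  integral_comp_conv_le n hn f t (φ := fun r => |r|) continuous_abs fun x => by
    rw [conv_apply]
    refine abs_integral_le_integral_abs.trans (le_of_eq (integral_congr_ae (.of_forall fun y => ?_)))
    simp only [abs_mul, abs_of_nonneg (fejer_nonneg n 0 y)]

lemma CB_conv {J : Set ℝ} {L B I : ℝ} : ∀ {k : ℕ} {K f : Fld} (_ : CB Set.univ L k (fun _ _ => B) K)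
    (_ : 0 ≤ L) (_ : ∀ t ∈ J, ∫ x in cube, |f t x| ≤ I), CB J L k (fun _ _ => B * I) (conv K f) := by
  have key : ∀ {K f : Fld} {B : ℝ}, (∀ y, |K 0 y| ≤ B) → (∀ t ∈ J, ∫ x in cube, |f t x| ≤ I) →
      ∀ t ∈ J, ∀ x, |conv K f t x| ≤ B * I := fun {K f B} hK hf t ht x =>
    (abs_conv_le K f hK t x).trans
      (mul_le_mul_of_nonneg_left (hf t ht) ((abs_nonneg _).trans (hK 0)))
  intro k
  induction k generalizing B with
  | zero => exact fun hK _ hf => key (hK 0 trivial) hf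
  | succ k ih =>
    refine fun {K f} hK hL hf => ⟨key (hK.1 0 trivial) hf, fun i => ?_⟩
    rw [D_conv, conv_D]
    exact (ih (B := L * B) (hK.2 i) hL hf).congr fun t x => by ring

/-- Smooth profiles supported in a compact subinterval of `(0,1)`. -/
def IsProf (f : ℝ → ℝ) : Prop :=
  ContDiff ℝ (⊤ : ℕ∞) f ∧ ∀ y, y ∉ Icc (1 / 36 : ℝ) (35 / 36) → f y = 0

/-- Smooth `1`-periodic functions. -/
def IsPer (f : ℝ → ℝ) : Prop := ContDiff ℝ (⊤ : ℕ∞) f ∧ Function.Periodic f 1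

lemma contDiff_deriv {f : ℝ → ℝ} (hf : ContDiff ℝ (⊤ : ℕ∞) f) :
    ContDiff ℝ (⊤ : ℕ∞) (deriv f) := by
  have := hf.iterate_deriv 1
  simpa using this

lemma IsProf.deriv {f : ℝ → ℝ} (hf : IsProf f) : IsProf (deriv f) := by
  refine ⟨contDiff_deriv hf.1, fun y hy => ?_⟩
  have : f =ᶠ[nhds y] fun _ => 0 := by
    filter_upwards [isClosed_Icc.isOpen_compl.mem_nhds hy] with z hz using hf.2 z hz
  rw [this.deriv_eq]; simp

lemma IsProf.mul {f g : ℝ → ℝ} (hf : IsProf f) (hg : IsProf g) : IsProf (fun y => f y * g y) :=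
  ⟨hf.1.mul hg.1, fun y hy => by
    show f y * g y = 0
    rw [hf.2 y hy, zero_mul]⟩

lemma IsProf.bounded {f : ℝ → ℝ} (hf : IsProf f) : ∃ C, ∀ y, |f y| ≤ C := by
  obtain ⟨C, hC⟩ := (isCompact_Icc (a := (1/36:ℝ)) (b := 35/36)).exists_bound_of_continuousOn
    hf.1.continuous.continuousOn
  refine ⟨max C 0, fun y => ?_⟩
  by_cases hy : y ∈ Icc (1/36:ℝ) (35/36)
  · exact (hC y hy).trans (le_max_left _ _)
  · rw [hf.2 y hy, abs_zero]; exact le_max_right _ _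

lemma IsProf.bounded_iter {f : ℝ → ℝ} (k : ℕ) (hf : IsProf f) :
    ∃ C, 1 ≤ C ∧ ∀ j ≤ k, ∀ y, |_root_.deriv^[j] f y| ≤ C := by
  induction k generalizing f with
  | zero =>
    obtain ⟨C, hC⟩ := hf.bounded
    exact ⟨max C 1, le_max_right _ _, fun j hj y => by
      obtain rfl : j = 0 := by omega
      exact (hC y).trans (le_max_left _ _)⟩
  | succ k ih =>
    obtain ⟨C, hC⟩ := hf.bounded
    obtain ⟨C', h1, hC'⟩ := ih hf.deriv
    refine ⟨max C C', h1.trans (le_max_right _ _), fun j hj y => ?_⟩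
    cases j with
    | zero => exact (hC y).trans (le_max_left _ _)
    | succ j => exact (hC' j (by omega) y).trans (le_max_right _ _)

/-- Periodization of the concentrated profile `f (m ·)`. -/
def conc (m : ℝ) (f : ℝ → ℝ) (y : ℝ) : ℝ := f (m * Int.fract y)

lemma conc_eventually {f : ℝ → ℝ} (hf : IsProf f) {m : ℝ} (hm : 1 ≤ m) (y : ℝ) :
    conc m f =ᶠ[nhds y] fun z => f (m * (z - ⌊y⌋)) := by
  have hz : ∀ z, m * z < 1 / 36 ∨ 35 / 36 < m * z → f (m * z) = 0 := fun z h => by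
    refine hf.2 _ fun h' => ?_
    rcases h with h | h
    · exact absurd h'.1 (not_le.2 h)
    · exact absurd h'.2 (not_le.2 h)
  rcases (Int.fract_nonneg y).eq_or_lt with h0 | h0
  · have hy : (⌊y⌋ : ℝ) = y := by have := Int.self_sub_floor y; linarith
    have hd : (0:ℝ) < 1 / 36 / m := by positivity
    filter_upwards [Metric.ball_mem_nhds y hd] with z hz'
    rw [Metric.mem_ball, Real.dist_eq, abs_lt] at hz'
    have hd1 : 1 / 36 / m ≤ 1 / 36 := div_le_self (by norm_num) hm
    have hmd : m * (1 / 36 / m) = 1 / 36 := by field_simp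
    rw [hy]
    unfold conc
    rcases le_or_gt y z with h | h
    · have : ⌊z⌋ = ⌊y⌋ := by
        rw [Int.floor_eq_iff, hy]; constructor <;> linarith
      rw [Int.fract, this, hy]
    · have : ⌊z⌋ = ⌊y⌋ - 1 := by
        rw [Int.floor_eq_iff]; push_cast; rw [hy]; constructor <;> linarith
      have e : Int.fract z = z - y + 1 := by rw [Int.fract, this]; push_cast; rw [hy]; ring
      have h4 : f (m * Int.fract z) = 0 := by
        refine hz _ (Or.inr ?_)
        rw [e]
        have : m * (z - y + 1) = m * (z - y) + m := by ring
        have h3 : m * (-(1/36/m)) < m * (z - y) := by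
          apply mul_lt_mul_of_pos_left _ (by linarith); linarith
        rw [mul_neg, hmd] at h3
        linarith
      have h5 : f (m * (z - y)) = 0 := by
        refine hz _ (Or.inl ?_)
        have : m * (z - y) ≤ 0 := mul_nonpos_of_nonneg_of_nonpos (by linarith) (by linarith)
        linarith
      rw [h4, h5]
  · have h1 := Int.fract_lt_one y
    have e := Int.self_sub_floor y
    filter_upwards [Ioo_mem_nhds (a := (⌊y⌋:ℝ)) (b := ⌊y⌋ + 1) (by linarith) (by linarith)]
      with z hz'
    have : ⌊z⌋ = ⌊y⌋ := by
      rw [Int.floor_eq_iff]; exact ⟨hz'.1.le, hz'.2⟩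
    rw [conc, Int.fract, this]

lemma conc_periodic (m : ℝ) (f : ℝ → ℝ) : Function.Periodic (conc m f) 1 := fun y => by
  simp [conc]

lemma conc_isPer {f : ℝ → ℝ} (hf : IsProf f) {m : ℝ} (hm : 1 ≤ m) : IsPer (conc m f) := by
  refine ⟨contDiff_iff_contDiffAt.2 fun y => ?_, conc_periodic m f⟩
  refine ContDiffAt.congr_of_eventuallyEq ?_ (conc_eventually hf hm y)
  exact (hf.1.comp (by fun_prop : ContDiff ℝ (⊤ : ℕ∞) fun z : ℝ => m * (z - ⌊y⌋))).contDiffAt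

lemma deriv_conc {f : ℝ → ℝ} (hf : IsProf f) {m : ℝ} (hm : 1 ≤ m) (y : ℝ) :
    deriv (conc m f) y = m * conc m (deriv f) y := by
  rw [(conc_eventually hf hm y).deriv_eq]
  have h1 : HasDerivAt (fun z : ℝ => m * (z - ⌊y⌋)) m y := by
    simpa using ((hasDerivAt_id y).sub_const (⌊y⌋:ℝ)).const_mul m
  have h2 : HasDerivAt f (deriv f (m * (y - ⌊y⌋))) (m * (y - ⌊y⌋)) :=
    (hf.1.differentiable (by simp) _).hasDerivAt
  have := (h2.comp y h1).deriv
  simp only [Function.comp_def] at this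
  rw [this, conc, Int.fract, mul_comm]

/-- Indicator of the set on which the profiles concentrate. -/
def ind (m : ℝ) (y : ℝ) : ℝ := if Int.fract y ≤ 1 / m then 1 else 0

lemma ind_nonneg (m y : ℝ) : 0 ≤ ind m y := by unfold ind; split_ifs <;> norm_num
lemma ind_le_one (m y : ℝ) : ind m y ≤ 1 := by unfold ind; split_ifs <;> norm_num
lemma ind_periodic (m : ℝ) : Function.Periodic (ind m) 1 := fun y => by simp [ind]

lemma measurable_ind (m : ℝ) : Measurable (ind m) :=
  Measurable.ite (measurable_fract measurableSet_Iic) measurable_const measurable_const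

lemma abs_conc_le {f : ℝ → ℝ} (hf : IsProf f) {m : ℝ} (hm : 1 ≤ m) {C : ℝ}
    (hC : ∀ y, |f y| ≤ C) (y : ℝ) : |conc m f y| ≤ C * ind m y := by
  unfold ind
  split_ifs with h
  · rw [mul_one]; exact hC _
  · rw [conc, hf.2, abs_zero, mul_zero]
    rintro ⟨-, h2⟩
    refine h ?_
    rw [le_div_iff₀ (by linarith), mul_comm]
    linarith

lemma integral_scale {f : ℝ → ℝ} (hp : Function.Periodic f 1) {N : ℕ}
    (hN : 1 ≤ N) : ∫ y in Icc (0:ℝ) 1, f (N * y) = ∫ y in Icc (0:ℝ) 1, f y := by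
  have hN0 : (N:ℝ) ≠ 0 := by positivity
  rw [integral_Icc_eq_integral_Ioc, integral_Icc_eq_integral_Ioc,
    ← intervalIntegral.integral_of_le zero_le_one, ← intervalIntegral.integral_of_le zero_le_one,
    intervalIntegral.integral_comp_mul_left _ hN0]
  by_cases h : IntervalIntegrable f volume 0 1
  · have := hp.intervalIntegral_add_zsmul_eq N 0 (hp.intervalIntegrable₀ one_ne_zero h)
    simp only [zero_add, zsmul_eq_mul, mul_one, Int.cast_natCast] at this
    rw [mul_zero, mul_one, this]
    simp [hN0]
  · rw [intervalIntegral.integral_undef h, intervalIntegral.integral_undef, smul_zero]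
    intro h'
    rw [mul_zero, mul_one] at h'
    refine h (h'.mono_set ?_)
    rw [uIcc_of_le zero_le_one, uIcc_of_le (by positivity)]
    exact Icc_subset_Icc_right (by exact_mod_cast hN)

lemma integral_ind {m : ℝ} (hm : 1 ≤ m) : ∫ y in Icc (0:ℝ) 1, ind m y ≤ 1 / m := by
  have h1 : (1:ℝ) / m ≤ 1 := by rw [div_le_one (by linarith)]; exact hm
  rw [integral_Icc_eq_integral_Ico]
  have : ∫ y in Ico (0:ℝ) 1, ind m y = ∫ y in Ico (0:ℝ) 1, (Iic (1/m)).indicator (fun _ => 1) y := by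
    refine setIntegral_congr_fun measurableSet_Ico fun y hy => ?_
    simp only [ind, indicator, mem_Iic]
    rw [Int.fract_eq_self.2 hy]
  rw [this, setIntegral_indicator measurableSet_Iic]
  simp only [integral_const, smul_eq_mul, mul_one]
  have hsub : Ico (0:ℝ) 1 ∩ Iic (1/m) ⊆ Icc 0 (1/m) := fun y hy => ⟨hy.1.1, hy.2⟩
  rw [measureReal_restrict_apply_univ]
  refine (measureReal_mono hsub (by simp)).trans ?_
  rw [Measure.real, Real.volume_Icc, ENNReal.toReal_ofReal (by rw [sub_zero]; positivity), sub_zero]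

lemma integral_cube_coord (l : Fin 3) (f : ℝ → ℝ) :
    ∫ x in cube, f (x l) = ∫ y in Icc (0:ℝ) 1, f y := by
  have := integral_cube_prod fun j => if j = l then f else fun _ => 1
  rw [Finset.prod_eq_single l (fun j _ hj => by simp [hj]) (by simp)] at this
  rw [if_pos rfl] at this
  rw [← this]
  congr 1
  ext x
  rw [Finset.prod_eq_single l (fun j _ hj => by simp [hj]) (by simp), if_pos rfl]

lemma IsPer.scale {f : ℝ → ℝ} (hf : IsPer f) (N : ℕ) : IsPer fun y => f (N * y) := by
  refine ⟨hf.1.comp (by fun_prop), fun y => ?_⟩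
  have := hf.2.nat_mul N (N * y)
  simpa [mul_add] using this

/-- The oscillating field `f (N x_l)`. -/
def osc (l : Fin 3) (N : ℕ) (f : ℝ → ℝ) (hf : IsPer f) : Fld :=
  xf l (fun y => f (N * y)) (hf.scale N).1 (hf.scale N).2

@[simp] lemma osc_apply (l : Fin 3) (N : ℕ) (f : ℝ → ℝ) (hf : IsPer f) (t : ℝ) (x : V3) :
    osc l N f hf t x = f (N * x l) := rfl

lemma IsPer.deriv {f : ℝ → ℝ} (hf : IsPer f) : IsPer (deriv f) := by
  refine ⟨contDiff_deriv hf.1, fun y => ?_⟩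
  have : f = fun z => f (z + 1) := funext fun z => (hf.2 z).symm
  conv_rhs => rw [this]
  rw [deriv_comp_add_const]

lemma D_osc (i l : Fin 3) (N : ℕ) (f : ℝ → ℝ) (hf : IsPer f) :
    D i (osc l N f hf) = if i = l then (N:ℝ) • osc l N (deriv f) hf.deriv else 0 := by
  ext t x
  rw [osc, D_xf_apply]
  split_ifs
  · rw [smul_apply, osc_apply]
    have h1 : HasDerivAt (fun z : ℝ => (N:ℝ) * z) N (x l) := by
      simpa using (hasDerivAt_id (x l)).const_mul (N:ℝ)
    have h2 : HasDerivAt f (_root_.deriv f (N * x l)) (N * x l) :=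
      (hf.1.differentiable (by simp) _).hasDerivAt
    have := (h2.comp (x l) h1).deriv
    simp only [Function.comp_def] at this
    rw [this, mul_comm]
  · rfl

lemma Dt_osc (l : Fin 3) (N : ℕ) (f : ℝ → ℝ) (hf : IsPer f) : Dt (osc l N f hf) = 0 := by
  rw [osc, Dt_xf]

lemma CB_osc_conc (J : Set ℝ) (l : Fin 3) (N : ℕ) {m C : ℝ} (hm : 1 ≤ m) (k : ℕ) {f : ℝ → ℝ}
    (hf : IsProf f) (hC : ∀ j ≤ k, ∀ y, |deriv^[j] f y| ≤ C) :
    CB J (N * m) k (fun _ x => C * ind m (N * x l)) (osc l N (conc m f) (conc_isPer hf hm)) := by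
  have hC0 : 0 ≤ C := (abs_nonneg _).trans (hC 0 (by omega) 0)
  induction k generalizing f with
  | zero => exact fun t _ x => abs_conc_le hf hm (hC 0 le_rfl) _
  | succ k ih =>
    refine ⟨fun t _ x => abs_conc_le hf hm (hC 0 (by omega)) _, fun i => ?_⟩
    have h0 : ∀ x : V3, 0 ≤ N * m * (C * ind m (N * x l)) := fun x =>
      mul_nonneg (by positivity) (mul_nonneg hC0 (ind_nonneg _ _))
    rw [D_osc]
    split_ifs
    · have e : osc l N (deriv (conc m f)) (conc_isPer hf hm).deriv
          = m • osc l N (conc m (deriv f)) (conc_isPer hf.deriv hm) := by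
        ext t x
        rw [smul_apply, osc_apply, osc_apply, deriv_conc hf hm]
      rw [e, smul_smul]
      have := (ih hf.deriv fun j hj y => hC (j + 1) (by omega) y).smul ((N:ℝ) * m)
      refine this.congr fun t x => ?_
      rw [abs_of_nonneg (by positivity)]
    · exact CB.of_zero (by positivity) fun t _ x => h0 x

lemma exists_bump : ∃ f : ℝ → ℝ, ContDiff ℝ (⊤ : ℕ∞) f ∧ (∀ y, y ∉ Icc (1 / 4 : ℝ) (3 / 4) → f y = 0) ∧
    f (1 / 2) = 1 := by
  let φ : ContDiffBump (1 / 2 : ℝ) := ⟨1 / 8, 1 / 4, by norm_num, by norm_num⟩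
  refine ⟨φ, φ.contDiff, fun y hy => φ.zero_of_le_dist ?_, φ.one_of_mem_closedBall ?_⟩
  · by_contra h
    push Not at h
    rw [Real.dist_eq, abs_lt] at h
    have h1 : φ.rOut = 1 / 4 := rfl
    rw [h1] at h
    exact hy ⟨by linarith [h.1], by linarith [h.2]⟩
  · exact Metric.mem_closedBall_self (by norm_num [φ])

lemma integral_sq_pos {f : ℝ → ℝ} (hf : Continuous f) (h : ∃ c ∈ Icc (0:ℝ) 1, f c ≠ 0) :
    0 < ∫ y in Icc (0:ℝ) 1, f y ^ 2 := by
  rw [integral_Icc_eq_integral_Ioc, ← intervalIntegral.integral_of_le zero_le_one]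
  refine intervalIntegral.integral_pos one_pos (hf.pow 2).continuousOn (fun _ _ => sq_nonneg _) ?_
  obtain ⟨c, hc, h⟩ := h
  exact ⟨c, hc, by positivity⟩

lemma exists_profile : ∃ f : ℝ → ℝ, IsProf f ∧
    ∫ y in Icc (0:ℝ) 1, deriv (deriv f) y ^ 2 = 1 := by
  obtain ⟨f, h1, h2, h3⟩ := exists_bump
  have hp : IsProf f := ⟨h1, fun y hy => h2 y fun h => hy ⟨by linarith [h.1], by linarith [h.2]⟩⟩
  have hI : 0 < ∫ y in Icc (0:ℝ) 1, deriv (deriv f) y ^ 2 := by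
    refine integral_sq_pos hp.deriv.deriv.1.continuous ?_
    by_contra! h
    have z : ∀ {g : ℝ → ℝ}, IsProf g → (∀ y, deriv g y = 0) → ∀ y, g y = 0 := fun {g} hg h y => by
      rw [is_const_of_deriv_eq_zero (hg.1.differentiable (by simp)) h y 0]
      exact hg.2 0 fun h => by norm_num at h
    have := z hp (z hp.deriv fun y => by
      by_cases hy : y ∈ Icc (0:ℝ) 1
      · exact h y hy
      · exact hp.deriv.deriv.2 y fun h => hy ⟨by linarith [h.1], by linarith [h.2]⟩) (1/2)
    rw [h3] at this
    norm_num at this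
  set I := ∫ y in Icc (0:ℝ) 1, deriv (deriv f) y ^ 2
  refine ⟨fun y => (√I)⁻¹ * f y, ⟨contDiff_const.mul h1, fun y hy => by simp [hp.2 y hy]⟩, ?_⟩
  have e : ∀ g : ℝ → ℝ, deriv (fun y => (√I)⁻¹ * g y) = fun y => (√I)⁻¹ * deriv g y := fun g =>
    funext fun y => deriv_const_mul_field _
  rw [e, e]
  simp only [mul_pow]
  rw [integral_const_mul, inv_pow, sq_sqrt hI.le]
  exact inv_mul_cancel₀ hI.ne'

lemma IsProf.integral_conc {f : ℝ → ℝ} (hf : IsProf f) {m : ℝ} (hm : 1 ≤ m) :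
    ∫ y in Icc (0:ℝ) 1, conc m f y = (∫ y in Icc (0:ℝ) 1, f y) / m := by
  have h1 : ∫ y in Icc (0:ℝ) 1, conc m f y = ∫ y in (0:ℝ)..1, f (m * y) := by
    rw [integral_Icc_eq_integral_Ico, intervalIntegral.integral_of_le zero_le_one,
      ← integral_Ico_eq_integral_Ioc]
    refine setIntegral_congr_fun measurableSet_Ico fun y hy => ?_
    simp only [conc, Int.fract_eq_self.2 hy]
  have h2 : ∫ y in (1:ℝ)..m, f y = 0 := by
    rw [intervalIntegral.integral_congr (g := fun _ => 0), intervalIntegral.integral_zero]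
    intro y hy
    rw [uIcc_of_le hm] at hy
    exact hf.2 y fun h => by linarith [h.2, hy.1]
  have hi : ∀ a b, IntervalIntegrable f volume a b := fun a b =>
    hf.1.continuous.intervalIntegrable a b
  rw [h1, intervalIntegral.integral_comp_mul_left _ (by positivity), mul_zero, mul_one,
    ← intervalIntegral.integral_add_adjacent_intervals (hi 0 1) (hi 1 m), h2, add_zero,
    integral_Icc_eq_integral_Ioc, ← intervalIntegral.integral_of_le zero_le_one, smul_eq_mul]
  field_simp

/-- Primitive vanishing at the origin. -/
def prim (f : ℝ → ℝ) (y : ℝ) : ℝ := ∫ r in (0:ℝ)..y, f r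

lemma deriv_prim {f : ℝ → ℝ} (hf : Continuous f) : deriv (prim f) = f :=
  funext fun y => (intervalIntegral.integral_hasDerivAt_right (hf.intervalIntegrable _ _)
    (hf.stronglyMeasurableAtFilter _ _) hf.continuousAt).deriv

lemma isPer_prim {f : ℝ → ℝ} (hf : IsPer f) (h0 : ∫ y in Icc (0:ℝ) 1, f y = 0) :
    IsPer (prim f) := by
  have hi : ∀ a b, IntervalIntegrable f volume a b := fun a b =>
    hf.1.continuous.intervalIntegrable a b
  constructor
  · refine contDiff_infty_iff_deriv.2 ⟨fun y => ?_, ?_⟩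
    · exact (intervalIntegral.integral_hasDerivAt_right (hi _ _)
        (hf.1.continuous.stronglyMeasurableAtFilter _ _) hf.1.continuous.continuousAt).differentiableAt
    · rw [deriv_prim hf.1.continuous]; exact hf.1
  · intro y
    have h1 := hf.2.intervalIntegral_add_eq y 0
    rw [zero_add, intervalIntegral.integral_of_le (zero_le_one), ← integral_Icc_eq_integral_Ioc,
      h0] at h1
    rw [prim, ← intervalIntegral.integral_add_adjacent_intervals (hi 0 y) (hi y (y+1)), h1,
      add_zero, prim]

lemma abs_prim_le {f : ℝ → ℝ} (hf : IsPer f) (h0 : ∫ y in Icc (0:ℝ) 1, f y = 0) (y : ℝ) :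
    |prim f y| ≤ ∫ y in Icc (0:ℝ) 1, |f y| := by
  have h1 : prim f y = prim f (Int.fract y) := by
    have := (isPer_prim hf h0).2.sub_int_mul_eq (x := y) ⌊y⌋
    rw [← this, Int.fract, mul_one]
  rw [h1, prim]
  have a := Int.fract_nonneg y
  have b := (Int.fract_lt_one y).le
  have c : Continuous fun y => |f y| := hf.1.continuous.abs
  refine (intervalIntegral.abs_integral_le_integral_abs a).trans ?_
  rw [integral_Icc_eq_integral_Ioc, ← intervalIntegral.integral_of_le zero_le_one]
  exact intervalIntegral.integral_mono_interval le_rfl a b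
    (.of_forall fun _ => abs_nonneg _) (c.intervalIntegrable _ _)

lemma abs_integral_le_sup {f : ℝ → ℝ} {C : ℝ} (h : ∀ y, |f y| ≤ C) :
    |∫ y in Icc (0:ℝ) 1, f y| ≤ C := by
  have := norm_setIntegral_le_of_norm_le_const (μ := volume) (s := Icc (0:ℝ) 1) (f := f) (C := C)
    (by simp) fun y _ => h y
  simpa using this

lemma integral_abs_le_sup {f : ℝ → ℝ} {C : ℝ} (h : ∀ y, |f y| ≤ C) :
    ∫ y in Icc (0:ℝ) 1, |f y| ≤ C :=
  (le_abs_self _).trans (abs_integral_le_sup fun y => by rw [abs_abs]; exact h y)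

lemma iterate_deriv_const_mul (m : ℝ) : ∀ (j : ℕ) (g : ℝ → ℝ),
    deriv^[j] (fun y => m * g y) = fun y => m * deriv^[j] g y
  | 0, _ => rfl
  | j + 1, g => by
    have : deriv (fun y => m * g y) = fun y => m * deriv g y :=
      funext fun y => deriv_const_mul_field _
    rw [Function.iterate_succ_apply, this, iterate_deriv_const_mul m j]
    rfl

lemma iterate_deriv_conc {m : ℝ} (hm : 1 ≤ m) : ∀ (j : ℕ) {f : ℝ → ℝ} (_ : IsProf f) (y : ℝ),
    deriv^[j] (conc m f) y = m ^ j * conc m (deriv^[j] f) y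
  | 0, _, _, y => by simp
  | j + 1, f, hf, y => by
    have e : deriv (conc m f) = fun y => m * conc m (deriv f) y := funext (deriv_conc hf hm)
    rw [Function.iterate_succ_apply, e, iterate_deriv_const_mul]
    simp only
    rw [iterate_deriv_conc hm j hf.deriv y, Function.iterate_succ_apply]
    ring

lemma IsPer.sub_const {f : ℝ → ℝ} (hf : IsPer f) (c : ℝ) : IsPer fun y => f y - c :=
  ⟨hf.1.sub contDiff_const, fun y => by simp only [hf.2 y]⟩

/-- Second primitive of the concentrated profile minus its mean. -/
lemma exists_second_primitive {f : ℝ → ℝ} (hf : IsProf f) (h0 : ∀ y, 0 ≤ f y)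
    (h1 : ∫ y in Icc (0:ℝ) 1, f y = 1) (k : ℕ) :
    ∃ C, 1 ≤ C ∧ ∀ m : ℝ, 1 ≤ m → ∃ ψ, IsPer ψ ∧ (∀ y, deriv (deriv ψ) y = m * conc m f y - 1) ∧
      (∀ j ≤ k, ∀ y, |deriv^[j] ψ y| ≤ C * m ^ j) ∧
      (∀ j ≤ k, ∀ y, |deriv^[j] (deriv ψ) y| ≤ C * m ^ j) := by
  obtain ⟨C, hC1, hC⟩ := hf.bounded_iter k
  refine ⟨C + 4, by linarith, fun m hm => ?_⟩
  have hcp := conc_isPer hf hm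
  set F : ℝ → ℝ := fun y => m * conc m f y - 1 with hF
  have hFp : IsPer F := ⟨(contDiff_const.mul hcp.1).sub contDiff_const, fun y => by
    simp only [hF, hcp.2 y]⟩
  have hic : IntegrableOn (conc m f) (Icc 0 1) := hcp.1.continuous.integrableOn_Icc
  have hm0 : (0:ℝ) < m := by linarith
  have hFI : ∫ y in Icc (0:ℝ) 1, F y = 0 := by
    rw [hF, integral_sub (hic.const_mul m) (by simp), integral_const_mul, hf.integral_conc hm, h1]
    simp [hm0.ne']
  have hFabs : ∫ y in Icc (0:ℝ) 1, |F y| ≤ 2 := by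
    have : ∀ y, |F y| ≤ m * conc m f y + 1 := fun y => by
      have : 0 ≤ m * conc m f y := mul_nonneg hm0.le (h0 _)
      rw [hF, abs_le]; constructor <;> linarith
    refine (integral_mono hFp.1.continuous.abs.integrableOn_Icc
      ((hic.const_mul m).add (integrable_const 1)) this).trans_eq ?_
    have := integral_add (hic.const_mul m) (integrable_const (1:ℝ))
    rw [integral_const_mul, hf.integral_conc hm, h1] at this
    refine this.trans ?_
    simp [hm0.ne']; norm_num
  set μ₁ := ∫ y in Icc (0:ℝ) 1, prim F y
  have hP := isPer_prim hFp hFI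
  have hPb : ∀ y, |prim F y| ≤ 2 := fun y => (abs_prim_le hFp hFI y).trans hFabs
  have hμ : |μ₁| ≤ 2 := abs_integral_le_sup hPb
  have hP' := hP.sub_const μ₁
  have hP0 : ∫ y in Icc (0:ℝ) 1, (prim F y - μ₁) = 0 := by
    rw [integral_sub hP.1.continuous.integrableOn_Icc (by simp)]; simp [μ₁]
  have hPb' : ∀ y, |prim F y - μ₁| ≤ 4 := fun y =>
    (abs_sub _ _).trans (by linarith [hPb y])
  have d1 : deriv (prim fun y => prim F y - μ₁) = fun y => prim F y - μ₁ :=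
    deriv_prim hP'.1.continuous
  have d2 : deriv (fun y => prim F y - μ₁) = F := by
    ext y; rw [deriv_sub_const, deriv_prim hFp.1.continuous]
  have dj : ∀ j ≤ k, ∀ y, |deriv^[j] F y| ≤ (C + 4) * m ^ (j + 1) := by
    intro j hj y
    have hb : ∀ j ≤ k, |m * (m ^ j * conc m (deriv^[j] f) y)| ≤ C * m ^ (j + 1) := by
      intro j hj
      rw [abs_mul, abs_mul, abs_of_pos hm0, abs_of_pos (by positivity : 0 < m ^ j), pow_succ]
      have := mul_le_mul_of_nonneg_left (hC j hj (m * Int.fract y))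
        (by positivity : 0 ≤ m ^ j * m)
      calc _ = m ^ j * m * |conc m (deriv^[j] f) y| := by ring
        _ ≤ _ := this.trans_eq (by ring)
    have hmj : 1 ≤ m ^ (j + 1) := one_le_pow₀ hm
    cases j with
    | zero =>
      have := hb 0 hj
      simp only [pow_zero, one_mul, Function.iterate_zero, id_eq, zero_add, pow_one] at this ⊢
      refine (abs_sub _ _).trans ?_
      rw [abs_one]
      nlinarith
    | succ j =>
      have e : deriv F = fun y => m * deriv (conc m f) y := by
        ext z; rw [hF, deriv_sub_const, deriv_const_mul_field]
      rw [Function.iterate_succ_apply, e, iterate_deriv_const_mul]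
      simp only
      rw [← Function.iterate_succ_apply, iterate_deriv_conc hm _ hf]
      exact (hb _ hj).trans (by nlinarith)
  have q1 : ∀ j ≤ k, ∀ y, |deriv^[j] (fun y => prim F y - μ₁) y| ≤ (C + 4) * m ^ j := by
    intro j hj y
    cases j with
    | zero => simp only [Function.iterate_zero, id_eq, pow_zero, mul_one]; linarith [hPb' y]
    | succ j =>
      rw [Function.iterate_succ_apply, d2]
      exact dj j (by omega) y
  refine ⟨prim fun y => prim F y - μ₁, isPer_prim hP' hP0, fun y => by rw [d1, d2], ?_, ?_⟩
  · intro j hj y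
    cases j with
    | zero =>
      simp only [Function.iterate_zero, id_eq, pow_zero, mul_one]
      exact ((abs_prim_le hP' hP0 y).trans (integral_abs_le_sup hPb')).trans (by linarith)
    | succ j =>
      rw [Function.iterate_succ_apply, d1]
      refine (q1 j (by omega) y).trans ?_
      exact mul_le_mul_of_nonneg_left (pow_le_pow_right₀ hm (by omega)) (by linarith)
  · intro j hj y
    rw [d1]
    exact q1 j hj y

lemma CB_osc (J : Set ℝ) (l : Fin 3) (N : ℕ) {m C : ℝ} (hm : 0 ≤ m) (hC0 : 0 ≤ C) (k : ℕ)
    {f : ℝ → ℝ} (hf : IsPer f) (hC : ∀ j ≤ k, ∀ y, |deriv^[j] f y| ≤ C * m ^ j) :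
    CB J (N * m) k (fun _ _ => C) (osc l N f hf) := by
  induction k generalizing f C with
  | zero => exact fun t _ x => by simpa using hC 0 le_rfl (N * x l)
  | succ k ih =>
    refine ⟨fun t _ x => by simpa using hC 0 (by omega) (N * x l), fun i => ?_⟩
    rw [D_osc]
    split_ifs
    · refine ((ih (C := C * m) (by positivity) hf.deriv fun j hj y => ?_).smul (N:ℝ)).congr ?_
      · exact (hC (j + 1) (by omega) y).trans_eq (by ring)
      · intro t x
        rw [abs_of_nonneg (by positivity)]; ring
    · exact CB.of_zero (by positivity) fun t _ x => by positivity

lemma exists_disjoint_profiles : ∃ G : Fin 3 × Fin 3 → ℝ → ℝ, (∀ c, IsProf (G c)) ∧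
    (∀ c, ∫ y in Icc (0:ℝ) 1, G c y ^ 2 = 1) ∧ ∀ c c', c ≠ c' → ∀ y, G c y * G c' y = 0 := by
  obtain ⟨f, h1, h2, h3⟩ := exists_bump
  let n : Fin 3 × Fin 3 → ℕ := fun c => 3 * c.1 + c.2
  have hn : ∀ c, (n c : ℝ) ≤ 8 := fun c => by
    have : n c ≤ 8 := by simp only [n]; omega
    exact_mod_cast this
  have hn0 : ∀ c, (0:ℝ) ≤ n c := fun c => by positivity
  have hI : ∀ c, 0 < ∫ y in Icc (0:ℝ) 1, f (9 * y - n c) ^ 2 := fun c =>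
    integral_sq_pos (h1.continuous.comp (by fun_prop)) ⟨(n c + 1/2) / 9,
      by constructor <;> linarith [hn c, hn0 c], by
        have : 9 * ((n c + 1/2 : ℝ) / 9) - n c = 1 / 2 := by ring
        rw [this, h3]; norm_num⟩
  refine ⟨fun c y => (√(∫ y in Icc (0:ℝ) 1, f (9 * y - n c) ^ 2))⁻¹ * f (9 * y - n c),
    fun c => ⟨contDiff_const.mul (h1.comp (by fun_prop)), fun y hy => ?_⟩, fun c => ?_, ?_⟩
  · simp only
    rw [h2, mul_zero]
    rintro ⟨a, b⟩
    exact hy ⟨by linarith [hn c, hn0 c], by linarith [hn c, hn0 c]⟩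
  · simp only [mul_pow]
    rw [integral_const_mul, inv_pow, sq_sqrt (hI c).le]
    exact inv_mul_cancel₀ (hI c).ne'
  · intro c c' hc y
    have hne : n c ≠ n c' := fun h => hc (by
      simp only [n] at h
      ext <;> omega)
    by_cases ha : 9 * y - n c ∈ Icc (1 / 4 : ℝ) (3 / 4)
    · have : f (9 * y - n c') = 0 := by
        refine h2 _ fun hb => ?_
        rcases lt_or_gt_of_ne hne with h | h
        · have : (n c : ℝ) + 1 ≤ n c' := by exact_mod_cast h
          linarith [ha.2, hb.1]
        · have : (n c' : ℝ) + 1 ≤ n c := by exact_mod_cast h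
          linarith [hb.2, ha.1]
      simp only [this, mul_zero]
    · simp only [h2 _ ha, mul_zero, zero_mul]

lemma integrableOn_ind_scale (m : ℝ) (N : ℕ) : IntegrableOn (fun y => ind m (N * y)) (Icc 0 1) := by
  refine Integrable.of_bound (C := 1)
    ((measurable_ind m).comp (measurable_const.mul measurable_id)).aestronglyMeasurable
    (.of_forall fun y => ?_)
  rw [Real.norm_eq_abs, abs_of_nonneg (ind_nonneg _ _)]
  exact ind_le_one _ _

lemma integral_ind_scale {m : ℝ} (hm : 1 ≤ m) {N : ℕ} (hN : 1 ≤ N) :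
    ∫ y in Icc (0:ℝ) 1, ind m (N * y) ≤ 1 / m := by
  rw [integral_scale (ind_periodic m) hN]
  exact integral_ind hm

lemma integral_le_of_ind {f : ℝ → ℝ} {C m : ℝ} (hC : 0 ≤ C) (hm : 1 ≤ m) {N : ℕ} (hN : 1 ≤ N)
    (h0 : ∀ y, 0 ≤ f y) (h : ∀ y, f y ≤ C * ind m (N * y)) :
    ∫ y in Icc (0:ℝ) 1, f y ≤ C / m := by
  refine (integral_mono_of_nonneg (.of_forall h0)
    ((integrableOn_ind_scale m N).const_mul C) (.of_forall h)).trans ?_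
  rw [integral_const_mul]
  exact (mul_le_mul_of_nonneg_left (integral_ind_scale hm hN) hC).trans_eq (by ring)

/-- Intermittent oscillating functions of time with pairwise disjoint supports, together with the
primitives of `1 - g ^ 2`. -/
structure TimeSys (C p κ : ℝ) (ν : ℕ) (g h : Fin 3 × Fin 3 → ℝ → ℝ) : Prop where
  smooth_g : ∀ c, ContDiff ℝ (⊤ : ℕ∞) (g c)
  smooth_h : ∀ c, ContDiff ℝ (⊤ : ℕ∞) (h c)
  disj : ∀ c c', c ≠ c' → ∀ t, g c t * g c' t = 0
  deriv_h : ∀ c t, deriv (h c) t = 1 - g c t ^ 2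
  abs_h : ∀ c t, |h c t| ≤ 2 / ν
  int_sq : ∀ c, ∫ t in Icc (0:ℝ) 1, g c t ^ 2 = 1
  int_abs : ∀ c, ∫ t in Icc (0:ℝ) 1, |g c t| ≤ C / √κ
  int_deriv : ∀ c, ∫ t in Icc (0:ℝ) 1, |deriv (g c) t| ≤ C * ν * √κ
  abs_g : ∀ c t, |g c t| ≤ C * √κ
  abs_deriv : ∀ c t, |deriv (g c) t| ≤ C * ν * κ * √κ
  int_rpow : ∀ c, ∫ t in Icc (0:ℝ) 1, |g c t| ^ p ≤ C * κ ^ (p / 2 - 1)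

lemma exists_timeSys {p : ℝ} (hp : 1 ≤ p) : ∃ C, 1 ≤ C ∧ ∀ κ : ℝ, 1 ≤ κ → ∀ ν : ℕ, 1 ≤ ν →
    ∃ g h, TimeSys C p κ ν g h := by
  obtain ⟨G, hG, hG1, hGd⟩ := exists_disjoint_profiles
  have hb : ∃ C, 1 ≤ C ∧ ∀ c, ∀ j ≤ 1, ∀ y, |deriv^[j] (G c) y| ≤ C := by
    choose B hB1 hB using fun c => (hG c).bounded_iter 1
    refine ⟨∑ c, B c, (hB1 (0,0)).trans (Finset.single_le_sum (f := B)
      (fun c _ => zero_le_one.trans (hB1 c)) (Finset.mem_univ _)), fun c j hj y => ?_⟩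
    exact (hB c j hj y).trans (Finset.single_le_sum (f := B)
      (fun c _ => zero_le_one.trans (hB1 c)) (Finset.mem_univ _))
  obtain ⟨B, hB1, hB⟩ := hb
  have hB0 : ∀ c y, |G c y| ≤ B := fun c => hB c 0 (by omega)
  have hB' : ∀ c y, |deriv (G c) y| ≤ B := fun c => hB c 1 le_rfl
  have hBp : 0 ≤ B ^ p := by positivity
  refine ⟨B + B ^ p, by linarith, fun κ hκ ν hν => ?_⟩
  have hκ0 : 0 < κ := by linarith
  have hsκ : 0 < √κ := sqrt_pos.2 hκ0
  have hν0 : (0:ℝ) < ν := by exact_mod_cast hν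
  have hss : √κ * √κ = κ := mul_self_sqrt hκ0.le
  have hcp := fun c => conc_isPer (hG c) hκ
  let F : Fin 3 × Fin 3 → ℝ → ℝ := fun c y => κ * conc κ (G c) y ^ 2 - 1
  have hFp : ∀ c, IsPer (F c) := fun c =>
    ⟨(contDiff_const.mul ((hcp c).1.pow 2)).sub contDiff_const, fun y => by
      simp only [F, (hcp c).2 y]⟩
  have hGs : ∀ c, IsProf fun y => G c y ^ 2 := fun c => by
    have := (hG c).mul (hG c)
    simpa only [pow_two] using this
  have hcI : ∀ c, ∫ y in Icc (0:ℝ) 1, conc κ (G c) y ^ 2 = 1 / κ := fun c => by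
    have := (hGs c).integral_conc hκ
    rw [hG1] at this
    exact this
  have hi : ∀ c, IntegrableOn (fun y => conc κ (G c) y ^ 2) (Icc 0 1) := fun c =>
    ((hcp c).1.continuous.pow 2).integrableOn_Icc
  have hF0 : ∀ c, ∫ y in Icc (0:ℝ) 1, F c y = 0 := fun c => by
    simp only [F]
    rw [integral_sub ((hi c).const_mul κ) (by simp), integral_const_mul, hcI]
    simp [hκ0.ne']
  have hFa : ∀ c, ∫ y in Icc (0:ℝ) 1, |F c y| ≤ 2 := fun c => by
    have : ∀ y, |F c y| ≤ κ * conc κ (G c) y ^ 2 + 1 := fun y => by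
      have : 0 ≤ κ * conc κ (G c) y ^ 2 := by positivity
      simp only [F]
      rw [abs_le]; constructor <;> linarith
    refine (integral_mono (hFp c).1.continuous.abs.integrableOn_Icc
      (((hi c).const_mul κ).add (integrable_const 1)) this).trans_eq ?_
    have := integral_add ((hi c).const_mul κ) (integrable_const (1:ℝ))
    rw [integral_const_mul, hcI] at this
    refine this.trans ?_
    simp [hκ0.ne']; norm_num
  have hg' : ∀ c t, HasDerivAt (fun t => √κ * conc κ (G c) (ν * t))
      (√κ * (κ * conc κ (deriv (G c)) (ν * t) * ν)) t := fun c t => by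
    have h1 : HasDerivAt (fun z : ℝ => (ν:ℝ) * z) ν t := by
      simpa using (hasDerivAt_id t).const_mul (ν:ℝ)
    have h2 : HasDerivAt (conc κ (G c)) (κ * conc κ (deriv (G c)) (ν * t)) (ν * t) := by
      rw [← deriv_conc (hG c) hκ]
      exact ((hcp c).1.differentiable (by simp) _).hasDerivAt
    exact (h2.comp t h1).const_mul _
  have bd0 : ∀ c t, |√κ * conc κ (G c) (ν * t)| ≤ √κ * B * ind κ (ν * t) := fun c t => by
    rw [abs_mul, abs_of_pos hsκ, mul_assoc]
    exact mul_le_mul_of_nonneg_left (abs_conc_le (hG c) hκ (hB0 c) _) hsκ.le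
  have bd1 : ∀ c t, |deriv (fun t => √κ * conc κ (G c) (ν * t)) t|
      ≤ (B * ν * κ * √κ) * ind κ (ν * t) := fun c t => by
    rw [(hg' c t).deriv, abs_mul, abs_mul, abs_mul, abs_of_pos hsκ, abs_of_pos hν0,
      abs_of_pos hκ0]
    have := abs_conc_le (hG c).deriv hκ (hB' c) (ν * t)
    calc _ = (√κ * κ * ν) * |conc κ (deriv (G c)) (ν * t)| := by ring
      _ ≤ (√κ * κ * ν) * (B * ind κ (ν * t)) := by gcongr
      _ = _ := by ring
  have hle : B ≤ B + B ^ p := by linarith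
  refine ⟨fun c t => √κ * conc κ (G c) (ν * t), fun c t => -(prim (F c) (ν * t) / ν),
    ?_, ?_, ?_, ?_, ?_, ?_, ?_, ?_, ?_, ?_, ?_⟩
  · exact fun c => contDiff_const.mul ((hcp c).1.comp (by fun_prop))
  · exact fun c => (((isPer_prim (hFp c) (hF0 c)).1.comp (by fun_prop)).div_const _).neg
  · intro c c' hc t
    have := hGd c c' hc (κ * Int.fract (ν * t))
    simp only [conc]
    linear_combination (√κ * √κ) * this
  · intro c t
    have h1 : HasDerivAt (fun z : ℝ => (ν:ℝ) * z) ν t := by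
      simpa using (hasDerivAt_id t).const_mul (ν:ℝ)
    have h2 : HasDerivAt (prim (F c)) (F c (ν * t)) (ν * t) := by
      rw [← deriv_prim (hFp c).1.continuous]
      rw [deriv_prim (hFp c).1.continuous]
      have := ((isPer_prim (hFp c) (hF0 c)).1.differentiable (by simp) (ν * t)).hasDerivAt
      rwa [deriv_prim (hFp c).1.continuous] at this
    have := (((h2.comp t h1).div_const (ν:ℝ)).neg).deriv
    simp only [Function.comp_def] at this
    refine this.trans ?_
    simp only [F]
    rw [mul_pow, sq_sqrt hκ0.le]
    field_simp
    ring
  · intro c t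
    rw [abs_neg, abs_div, abs_of_pos hν0]
    gcongr
    exact (abs_prim_le (hFp c) (hF0 c) _).trans (hFa c)
  · intro c
    have e : ∀ t : ℝ, (√κ * conc κ (G c) (ν * t)) ^ 2 = κ * conc κ (G c) (ν * t) ^ 2 := fun t => by
      rw [mul_pow, sq_sqrt hκ0.le]
    simp only [e]
    rw [integral_const_mul, integral_scale (f := fun y => conc κ (G c) y ^ 2)
      (fun y => by simp only [(hcp c).2 y]) hν, hcI]
    field_simp
  · intro c
    refine (integral_le_of_ind (by positivity) hκ hν (fun _ => abs_nonneg _) (bd0 c)).trans ?_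
    rw [div_le_div_iff₀ hκ0 hsκ]
    calc √κ * B * √κ = B * κ := by rw [← hss]; ring_nf; rw [sqrt_sq hsκ.le]
      _ ≤ _ := by gcongr
  · intro c
    refine (integral_le_of_ind (by positivity) hκ hν (fun _ => abs_nonneg _) (bd1 c)).trans ?_
    rw [div_le_iff₀ hκ0]
    calc B * ν * κ * √κ = B * ν * √κ * κ := by ring
      _ ≤ _ := by gcongr
  · intro c t
    refine (bd0 c t).trans ?_
    calc √κ * B * ind κ (ν * t) ≤ √κ * B * 1 := by gcongr; exact ind_le_one _ _
      _ = B * √κ := by ring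
      _ ≤ _ := by gcongr
  · intro c t
    refine (bd1 c t).trans ?_
    calc B * ν * κ * √κ * ind κ (ν * t) ≤ B * ν * κ * √κ * 1 := by gcongr; exact ind_le_one _ _
      _ = B * ν * κ * √κ := by ring
      _ ≤ _ := by gcongr
  · intro c
    have : ∀ t, |√κ * conc κ (G c) (ν * t)| ^ p ≤ ((√κ) ^ p * B ^ p) * ind κ (ν * t) := fun t => by
      refine (Real.rpow_le_rpow (abs_nonneg _) (bd0 c t) (by linarith)).trans ?_
      rw [Real.mul_rpow (by positivity) (ind_nonneg _ _), Real.mul_rpow hsκ.le (by linarith)]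
      unfold ind
      split_ifs
      · simp
      · rw [Real.zero_rpow (by linarith)]
    refine (integral_le_of_ind (by positivity) hκ hν (fun _ => by positivity) this).trans ?_
    rw [Real.rpow_sub hκ0, Real.rpow_one, sqrt_eq_rpow, ← Real.rpow_mul hκ0.le]
    have : 1 / 2 * p = p / 2 := by ring
    rw [this, ← mul_div_assoc, mul_comm (B + B ^ p)]
    gcongr
    linarith

section N1

lemma continuous_integral_cube {F : ℝ → V3 → ℝ} (cF : Continuous (Function.uncurry F)) :
    Continuous fun t => ∫ x in cube, F t x :=
  continuous_parametric_integral_of_continuous (f := F) cF isCompact_cube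

/-- The space-time `L¹` norm. -/
def N1 (f : Fld) : ℝ := ∫ t in Icc (0:ℝ) 1, ∫ x in cube, |f t x|

lemma continuous_uncurry (f : Fld) : Continuous (Function.uncurry fun t x => f t x) := f.cont

lemma continuous_slice_abs (f : Fld) : Continuous fun t => ∫ x in cube, |f t x| :=
  continuous_integral_cube f.cont.abs

lemma integrable_slice_abs (f : Fld) :
    IntegrableOn (fun t => ∫ x in cube, |f t x|) (Icc (0:ℝ) 1) :=
  (continuous_slice_abs f).continuousOn.integrableOn_compact isCompact_Icc

lemma slice_abs_nonneg (f : Fld) (t : ℝ) : 0 ≤ ∫ x in cube, |f t x| :=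
  integral_nonneg fun _ => abs_nonneg _

lemma N1_nonneg (f : Fld) : 0 ≤ N1 f := integral_nonneg fun t => slice_abs_nonneg f t

lemma N1_congr {f g : Fld} (h : ∀ t ∈ Icc (0:ℝ) 1, ∀ x, |f t x| = |g t x|) : N1 f = N1 g :=
  setIntegral_congr_fun measurableSet_Icc fun t ht => by simp only [h t ht]

lemma N1_neg (f : Fld) : N1 (-f) = N1 f := N1_congr fun t _ x => by simp

lemma N1_zero : N1 0 = 0 := by simp [N1]

lemma integrable_cube_abs (f : Fld) (t : ℝ) : IntegrableOn (fun x => |f t x|) cube :=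
  integrable_cube (f.cont_space t).abs

lemma slice_abs_add_le (f g : Fld) (t : ℝ) :
    ∫ x in cube, |(f + g) t x| ≤ (∫ x in cube, |f t x|) + ∫ x in cube, |g t x| := by
  rw [← integral_add (integrable_cube_abs f t) (integrable_cube_abs g t)]
  exact integral_mono (integrable_cube_abs _ t)
    ((integrable_cube_abs f t).add (integrable_cube_abs g t)) fun x => abs_add_le _ _

lemma N1_add_le (f g : Fld) : N1 (f + g) ≤ N1 f + N1 g := by
  unfold N1
  rw [← integral_add (integrable_slice_abs f) (integrable_slice_abs g)]
  exact integral_mono (integrable_slice_abs _)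
    ((integrable_slice_abs f).add (integrable_slice_abs g)) fun t => slice_abs_add_le f g t

lemma N1_le_of_slice {f : Fld} {B : ℝ} (h : ∀ t ∈ Icc (0:ℝ) 1, ∫ x in cube, |f t x| ≤ B) :
    N1 f ≤ B := by
  have : N1 f ≤ ∫ t in Icc (0:ℝ) 1, B :=
    setIntegral_mono_on (integrable_slice_abs f) (integrableOn_const (by simp)) measurableSet_Icc h
  simpa using this

lemma N1_mono {f g : Fld} (h : ∀ t ∈ Icc (0:ℝ) 1, ∀ x, |f t x| ≤ |g t x|) : N1 f ≤ N1 g :=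
  setIntegral_mono_on (integrable_slice_abs f) (integrable_slice_abs g) measurableSet_Icc
    fun t ht => integral_mono (integrable_cube_abs f t) (integrable_cube_abs g t) (h t ht)

lemma N1_mono_slice {f g : Fld}
    (h : ∀ t ∈ Icc (0:ℝ) 1, ∫ x in cube, |f t x| ≤ ∫ x in cube, |g t x|) : N1 f ≤ N1 g :=
  setIntegral_mono_on (integrable_slice_abs f) (integrable_slice_abs g) measurableSet_Icc h

lemma N1_conv_le (n : ℕ) (hn : 1 ≤ n) (f : Fld) : N1 (conv (fejer n) f) ≤ N1 f :=
  N1_mono_slice fun t _ => integral_abs_conv_le n hn f t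

lemma N1_le_prod {f : Fld} {a : ℝ → ℝ} {e : V3 → ℝ} (ha : Continuous a)
    (ha0 : ∀ t ∈ Icc (0:ℝ) 1, 0 ≤ a t) (he : IntegrableOn e cube)
    (h : ∀ t ∈ Icc (0:ℝ) 1, ∀ x, |f t x| ≤ a t * e x) :
    N1 f ≤ (∫ t in Icc (0:ℝ) 1, a t) * ∫ x in cube, e x := by
  rw [← integral_mul_const]
  refine setIntegral_mono_on (integrable_slice_abs f)
    ((ha.mul continuous_const).continuousOn.integrableOn_compact isCompact_Icc)
    measurableSet_Icc fun t ht => ?_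
  rw [← integral_const_mul]
  exact integral_mono (integrable_cube_abs f t) (he.const_mul _) (h t ht)

end N1

/-- Minkowski's inequality for `HB`. -/
lemma HB.add' {J : Set ℝ} : ∀ {k : ℕ} {M M' : ℝ} {f g : Fld}, HB J k M f → HB J k M' g → 0 < M →
    0 < M' → HB J k (M + M') (f + g) := by
  have key : ∀ {M M' : ℝ} {f g : Fld} (t : ℝ), ∫ x in cube, f t x ^ 2 ≤ M ^ 2 →
      ∫ x in cube, g t x ^ 2 ≤ M' ^ 2 → 0 < M → 0 < M' →
      ∫ x in cube, (f + g) t x ^ 2 ≤ (M + M') ^ 2 := by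
    intro M M' f g t hf hg hM hM'
    have i1 : IntegrableOn (fun x => f t x ^ 2) cube := integrable_cube ((f.cont_space t).pow 2)
    have i2 : IntegrableOn (fun x => g t x ^ 2) cube := integrable_cube ((g.cont_space t).pow 2)
    have h : ∫ x in cube, (f + g) t x ^ 2
        ≤ ∫ x in cube, ((1 + M' / M) * f t x ^ 2 + (1 + M / M') * g t x ^ 2) := by
      refine integral_mono (integrable_cube (((f + g).cont_space t).pow 2))
        ((i1.const_mul _).add (i2.const_mul _)) fun x => ?_
      have e : (1 + M' / M) * f t x ^ 2 + (1 + M / M') * g t x ^ 2 - (f t x + g t x) ^ 2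
          = (M' * f t x - M * g t x) ^ 2 / (M * M') := by
        field_simp; ring
      have : 0 ≤ (M' * f t x - M * g t x) ^ 2 / (M * M') := by positivity
      show (f t x + g t x) ^ 2 ≤ _
      linarith
    refine h.trans ?_
    rw [integral_add (i1.const_mul _) (i2.const_mul _), integral_const_mul, integral_const_mul]
    have e : (M + M') ^ 2 = (1 + M' / M) * M ^ 2 + (1 + M / M') * M' ^ 2 := by
      field_simp; ring
    rw [e]
    gcongr
  intro k
  induction k with
  | zero => intro M M' f g hf hg hM hM' t ht; exact key t (hf t ht) (hg t ht) hM hM'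
  | succ k ih =>
    intro M M' f g hf hg hM hM'
    refine ⟨fun t ht => key t (hf.1 t ht) (hg.1 t ht) hM hM', fun i => ?_⟩
    rw [map_add]
    exact ih (hf.2 i) (hg.2 i) hM hM'

lemma HB.neg {J : Set ℝ} : ∀ {k : ℕ} {M : ℝ} {f : Fld}, HB J k M f → HB J k M (-f)
  | 0, _, _, h => fun t ht => by simpa using h t ht
  | _ + 1, _, _, h => ⟨fun t ht => by simpa using h.1 t ht, fun i => by
      rw [map_neg]; exact (h.2 i).neg⟩

/-- Simultaneous `L¹` smallness and `L^∞H³` control on the unit time interval. -/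
structure Sm (η K : ℝ) (f : Fld) : Prop where
  pos : 0 < K
  n1 : N1 f ≤ η
  hb : HB (Icc 0 1) 3 K f

section Sm
variable {η η' K K' : ℝ} {f g : Fld}

lemma Sm.nonneg (h : Sm η K f) : 0 ≤ η := (N1_nonneg f).trans h.n1

lemma Sm.add (hf : Sm η K f) (hg : Sm η' K' g) : Sm (η + η') (K + K') (f + g) :=
  ⟨add_pos hf.pos hg.pos, (N1_add_le f g).trans (add_le_add hf.n1 hg.n1),
    hf.hb.add' hg.hb hf.pos hg.pos⟩

lemma Sm.neg (hf : Sm η K f) : Sm η K (-f) := ⟨hf.pos, (N1_neg f).trans_le hf.n1, hf.hb.neg⟩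

lemma Sm.sub (hf : Sm η K f) (hg : Sm η' K' g) : Sm (η + η') (K + K') (f - g) := by
  rw [sub_eq_add_neg]; exact hf.add hg.neg

lemma Sm.mono (hf : Sm η K f) (h : η ≤ η') (hK : K ≤ K') : Sm η' K' f :=
  ⟨hf.pos.trans_le hK, hf.n1.trans h, hf.hb.mono hf.pos.le hK⟩

lemma Sm.zero (hη : 0 ≤ η) (hK : 0 < K) : Sm η K 0 := ⟨hK, N1_zero.trans_le hη, HB.of_zero⟩

lemma Sm.ite (hf : Sm η K f) (P : Prop) [Decidable P] : Sm η K (if P then f else 0) := by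
  split_ifs
  · exact hf
  · exact Sm.zero hf.nonneg hf.pos

lemma Sm.sum {ι : Type*} [Fintype ι] [Nonempty ι] {f : ι → Fld} (h : ∀ c, Sm η K (f c)) :
    Sm (Fintype.card ι * η) (Fintype.card ι * K) (∑ c, f c) := by
  classical
  have : ∀ s : Finset ι, s.Nonempty → Sm (s.card * η) (s.card * K) (∑ c ∈ s, f c) := by
    intro s hs
    induction hs using Finset.Nonempty.cons_induction with
    | singleton a => simpa using h a
    | cons a s ha hs ih =>
      rw [Finset.sum_cons, Finset.card_cons]
      refine ((h a).add ih).mono (le_of_eq ?_) (le_of_eq ?_) <;> push_cast <;> ring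
  exact this Finset.univ Finset.univ_nonempty

lemma Sm.of_CB {L A E α ε' : ℝ} {a : ℝ → ℝ} {e : V3 → ℝ} (hL : 1 ≤ L) (ha : Continuous a)
    (ha0 : ∀ t ∈ Icc (0:ℝ) 1, 0 ≤ a t) (haA : ∀ t ∈ Icc (0:ℝ) 1, a t ≤ A)
    (hA : 0 < A) (hE : 0 < E)
    (he : IntegrableOn e cube) (he0 : ∀ x, 0 ≤ e x) (heE : ∀ x, e x ≤ E)
    (hα : ∫ t in Icc (0:ℝ) 1, a t ≤ α) (hε : ∫ x in cube, e x ≤ ε')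
    (h : CB (Icc 0 1) L 3 (fun t x => a t * e x) f) : Sm (α * ε') (L ^ 3 * (A * E)) f := by
  have h1 : 0 ≤ ∫ t in Icc (0:ℝ) 1, a t := setIntegral_nonneg measurableSet_Icc ha0
  refine ⟨by positivity, ?_, ?_⟩
  · exact (N1_le_prod ha ha0 he h.bound).trans (mul_le_mul hα hε
      (integral_nonneg he0) (h1.trans hα))
  · exact ((h.le (by linarith) fun t ht x => mul_le_mul (haA t ht) (heE x) (he0 x) hA.le).unweight
      hL (by positivity)).toHB

/-- Uniformly bounded fields. -/
lemma Sm.of_const {L B : ℝ} (hL : 1 ≤ L) (hB : 0 < B)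
    (h : CB (Icc 0 1) L 3 (fun _ _ => B) f) : Sm B (L ^ 3 * B) f := by
  have := Sm.of_CB (A := B) (E := 1) (a := fun _ => B) (e := fun _ => 1) (α := B) (ε' := 1) hL
    continuous_const (fun _ _ => hB.le) (fun _ _ => le_rfl) hB one_pos
    (integrable_cube continuous_const)
    (fun _ => zero_le_one) (fun _ => le_rfl) (by simp) (by simp [volume_cube, Measure.real])
    (h.congr fun t x => by ring)
  simpa using this

end Sm

/-! The Green kernel of the squared Laplacian on the Fejér frequencies. -/

def green2 (n : ℕ) : Fld :=
  ((n:ℝ) ^ 3)⁻¹ • ∑ P : Fin 3 → Fin n × Fin n, frqInv P ^ 2 • cosP (frq P)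

lemma CB_green2 (J : Set ℝ) (n k : ℕ) (hn : 1 ≤ n) :
    CB J (26 * n) k (fun _ _ => (n:ℝ) ^ 3) (green2 n) := CB_sum_cosP J n k hn fun P => by
  rw [abs_pow]; exact pow_le_one₀ (abs_nonneg _) (abs_frqInv_le P)

lemma Lap_green2 (n : ℕ) : Lap (green2 n) = -green n := by
  rw [green2, green, map_smul, map_sum, ← smul_neg, ← Finset.sum_neg_distrib]
  congr 1
  refine Finset.sum_congr rfl fun P _ => ?_
  rw [map_smul, Lap_cosP, smul_smul, frqInv]
  split_ifs with h
  · simp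
  · have := one_le_sum_frq_sq h
    rw [← neg_smul]
    congr 1
    field_simp

lemma CB.of_slice {J : Set ℝ} {L : ℝ} : ∀ {k : ℕ} {M : ℝ → V3 → ℝ} {f g : Fld}
    (_ : ∀ t ∈ J, ∀ x, f t x = g t x) (_ : CB J L k M g), CB J L k M f
  | 0, _, _, _, e, h => fun t ht x => by rw [e t ht x]; exact h t ht x
  | k + 1, _, f, g, e, h => ⟨fun t ht x => by rw [e t ht x]; exact h.1 t ht x, fun i =>
      (h.2 i).of_slice fun t ht x => by
        rw [D_apply, D_apply, funext (e t ht)]⟩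

lemma D_slice {f g : Fld} {t : ℝ} (h : ∀ x, f t x = g t x) (i : Fin 3) (x : V3) :
    D i f t x = D i g t x := by rw [D_apply, D_apply, funext h]

lemma conv_slice {f g : Fld} {t : ℝ} (h : ∀ x, f t x = g t x) (k : Fld) (x : V3) :
    conv k f t x = conv k g t x := by simp only [conv_apply, h]

lemma shift_mem {ℓ t r : ℝ} (hℓ : 0 ≤ ℓ) (hℓ' : ℓ ≤ 1 / 4) (ht : t ∈ Icc (0:ℝ) (3 / 4))
    (hr : r ∈ Icc (0:ℝ) 1) : t + ℓ * r ∈ Icc (0:ℝ) 1 :=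
  ⟨add_nonneg ht.1 (mul_nonneg hℓ hr.1), by nlinarith [ht.2, hr.1, hr.2]⟩

lemma abs_shift_sub_le {ℓ B t r : ℝ} (hℓ : 0 ≤ ℓ) (hr : r ∈ Icc (0:ℝ) 1) (f : Fld) (x : V3)
    (h : ∀ s ∈ Icc (0:ℝ) 1, |Dt f (t + ℓ * s) x| ≤ B) :
    |f (t + ℓ * r) x - f t x| ≤ ℓ * B := by
  have hB : 0 ≤ B := (abs_nonneg _).trans (h 0 (by simp))
  have := norm_image_sub_le_of_norm_deriv_le_segment_01' (f := fun s => f (t + ℓ * (r * s)) x)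
    (f' := fun s => Dt f (t + ℓ * (r * s)) x * (ℓ * r)) (C := ℓ * B) (fun s hs => by
      have h1 : HasDerivAt (fun s : ℝ => t + ℓ * (r * s)) (ℓ * r) s := by
        simpa using (((hasDerivAt_id s).const_mul r).const_mul ℓ).const_add t
      exact ((hasDerivAt_time f _ x).comp s h1).hasDerivWithinAt) (fun s hs => by
      rw [norm_mul, norm_eq_abs, norm_eq_abs, abs_of_nonneg (mul_nonneg hℓ hr.1), mul_comm]
      have h2 := h (r * s) ⟨mul_nonneg hr.1 hs.1, by nlinarith [hr.1, hr.2, hs.1, hs.2]⟩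
      have h3 : ℓ * r ≤ ℓ := by nlinarith [hr.2]
      exact mul_le_mul h3 h2 (abs_nonneg _) hℓ)
  simpa using this

lemma CB_mavg_sub {L ℓ : ℝ} (hℓ : 0 ≤ ℓ) (hℓ' : ℓ ≤ 1 / 4) : ∀ {k : ℕ} {B : ℝ} {f : Fld}
    (_ : CB (Icc 0 1) L k (fun _ _ => B) (Dt f)),
    CB (Icc 0 (3 / 4)) L k (fun _ _ => ℓ * B) (mavg ℓ f - f) := by
  have key : ∀ {B : ℝ} {f : Fld}, (∀ t ∈ Icc (0:ℝ) 1, ∀ x, |Dt f t x| ≤ B) →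
      ∀ t ∈ Icc (0:ℝ) (3 / 4), ∀ x, |(mavg ℓ f - f) t x| ≤ ℓ * B := by
    intro B f h t ht x
    have e : (mavg ℓ f - f) t x = ∫ r in Icc (0:ℝ) 1, (f (t + ℓ * r) x - f t x) := by
      have i1 : IntegrableOn (fun r => f (t + ℓ * r) x) (Icc (0:ℝ) 1) :=
        ((f.cont_time x).comp (by fun_prop)).continuousOn.integrableOn_compact isCompact_Icc
      rw [integral_sub i1 (integrableOn_const (by simp)), sub_apply, mavg_apply]
      simp
    rw [e]
    have := norm_setIntegral_le_of_norm_le_const (μ := volume) (s := Icc (0:ℝ) 1)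
      (f := fun r => f (t + ℓ * r) x - f t x) (C := ℓ * B) (by simp) (fun r hr =>
        abs_shift_sub_le hℓ hr f x fun s hs => h _ (shift_mem hℓ hℓ' ht hs) x)
    simpa [Measure.real] using this
  intro k
  induction k with
  | zero => intro B f h; exact key h
  | succ k ih =>
    intro B f h
    refine ⟨key h.1, fun i => ?_⟩
    rw [map_sub, D_mavg]
    refine (ih (B := L * B) ?_).congr fun t x => by ring
    rw [D_Dt]; exact h.2 i

lemma slice_mavg_le {ℓ B t : ℝ} (f : Fld)
    (h : ∀ r ∈ Icc (0:ℝ) 1, ∫ x in cube, |f (t + ℓ * r) x| ≤ B) :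
    ∫ x in cube, |mavg ℓ f t x| ≤ B := by
  have c : Continuous (Function.uncurry fun (x : V3) (r : ℝ) => |f (t + ℓ * r) x|) :=
    (f.cont.comp (f := fun q : V3 × ℝ => (t + ℓ * q.2, q.1)) (by fun_prop)).abs
  have h1 : ∫ x in cube, |mavg ℓ f t x|
      ≤ ∫ x in cube, ∫ r in Icc (0:ℝ) 1, |f (t + ℓ * r) x| := by
    refine integral_mono (integrable_cube_abs _ t) ?_ fun x => ?_
    · exact integrable_cube
        (continuous_parametric_integral_of_continuous c isCompact_Icc)
    · show |mavg ℓ f t x| ≤ _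
      rw [mavg_apply]; exact abs_integral_le_integral_abs
  refine h1.trans ?_
  rw [integral_swap_compact isCompact_cube isCompact_Icc c]
  have c2 : Continuous fun r => ∫ x in cube, |f (t + ℓ * r) x| :=
    (continuous_slice_abs f).comp (f := fun r => t + ℓ * r) (by fun_prop)
  have : ∫ r in Icc (0:ℝ) 1, ∫ x in cube, |f (t + ℓ * r) x| ≤ ∫ r in Icc (0:ℝ) 1, B :=
    setIntegral_mono_on (c2.continuousOn.integrableOn_compact isCompact_Icc)
      (integrableOn_const (by simp)) measurableSet_Icc h
  simpa using this

/-- Averaging forward in time does not increase the `L¹` norm of fields vanishing at late times. -/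
lemma N1_mavg_le {ℓ : ℝ} (hℓ : 0 ≤ ℓ) {f : Fld} (h : ∀ t, 3 / 4 ≤ t → ∀ x, f t x = 0) :
    N1 (mavg ℓ f) ≤ N1 f := by
  have c : Continuous (Function.uncurry fun (r : ℝ) (t : ℝ) => ∫ x in cube, |f (t + ℓ * r) x|) :=
    (continuous_slice_abs f).comp (f := fun q : ℝ × ℝ => q.2 + ℓ * q.1) (by fun_prop)
  have h1 : N1 (mavg ℓ f) ≤ ∫ t in Icc (0:ℝ) 1, ∫ r in Icc (0:ℝ) 1,
      ∫ x in cube, |f (t + ℓ * r) x| := by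
    refine setIntegral_mono_on (integrable_slice_abs _) ?_ measurableSet_Icc fun t _ => ?_
    · exact (continuous_parametric_integral_of_continuous (f := fun t r : ℝ =>
        ∫ x in cube, |f (t + ℓ * r) x|) (c.comp continuous_swap)
        isCompact_Icc).continuousOn.integrableOn_compact isCompact_Icc
    · have cc : Continuous (Function.uncurry fun (x : V3) (r : ℝ) => |f (t + ℓ * r) x|) :=
        (f.cont.comp (f := fun q : V3 × ℝ => (t + ℓ * q.2, q.1)) (by fun_prop)).abs
      rw [← integral_swap_compact isCompact_cube isCompact_Icc cc]
      refine integral_mono (integrable_cube_abs _ t) (integrable_cube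
        (continuous_parametric_integral_of_continuous cc isCompact_Icc)) fun x => ?_
      show |mavg ℓ f t x| ≤ _
      rw [mavg_apply]; exact abs_integral_le_integral_abs
  refine h1.trans ?_
  rw [← integral_swap_compact isCompact_Icc isCompact_Icc c]
  have hr : ∀ r ∈ Icc (0:ℝ) 1, ∫ t in Icc (0:ℝ) 1, ∫ x in cube, |f (t + ℓ * r) x| ≤ N1 f := by
    intro r hr
    have hs : 0 ≤ ℓ * r := mul_nonneg hℓ hr.1
    have e1 : ∫ t in Icc (0:ℝ) 1, ∫ x in cube, |f (t + ℓ * r) x|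
        = ∫ t in (0:ℝ)..1, ∫ x in cube, |f (t + ℓ * r) x| := by
      rw [intervalIntegral.integral_of_le zero_le_one, integral_Icc_eq_integral_Ioc]
    have e2 : N1 f = ∫ t in (0:ℝ)..1, ∫ x in cube, |f t x| := by
      rw [intervalIntegral.integral_of_le zero_le_one, N1, integral_Icc_eq_integral_Ioc]
    rw [e1, e2, intervalIntegral.integral_comp_add_right (fun t => ∫ x in cube, |f t x|)]
    have ii : ∀ a b : ℝ, IntervalIntegrable (fun t => ∫ x in cube, |f t x|) volume a b :=
      fun a b => (continuous_slice_abs f).intervalIntegrable a b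
    have h3 : ∫ t in (1:ℝ)..1 + ℓ * r, ∫ x in cube, |f t x| = 0 := by
      rw [intervalIntegral.integral_congr (g := fun _ => 0), intervalIntegral.integral_zero]
      intro t ht
      rw [uIcc_of_le (by linarith)] at ht
      simp [h t (by linarith [ht.1])]
    have h4 : 0 ≤ ∫ t in (0:ℝ)..0 + ℓ * r, ∫ x in cube, |f t x| :=
      intervalIntegral.integral_nonneg (by linarith) fun t _ => slice_abs_nonneg f t
    have h5 := intervalIntegral.integral_add_adjacent_intervals (ii 0 (0 + ℓ * r))
      (ii (0 + ℓ * r) (1 + ℓ * r))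
    have h6 := intervalIntegral.integral_add_adjacent_intervals (ii 0 1) (ii 1 (1 + ℓ * r))
    linarith
  have : ∫ r in Icc (0:ℝ) 1, ∫ t in Icc (0:ℝ) 1, ∫ x in cube, |f (t + ℓ * r) x|
      ≤ ∫ r in Icc (0:ℝ) 1, N1 f :=
    setIntegral_mono_on ((continuous_parametric_integral_of_continuous c
      isCompact_Icc).continuousOn.integrableOn_compact isCompact_Icc)
      (integrableOn_const (by simp)) measurableSet_Icc hr
  simpa using this

lemma HB.conv {J : Set ℝ} (n : ℕ) (hn : 1 ≤ n) : ∀ {k : ℕ} {M : ℝ} {f : Fld}, HB J k M f →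
    HB J k M (conv (fejer n) f)
  | 0, _, f, h => fun t ht => (integral_conv_sq_le n hn f t).trans (h t ht)
  | _ + 1, _, f, h => ⟨fun t ht => (integral_conv_sq_le n hn f t).trans (h.1 t ht), fun i => by
      rw [D_conv]; exact (h.2 i).conv n hn⟩

section kernel
variable {u z : Fin 3 → Fld} {p : Fld} {F : Fin 3 → Fin 3 → Fld}

lemma Lin.swap {S : Set ℝ} (h : Lin S u z p F) : Lin S z u p (fun a b => F b a) :=
  fun t ht x => ⟨(h t ht x).2.1, (h t ht x).1, (h t ht x).2.2.2, (h t ht x).2.2.1⟩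

lemma Lin.Lap_pressure (h : Lin (Ioo 0 1) u z p F) : ∀ t ∈ Icc (0:ℝ) 1, ∀ x,
    Lap p t x = (∑ i, ∑ j, D i (D j (F j i))) t x := by
  intro t ht x
  have key : ∀ t ∈ Ioo (0:ℝ) 1, (Lap p - ∑ i, ∑ j, D i (D j (F j i))) t x = 0 := by
    intro t ht
    have h1 : ∀ i, D i (Heat (u i) + D i p) t x = D i (∑ j, D j (F j i)) t x := fun i =>
      D_slice (fun y => by
        have := (h t ht y).1 i
        rw [sub_apply] at this; linarith) i x
    have h2 : (∑ i, D i (Heat (u i))) t x = 0 := by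
      have e : ∑ i, D i (Heat (u i)) = Heat (∑ i, D i (u i)) := by
        rw [map_sum]; exact Finset.sum_congr rfl fun i _ => D_Heat i _
      have h3 : ∀ s ∈ Ioo (0:ℝ) 1, ∀ y, (∑ i, D i (u i)) s y = 0 := fun s hs y =>
        (h s hs y).2.2.1
      have h4 : Dt (∑ i, D i (u i)) t x = 0 := by
        rw [Dt_apply]
        have : (fun s => (∑ i, D i (u i)) s x) =ᶠ[nhds t] fun _ => 0 := by
          filter_upwards [isOpen_Ioo.mem_nhds ht] with s hs using h3 s hs x
        rw [this.deriv_eq]; simp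
      have h5 : Lap (∑ i, D i (u i)) t x = 0 := by
        rw [Lap_eq, sum_apply]
        refine Finset.sum_eq_zero fun i _ => ?_
        have : ∀ y, D i (∑ i, D i (u i)) t y = (0 : Fld) t y := fun y => by
          rw [D_slice (g := 0) (fun y => h3 t ht y) i y]; simp
        rw [D_slice this]; simp
      rw [e, Heat_eq, sub_apply, h4, h5, sub_zero]
    simp only [map_add, add_apply, map_sum, sum_apply] at h1 h2
    rw [Lap_eq, sub_apply, sum_apply, sum_apply]
    simp only [sum_apply]
    have := Finset.sum_congr (rfl : (Finset.univ : Finset (Fin 3)) = _) fun i _ => h1 i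
    rw [Finset.sum_add_distrib, h2, zero_add] at this
    rw [this, sub_self]
  have := eq_zero_of_Ioo _ x key t ht
  rw [sub_apply] at this
  linarith

/-- Time derivatives of low-frequency projections, with the pressure eliminated. -/
lemma Lin.conv_Dt (h : Lin (Ioo 0 1) u z p F) {k k2 : Fld}
    (hk : ∀ i, D i (Lap k2) = - D i k) (i : Fin 3) : ∀ t ∈ Icc (0:ℝ) 1, ∀ x,
    Dt (conv k (u i)) t x = (conv (Lap k) (u i) + ∑ j, conv (D j k) (F j i)
      + ∑ j, ∑ l, conv (D i (D j (D l k2))) (F l j)) t x := by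
  intro t ht x
  have e1 : ∀ y, Dt (u i) t y = (Lap (u i) - D i p + ∑ j, D j (F j i)) t y := fun y => by
    have := (h.to_Icc t ht y).1 i
    rw [Heat_eq] at this
    simp only [add_apply, sub_apply] at this ⊢
    linarith
  rw [Dt_conv, conv_slice e1, map_add, map_sub, conv_D k p i, map_sum]
  have e2 : conv (D i k) p = - conv (D i k2) (Lap p) := by
    have : D i k = - Lap (D i k2) := by rw [← D_Lap, hk, neg_neg]
    rw [this, conv_neg_left, conv_Lap, Lap_eq, Lap_eq, map_sum]
    simp only [D_conv]
  have e3 : conv (D i k2) (Lap p) t x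
      = (∑ j, ∑ l, conv (D i (D j (D l k2))) (F l j)) t x := by
    rw [conv_slice (h.Lap_pressure t ht)]
    simp only [map_sum, sum_apply]
    refine Finset.sum_congr rfl fun j _ => Finset.sum_congr rfl fun l _ => ?_
    rw [conv_D, conv_D, D_comm i j, D_comm i l, D_comm l j (D i k2)]
  have e4 : conv k (Lap (u i)) = conv (Lap k) (u i) := by
    rw [conv_Lap, Lap_eq, Lap_eq, map_sum]; simp only [D_conv]
  simp only [e2, e4, add_apply, sub_apply, neg_apply, e3, sub_neg_eq_add, conv_D]
  ring

end kernel

/-- The low-frequency part (with kernel `k`) of the forward time increment. -/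
def lf (k : Fld) (ℓ : ℝ) : Fld →ₗ[ℝ] Fld := conv k ∘ₗ (mavg ℓ - LinearMap.id)

lemma lf_apply (k : Fld) (ℓ : ℝ) (f : Fld) : lf k ℓ f = conv k (mavg ℓ f - f) := rfl

lemma D_lf (k : Fld) (ℓ : ℝ) (f : Fld) (i : Fin 3) : D i (lf k ℓ f) = lf k ℓ (D i f) := by
  rw [lf_apply, lf_apply, D_conv, map_sub, D_mavg]

lemma Heat_lf (k : Fld) (ℓ : ℝ) (f : Fld) : Heat (lf k ℓ f) = lf k ℓ (Heat f) := by
  rw [lf_apply, lf_apply, conv_Heat, map_sub, mavg_Heat]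

lemma lf_comm (k : Fld) (ℓ : ℝ) (f : Fld) : lf k ℓ f = mavg ℓ (conv k f) - conv k f := by
  ext t x
  simp only [lf_apply, map_sub, sub_apply, conv_apply, mavg_apply]
  congr 1
  have c : Continuous (Function.uncurry fun (y : V3) (r : ℝ) => k 0 y * f (t + ℓ * r) (x - y)) := by
    have h1 : Continuous fun q : V3 × ℝ => k 0 q.1 := (k.cont_space 0).comp continuous_fst
    have h2 : Continuous fun q : V3 × ℝ => f (t + ℓ * q.2) (x - q.1) :=
      f.cont.comp (f := fun q : V3 × ℝ => (t + ℓ * q.2, x - q.1)) (by fun_prop)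
    exact h1.mul h2
  rw [← integral_swap_compact isCompact_cube isCompact_Icc c]
  simp only [integral_const_mul]

lemma lf_eq_zero {k : Fld} {ℓ : ℝ} (hℓ : 0 ≤ ℓ) (hℓ' : ℓ ≤ 1 / 4) {f : Fld}
    (h : ∀ t ∈ Icc (0:ℝ) 1, ∀ x, f t x = 0) {t : ℝ} (ht : t ∈ Icc (0:ℝ) (3 / 4)) (x : V3) :
    lf k ℓ f t x = 0 := by
  have : ∀ y, (mavg ℓ f - f) t y = (0 : Fld) t y := fun y => by
    rw [sub_apply, mavg_apply, h t ⟨ht.1, by linarith [ht.2]⟩ y, sub_zero, zero_apply]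
    exact setIntegral_eq_zero_of_forall_eq_zero fun r hr => h _ (shift_mem hℓ hℓ' ht hr) y
  rw [lf_apply, conv_slice this]; simp

lemma D_one (i : Fin 3) : D i (1 : Fld) = 0 := (D i).map_one_eq_zero

lemma D_conv_one (i : Fin 3) (f : Fld) : D i (conv 1 f) = 0 := by
  rw [D_conv, conv_D, D_one, conv_zero_left]

section step
variable {u z : Fin 3 → Fld} {p χ : Fld} {F : Fin 3 → Fin 3 → Fld} {n : ℕ} {ℓ : ℝ}

/-- The stress of the low-frequency time mollification. -/
def mollF (n : ℕ) (ℓ : ℝ) (χ : Fld) (u z : Fin 3 → Fld) (F : Fin 3 → Fin 3 → Fld)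
    (a b : Fin 3) : Fld :=
  χ * lf (fejer n) ℓ (F a b) - Dt χ * lf (D a (green n)) ℓ (u b)
    - Dt χ * lf (D b (green n)) ℓ (z a)

lemma lf_fejer_sub_one (n : ℕ) (hn : 1 ≤ n) (f : Fld) :
    lf (fejer n - 1) ℓ f = - ∑ j, D j (lf (D j (green n)) ℓ f) := by
  have : fejer n - 1 = - Lap (green n) := by rw [Lap_green n hn, neg_sub]
  rw [this, lf_apply, conv_neg_left, conv_Lap, Lap_eq]
  congr 1
  refine Finset.sum_congr rfl fun j _ => ?_
  rw [lf_apply, D_conv, ← conv_D, D_conv]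

lemma D_lf_fejer (f : Fld) (j : Fin 3) : D j (lf (fejer n - 1) ℓ f) = D j (lf (fejer n) ℓ f) := by
  rw [lf_apply, lf_apply, conv_sub_left, map_sub, D_conv_one, sub_zero]

lemma lin_moll_aux (hn : 1 ≤ n) (hℓ : 0 ≤ ℓ) (hℓ' : ℓ ≤ 1 / 4) (hχ : ∀ i, D i χ = 0)
    (h : Lin (Icc 0 1) u z p F) {t : ℝ} (ht : t ∈ Icc (0:ℝ) (3 / 4)) (x : V3) :
    (∀ i, (Heat (χ * lf (fejer n - 1) ℓ (u i)) + D i (χ * lf (fejer n - 1) ℓ p)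
      - ∑ j, D j (mollF n ℓ χ u z F j i)) t x = 0) ∧
    (∑ i, D i (χ * lf (fejer n - 1) ℓ (u i))) t x = 0 := by
  have hχt : ∀ i, D i (Dt χ) = 0 := fun i => by rw [← D_Dt, hχ, map_zero]
  have hdiv : ∀ (v : Fin 3 → Fld), (∀ t ∈ Icc (0:ℝ) 1, ∀ x, (∑ i, D i (v i)) t x = 0) → ∀ k,
      (∑ j, D j (lf k ℓ (v j))) t x = 0 := fun v hv k => by
    have := lf_eq_zero (k := k) hℓ hℓ' hv ht x
    rw [map_sum] at this
    simpa only [D_lf] using this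
  refine ⟨fun i => ?_, ?_⟩
  · have h1 := lf_eq_zero (k := fejer n - 1) hℓ hℓ' (fun t ht x => (h t ht x).1 i) ht x
    rw [map_sub, map_add, map_sum, ← Heat_lf, ← D_lf] at h1
    simp only [← D_lf, D_lf_fejer] at h1
    have h2 := hdiv z (fun t ht x => (h t ht x).2.2.2) (D i (green n))
    simp only [mollF, map_sub, Heat_mul_const hχ, D_mul_const _ (hχ _), D_mul_const _ (hχt _)]
    rw [lf_fejer_sub_one n hn (u i)] at h1 ⊢
    simp only [D_lf_fejer, add_apply, sub_apply, neg_apply, mul_apply, sum_apply,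
      Fin.sum_univ_three] at h1 h2 ⊢
    linear_combination χ t x * h1 + Dt χ t x * h2
  · have h2 := hdiv u (fun t ht x => (h t ht x).2.2.1) (fejer n - 1)
    simp only [D_mul_const _ (hχ _), sum_apply, mul_apply] at h2 ⊢
    rw [← Finset.mul_sum, h2, mul_zero]

lemma D_zero_of_time {f : Fld} {t : ℝ} (h : ∀ x, f t x = 0) (i : Fin 3) (x : V3) :
    D i f t x = 0 := by
  rw [D_slice (g := 0) (by simpa using h)]; simp

lemma Dt_zero_of_eventually {f : Fld} {t : ℝ} (h : ∀ᶠ s in nhds t, ∀ x, f s x = 0) (x : V3) :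
    Dt f t x = 0 := by
  rw [Dt_apply]
  have : (fun s => f s x) =ᶠ[nhds t] fun _ => 0 := by filter_upwards [h] with s hs using hs x
  rw [this.deriv_eq]; simp

lemma Heat_zero_of_eventually {f : Fld} {t : ℝ} (h : ∀ᶠ s in nhds t, ∀ x, f s x = 0) (x : V3) :
    Heat f t x = 0 := by
  rw [Heat_eq, sub_apply, Dt_zero_of_eventually h, Lap_eq, sum_apply, zero_sub, neg_eq_zero]
  exact Finset.sum_eq_zero fun i _ => D_zero_of_time (D_zero_of_time h.self_of_nhds i) i x

/-- The low-frequency time mollification increment solves the linear system. -/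
lemma lin_moll (hn : 1 ≤ n) (hℓ : 0 ≤ ℓ) (hℓ' : ℓ ≤ 1 / 4) (hχ : ∀ i, D i χ = 0)
    (hχ0 : ∀ t, 3 / 4 < t → ∀ x, χ t x = 0) (h : Lin (Icc 0 1) u z p F) :
    Lin (Ioo 0 1) (fun i => χ * lf (fejer n - 1) ℓ (u i))
      (fun i => χ * lf (fejer n - 1) ℓ (z i)) (χ * lf (fejer n - 1) ℓ p)
      (mollF n ℓ χ u z F) := by
  intro t ht x
  by_cases h34 : t ≤ 3 / 4
  · have h1 := lin_moll_aux hn hℓ hℓ' hχ h ⟨ht.1.le, h34⟩ x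
    have h2 := lin_moll_aux hn hℓ hℓ' hχ h.swap ⟨ht.1.le, h34⟩ x
    refine ⟨h1.1, fun i => ?_, h1.2, h2.2⟩
    have e : ∀ j, mollF n ℓ χ z u (fun a b => F b a) j i = mollF n ℓ χ u z F i j := fun j => by
      simp only [mollF]; ring
    simpa only [e] using h2.1 i
  · push Not at h34
    have ev : ∀ f : Fld, ∀ᶠ s in nhds t, ∀ x, (χ * f) s x = 0 := fun f => by
      filter_upwards [isOpen_Ioi.mem_nhds h34] with s hs x
      rw [mul_apply, hχ0 s hs x, zero_mul]
    have hχt : ∀ x, Dt χ t x = 0 := Dt_zero_of_eventually (by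
      filter_upwards [isOpen_Ioi.mem_nhds h34] with s hs x using hχ0 s hs x)
    have hF : ∀ a b x, mollF n ℓ χ u z F a b t x = 0 := fun a b x => by
      simp [mollF, hχt, hχ0 t h34]
    have hD : ∀ f i, D i (χ * f) t x = 0 := fun f i => D_zero_of_time (ev f).self_of_nhds i x
    have hDF : ∀ a b i, D i (mollF n ℓ χ u z F a b) t x = 0 := fun a b i =>
      D_zero_of_time (hF a b) i x
    refine ⟨fun i => ?_, fun i => ?_, ?_, ?_⟩ <;>
      simp [Heat_zero_of_eventually (ev _), hD, hDF, hχ, hχ0 t h34]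

end step

lemma zpow_mul_le {Λ : ℝ} (h : 1 ≤ Λ) {a b c : ℤ} (hc : a + b ≤ c) : Λ ^ a * Λ ^ b ≤ Λ ^ c := by
  rw [← zpow_add₀ (by positivity)]; exact zpow_le_zpow_right₀ h hc

lemma const_mul_zpow_le {Λ C : ℝ} (h : 1 ≤ Λ) (hC : C ≤ Λ) {a b : ℤ} (hb : a + 1 ≤ b) :
    C * Λ ^ a ≤ Λ ^ b := by
  have : C * Λ ^ a ≤ Λ ^ (1:ℤ) * Λ ^ a := by
    rw [zpow_one]; exact mul_le_mul_of_nonneg_right hC (by positivity)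
  exact this.trans (zpow_mul_le h (by omega))

lemma HB.mul_time {J : Set ℝ} {h : Fld} (hh : ∀ i, D i h = 0) (h1 : ∀ t ∈ J, ∀ x, |h t x| ≤ 1) :
    ∀ {k : ℕ} {M : ℝ} {f : Fld}, HB J k M f → HB J k M (h * f) := by
  have key : ∀ {f : Fld} {M : ℝ} (t) (_ : t ∈ J), ∫ x in cube, f t x ^ 2 ≤ M ^ 2 →
      ∫ x in cube, (h * f) t x ^ 2 ≤ M ^ 2 := fun {f M} t ht hf => by
    have := integral_sq_mul_le f h t (h1 t ht)
    rw [mul_comm f h] at this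
    linarith
  intro k
  induction k with
  | zero => intro M f hf t ht; exact key t ht (hf t ht)
  | succ k ih =>
    intro M f hf
    refine ⟨fun t ht => key t ht (hf.1 t ht), fun i => ?_⟩
    rw [D_mul_const i (hh i)]
    exact ih (hf.2 i)

lemma Sm_mul {M B : ℝ} (hM : 0 < M) (hB : 0 < B) {f g : Fld} (hf : HB (Icc 0 1) 3 M f)
    (hg : CB (Icc 0 1) 1 3 (fun _ _ => B) g) : Sm (M * B) (64 * (M * B)) (f * g) := by
  refine ⟨by positivity, N1_le_of_slice fun t ht =>
    abs_integral_mul_le f g t hM hB (hf.bound t ht) (hg.toHB.bound t ht), ?_⟩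
  have := hf.mul_CB hg hM.le hB.le
  norm_num at this
  exact this

lemma slice_le_of_CB {f : Fld} {B t : ℝ} (h : ∀ x, |f t x| ≤ B) :
    ∫ x in cube, |f t x| ≤ B := by
  have : ∫ x in cube, |f t x| ≤ ∫ x in cube, B :=
    setIntegral_mono_on (integrable_cube_abs f t) (integrableOn_const (by simp [volume_cube]))
      isCompact_cube.measurableSet fun x _ => h x
  simpa [Measure.real, volume_cube] using this

section kernels
variable {lam : ℕ}

/-- All kernels used for the low-frequency projections. -/
lemma kernel_bounds (h : 1000 ≤ lam) (k : ℕ) :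
    let Λ : ℝ := lam
    CB univ (Λ ^ 49) k (fun _ _ => Λ ^ 144) (fejer (lam ^ 48)) ∧
    CB univ (Λ ^ 49) k (fun _ _ => Λ ^ 144) (green (lam ^ 48)) ∧
    CB univ (Λ ^ 49) k (fun _ _ => Λ ^ 144) (green2 (lam ^ 48)) := by
  have h1 : 1 ≤ lam ^ 48 := Nat.one_le_pow _ _ (by omega)
  have hΛ : (1000:ℝ) ≤ lam := by exact_mod_cast h
  have h2 : (26:ℝ) * ((lam ^ 48 : ℕ):ℝ) ≤ (lam:ℝ) ^ 49 := by
    push_cast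
    rw [pow_succ (lam:ℝ) 48, mul_comm]
    exact mul_le_mul_of_nonneg_left (by linarith) (by positivity)
  have h3 : (((lam ^ 48 : ℕ):ℝ)) ^ 3 ≤ (lam:ℝ) ^ 144 := by
    push_cast; rw [← pow_mul]
  exact ⟨(CB_fejer univ _ k h1).mono (by positivity) h2 fun _ _ _ => h3,
    (CB_green univ _ k h1).mono (by positivity) h2 fun _ _ _ => h3,
    (CB_green2 univ _ k h1).mono (by positivity) h2 fun _ _ _ => h3⟩

end kernels

section est
variable {u z : Fin 3 → Fld} {p : Fld} {F : Fin 3 → Fin 3 → Fld} {L K M I : ℝ}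

/-- Quantitative bound for time derivatives of low-frequency projections. -/
lemma CB_conv_Dt (h : Lin (Ioo 0 1) u z p F) {k k2 : Fld} (hL : 0 ≤ L)
    (hk : ∀ i, D i (Lap k2) = - D i k) (h1 : CB univ L 3 (fun _ _ => K) (Lap k))
    (h2 : ∀ j, CB univ L 3 (fun _ _ => K) (D j k))
    (h3 : ∀ i j l, CB univ L 3 (fun _ _ => K) (D i (D j (D l k2))))
    (hu : ∀ i, ∀ t ∈ Icc (0:ℝ) 1, ∫ x in cube, |u i t x| ≤ I)
    (hF : ∀ i j, ∀ t ∈ Icc (0:ℝ) 1, ∫ x in cube, |F i j t x| ≤ I) (i : Fin 3) :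
    CB (Icc 0 1) L 3 (fun _ _ => 13 * (K * I)) (Dt (conv k (u i))) := by
  refine CB.of_slice (h.conv_Dt hk i) ?_
  refine (((CB_conv h1 hL (hu i)).add (CB.sum Finset.univ hL fun j _ =>
    CB_conv (h2 j) hL (hF j i))).add (CB.sum Finset.univ hL fun j _ =>
    CB.sum Finset.univ hL fun l _ => CB_conv (h3 i j l) hL (hF l j))).congr fun t x => ?_
  simp; ring

end est

/-- Data for the low-frequency regularisation of the stress. -/
structure LowHyp (lam : ℕ) (u z : Fin 3 → Fld) (p : Fld) (S : Fin 3 → Fin 3 → Fld) (χ : Fld) :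
    Prop where
  lam_ge : 1000 ≤ lam
  lin : Lin (Ioo 0 1) u z p (fun a b => S a b - u a * z b)
  hu : ∀ i, HB (Icc 0 1) 3 ((lam:ℝ) ^ 7) (u i)
  hz : ∀ i, HB (Icc 0 1) 3 ((lam:ℝ) ^ 7) (z i)
  hS : ∀ a b, HB (Icc 0 1) 3 ((lam:ℝ) ^ 7) (S a b)
  S_zero : ∀ a b t, 3 / 4 ≤ t → ∀ x, S a b t x = 0
  D_cut : ∀ i, D i χ = 0
  abs_cut : ∀ t x, |χ t x| ≤ 1
  Dt_cut : ∀ t ∈ Icc (0:ℝ) 1, ∀ x, |Dt χ t x| ≤ (lam:ℝ) ^ 16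
  cut_zero : ∀ t, 3 / 4 ≤ t → ∀ x, χ t x = 0
  cut_S : ∀ a b, χ * S a b = S a b

/-- Kernels whose convolutions control time derivatives, `k2` being a potential of `k`. -/
structure IsLow (lam : ℕ) (k k2 : Fld) : Prop where
  pot : ∀ i, D i (Lap k2) = - D i k
  b1 : CB univ ((lam:ℝ) ^ 49) 3 (fun _ _ => (lam:ℝ) ^ 341) (Lap k)
  b2 : ∀ j, CB univ ((lam:ℝ) ^ 49) 3 (fun _ _ => (lam:ℝ) ^ 341) (D j k)
  b3 : ∀ i j l, CB univ ((lam:ℝ) ^ 49) 3 (fun _ _ => (lam:ℝ) ^ 341) (D i (D j (D l k2)))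

lemma Lap_one : Lap (1 : Fld) = 0 := by simp [Lap_eq]

section
variable {lam : ℕ} (h : 1000 ≤ lam)
include h

lemma three_mul_pow_le {a b : ℕ} (hab : a + 1 ≤ b) : 3 * (lam:ℝ) ^ a ≤ (lam:ℝ) ^ b := by
  have hΛ : (1000:ℝ) ≤ lam := by exact_mod_cast h
  calc 3 * (lam:ℝ) ^ a ≤ lam * (lam:ℝ) ^ a := by gcongr; linarith
    _ = (lam:ℝ) ^ (a + 1) := by ring
    _ ≤ _ := pow_le_pow_right₀ (by linarith) hab

lemma pow_lam_le {a b : ℕ} (hab : a ≤ b) : (lam:ℝ) ^ a ≤ (lam:ℝ) ^ b := by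
  have hΛ : (1000:ℝ) ≤ lam := by exact_mod_cast h
  exact pow_le_pow_right₀ (by linarith) hab

lemma isLow_fejer : IsLow lam (fejer (lam ^ 48)) (green (lam ^ 48)) := by
  have hn : 1 ≤ lam ^ 48 := Nat.one_le_pow _ _ (by omega)
  obtain ⟨h1, h2, -⟩ := kernel_bounds h 6
  refine ⟨fun i => by rw [Lap_green _ hn, map_sub, D_one, zero_sub], ?_, fun j => ?_,
    fun i j l => ?_⟩
  · refine ((h1.of_le (by norm_num : 5 ≤ 6)).Lap).le (by positivity) fun _ _ _ => ?_
    rw [← pow_mul, mul_assoc, ← pow_add]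
    exact three_mul_pow_le h (by norm_num)
  · refine (CB.D (h1.of_le (by norm_num : 4 ≤ 6)) j).le (by positivity) fun _ _ _ => ?_
    rw [← pow_add]; exact pow_lam_le h (by norm_num)
  · refine (h2.D3 i j l).le (by positivity) fun _ _ _ => ?_
    rw [← pow_mul, ← pow_add]; exact pow_lam_le h (by norm_num)

lemma isLow_fejer_sub : IsLow lam (fejer (lam ^ 48) - 1) (green (lam ^ 48)) := by
  have := isLow_fejer h
  refine ⟨fun i => ?_, ?_, fun j => ?_, this.b3⟩
  · rw [map_sub, D_one, sub_zero]; exact this.pot i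
  · rw [map_sub, Lap_one, sub_zero]; exact this.b1
  · rw [map_sub, D_one, sub_zero]; exact this.b2 j

lemma isLow_green (a : Fin 3) :
    IsLow lam (D a (green (lam ^ 48))) (D a (green2 (lam ^ 48))) := by
  obtain ⟨-, h1, h2⟩ := kernel_bounds h 7
  refine ⟨fun i => ?_, ?_, fun j => ?_, fun i j l => ?_⟩
  · rw [← D_Lap, Lap_green2, map_neg, map_neg]
  · refine (CB.Lap (CB.D (h1.of_le (by norm_num : 6 ≤ 7)) a)).le (by positivity) fun _ _ _ => ?_
    rw [← pow_mul, mul_assoc, ← pow_add, ← pow_add]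
    exact three_mul_pow_le h (by norm_num)
  · refine ((h1.of_le (by norm_num : 5 ≤ 7)).D2 j a).le (by positivity) fun _ _ _ => ?_
    rw [← pow_mul, ← pow_add]; exact pow_lam_le h (by norm_num)
  · refine ((h2.D a).D3 i j l).le (by positivity) fun _ _ _ => ?_
    rw [← pow_mul, ← pow_add, ← pow_add]; exact pow_lam_le h (by norm_num)

end

namespace LowHyp
variable {lam : ℕ} {u z : Fin 3 → Fld} {p : Fld} {S : Fin 3 → Fin 3 → Fld} {χ : Fld}
  (H : LowHyp lam u z p S χ)
include H

lemma swap : LowHyp lam z u p (fun a b => S b a) χ where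
  lam_ge := H.lam_ge
  lin := by
    have := H.lin.swap
    simp only [mul_comm (u _)] at this
    exact this
  hu := H.hz
  hz := H.hu
  hS a b := H.hS b a
  S_zero a b := H.S_zero b a
  D_cut := H.D_cut
  abs_cut := H.abs_cut
  Dt_cut := H.Dt_cut
  cut_zero := H.cut_zero
  cut_S a b := H.cut_S b a

lemma lam_real : (1000:ℝ) ≤ lam := by exact_mod_cast H.lam_ge

lemma lam_pos : (0:ℝ) < lam := by linarith [H.lam_real]

lemma slice_u (i : Fin 3) : ∀ t ∈ Icc (0:ℝ) 1, ∫ x in cube, |u i t x| ≤ (lam:ℝ) ^ 7 :=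
  fun t ht => integral_abs_le_of_sq _ t (pow_pos H.lam_pos _) ((H.hu i).bound t ht)

lemma slice_S (a b : Fin 3) : ∀ t, 0 ≤ t → ∫ x in cube, |S a b t x| ≤ (lam:ℝ) ^ 7 := by
  intro t ht
  by_cases h : t ≤ 1
  · exact integral_abs_le_of_sq _ t (pow_pos H.lam_pos _) ((H.hS a b).bound t ⟨ht, h⟩)
  · simp only [H.S_zero a b t (by linarith), abs_zero, integral_zero]
    exact (pow_pos H.lam_pos _).le

lemma slice_prod (a b : Fin 3) : ∀ t ∈ Icc (0:ℝ) 1,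
    ∫ x in cube, |(u a * z b) t x| ≤ (lam:ℝ) ^ 7 * (lam:ℝ) ^ 7 := fun t ht =>
  abs_integral_mul_le _ _ t (pow_pos H.lam_pos _) (pow_pos H.lam_pos _)
    ((H.hu a).bound t ht) ((H.hz b).bound t ht)

lemma slice_F (a b : Fin 3) : ∀ t ∈ Icc (0:ℝ) 1,
    ∫ x in cube, |(S a b - u a * z b) t x| ≤ (lam:ℝ) ^ 15 := by
  intro t ht
  have h1 := slice_abs_add_le (S a b) (-(u a * z b)) t
  rw [← sub_eq_add_neg] at h1
  have h2 := H.slice_S a b t ht.1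
  have h3 := H.slice_prod a b t ht
  have h4 : ∀ x, |(-(u a * z b)) t x| = |(u a * z b) t x| := fun x => by simp
  simp only [h4] at h1
  rw [← pow_add] at h3
  have h5 := three_mul_pow_le H.lam_ge (show 14 + 1 ≤ 15 by norm_num)
  have h6 := pow_lam_le H.lam_ge (show 7 ≤ 14 by norm_num)
  have h7 := pow_pos H.lam_pos 14
  simp only [Nat.reduceAdd] at h3
  linarith

lemma CB_Dt_conv {k k2 : Fld} (hk : IsLow lam k k2) (i : Fin 3) :
    CB (Icc 0 1) ((lam:ℝ) ^ 49) 3 (fun _ _ => (lam:ℝ) ^ 357) (Dt (conv k (u i))) := by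
  refine (CB_conv_Dt H.lin (pow_pos H.lam_pos _).le hk.pot hk.b1 hk.b2 hk.b3
    (I := (lam:ℝ) ^ 15) (fun i t ht => (H.slice_u i t ht).trans
      (pow_lam_le H.lam_ge (by norm_num))) H.slice_F i).le (pow_pos H.lam_pos _).le
        fun _ _ _ => ?_
  rw [← pow_add]
  calc 13 * (lam:ℝ) ^ (341 + 15) ≤ lam * (lam:ℝ) ^ (341 + 15) := by
        gcongr; linarith [H.lam_real]
    _ = _ := by rw [← pow_succ']

/-- The averaging scale in time. -/
lemma scale_pos : (0:ℝ) ≤ (lam:ℝ) ^ (-600:ℤ) := (zpow_pos H.lam_pos _).le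

lemma scale_le : (lam:ℝ) ^ (-600:ℤ) ≤ 1 / 4 := by
  have h1 : (lam:ℝ) ^ (-600:ℤ) ≤ (lam:ℝ) ^ (-1:ℤ) :=
    zpow_le_zpow_right₀ (by linarith [H.lam_real]) (by norm_num)
  have h2 : (lam:ℝ) ^ (-1:ℤ) ≤ (1000:ℝ)⁻¹ := by
    rw [zpow_neg_one]; exact inv_anti₀ (by norm_num) H.lam_real
  linarith

lemma CB_cut_lf {k k2 : Fld} (hk : IsLow lam k k2) {c : Fld} (hc : ∀ i, D i c = 0)
    (hcb : ∀ t ∈ Icc (0:ℝ) 1, ∀ x, |c t x| ≤ (lam:ℝ) ^ 16)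
    (hc0 : ∀ t, 3 / 4 < t → ∀ x, c t x = 0) (i : Fin 3) :
    CB (Icc 0 1) 1 3 (fun _ _ => (lam:ℝ) ^ (-78:ℤ))
      (c * lf k ((lam:ℝ) ^ (-600:ℤ)) (u i)) := by
  have hΛ := H.lam_pos
  have h1 := CB_mavg_sub H.scale_pos H.scale_le (H.CB_Dt_conv hk i)
  rw [← lf_comm] at h1
  have h2 := CB.mul_indep (a := fun _ => (lam:ℝ) ^ 16) hc
    (fun t ht x => hcb t ⟨ht.1, by linarith [ht.2]⟩ x) h1
  have h3 : CB (Icc 0 1) ((lam:ℝ) ^ 49) 3 (fun _ _ => (lam:ℝ) ^ 16 * ((lam:ℝ) ^ (-600:ℤ)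
      * (lam:ℝ) ^ 357)) (c * lf k ((lam:ℝ) ^ (-600:ℤ)) (u i)) := by
    refine h2.of_support (by positivity) (fun _ _ _ => by positivity) fun t ht ht' x => ?_
    rw [mul_apply, hc0 t (by by_contra hh; exact ht' ⟨ht.1, not_lt.1 hh⟩), zero_mul]
  have h4 := h3.unweight (one_le_pow₀ (by linarith [H.lam_real])) (by positivity)
  refine h4.le (by norm_num) fun _ _ _ => ?_
  rw [← pow_mul, ← zpow_natCast, ← zpow_natCast, ← zpow_natCast, ← zpow_add₀ hΛ.ne',
    ← zpow_add₀ hΛ.ne', ← zpow_add₀ hΛ.ne']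
  exact zpow_le_zpow_right₀ (by linarith [H.lam_real]) (by norm_num)

end LowHyp
namespace LowHyp
variable {lam : ℕ} {u z : Fin 3 → Fld} {p : Fld} {S : Fin 3 → Fin 3 → Fld} {χ : Fld}
  (H : LowHyp lam u z p S χ)
include H

lemma one_le_pow48 : 1 ≤ lam ^ 48 := Nat.one_le_pow _ _ (by have := H.lam_ge; omega)

lemma sq_sub_conv_le {f : Fld} (hf : HB (Icc 0 1) 3 ((lam:ℝ) ^ 7) f) :
    ∀ t ∈ Icc (0:ℝ) 1, ∫ x in cube, (f - conv (fejer (lam ^ 48)) f) t x ^ 2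
      ≤ ((lam:ℝ) ^ (-16:ℤ)) ^ 2 := by
  intro t ht
  have hΛ := H.lam_pos
  refine (integral_conv_sub_sq _ H.one_le_pow48 f t).trans ?_
  have h1 : ∑ l, ∫ x in cube, D l f t x ^ 2 ≤ ∑ _l : Fin 3, ((lam:ℝ) ^ 7) ^ 2 :=
    Finset.sum_le_sum fun l _ => (hf.2 l).bound t ht
  have h2 : (6:ℝ) / ((lam ^ 48 : ℕ) : ℝ) * ∑ _l : Fin 3, ((lam:ℝ) ^ 7) ^ 2
      = 18 * (lam:ℝ) ^ (-34:ℤ) := by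
    simp only [Finset.sum_const, Finset.card_univ, Fintype.card_fin, nsmul_eq_mul]
    rw [zpow_neg, show (34:ℤ) = ((34:ℕ):ℤ) by norm_num, zpow_natCast]
    push_cast
    field_simp
    norm_num
  refine (mul_le_mul_of_nonneg_left h1 (by positivity)).trans (h2.trans_le ?_)
  rw [← zpow_natCast ((lam:ℝ) ^ (-16:ℤ)), ← zpow_mul]
  exact const_mul_zpow_le (by linarith [H.lam_real]) (by linarith [H.lam_real]) (by norm_num)

lemma scale_cut (t : ℝ) (x : V3) : |χ t x| ≤ (lam:ℝ) ^ 16 :=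
  (H.abs_cut t x).trans (one_le_pow₀ (by linarith [H.lam_real]))

lemma Sm_smoothing (a b : Fin 3) :
    Sm ((lam:ℝ) ^ (-16:ℤ)) (2 * (lam:ℝ) ^ 7) (S a b - χ * conv (fejer (lam ^ 48)) (S a b)) := by
  have hΛ := H.lam_pos
  have e : S a b - χ * conv (fejer (lam ^ 48)) (S a b)
      = χ * (S a b - conv (fejer (lam ^ 48)) (S a b)) := by rw [mul_sub, H.cut_S]
  rw [e]
  refine ⟨by positivity, (N1_mono (g := S a b - conv (fejer (lam ^ 48)) (S a b))
    fun t _ x => ?_).trans (N1_le_of_slice fun t ht =>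
      integral_abs_le_of_sq _ t (by positivity) (H.sq_sub_conv_le (H.hS a b) t ht)), ?_⟩
  · rw [mul_apply, abs_mul]; exact mul_le_of_le_one_left (abs_nonneg _) (H.abs_cut t x)
  · refine HB.mul_time H.D_cut (fun t _ x => H.abs_cut t x) ?_
    have := (H.hS a b).add' ((H.hS a b).conv _ H.one_le_pow48).neg (by positivity) (by positivity)
    rw [sub_eq_add_neg]
    convert this using 1
    ring

lemma CB_conv_fejer (i : Fin 3) : CB (Icc 0 1) ((lam:ℝ) ^ 49) 0 (fun _ _ => (lam:ℝ) ^ 151)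
    (conv (fejer (lam ^ 48)) (u i)) := by
  refine (CB_conv (kernel_bounds H.lam_ge 0).1 (pow_pos H.lam_pos _).le (H.slice_u i)).congr
    fun _ _ => by ring

lemma prod_split (a b : Fin 3) (K : Fld) : u a * z b - conv K (u a) * conv K (z b)
    = (u a - conv K (u a)) * z b + conv K (u a) * (z b - conv K (z b)) := by ring

lemma slice_rem (a b : Fin 3) : ∀ t ∈ Icc (0:ℝ) 1,
    ∫ x in cube, |(u a * z b - conv (fejer (lam ^ 48)) (u a) * conv (fejer (lam ^ 48)) (z b)) t x|
      ≤ 2 * (lam:ℝ) ^ (-9:ℤ) := by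
  intro t ht
  have hΛ := H.lam_pos
  rw [H.prod_split]
  refine (slice_abs_add_le _ _ t).trans ?_
  have h1 := abs_integral_mul_le _ _ t (by positivity) (by positivity)
    (H.sq_sub_conv_le (H.hu a) t ht) ((H.hz b).bound t ht)
  have h2 := abs_integral_mul_le _ _ t (by positivity) (by positivity)
    (((H.hu a).conv _ H.one_le_pow48).bound t ht) (H.sq_sub_conv_le (H.hz b) t ht)
  have h3 : (lam:ℝ) ^ (-16:ℤ) * (lam:ℝ) ^ 7 = (lam:ℝ) ^ (-9:ℤ) := by
    rw [← zpow_natCast, ← zpow_add₀ hΛ.ne']; norm_num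
  rw [h3] at h1
  rw [mul_comm ((lam:ℝ) ^ 7), h3] at h2
  linarith

/-- The time regularisation error of the quadratic term after mollification. -/
lemma slice_avg (a b : Fin 3) : ∀ t ∈ Icc (0:ℝ) (3 / 4),
    ∫ x in cube, |(mavg ((lam:ℝ) ^ (-600:ℤ)) (u a * z b) - u a * z b) t x|
      ≤ (lam:ℝ) ^ (-7:ℤ) := by
  intro t ht
  have hΛ := H.lam_pos
  have hΛ' := H.lam_real
  set ℓ := (lam:ℝ) ^ (-600:ℤ) with hℓ
  set K := fejer (lam ^ 48) with hK
  have ku := H.CB_conv_fejer a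
  have kz := H.swap.CB_conv_fejer b
  have du := (H.CB_Dt_conv (isLow_fejer H.lam_ge) a).of_le (show 0 ≤ 3 by norm_num)
  have dz := (H.swap.CB_Dt_conv (isLow_fejer H.lam_ge) b).of_le (show 0 ≤ 3 by norm_num)
  have e : mavg ℓ (u a * z b) - u a * z b
      = (mavg ℓ (conv K (u a) * conv K (z b)) - conv K (u a) * conv K (z b))
        + (mavg ℓ (u a * z b - conv K (u a) * conv K (z b))
          + -(u a * z b - conv K (u a) * conv K (z b))) := by
    rw [map_sub]; ring
  have dw : CB (Icc 0 1) 1 0 (fun _ _ => 2 * (lam:ℝ) ^ 508)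
      (Dt (conv K (u a) * conv K (z b))) := by
    intro s hs x
    have h1 : Dt (conv K (u a) * conv K (z b)) s x = conv K (u a) s x * Dt (conv K (z b)) s x
        + conv K (z b) s x * Dt (conv K (u a)) s x := by
      rw [Dt_mul]; simp
    rw [h1]
    have h2 : |conv K (u a) s x * Dt (conv K (z b)) s x| ≤ (lam:ℝ) ^ 151 * (lam:ℝ) ^ 357 := by
      rw [abs_mul]
      exact mul_le_mul (ku s hs x) (dz s hs x) (abs_nonneg _) (by positivity)
    have h3 : |conv K (z b) s x * Dt (conv K (u a)) s x| ≤ (lam:ℝ) ^ 151 * (lam:ℝ) ^ 357 := by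
      rw [abs_mul]
      exact mul_le_mul (kz s hs x) (du s hs x) (abs_nonneg _) (by positivity)
    refine (abs_add_le _ _).trans ?_
    rw [← pow_add] at h2 h3
    norm_num1 at h2 h3
    linarith
  rw [e]
  refine (slice_abs_add_le _ _ t).trans ?_
  have h1 : ∫ x in cube, |(mavg ℓ (conv K (u a) * conv K (z b))
      - conv K (u a) * conv K (z b)) t x| ≤ ℓ * (2 * (lam:ℝ) ^ 508) :=
    slice_le_of_CB fun x => CB_mavg_sub H.scale_pos H.scale_le dw t ht x
  have h2 := slice_abs_add_le (mavg ℓ (u a * z b - conv K (u a) * conv K (z b)))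
    (-(u a * z b - conv K (u a) * conv K (z b))) t
  have h3 := slice_mavg_le (ℓ := ℓ) (t := t) (u a * z b - conv K (u a) * conv K (z b))
    fun r hr => H.slice_rem a b _ (shift_mem H.scale_pos H.scale_le ht hr)
  have h4 := H.slice_rem a b t ⟨ht.1, by linarith [ht.2]⟩
  have h5 : ∀ x, |(-(u a * z b - conv K (u a) * conv K (z b))) t x|
      = |(u a * z b - conv K (u a) * conv K (z b)) t x| := fun x => by
    rw [neg_apply, abs_neg]
  simp only [h5] at h2
  have h6 : ℓ * (2 * (lam:ℝ) ^ 508) = 2 * (lam:ℝ) ^ (-92:ℤ) := by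
    rw [hℓ, mul_left_comm, ← zpow_natCast, ← zpow_add₀ hΛ.ne']; norm_num
  have h7 : (lam:ℝ) ^ (-92:ℤ) ≤ (lam:ℝ) ^ (-9:ℤ) :=
    zpow_le_zpow_right₀ (by linarith) (by norm_num)
  have h8 : 6 * (lam:ℝ) ^ (-9:ℤ) ≤ (lam:ℝ) ^ (-7:ℤ) :=
    const_mul_zpow_le (by linarith) (by linarith) (by norm_num)
  linarith

lemma Sm_lf_prod (a b : Fin 3) :
    Sm ((lam:ℝ) ^ (-7:ℤ)) ((lam:ℝ) ^ 300)
      (χ * lf (fejer (lam ^ 48)) ((lam:ℝ) ^ (-600:ℤ)) (u a * z b)) := by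
  have hΛ := H.lam_pos
  have hΛ' := H.lam_real
  rw [lf_apply]
  set X := mavg ((lam:ℝ) ^ (-600:ℤ)) (u a * z b) - u a * z b
  set K := fejer (lam ^ 48)
  have hX : ∀ t ∈ Icc (0:ℝ) (3 / 4), ∫ x in cube, |X t x| ≤ (lam:ℝ) ^ (-7:ℤ) := H.slice_avg a b
  refine ⟨by positivity, N1_le_of_slice fun t ht => ?_, ?_⟩
  · by_cases h : t ≤ 3 / 4
    · refine le_trans ?_ ((integral_abs_conv_le _ H.one_le_pow48 X t).trans (hX t ⟨ht.1, h⟩))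
      refine setIntegral_mono_on (integrable_cube_abs _ t) (integrable_cube_abs _ t)
        isCompact_cube.measurableSet fun x _ => ?_
      rw [mul_apply, abs_mul]; exact mul_le_of_le_one_left (abs_nonneg _) (H.abs_cut t x)
    · have : ∀ x, (χ * conv K X) t x = 0 := fun x => by
        rw [mul_apply, H.cut_zero t (not_le.1 h).le, zero_mul]
      simp only [this, abs_zero, integral_zero]; positivity
  · have h1 := CB_conv (kernel_bounds H.lam_ge 3).1 (pow_pos hΛ _).le hX
    have h2 := CB.mul_indep (a := fun _ => 1) H.D_cut (fun t _ x => H.abs_cut t x) h1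
    have h3 := h2.of_support (J' := Icc 0 1) (by positivity) (fun _ _ _ => by positivity)
      fun t ht ht' x => by
        rw [mul_apply, H.cut_zero t (by by_contra hh; exact ht' ⟨ht.1, (not_le.1 hh).le⟩), zero_mul]
    refine (h3.unweight (one_le_pow₀ (by linarith)) (by positivity)).toHB.mono (by positivity) ?_
    rw [one_mul, ← pow_mul]
    calc (lam:ℝ) ^ (49 * 3) * ((lam:ℝ) ^ 144 * (lam:ℝ) ^ (-7:ℤ))
        ≤ (lam:ℝ) ^ (49 * 3) * ((lam:ℝ) ^ 144 * 1) := by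
          gcongr; exact zpow_le_one_of_nonpos₀ (by linarith) (by norm_num)
      _ ≤ _ := by rw [mul_one, ← pow_add]; exact pow_lam_le H.lam_ge (by norm_num)

end LowHyp
/-- The result of the low-frequency regularisation of the stress. -/
structure LowOut (lam : ℕ) (u z : Fin 3 → Fld) (S : Fin 3 → Fin 3 → Fld) (χ : Fld)
    (u1 z1 : Fin 3 → Fld) (p1 : Fld) (s E Qc : Fin 3 → Fin 3 → Fld) : Prop where
  lin : Lin (Ioo 0 1) u1 z1 p1 (fun a b => χ * s a b + E a b - u1 a * z1 b)
  err : ∀ a b, Sm ((lam:ℝ) ^ (-4:ℤ)) ((lam:ℝ) ^ 400) (E a b)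
  n1 : ∀ a b, N1 (χ * s a b) ≤ N1 (S a b)
  s_cb : ∀ a b, CB (Icc 0 1) ((lam:ℝ) ^ 49) 9 (fun _ _ => (lam:ℝ) ^ 160) (s a b)
  Dt_s_cb : ∀ a b, CB (Icc 0 1) ((lam:ℝ) ^ 49) 9 (fun _ _ => (lam:ℝ) ^ 760) (Dt (s a b))
  pot_cb : ∀ a b, CB (Icc 0 1) ((lam:ℝ) ^ 49) 9 (fun _ _ => (lam:ℝ) ^ 1000) (Qc a b)
  Dt_pot_cb : ∀ a b, CB (Icc 0 1) ((lam:ℝ) ^ 49) 9 (fun _ _ => (lam:ℝ) ^ 1000) (Dt (Qc a b))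
  pot : ∀ a b i, D i (Lap (Qc a b)) = - D i (χ * s a b)
  diff_u : ∀ i, CB (Icc 0 1) 1 3 (fun _ _ => (lam:ℝ) ^ (-78:ℤ)) (u1 i - u i)
  diff_z : ∀ i, CB (Icc 0 1) 1 3 (fun _ _ => (lam:ℝ) ^ (-78:ℤ)) (z1 i - z i)
  eq_u : ∀ i t, (∀ x, χ t x = 0) → ∀ x, u1 i t x = u i t x
  eq_z : ∀ i t, (∀ x, χ t x = 0) → ∀ x, z1 i t x = z i t x
  pot_zero : ∀ a b t, (∀ x, χ t x = 0) → ∀ x, Qc a b t x = 0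

lemma CB_Sm {Λ : ℝ} (hΛ : 1000 ≤ Λ) {f : Fld}
    (h : CB (Icc 0 1) 1 3 (fun _ _ => Λ ^ (-78:ℤ)) f) : Sm (Λ ^ (-7:ℤ)) (Λ ^ 7) f := by
  refine (Sm.of_const le_rfl (by positivity) h).mono
    (zpow_le_zpow_right₀ (by linarith) (by norm_num)) ?_
  rw [one_pow, one_mul, ← zpow_natCast]
  exact zpow_le_zpow_right₀ (by linarith) (by norm_num)

lemma Sm_mul_small {Λ : ℝ} (hΛ : 1000 ≤ Λ) {f g : Fld} (hf : HB (Icc 0 1) 3 (Λ ^ 7) f)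
    (h : CB (Icc 0 1) 1 3 (fun _ _ => Λ ^ (-78:ℤ)) g) : Sm (Λ ^ (-7:ℤ)) (Λ ^ 7) (f * g) := by
  have e : Λ ^ 7 * Λ ^ (-78:ℤ) = Λ ^ (-71:ℤ) := by
    rw [← zpow_natCast, ← zpow_add₀ (by positivity)]; norm_num
  have := Sm_mul (by positivity) (by positivity) hf h
  rw [e] at this
  refine this.mono (zpow_le_zpow_right₀ (by linarith) (by norm_num)) ?_
  rw [← zpow_natCast]
  exact const_mul_zpow_le (by linarith) (by linarith) (by norm_num)

namespace LowHyp
variable {lam : ℕ} {u z : Fin 3 → Fld} {p : Fld} {S : Fin 3 → Fin 3 → Fld} {χ : Fld}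
  (H : LowHyp lam u z p S χ)
include H

lemma Dt_cut_zero : ∀ t, 3 / 4 < t → ∀ x, Dt χ t x = 0 := fun t ht x =>
  Dt_zero_of_eventually (Filter.eventually_of_mem (Ioi_mem_nhds ht)
    fun s hs => H.cut_zero s (mem_Ioi.1 hs).le) x

lemma slice_mavg_S (a b : Fin 3) : ∀ t ∈ Icc (0:ℝ) 1,
    ∫ x in cube, |mavg ((lam:ℝ) ^ (-600:ℤ)) (S a b) t x| ≤ (lam:ℝ) ^ 7 := fun t ht =>
  slice_mavg_le _ fun r hr => H.slice_S a b _ (by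
    nlinarith [ht.1, mul_nonneg H.scale_pos hr.1])

lemma slice_Dt_mavg_S (a b : Fin 3) : ∀ t ∈ Icc (0:ℝ) 1,
    ∫ x in cube, |Dt (mavg ((lam:ℝ) ^ (-600:ℤ)) (S a b)) t x| ≤ (lam:ℝ) ^ 608 := by
  intro t ht
  have hΛ := H.lam_pos
  have hΛ' := H.lam_real
  have h0 : ((lam:ℝ) ^ (-600:ℤ)) ≠ 0 := (zpow_pos hΛ _).ne'
  have e : ∀ x, |Dt (mavg ((lam:ℝ) ^ (-600:ℤ)) (S a b)) t x|
      ≤ (lam:ℝ) ^ 600 * |S a b (t + (lam:ℝ) ^ (-600:ℤ)) x| + (lam:ℝ) ^ 600 * |S a b t x| := by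
    intro x
    rw [Dt_mavg_apply h0, abs_div, abs_of_nonneg H.scale_pos, zpow_neg, div_inv_eq_mul,
      mul_comm, ← mul_add]
    exact mul_le_mul_of_nonneg_left (abs_sub _ _) (by positivity)
  have h1 := setIntegral_mono_on (integrable_cube_abs _ t)
    (((integrable_cube_abs (S a b) (t + (lam:ℝ) ^ (-600:ℤ))).const_mul ((lam:ℝ) ^ 600)).add
      ((integrable_cube_abs (S a b) t).const_mul ((lam:ℝ) ^ 600)))
    isCompact_cube.measurableSet fun x _ => e x
  refine h1.trans ?_
  rw [integral_add' ((integrable_cube_abs _ _).const_mul _)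
    ((integrable_cube_abs _ _).const_mul _), integral_const_mul, integral_const_mul]
  have h2 := H.slice_S a b t ht.1
  have h3 := H.slice_S a b (t + (lam:ℝ) ^ (-600:ℤ)) (by linarith [ht.1, H.scale_pos])
  have h4 : (lam:ℝ) ^ 600 * (lam:ℝ) ^ 7 = (lam:ℝ) ^ 607 := by rw [← pow_add]
  have h5 := three_mul_pow_le H.lam_ge (show 607 + 1 ≤ 608 by norm_num)
  have h6 := mul_le_mul_of_nonneg_left h2 (show 0 ≤ (lam:ℝ) ^ 600 by positivity)
  have h7 := mul_le_mul_of_nonneg_left h3 (show 0 ≤ (lam:ℝ) ^ 600 by positivity)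
  have h8 : 0 < (lam:ℝ) ^ 607 := by positivity
  rw [h4] at h6 h7
  linarith

lemma CB_low {k : Fld} (hk : CB univ ((lam:ℝ) ^ 49) 9 (fun _ _ => (lam:ℝ) ^ 144) k)
    (a b : Fin 3) {c d : ℕ} {g : Fld} (hg : ∀ i, D i g = 0)
    (hg' : ∀ t ∈ Icc (0:ℝ) 1, ∀ x, |g t x| ≤ (lam:ℝ) ^ c) {f : Fld}
    (hf : ∀ t ∈ Icc (0:ℝ) 1, ∫ x in cube, |f t x| ≤ (lam:ℝ) ^ d) :
    CB (Icc 0 1) ((lam:ℝ) ^ 49) 9 (fun _ _ => (lam:ℝ) ^ (144 + d + c)) (g * conv k f) := by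
  have hΛ := H.lam_pos
  refine (CB.mul_indep (a := fun _ => (lam:ℝ) ^ c) hg hg'
    (CB_conv hk (pow_pos hΛ _).le hf)).mono (pow_pos hΛ _).le
    le_rfl fun t _ x => ?_
  rw [← pow_add, ← pow_add]
  exact pow_lam_le H.lam_ge (by omega)

/-- Low-frequency regularisation of the stress. -/
theorem step_low : ∃ u1 z1 p1 s E Qc, LowOut lam u z S χ u1 z1 p1 s E Qc := by
  have hΛ := H.lam_pos
  have hΛ' := H.lam_real
  set Λ : ℝ := (lam:ℝ) with hΛdef
  set ℓ := Λ ^ (-600:ℤ) with hℓ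
  have h0 : ℓ ≠ 0 := (zpow_pos hΛ _).ne'
  set n := lam ^ 48 with hn
  have hn1 : 1 ≤ n := H.one_le_pow48
  obtain ⟨kf, kg, -⟩ := kernel_bounds H.lam_ge 9
  set Y : Fld → Fld := fun f => χ * lf (fejer n - 1) ℓ f with hY
  have hYu : ∀ i, CB (Icc 0 1) 1 3 (fun _ _ => Λ ^ (-78:ℤ)) (Y (u i)) := fun i =>
    H.CB_cut_lf (isLow_fejer_sub H.lam_ge) H.D_cut (fun t _ x => H.scale_cut t x)
      (fun t ht => H.cut_zero t ht.le) i
  have hYz : ∀ i, CB (Icc 0 1) 1 3 (fun _ _ => Λ ^ (-78:ℤ)) (Y (z i)) := fun i =>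
    H.swap.CB_cut_lf (isLow_fejer_sub H.lam_ge) H.D_cut (fun t _ x => H.scale_cut t x)
      (fun t ht => H.cut_zero t ht.le) i
  have hDχ : ∀ i, D i (Dt χ) = 0 := fun i => by rw [← D_Dt, H.D_cut, map_zero]
  have hGu : ∀ a b, CB (Icc 0 1) 1 3 (fun _ _ => Λ ^ (-78:ℤ))
      (Dt χ * lf (D a (green n)) ℓ (u b)) := fun a b =>
    H.CB_cut_lf (isLow_green H.lam_ge a) hDχ H.Dt_cut H.Dt_cut_zero b
  have hGz : ∀ a b, CB (Icc 0 1) 1 3 (fun _ _ => Λ ^ (-78:ℤ))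
      (Dt χ * lf (D a (green n)) ℓ (z b)) := fun a b =>
    H.swap.CB_cut_lf (isLow_green H.lam_ge a) hDχ H.Dt_cut H.Dt_cut_zero b
  have hm : ∀ a b, ∀ t ∈ Icc (0:ℝ) 1, ∫ x in cube, |mavg ℓ (S a b) t x| ≤ Λ ^ 7 :=
    H.slice_mavg_S
  have hone : ∀ i, D i (1:Fld) = 0 := D_one
  have hone' : ∀ t ∈ Icc (0:ℝ) 1, ∀ x, |(1:Fld) t x| ≤ Λ ^ 0 := by simp
  have hcut : ∀ t ∈ Icc (0:ℝ) 1, ∀ x, |χ t x| ≤ Λ ^ 0 := fun t _ x => by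
    simpa using H.abs_cut t x
  refine ⟨fun i => u i + Y (u i), fun i => z i + Y (z i), p + Y p,
    fun a b => conv (fejer n) (mavg ℓ (S a b)),
    fun a b => (S a b - χ * conv (fejer n) (S a b)) - χ * lf (fejer n) ℓ (u a * z b)
      - Dt χ * lf (D a (green n)) ℓ (u b) - Dt χ * lf (D b (green n)) ℓ (z a)
      + u a * Y (z b) + z b * Y (u a) + Y (u a) * Y (z b),
    fun a b => χ * conv (green n) (mavg ℓ (S a b)), ?_⟩
  constructor
  · have hl : Lin (Ioo 0 1) (fun i => u i + Y (u i)) (fun i => z i + Y (z i)) (p + Y p) _ :=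
      H.lin.add (lin_moll hn1 H.scale_pos H.scale_le H.D_cut
        (fun t ht => H.cut_zero t ht.le) H.lin.to_Icc)
    convert hl using 1
    funext a b
    simp only [Pi.add_apply]
    simp only [mollF, lf_apply, map_sub, mul_sub, hY, ← hℓ]
    ring
  · intro a b
    have t1 := H.Sm_smoothing a b
    have t2 := H.Sm_lf_prod a b
    have t3 := CB_Sm hΛ' (hGu a b)
    have t4 := CB_Sm hΛ' (hGz b a)
    have t5 := Sm_mul_small hΛ' (H.hu a) (hYz b)
    have t6 := Sm_mul_small hΛ' (H.hz b) (hYu a)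
    have hb : HB (Icc 0 1) 3 (Λ ^ 7) (Y (u a)) := by
      refine (hYu a).toHB.mono (by positivity) ?_
      rw [← zpow_natCast]
      exact zpow_le_zpow_right₀ (by linarith) (by norm_num)
    have t7 := Sm_mul_small hΛ' hb (hYz b)
    refine ((((((t1.sub t2).sub t3).sub t4).add t5).add t6).add t7).mono ?_ ?_
    · have e1 : Λ ^ (-16:ℤ) ≤ Λ ^ (-7:ℤ) := zpow_le_zpow_right₀ (by linarith) (by norm_num)
      have e2 : 7 * Λ ^ (-7:ℤ) ≤ Λ ^ (-4:ℤ) :=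
        const_mul_zpow_le (by linarith) (by linarith) (by norm_num)
      linarith
    · have e1 : Λ ^ 7 ≤ Λ ^ 300 := pow_lam_le H.lam_ge (by norm_num)
      have e2 : 8 * Λ ^ 300 ≤ Λ * Λ ^ 300 := by gcongr; linarith
      have e3 : Λ * Λ ^ 300 ≤ Λ ^ 400 := by
        rw [← pow_succ']; exact pow_lam_le H.lam_ge (by norm_num)
      linarith
  · intro a b
    refine (N1_mono fun t _ x => ?_).trans ((N1_conv_le n hn1 _).trans
      (N1_mavg_le H.scale_pos (H.S_zero a b)))
    rw [mul_apply, abs_mul]; exact mul_le_of_le_one_left (abs_nonneg _) (H.abs_cut t x)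
  · intro a b
    have := H.CB_low kf a b hone hone' (hm a b)
    rw [one_mul] at this
    exact this.le (by positivity) fun _ _ _ => pow_lam_le H.lam_ge (by norm_num)
  · intro a b
    have := H.CB_low kf a b hone hone'
      (H.slice_Dt_mavg_S a b)
    rw [one_mul] at this
    rw [Dt_conv]
    exact this.le (by positivity) fun _ _ _ => pow_lam_le H.lam_ge (by norm_num)
  · intro a b
    exact (H.CB_low kg a b H.D_cut hcut (hm a b)).le (by positivity)
      fun _ _ _ => pow_lam_le H.lam_ge (by norm_num)
  · intro a b
    have h1 := H.CB_low kg a b H.D_cut hcut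
      (H.slice_Dt_mavg_S a b)
    have h2 := H.CB_low kg a b hDχ H.Dt_cut (hm a b)
    rw [Dt_mul, Dt_conv, mul_comm _ (Dt χ)]
    refine (h1.add h2).le (by positivity) fun _ _ _ => ?_
    have e1 : Λ ^ (144 + 7 + 16) ≤ Λ ^ (144 + 608 + 0) := pow_lam_le H.lam_ge (by norm_num)
    have e2 := three_mul_pow_le H.lam_ge (show 144 + 608 + 0 + 1 ≤ 1000 by norm_num)
    have e3 : 0 < Λ ^ (144 + 608 + 0) := by positivity
    linarith
  · intro a b i
    have e : (fejer n : Fld) = 1 - Lap (green n) := by rw [Lap_green n hn1]; ring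
    rw [Lap_mul_const H.D_cut, D_mul_const _ (H.D_cut i), D_mul_const _ (H.D_cut i), ← conv_Lap, e,
      conv_sub_left, map_sub, D_conv_one]
    ring
  · intro i
    simpa only [add_sub_cancel_left] using hYu i
  · intro i
    simpa only [add_sub_cancel_left] using hYz i
  · intro i t ht x
    simp [hY, ht]
  · intro i t ht x
    simp [hY, ht]
  · intro a b t ht x
    simp [ht]

end LowHyp
/-- Smooth steps with quantitative derivative bounds. -/
lemma exists_step : ∃ C : ℝ, 1 ≤ C ∧ ∀ a b : ℝ, a < b → ∃ η : ℝ → ℝ, ContDiff ℝ (⊤ : ℕ∞) η ∧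
    (∀ t, t ≤ a → η t = 0) ∧ (∀ t, b ≤ t → η t = 1) ∧ (∀ t, 0 ≤ η t) ∧ (∀ t, η t ≤ 1) ∧
    ∀ t, |deriv η t| ≤ C / (b - a) := by
  have hs : ContDiff ℝ (⊤ : ℕ∞) smoothTransition := smoothTransition.contDiff
  have hc : Continuous (deriv smoothTransition) := hs.continuous_deriv (by simp)
  obtain ⟨C, hC⟩ := (isCompact_Icc (a := (0:ℝ)) (b := 1)).exists_bound_of_continuousOn
    hc.continuousOn
  have hb : ∀ t, |deriv smoothTransition t| ≤ max C 1 := by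
    intro t
    by_cases h0 : t < 0
    · have : smoothTransition =ᶠ[nhds t] fun _ => 0 :=
        Filter.eventually_of_mem (Iio_mem_nhds h0) fun s hs =>
          smoothTransition.zero_of_nonpos (mem_Iio.1 hs).le
      rw [this.deriv_eq]; simp
    by_cases h1 : 1 < t
    · have : smoothTransition =ᶠ[nhds t] fun _ => 1 :=
        Filter.eventually_of_mem (Ioi_mem_nhds h1) fun s hs =>
          smoothTransition.one_of_one_le (mem_Ioi.1 hs).le
      rw [this.deriv_eq]; simp
    exact (hC t ⟨not_lt.1 h0, not_lt.1 h1⟩).trans (le_max_left _ _)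
  refine ⟨max C 1, le_max_right _ _, fun a b hab => ⟨fun t => smoothTransition ((t - a) / (b - a)),
    hs.comp ((contDiff_id.sub contDiff_const).div_const _), fun t ht => ?_, fun t ht => ?_,
    fun t => smoothTransition.nonneg _, fun t => smoothTransition.le_one _, fun t => ?_⟩⟩
  · exact smoothTransition.zero_of_nonpos (div_nonpos_of_nonpos_of_nonneg (by linarith) (by linarith))
  · exact smoothTransition.one_of_one_le ((one_le_div (by linarith)).2 (by linarith))
  · have h1 : HasDerivAt (fun t : ℝ => (t - a) / (b - a)) (1 / (b - a)) t :=
      ((hasDerivAt_id t).sub_const a).div_const _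
    have h2 := ((hs.differentiable (by simp)) ((t - a) / (b - a))).hasDerivAt.comp t h1
    have h3 := h2.deriv
    simp only [Function.comp_def] at h3
    rw [h3, abs_mul, abs_of_pos (show 0 < 1 / (b - a) by have := sub_pos.2 hab; positivity),
      mul_one_div]
    exact div_le_div_of_nonneg_right (hb _) (by linarith)

/-- Fields agreeing near a time with a solution satisfy the same equations there. -/
lemma Lin.congr_near {u z u' z' : Fin 3 → Fld} {P : Fld} {S S' : Set ℝ}
    (h : Lin S u' z' P (fun i j => 0 - u' i * z' j)) (hS : S' ⊆ S)
    (hu : ∀ t ∈ S', ∀ᶠ s in nhds t, ∀ i x, u i s x = u' i s x ∧ z i s x = z' i s x) :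
    Lin S' u z P (fun i j => 0 - u i * z j) := by
  intro t ht x
  obtain ⟨h1, h2, h3, h4⟩ := h t (hS ht) x
  have hn := hu t ht
  have ht' := hn.self_of_nhds
  have e1 : ∀ i, Heat (u i) t x = Heat (u' i) t x := fun i => by
    have := Heat_zero_of_eventually (f := u i - u' i) (hn.mono fun s hs y => by
      rw [sub_apply, (hs i y).1, sub_self]) x
    rw [map_sub, sub_apply] at this; linarith
  have e2 : ∀ i, Heat (z i) t x = Heat (z' i) t x := fun i => by
    have := Heat_zero_of_eventually (f := z i - z' i) (hn.mono fun s hs y => by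
      rw [sub_apply, (hs i y).2, sub_self]) x
    rw [map_sub, sub_apply] at this; linarith
  have e3 : ∀ i j l, D l (0 - u i * z j) t x = D l (0 - u' i * z' j) t x := fun i j l =>
    D_slice (fun y => by simp [(ht' i y).1, (ht' j y).2]) l x
  have e4 : ∀ i j, D j (u i) t x = D j (u' i) t x := fun i j =>
    D_slice (fun y => (ht' i y).1) j x
  have e5 : ∀ i j, D j (z i) t x = D j (z' i) t x := fun i j =>
    D_slice (fun y => (ht' i y).2) j x
  simp only [add_apply, sub_apply, sum_apply] at h1 h2 h3 h4 ⊢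
  exact ⟨fun i => by simpa only [e1, e3] using h1 i, fun i => by simpa only [e2, e3] using h2 i,
    by simpa only [e4] using h3, by simpa only [e5] using h4⟩

/-- Pressure gluing: the stress can be cut off where the fields solve the exact system. -/
lemma Lin.glue {u z : Fin 3 → Fld} {P P1 P2 : Fld} {S : Fin 3 → Fin 3 → Fld} {ηl ηr : Fld}
    (hl : ∀ i, D i ηl = 0) (hr : ∀ i, D i ηr = 0)
    (h : Lin (Ioo 0 1) u z P (fun i j => S i j - u i * z j))
    (h1 : Lin (Ioo 0 1 ∩ {t | ∃ x, ηl t x ≠ 1}) u z P1 (fun i j => 0 - u i * z j))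
    (h2 : Lin (Ioo 0 1 ∩ {t | ∃ x, ηr t x ≠ 1}) u z P2 (fun i j => 0 - u i * z j))
    (hlr : ∀ t x, ηl t x = 1 ∨ ηr t x = 1) :
    Lin (Ioo 0 1) u z (ηl * ηr * P + (1 - ηl) * P1 + (1 - ηr) * P2)
      (fun i j => ηl * ηr * S i j - u i * z j) := by
  intro t ht x
  obtain ⟨a1, a2, a3, a4⟩ := h t ht x
  have key : ∀ f f1 f2 g s w : ℝ, f + g - (s - w) = 0 →
      (ηl t x ≠ 1 → f + f1 + w = 0) → (ηr t x ≠ 1 → f + f2 + w = 0) →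
      f + (ηl t x * ηr t x * g + (1 - ηl t x) * f1 + (1 - ηr t x) * f2)
        - (ηl t x * ηr t x * s - w) = 0 := by
    intro f f1 f2 g s w e e1 e2
    have k1 : (1 - ηl t x) * (f + f1 + w) = 0 := by
      by_cases hh : ηl t x = 1
      · rw [hh]; ring
      · rw [e1 hh, mul_zero]
    have k2 : (1 - ηr t x) * (f + f2 + w) = 0 := by
      by_cases hh : ηr t x = 1
      · rw [hh]; ring
      · rw [e2 hh, mul_zero]
    have k3 : (1 - ηl t x) * (1 - ηr t x) = 0 := by
      rcases hlr t x with hh | hh <;> rw [hh] <;> ring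
    linear_combination ηl t x * ηr t x * e + k1 + k2 - (f + w) * k3
  have dP : ∀ i, D i (ηl * ηr * P + (1 - ηl) * P1 + (1 - ηr) * P2) t x
      = ηl t x * ηr t x * D i P t x + (1 - ηl t x) * D i P1 t x + (1 - ηr t x) * D i P2 t x := by
    intro i
    rw [map_add, map_add, mul_assoc, D_mul_const i (hl i), D_mul_const i (hr i),
      D_mul_const i (h := 1 - ηl) (by rw [map_sub, D_one, hl, sub_zero]),
      D_mul_const i (h := 1 - ηr) (by rw [map_sub, D_one, hr, sub_zero])]
    simp only [add_apply, mul_apply, sub_apply, one_apply]; ring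
  have dF : ∀ i j l, D l (ηl * ηr * S i j - u i * z j) t x
      = ηl t x * ηr t x * D l (S i j) t x - D l (u i * z j) t x := by
    intro i j l
    rw [map_sub, mul_assoc, D_mul_const l (hl l), D_mul_const l (hr l)]
    simp only [mul_apply, sub_apply]; ring
  have b1 : ηl t x ≠ 1 → _ := fun hh => h1 t ⟨ht, x, hh⟩ x
  have b2 : ηr t x ≠ 1 → _ := fun hh => h2 t ⟨ht, x, hh⟩ x
  simp only [add_apply, sub_apply, sum_apply, map_sub, map_zero, zero_apply] at a1 a2 b1 b2
  simp only [add_apply, sub_apply, sum_apply, dP, dF]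
  refine ⟨fun i => ?_, fun i => ?_, by simpa only [sum_apply] using a3,
    by simpa only [sum_apply] using a4⟩
  · have := key (Heat (u i) t x) (D i P1 t x) (D i P2 t x) (D i P t x)
      (∑ j, D j (S j i) t x) (∑ j, D j (u j * z i) t x)
      (by rw [← Finset.sum_sub_distrib]; exact a1 i)
      (fun hh => by have := (b1 hh).1 i; rw [Finset.sum_sub_distrib] at this; simpa using this)
      (fun hh => by have := (b2 hh).1 i; rw [Finset.sum_sub_distrib] at this; simpa using this)
    rwa [Finset.mul_sum, ← Finset.sum_sub_distrib] at this
  · have := key (Heat (z i) t x) (D i P1 t x) (D i P2 t x) (D i P t x)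
      (∑ j, D j (S i j) t x) (∑ j, D j (u i * z j) t x)
      (by rw [← Finset.sum_sub_distrib]; exact a2 i)
      (fun hh => by have := (b1 hh).2.1 i; rw [Finset.sum_sub_distrib] at this; simpa using this)
      (fun hh => by have := (b2 hh).2.1 i; rw [Finset.sum_sub_distrib] at this; simpa using this)
    rwa [Finset.mul_sum, ← Finset.sum_sub_distrib] at this

/-- Localisation of the stress to the gluing window, with a slightly larger cutoff. -/
lemma exists_glue : ∃ C : ℝ, 1 ≤ C ∧ ∀ T τ : ℝ, 0 < T → 0 < τ → τ ≤ T / 8 →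
    ∀ (u z u1 z1 u2 z2 : Fin 3 → Fld) (P P1 P2 : Fld) (S : Fin 3 → Fin 3 → Fld),
    Lin (Ioo 0 1) u z P (fun i j => S i j - u i * z j) →
    Lin (Ioo 0 1) u1 z1 P1 (fun i j => 0 - u1 i * z1 j) →
    Lin (Ioo 0 1) u2 z2 P2 (fun i j => 0 - u2 i * z2 j) →
    (∀ t ∈ Icc (0:ℝ) (2 * T + 2 * τ), ∀ i x, u i t x = u1 i t x ∧ z i t x = z1 i t x) →
    (∀ t ∈ Icc (3 * T - τ) 1, ∀ i x, u i t x = u2 i t x ∧ z i t x = z2 i t x) →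
    ∃ θ p' χ : Fld, Lin (Ioo 0 1) u z p' (fun i j => θ * S i j - u i * z j) ∧
      (∀ i, D i θ = 0) ∧ (∀ t x, |θ t x| ≤ 1) ∧ (∀ t, 3 * T - τ / 2 ≤ t → ∀ x, θ t x = 0) ∧
      (∀ i, D i χ = 0) ∧ (∀ t x, 0 ≤ χ t x) ∧ (∀ t x, χ t x ≤ 1) ∧
      (∀ t x, |Dt χ t x| ≤ C / τ) ∧ χ * χ * θ = θ ∧
      (∀ t, t ≤ 2 * T + τ / 2 → ∀ x, χ t x = 0) ∧
      (∀ t, 3 * T - τ / 4 ≤ t → ∀ x, χ t x = 0) := by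
  obtain ⟨C, hC, hstep⟩ := exists_step
  refine ⟨6 * C, by linarith, ?_⟩
  intro T τ hT hτ hτT u z u1 z1 u2 z2 P P1 P2 S h h1 h2 e1 e2
  obtain ⟨ηl, sl, l0, l1, lp, lq, -⟩ := hstep (2 * T + τ) (2 * T + 2 * τ) (by linarith)
  obtain ⟨ηr, sr, r0, r1, rp, rq, -⟩ := hstep (3 * T - τ) (3 * T - τ / 2) (by linarith)
  obtain ⟨ζl, tl, m0, m1, mp, mq, md⟩ := hstep (2 * T + τ / 2) (2 * T + τ) (by linarith)
  obtain ⟨ζr, tr, n0, n1, np, nq, nd⟩ := hstep (3 * T - τ / 2) (3 * T - τ / 4) (by linarith)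
  have Hl : ∀ i, D i (tf ηl sl) = 0 := fun i => D_tf i _ _
  have Hr : ∀ i, D i (1 - tf ηr sr) = 0 := fun i => by rw [map_sub, D_one, D_tf, sub_zero]
  have Ml : ∀ i, D i (tf ζl tl) = 0 := fun i => D_tf i _ _
  have Mr : ∀ i, D i (1 - tf ζr tr) = 0 := fun i => by rw [map_sub, D_one, D_tf, sub_zero]
  have g := Lin.glue (ηl := tf ηl sl) (ηr := 1 - tf ηr sr) Hl Hr h
    (h1.congr_near inter_subset_left (u := u) (z := z) fun t ht => by
      obtain ⟨ht, x, hx⟩ := ht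
      have : t < 2 * T + 2 * τ := by
        by_contra hh; exact hx (l1 t (not_lt.1 hh))
      exact Filter.eventually_of_mem (Ioo_mem_nhds ht.1 this) fun s hs => e1 s ⟨hs.1.le, hs.2.le⟩)
    (h2.congr_near inter_subset_left (u := u) (z := z) fun t ht => by
      obtain ⟨ht, x, hx⟩ := ht
      have : 3 * T - τ < t := by
        by_contra hh
        refine hx ?_
        rw [sub_apply, tf_apply, r0 t (not_lt.1 hh)]; simp
      exact Filter.eventually_of_mem (Ioo_mem_nhds this ht.2) fun s hs => e2 s ⟨hs.1.le, hs.2.le⟩)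
    (fun t x => by
      by_cases hh : 2 * T + 2 * τ ≤ t
      · exact Or.inl (l1 t hh)
      · right; rw [sub_apply, tf_apply, r0 t (by linarith)]; simp)
  refine ⟨_, _, tf ζl tl * (1 - tf ζr tr), g, fun i => ?_, fun t x => ?_, fun t ht x => ?_,
    fun i => ?_, fun t x => ?_, fun t x => ?_, fun t x => ?_, ?_, fun t ht x => ?_,
    fun t ht x => ?_⟩
  · rw [D_mul_const i (Hl i), Hr, mul_zero]
  · simp only [mul_apply, sub_apply, one_apply, tf_apply, abs_mul]
    rw [abs_of_nonneg (lp t), abs_of_nonneg (by linarith [rq t])]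
    exact mul_le_one₀ (lq t) (by linarith [rq t]) (by linarith [rp t])
  · simp only [mul_apply, sub_apply, one_apply, tf_apply, r1 t ht]; ring
  · rw [D_mul_const i (Ml i), Mr, mul_zero]
  · simp only [mul_apply, sub_apply, one_apply, tf_apply]
    exact mul_nonneg (mp t) (by linarith [nq t])
  · simp only [mul_apply, sub_apply, one_apply, tf_apply]
    exact mul_le_one₀ (mq t) (by linarith [nq t]) (by linarith [np t])
  · have : Dt (tf ζl tl * (1 - tf ζr tr)) t x
        = ζl t * (- deriv ζr t) + (1 - ζr t) * deriv ζl t := by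
      rw [Dt_mul, map_sub, Dt.map_one_eq_zero]
      simp [Dt_tf]
    rw [this]
    have b1 : |ζl t * (- deriv ζr t)| ≤ C / (τ / 4) := by
      rw [abs_mul, abs_neg, abs_of_nonneg (mp t)]
      have := nd t
      rw [show 3 * T - τ / 4 - (3 * T - τ / 2) = τ / 4 by ring] at this
      exact (mul_le_of_le_one_left (abs_nonneg _) (mq t)).trans this
    have b2 : |(1 - ζr t) * deriv ζl t| ≤ C / (τ / 2) := by
      rw [abs_mul, abs_of_nonneg (show 0 ≤ 1 - ζr t by linarith [nq t])]
      have := md t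
      rw [show 2 * T + τ - (2 * T + τ / 2) = τ / 2 by ring] at this
      exact (mul_le_of_le_one_left (abs_nonneg _) (by linarith [np t])).trans this
    refine (abs_add_le _ _).trans ((add_le_add b1 b2).trans (le_of_eq ?_))
    field_simp; ring
  · ext t x
    simp only [mul_apply, sub_apply, one_apply, tf_apply]
    by_cases hh : t ≤ 2 * T + τ
    · rw [l0 t hh]; ring
    by_cases hh' : 3 * T - τ / 2 ≤ t
    · rw [r1 t hh']; ring
    · rw [m1 t (by linarith), n0 t (by linarith)]; ring
  · simp only [mul_apply, tf_apply, m0 t ht, zero_mul]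
  · simp only [mul_apply, sub_apply, one_apply, tf_apply, n1 t ht]; ring

/-- Real powers of a positive field. -/
def rp (r : ℝ) (w : Fld) (hw : ∀ t x, 0 < w t x) : Fld :=
  ⟨fun t x => w t x ^ r,
    ContDiff.rpow_const_of_ne (f := fun q : ℝ × V3 => w q.1 q.2) w.smooth fun q => (hw q.1 q.2).ne',
    fun t x n => by simp only [w.per t x n]⟩

@[simp] lemma rp_apply (r : ℝ) (w : Fld) (hw : ∀ t x, 0 < w t x) (t : ℝ) (x : V3) :
    rp r w hw t x = w t x ^ r := rfl

lemma dd_rp (e : ℝ × V3) (r : ℝ) (w : Fld) (hw : ∀ t x, 0 < w t x) :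
    dd e (rp r w hw) = r • (rp (r - 1) w hw * dd e w) := by
  ext t x
  have h := (w.smooth.differentiableAt (t, x)).hasFDerivAt.rpow_const (p := r)
    (Or.inl (hw t x).ne')
  simp only [dd_apply, smul_apply, mul_apply, rp_apply]
  have h2 : dirD e (rp r w hw).1 t x = _ := congrArg (fun L => L e) h.fderiv
  rw [h2]
  simp [dirD, mul_assoc]

/-- A strictly positive regularisation of `s²`. -/
def reg (δ : ℝ) (s : Fld) : Fld := (δ ^ 2) • 1 + s * s

lemma reg_apply (δ : ℝ) (s : Fld) (t : ℝ) (x : V3) : reg δ s t x = δ ^ 2 + s t x ^ 2 := by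
  simp [reg, sq]

lemma reg_pos {δ : ℝ} (hδ : 0 < δ) (s : Fld) (t : ℝ) (x : V3) : 0 < reg δ s t x := by
  rw [reg_apply]; positivity

lemma dd_reg (e : ℝ × V3) (δ : ℝ) (s : Fld) : dd e (reg δ s) = (2:ℝ) • (s * dd e s) := by
  have h1 : dd e ((δ ^ 2) • (1 : Fld)) = 0 := by rw [(dd e).map_smul]; simp
  rw [reg, map_add, h1, Derivation.leibniz]
  ext t x; simp; ring

lemma dd_rp_reg (e : ℝ × V3) (r : ℝ) {δ : ℝ} (hδ : 0 < δ) (s : Fld) :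
    dd e (rp r _ (reg_pos hδ s)) = (2 * r) • (rp (r - 1) _ (reg_pos hδ s) * (s * dd e s)) := by
  rw [dd_rp, dd_reg]
  ext t x; simp; ring

lemma rpow_reg_sub_one_le {δ : ℝ} (hδ : 0 < δ) (s : Fld) (r t : ℝ) (x : V3) :
    reg δ s t x ^ (r - 1) ≤ (δ ^ 2)⁻¹ * reg δ s t x ^ r := by
  have h := reg_pos hδ s t x
  rw [rpow_sub_one h.ne', div_eq_inv_mul]
  refine mul_le_mul_of_nonneg_right (inv_anti₀ (by positivity) ?_) (by positivity)
  rw [reg_apply]; nlinarith [sq_nonneg (s t x)]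

lemma CB_rp_reg {J : Set ℝ} {L δ M R W : ℝ} (hL : 0 ≤ L) (hδ : 0 < δ) (hM : 0 ≤ M) {s : Fld}
    (hW : W = (δ ^ 2)⁻¹ * (M * (L * M))) (hLW : L ≤ W) (hR : 1 ≤ R) :
    ∀ {k : ℕ} {r : ℝ} {X : ℝ → V3 → ℝ}, CB J L k (fun _ _ => M) s → |r| + k ≤ R →
    (∀ t ∈ J, ∀ x, reg δ s t x ^ r ≤ X t x) →
    CB J (4 ^ k * (2 * R * W)) k X (rp r _ (reg_pos hδ s))
  | 0, r, X, _, _, hX => fun t ht x => by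
      rw [rp_apply, abs_of_nonneg (rpow_nonneg (reg_pos hδ s t x).le _)]; exact hX t ht x
  | k + 1, r, X, hs, hr, hX => by
    have hW0 : 0 ≤ W := hL.trans hLW
    have h0 : ∀ t ∈ J, ∀ x, 0 ≤ X t x := fun t ht x =>
      (rpow_nonneg (reg_pos hδ s t x).le _).trans (hX t ht x)
    push_cast at hr
    have hk0 : (0:ℝ) ≤ k := k.cast_nonneg
    refine CB.succ (fun t ht x => ?_) fun i => ?_
    · rw [rp_apply, abs_of_nonneg (rpow_nonneg (reg_pos hδ s t x).le _)]; exact hX t ht x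
    · have e : D i (rp r _ (reg_pos hδ s))
          = (2 * r) • (rp (r - 1) _ (reg_pos hδ s) * (s * D i s)) := dd_rp_reg _ r hδ s
      rw [e]
      have h4 : (1:ℝ) ≤ 4 ^ k := one_le_pow₀ (by norm_num)
      have hbig : 2 * L ≤ 4 ^ k * (2 * R * W) := by
        have : L ≤ R * W := hLW.trans (le_mul_of_one_le_left hW0 hR)
        nlinarith [mul_nonneg (by linarith : (0:ℝ) ≤ R) hW0]
      have h1 : CB J (4 ^ k * (2 * R * W)) k (fun t x => (δ ^ 2)⁻¹ * X t x)
          (rp (r - 1) _ (reg_pos hδ s)) :=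
        CB_rp_reg hL hδ hM hW hLW hR hs.pred (by
          have := abs_sub r 1
          rw [abs_one] at this; linarith) fun t ht x =>
            (rpow_reg_sub_one_le hδ s r t x).trans
              (mul_le_mul_of_nonneg_left (hX t ht x) (by positivity))
      have h2 := (CB.mul hL hs.pred (hs.D i)).mono (by positivity) hbig fun _ _ _ => le_rfl
      have hb0 : 0 ≤ 4 ^ k * (2 * R * W) := by positivity
      refine ((CB.mul hb0 h1 h2).smul (2 * r)).mono (by positivity) (L' := 4 ^ (k + 1) * (2 * R * W))
        ?_ fun t ht x => ?_
      · rw [pow_succ]; nlinarith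
      · have hr2 : |2 * r| ≤ 2 * R := by
          rw [abs_mul, abs_two]; linarith
        have e2 : (δ ^ 2)⁻¹ * X t x * (M * (L * M)) = W * X t x := by rw [hW]; ring
        rw [e2]
        have hX0 := h0 t ht x
        calc |2 * r| * (W * X t x) ≤ 2 * R * (W * X t x) := by gcongr
          _ ≤ 4 ^ (k + 1) * (2 * R * (W * X t x)) :=
            le_mul_of_one_le_left (by positivity) (one_le_pow₀ (by norm_num))
          _ = _ := by ring

/-- Slowly varying data of one building block: amplitudes, their product, and a potential. -/
structure Slow (Q δ : ℝ) (st A B P : Fld) : Prop where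
  prod : A * B = -st
  A_cb : CB (Icc 0 1) Q 7 (fun _ _ => Q) A
  B_cb : CB (Icc 0 1) Q 7 (fun _ _ => Q) B
  Dt_A_cb : CB (Icc 0 1) Q 7 (fun _ _ => Q) (Dt A)
  Dt_B_cb : CB (Icc 0 1) Q 7 (fun _ _ => Q) (Dt B)
  st_cb : CB (Icc 0 1) Q 7 (fun _ _ => Q) st
  Dt_st_cb : CB (Icc 0 1) Q 7 (fun _ _ => Q) (Dt st)
  P_cb : CB (Icc 0 1) Q 7 (fun _ _ => Q) P
  Dt_P_cb : CB (Icc 0 1) Q 7 (fun _ _ => Q) (Dt P)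
  pot : ∀ i, D i (Lap P) = - D i st
  A_sq : ∀ t x, A t x ^ 2 ≤ |st t x| + δ
  B_sq : ∀ t x, B t x ^ 2 ≤ |st t x| + δ

/-- Space derivative bounds by powers of `lam`. -/
def PC (lam a b : ℕ) (f : Fld) : Prop :=
  CB (Icc 0 1) ((lam:ℝ) ^ a) 7 (fun _ _ => (lam:ℝ) ^ b) f

section PC
variable {lam : ℕ} (h : 1000 ≤ lam) {a a' b b' c : ℕ} {f g : Fld}
include h

lemma PC.mono (hf : PC lam a b f) (ha : a ≤ a') (hb : b ≤ b') : PC lam a' b' f :=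
  CB.mono (by positivity) (pow_lam_le h ha) hf fun _ _ _ => pow_lam_le h hb

lemma PC.mul (hf : PC lam a b f) (hg : PC lam a b' g) : PC lam (a + 1) (b + b') (f * g) := by
  refine (CB.mul (by positivity) hf hg).mono (by positivity) ?_ fun _ _ _ => by rw [pow_add]
  have := three_mul_pow_le h (le_refl (a + 1))
  have h0 : (0:ℝ) ≤ (lam:ℝ) ^ a := by positivity
  linarith

lemma PC.add (hf : PC lam a b f) (hg : PC lam a b g) : PC lam a (b + 1) (f + g) := by
  refine (CB.add hf hg).le (by positivity) fun _ _ _ => ?_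
  have := three_mul_pow_le h (le_refl (b + 1))
  have h0 : (0:ℝ) ≤ (lam:ℝ) ^ b := by positivity
  linarith

lemma PC.smul {r : ℝ} (hr : |r| ≤ 3) (hf : PC lam a b f) : PC lam a (b + 1) (r • f) := by
  refine (CB.smul r hf).le (by positivity) fun _ _ _ => ?_
  exact (mul_le_mul_of_nonneg_right hr (by positivity)).trans (three_mul_pow_le h le_rfl)

omit h in
lemma PC.time_mul (hg : ∀ i, D i g = 0) (hg' : ∀ t ∈ Icc (0:ℝ) 1, ∀ x, |g t x| ≤ (lam:ℝ) ^ c)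
    (hf : PC lam a b f) : PC lam a (c + b) (g * f) :=
  (CB.mul_indep (a := fun _ => (lam:ℝ) ^ c) hg hg' hf).congr fun _ _ => by rw [pow_add]

lemma PC.rp {s : Fld} (hs : PC lam 49 160 s) {r : ℝ} (hr : |r| ≤ 5 / 4)
    (hδ : (0:ℝ) < (lam:ℝ) ^ (-4:ℤ)) : PC lam 400 405 (rp r _ (reg_pos hδ s)) := by
  have hΛ : (1000:ℝ) ≤ lam := by exact_mod_cast h
  have hΛ0 : (0:ℝ) < lam := by linarith
  have e1 : (((lam:ℝ) ^ (-4:ℤ)) ^ 2)⁻¹ = (lam:ℝ) ^ 8 := by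
    rw [← zpow_natCast, ← zpow_mul, ← zpow_neg]; norm_num
  have hW : (lam:ℝ) ^ 377 = (((lam:ℝ) ^ (-4:ℤ)) ^ 2)⁻¹ * ((lam:ℝ) ^ 160 *
      ((lam:ℝ) ^ 49 * (lam:ℝ) ^ 160)) := by rw [e1]; ring
  refine (CB_rp_reg (R := 10) (by positivity) hδ (by positivity) hW
    (pow_lam_le h (by norm_num)) (by norm_num) hs (by push_cast; linarith)
    (X := fun _ _ => (lam:ℝ) ^ 405) fun t ht x => ?_).mono (by positivity) ?_ fun _ _ _ => le_rfl
  · have hp := reg_pos hδ s t x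
    set w := reg ((lam:ℝ) ^ (-4:ℤ)) s t x with hw
    have hb : 1 ≤ (lam:ℝ) ^ 324 := one_le_pow₀ (by linarith)
    have hw1 : w ≤ (lam:ℝ) ^ 324 := by
      rw [hw, reg_apply]
      have h1 : s t x ^ 2 ≤ ((lam:ℝ) ^ 160) ^ 2 := by
        rw [← sq_abs]; exact pow_le_pow_left₀ (abs_nonneg _) (hs.bound t ht x) 2
      have h2 : ((lam:ℝ) ^ (-4:ℤ)) ^ 2 ≤ 1 :=
        pow_le_one₀ hδ.le (zpow_le_one_of_nonpos₀ (by linarith) (by norm_num))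
      rw [← pow_mul] at h1
      have h3 := three_mul_pow_le h (show 320 + 1 ≤ 324 by norm_num)
      have h4 : 1 ≤ (lam:ℝ) ^ 320 := one_le_pow₀ (by linarith)
      norm_num at h1
      linarith
    have hw2 : w⁻¹ ≤ (lam:ℝ) ^ 324 := by
      refine (inv_anti₀ (b := ((lam:ℝ) ^ (-4:ℤ)) ^ 2) (by positivity) ?_).trans ?_
      · rw [hw, reg_apply]; nlinarith [sq_nonneg (s t x)]
      · rw [e1]; exact pow_lam_le h (by norm_num)
    have key : ∀ y q : ℝ, 0 < y → 0 ≤ q → q ≤ 5 / 4 → y ≤ (lam:ℝ) ^ 324 →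
        y ^ q ≤ (lam:ℝ) ^ 405 := by
      intro y q hy hq hq' hy'
      calc y ^ q ≤ ((lam:ℝ) ^ 324) ^ q := rpow_le_rpow hy.le hy' hq
        _ ≤ ((lam:ℝ) ^ 324) ^ (5 / 4 : ℝ) := rpow_le_rpow_of_exponent_le hb hq'
        _ = _ := by
          rw [← Real.rpow_natCast, ← rpow_mul hΛ0.le, ← Real.rpow_natCast]; norm_num
    rcases le_total 0 r with h0 | h0
    · exact key w r hp h0 ((le_abs_self r).trans hr) hw1
    · have := key w⁻¹ (-r) (by positivity) (by linarith) ((neg_le_abs r).trans hr) hw2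
      rwa [inv_rpow hp.le, rpow_neg hp.le, inv_inv] at this
  · have : (4:ℝ) ^ 7 * (2 * 10) ≤ (lam:ℝ) ^ 3 := by
      refine le_trans ?_ (pow_le_pow_left₀ (by norm_num) hΛ 3); norm_num
    calc (4:ℝ) ^ 7 * (2 * 10 * (lam:ℝ) ^ 377) = (4:ℝ) ^ 7 * (2 * 10) * (lam:ℝ) ^ 377 := by ring
      _ ≤ (lam:ℝ) ^ 3 * (lam:ℝ) ^ 377 := by gcongr
      _ = (lam:ℝ) ^ 380 := by ring
      _ ≤ _ := pow_lam_le h (by norm_num)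

lemma exists_slow {s P χ : Fld} (hs : PC lam 49 160 s) (hs' : PC lam 49 760 (Dt s))
    (hP : PC lam 49 1000 P) (hP' : PC lam 49 1000 (Dt P))
    (hpot : ∀ i, D i (Lap P) = - D i (χ * χ * s)) (hD : ∀ i, D i χ = 0)
    (h1 : ∀ t x, |χ t x| ≤ 1) (h2 : ∀ t ∈ Icc (0:ℝ) 1, ∀ x, |Dt χ t x| ≤ (lam:ℝ) ^ 16) :
    ∃ A B : Fld, Slow ((lam:ℝ) ^ 1500) ((lam:ℝ) ^ (-4:ℤ)) (χ * χ * s) A B P ∧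
      ∀ t, (∀ x, χ t x = 0) → ∀ x, A t x = 0 ∧ B t x = 0 := by
  have hΛ : (1000:ℝ) ≤ lam := by exact_mod_cast h
  have hΛ0 : (0:ℝ) < lam := by linarith
  have hδ : (0:ℝ) < (lam:ℝ) ^ (-4:ℤ) := by positivity
  have hDt : ∀ i, D i (Dt χ) = 0 := fun i => by rw [← D_Dt, hD, map_zero]
  have h1' : ∀ t ∈ Icc (0:ℝ) 1, ∀ x, |χ t x| ≤ (lam:ℝ) ^ 0 := fun t _ x => by simpa using h1 t x
  have fin : ∀ {a b : ℕ} {f : Fld}, PC lam a b f → a ≤ 1500 → b ≤ 1500 →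
      CB (Icc 0 1) ((lam:ℝ) ^ 1500) 7 (fun _ _ => (lam:ℝ) ^ 1500) f :=
    fun hf ha hb => hf.mono h ha hb
  have hDrp : ∀ r, Dt (rp r _ (reg_pos hδ s)) = (2 * r) • (rp (r - 1) _ (reg_pos hδ s) *
      (s * Dt s)) := fun r => dd_rp_reg _ r hδ s
  have hrpt : ∀ r, |r| ≤ 1 / 4 → |r - 1| ≤ 5 / 4 → PC lam 402 1326 (Dt (rp r _ (reg_pos hδ s))) := by
    intro r hr hr'
    rw [hDrp]
    exact PC.smul h (b := 1325) (by rw [abs_mul, abs_two]; linarith)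
      ((PC.rp h hs hr' hδ).mono h (show 400 ≤ 401 by norm_num) le_rfl |>.mul h
        ((hs.mul h hs').mono h (show _ ≤ 401 by norm_num) (show _ ≤ 920 by norm_num)))
  have r1 : |(-1 / 4 : ℝ)| ≤ 1 / 4 := by norm_num [abs_le]
  have r2 : |(-1 / 4 : ℝ) - 1| ≤ 5 / 4 := by norm_num [abs_le]
  have r3 : |(1 / 4 : ℝ)| ≤ 1 / 4 := by norm_num [abs_le]
  have r4 : |(1 / 4 : ℝ) - 1| ≤ 5 / 4 := by norm_num [abs_le]
  set ym := rp (-1 / 4) _ (reg_pos hδ s) with hym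
  set yp := rp (1 / 4) _ (reg_pos hδ s) with hyp
  have cm : PC lam 400 405 ym := PC.rp h hs (r1.trans (by norm_num)) hδ
  have cp : PC lam 400 405 yp := PC.rp h hs (r3.trans (by norm_num)) hδ
  have hs4 : PC lam 400 160 s := hs.mono h (by norm_num) le_rfl
  have hsm : PC lam 401 565 (s * ym) := hs4.mul h cm
  have hχ : ∀ {a b : ℕ} {f : Fld}, PC lam a b f → PC lam a (0 + b) (χ * f) := fun hf =>
    hf.time_mul hD h1'
  have hχ' : ∀ {a b : ℕ} {f : Fld}, PC lam a b f → PC lam a (16 + b) (Dt χ * f) := fun hf =>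
    hf.time_mul hDt h2
  have pp : ∀ t x, ym t x * yp t x = 1 := fun t x => by
    rw [hym, hyp, rp_apply, rp_apply, ← rpow_add (reg_pos hδ s t x)]; norm_num
  refine ⟨-(χ * (s * ym)), χ * yp, ⟨?_, ?_, ?_, ?_, ?_, ?_, ?_, ?_, ?_, hpot, ?_, ?_⟩, ?_⟩
  · ext t x
    simp only [mul_apply, neg_apply]
    linear_combination (- χ t x * χ t x * s t x) * pp t x
  · exact fin (hχ hsm).neg (by norm_num) (by norm_num)
  · exact fin (hχ cp) (by norm_num) (by norm_num)
  · have e : Dt (-(χ * (s * ym))) = -(χ * (s * Dt ym + ym * Dt s) + Dt χ * (s * ym)) := by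
      rw [map_neg, Dt_mul, Dt_mul]; ring
    rw [e]
    have q1 : PC lam 403 1486 (s * Dt ym) :=
      (hs.mono h (show _ ≤ 402 by norm_num) le_rfl).mul h (hrpt _ r1 r2)
    have q2 : PC lam 403 1486 (ym * Dt s) :=
      ((cm.mul h (hs'.mono h (show _ ≤ 400 by norm_num) le_rfl))).mono h (by norm_num) (by norm_num)
    have q3 : PC lam 403 1487 (χ * (s * Dt ym + ym * Dt s)) := 
      (hχ (q1.add h q2)).mono h le_rfl (by norm_num)
    have q4 : PC lam 403 1487 (Dt χ * (s * ym)) := (hχ' hsm).mono h (by norm_num) (by norm_num)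
    exact fin (CB.neg (q3.add h q4)) (by norm_num) (by norm_num)
  · rw [Dt_mul]
    have q1 : PC lam 402 1326 (χ * Dt yp) := (hχ (hrpt _ r3 r4)).mono h le_rfl (by norm_num)
    have q2 : PC lam 402 1326 (yp * Dt χ) := by
      rw [mul_comm]; exact (hχ' cp).mono h (by norm_num) (by norm_num)
    exact fin (q1.add h q2) (by norm_num) (by norm_num)
  · rw [mul_assoc]; exact fin (hχ (hχ hs)) (by norm_num) (by norm_num)
  · have e : Dt (χ * χ * s) = χ * (χ * Dt s) + (Dt χ * (χ * s) + Dt χ * (χ * s)) := by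
      rw [Dt_mul, Dt_mul]; ring
    rw [e]
    have q1 : PC lam 49 760 (χ * (χ * Dt s)) := (hχ (hχ hs')).mono h le_rfl (by norm_num)
    have q2 := hχ' (hχ hs)
    exact fin (q1.add h ((q2.add h q2).mono h le_rfl (by norm_num))) (by norm_num) (by norm_num)
  · exact fin hP (by norm_num) (by norm_num)
  · exact fin hP' (by norm_num) (by norm_num)
  · intro t x
    have hp := reg_pos hδ s t x
    have e1 : ym t x ^ 2 * √(reg ((lam:ℝ) ^ (-4:ℤ)) s t x) = 1 := by
      rw [hym, rp_apply, sqrt_eq_rpow, ← Real.rpow_natCast, ← rpow_mul hp.le, ← rpow_add hp]; norm_num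
    have e2 : |s t x| ≤ √(reg ((lam:ℝ) ^ (-4:ℤ)) s t x) := by
      apply abs_le_sqrt; rw [reg_apply]; nlinarith [sq_nonneg ((lam:ℝ) ^ (-4:ℤ))]
    have e3 : ym t x ^ 2 * |s t x| ≤ 1 := by
      rw [← e1]; exact mul_le_mul_of_nonneg_left e2 (sq_nonneg _)
    have e4 : (-(χ * (s * ym))) t x ^ 2 = (ym t x ^ 2 * |s t x|) * |(χ * χ * s) t x| := by
      simp only [neg_apply, mul_apply, abs_mul, abs_mul_abs_self]
      have := abs_mul_abs_self (s t x)
      linear_combination (- χ t x ^ 2 * ym t x ^ 2) * this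
    rw [e4]
    have := mul_le_of_le_one_left (abs_nonneg ((χ * χ * s) t x)) e3
    linarith
  · intro t x
    have hp := reg_pos hδ s t x
    have e1 : yp t x ^ 2 = √(reg ((lam:ℝ) ^ (-4:ℤ)) s t x) := by
      rw [hyp, rp_apply, sqrt_eq_rpow, ← Real.rpow_natCast, ← rpow_mul hp.le]; norm_num
    have e2 : √(reg ((lam:ℝ) ^ (-4:ℤ)) s t x) ≤ |s t x| + (lam:ℝ) ^ (-4:ℤ) := by
      apply sqrt_le_iff.2 ⟨by positivity, ?_⟩
      rw [reg_apply, ← sq_abs (s t x)]; nlinarith [abs_nonneg (s t x)]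
    have e4 : χ t x ^ 2 ≤ 1 := by rw [← sq_abs]; exact pow_le_one₀ (abs_nonneg _) (h1 t x)
    simp only [mul_apply, abs_mul, abs_mul_abs_self]
    rw [mul_pow, e1, ← sq]
    nlinarith [mul_le_mul_of_nonneg_left e2 (sq_nonneg (χ t x))]
  · intro t ht x; simp [ht x]

end PC
/-- The fields entering one building block with interaction entry `(i, j)`, oscillating in
direction `l` at frequency `X = N m`. -/
structure Blk where
  i : Fin 3
  j : Fin 3
  l : Fin 3
  N : ℝ
  m : ℝ
  g : Fld
  h : Fld
  A : Fld
  B : Fld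
  st : Fld
  P : Fld
  φ : Fld
  φ1 : Fld
  φ2 : Fld
  ψ : Fld
  ψ1 : Fld
  ψ2 : Fld

namespace Blk

/-- The algebraic relations between the fields of a block. -/
structure Good (b : Blk) : Prop where
  N_pos : 0 < b.N
  m_pos : 0 < b.m
  il : b.i ≠ b.l
  jl : b.j ≠ b.l
  D_g : ∀ k, D k b.g = 0
  D_h : ∀ k, D k b.h = 0
  Dt_h : Dt b.h = 1 - b.g * b.g
  prod : b.A * b.B = -b.st
  pot : ∀ k, D k (Lap b.P) = - D k b.st
  D_φ : ∀ k, D k b.φ = if k = b.l then (b.N * b.m) • b.φ1 else 0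
  D_φ1 : ∀ k, D k b.φ1 = if k = b.l then (b.N * b.m) • b.φ2 else 0
  Dt_φ : Dt b.φ = 0
  D_ψ : ∀ k, D k b.ψ = if k = b.l then b.N • b.ψ1 else 0
  D_ψ1 : ∀ k, D k b.ψ1 = if k = b.l then b.N • b.ψ2 else 0
  ψ2_eq : b.ψ2 = b.m • (b.φ2 * b.φ2) - 1

/-- The block with the roles of the two Elsasser fields exchanged. -/
def swap (b : Blk) : Blk := { b with i := b.j, j := b.i, A := b.B, B := b.A }

lemma Good.swap {b : Blk} (H : b.Good) : b.swap.Good where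
  N_pos := H.N_pos
  m_pos := H.m_pos
  il := H.jl
  jl := H.il
  D_g := H.D_g
  D_h := H.D_h
  Dt_h := H.Dt_h
  prod := (mul_comm _ _).trans H.prod
  pot := H.pot
  D_φ := H.D_φ
  D_φ1 := H.D_φ1
  Dt_φ := H.Dt_φ
  D_ψ := H.D_ψ
  D_ψ1 := H.D_ψ1
  ψ2_eq := H.ψ2_eq

/-- The potential of the high-frequency shear flow. -/
def H (b : Blk) : Fld := (√b.m / (b.N * b.m) ^ 2) • (b.g * (b.A * b.φ))

/-- The principal part of the shear flow. -/
def W (b : Blk) : Fld := √b.m • (b.g * (b.A * b.φ2))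

/-- The lower order part of the shear flow in direction `k`. -/
def rem (b : Blk) (k : Fin 3) : Fld := (√b.m / (b.N * b.m) ^ 2) •
  (b.g * (((if k = b.l then (2:ℝ) else 1) * (b.N * b.m)) • (D k b.A * b.φ1)
    + D k (D b.l b.A) * b.φ))

/-- The shear flow in the first Elsasser variable. -/
def sh (b : Blk) : Fin 3 → Fld := shear b.i b.l b.H

/-- The lower order part of the shear flow. -/
def shr (b : Blk) (k : Fin 3) : Fld :=
  (if k = b.i then b.rem b.l else 0) - (if k = b.l then b.rem b.i else 0)

/-- The temporal corrector. -/
def tc (b : Blk) (k : Fin 3) : Fld := b.h * tcX b.i b.j b.P k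

/-- The potential of the stress oscillating in space. -/
def K (b : Blk) : Fld := (b.N ^ 2)⁻¹ • (b.g * b.g * (b.st * b.ψ))

/-- Lower order part of the second derivatives of `K` in directions `k` and `l`. -/
def Kr (b : Blk) (k : Fin 3) : Fld := (b.N ^ 2)⁻¹ • (b.g * b.g *
  (((if k = b.l then (2:ℝ) else 1) * b.N) • (D k b.st * b.ψ1) + D k (D b.l b.st) * b.ψ))

/-- Flux generated by the block. -/
def flux (b : Blk) (x y : Fin 3) : Fld :=
  shearT b.i b.l (Heat b.H) x y + shearT b.j b.l (Heat b.swap.H) y x + nullF b.i b.j b.l b.K x y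
  + (-((if x = b.i then (if y = b.j then Dt b.h * b.st else 0) else 0))
    + tcS b.i b.j (b.h * Heat b.P) x y + tcS b.j b.i (b.h * Heat b.P) y x)

/-- Stress generated by the block. -/
def err (b : Blk) (x y : Fin 3) : Fld :=
  shearT b.i b.l (Heat b.H) x y + shearT b.j b.l (Heat b.swap.H) y x
  + (tcS b.i b.j (b.h * Heat b.P) x y + tcS b.j b.i (b.h * Heat b.P) y x)
  + ((if x = b.i then (if y = b.j then b.Kr b.l else 0) else 0)
    - (if x = b.l then (if y = b.j then b.Kr b.i else 0) else 0)
    - (if x = b.i then (if y = b.l then b.Kr b.j else 0) else 0)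
    + (if x = b.l then (if y = b.l then D b.i (D b.j b.K) else 0) else 0))
  + ((if x = b.i then b.W * b.swap.shr y else 0) + b.shr x * b.swap.sh y)

namespace Good
variable {b : Blk} (H : b.Good)
include H

lemma lin (J : Set ℝ) : Lin J (b.sh + b.tc) (b.swap.sh + b.swap.tc) (Dt b.h * D b.i (D b.j b.P))
    b.flux := by
  have h := ((lin_shear_u J b.i b.l b.H).add (lin_shear_z J b.j b.l b.swap.H)).add
    (lin_null J b.i b.j b.l b.K) |>.add (lin_tc J b.i b.j H.D_h fun k => H.pot k)
  simp only [zero_add, add_zero] at h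
  exact h

lemma D_smul_mul_const {g : Fld} {k : Fin 3} (hg : D k g = 0) (r : ℝ) (f : Fld) :
    D k (r • (g * f)) = r • (g * D k f) := by
  rw [(D k).map_smul, D_mul_const k hg]

lemma D_l_H : D b.l b.H = (√b.m / (b.N * b.m) ^ 2) •
    (b.g * ((b.N * b.m) • (b.A * b.φ1) + D b.l b.A * b.φ)) := by
  rw [Blk.H, H.D_smul_mul_const (H.D_g _), D_mul, H.D_φ, if_pos rfl]
  congr 2; rw [mul_smul_comm, mul_comm b.φ]

lemma D_ne_H {k : Fin 3} (hk : k ≠ b.l) : D k (D b.l b.H) = b.rem k := by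
  rw [H.D_l_H, H.D_smul_mul_const (H.D_g _), map_add, D_mul, (D k).map_smul, D_mul, H.D_φ1,
    H.D_φ, if_neg hk, if_neg hk, rem, if_neg hk]
  ext t x; simp only [add_apply, mul_apply, smul_apply, zero_apply]; ring

lemma D_eq_H : D b.l (D b.l b.H) = b.W + b.rem b.l := by
  have h1 := H.N_pos
  have h2 := H.m_pos
  rw [H.D_l_H, H.D_smul_mul_const (H.D_g _), map_add, D_mul, (D _).map_smul, D_mul, H.D_φ1,
    H.D_φ, if_pos rfl, if_pos rfl, rem, if_pos rfl, W]
  ext t x; simp; field_simp; ring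

lemma sh_eq (k : Fin 3) : b.sh k = (if k = b.i then b.W else 0) + b.shr k := by
  rw [sh, shear, shr, H.D_eq_H, H.D_ne_H H.il]
  by_cases h1 : k = b.i <;> by_cases h2 : k = b.l <;> simp [h1, h2, H.il.symm] <;> ring

lemma D_l_K : D b.l b.K = (b.N ^ 2)⁻¹ •
    (b.g * b.g * (b.N • (b.st * b.ψ1) + D b.l b.st * b.ψ)) := by
  have hg : D b.l (b.g * b.g) = 0 := by simp [H.D_g]
  rw [K, H.D_smul_mul_const hg, D_mul, H.D_ψ, if_pos rfl]
  congr 2; rw [mul_smul_comm, mul_comm b.ψ]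

lemma D_ne_K {k : Fin 3} (hk : k ≠ b.l) : D k (D b.l b.K) = b.Kr k := by
  have hg : D k (b.g * b.g) = 0 := by simp [H.D_g]
  rw [H.D_l_K, H.D_smul_mul_const hg, map_add, D_mul, (D k).map_smul, D_mul, H.D_ψ1,
    H.D_ψ, if_neg hk, if_neg hk, Kr, if_neg hk]
  ext t x; simp only [add_apply, mul_apply, smul_apply, zero_apply]; ring

lemma D_eq_K : D b.l (D b.l b.K) = b.g * b.g * b.st * b.ψ2 + b.Kr b.l := by
  have h1 := H.N_pos
  have hg : D b.l (b.g * b.g) = 0 := by simp [H.D_g]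
  rw [H.D_l_K, H.D_smul_mul_const hg, map_add, D_mul, (D _).map_smul, D_mul, H.D_ψ1,
    H.D_ψ, if_pos rfl, if_pos rfl, Kr, if_pos rfl]
  ext t x; simp; field_simp; ring

lemma cancel : b.W * b.swap.W + b.g * b.g * b.st * b.ψ2 - Dt b.h * b.st + b.st = 0 := by
  have h2 := Real.mul_self_sqrt H.m_pos.le
  change (√b.m • (b.g * (b.A * b.φ2))) * (√b.m • (b.g * (b.B * b.φ2)))
    + b.g * b.g * b.st * b.ψ2 - Dt b.h * b.st + b.st = 0
  rw [H.Dt_h, H.ψ2_eq]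
  ext t x
  have h3 : b.A t x * b.B t x = - b.st t x := by rw [← mul_apply, H.prod, neg_apply]
  simp only [add_apply, sub_apply, mul_apply, smul_apply, one_apply, zero_apply]
  linear_combination (b.g t x ^ 2 * b.A t x * b.B t x * b.φ2 t x ^ 2) * h2
    + (b.m * b.g t x ^ 2 * b.φ2 t x ^ 2) * h3

lemma stress_eq (x y : Fin 3) :
    b.flux x y + (if x = b.i then (if y = b.j then b.st else 0) else 0) + b.sh x * b.swap.sh y
      = b.err x y := by
  have e1 := H.sh_eq x
  have e2 := H.swap.sh_eq y
  have e2' : b.swap.sh y = (if y = b.j then b.swap.W else 0) + b.swap.shr y := e2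
  have e3 : b.sh x * b.swap.sh y = (if x = b.i then (if y = b.j then b.W * b.swap.W else 0) else 0)
      + ((if x = b.i then b.W * b.swap.shr y else 0) + b.shr x * b.swap.sh y) := by
    rw [e1, add_mul, ← add_assoc]
    congr 1
    rw [e2']
    split_ifs <;> simp [mul_add]
  rw [e3, flux, err, nullF, H.D_eq_K, H.D_ne_K H.il, H.D_ne_K H.jl]
  have c := H.cancel
  by_cases h1 : x = b.i <;> by_cases h2 : y = b.j
  · simp only [h1, h2, if_true]
    linear_combination c
  all_goals simp only [h1, h2, if_true, if_false]; ring

end Good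
end Blk
/-- Fields of the form `g F` with `F` and its derivatives bounded by multiples of `e`. -/
def OF (g : Fld) (L : ℝ) (e : V3 → ℝ) (k : ℕ) (β : ℝ) (f : Fld) : Prop :=
  ∃ F, f = g * F ∧ CB (Icc 0 1) L k (fun _ x => β * e x) F

/-- Time-dependent factors with `L¹` norm at most `α` and supremum at most `A`. -/
structure TB (α A : ℝ) (g : Fld) : Prop where
  D_eq : ∀ i, D i g = 0
  eq : ∀ t x, g t x = g t 0
  int : ∫ t in Icc (0:ℝ) 1, |g t 0| ≤ α
  sup : ∀ t ∈ Icc (0:ℝ) 1, |g t 0| ≤ A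

/-- Admissible spatial envelopes. -/
structure Env (ε' : ℝ) (e : V3 → ℝ) : Prop where
  int : IntegrableOn e cube
  nonneg : ∀ x, 0 ≤ e x
  le_one : ∀ x, e x ≤ 1
  le : ∫ x in cube, e x ≤ ε'

lemma Env.one : Env 1 (fun _ => 1) where
  int := integrable_cube continuous_const
  nonneg _ := zero_le_one
  le_one _ := le_rfl
  le := by simp [volume_cube, Measure.real]

section OF
variable {g g' f f' : Fld} {L L' : ℝ} {e : V3 → ℝ} {k k' : ℕ} {β β' α A ε' : ℝ}

lemma OF.mono (h : OF g L e k β f) (hL : 0 ≤ L) (hLL : L ≤ L') (he : Env ε' e) (hβ : β ≤ β')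
    (hk : k' ≤ k) : OF g L' e k' β' f := by
  obtain ⟨F, rfl, hF⟩ := h
  exact ⟨F, rfl, (hF.of_le hk).mono hL hLL fun t _ x =>
    mul_le_mul_of_nonneg_right hβ (he.nonneg x)⟩

lemma OF.add (h : OF g L e k β f) (h' : OF g L e k β' f') : OF g L e k (β + β') (f + f') := by
  obtain ⟨F, rfl, hF⟩ := h
  obtain ⟨F', rfl, hF'⟩ := h'
  exact ⟨F + F', by ring, (hF.add hF').congr fun t x => by ring⟩

lemma OF.neg (h : OF g L e k β f) : OF g L e k β (-f) := by
  obtain ⟨F, rfl, hF⟩ := h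
  exact ⟨-F, by ring, hF.neg⟩

lemma OF.sub (h : OF g L e k β f) (h' : OF g L e k β' f') : OF g L e k (β + β') (f - f') := by
  rw [sub_eq_add_neg]; exact h.add h'.neg

lemma OF.ite (h : OF g L e k β f) (hL : 0 ≤ L) (hβ : 0 ≤ β) (he : Env ε' e) (P : Prop)
    [Decidable P] : OF g L e k β (if P then f else 0) := by
  split_ifs
  · exact h
  · exact ⟨0, by simp, CB.of_zero hL fun t _ x => mul_nonneg hβ (he.nonneg x)⟩

lemma OF.D (h : OF g L e (k + 1) β f) (hg : ∀ i, Fld.D i g = 0) (i : Fin 3) :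
    OF g L e k (L * β) (Fld.D i f) := by
  obtain ⟨F, rfl, hF⟩ := h
  exact ⟨Fld.D i F, D_mul_const i (hg i) F, (hF.D i).congr fun t x => by ring⟩

lemma OF.mul (h : OF g L e k β f) (h' : OF g' L e k β' f') (hL : 0 ≤ L) (hβ : 0 ≤ β)
    (hβ' : 0 ≤ β') (he : Env ε' e) : OF (g * g') (2 * L) e k (β * β') (f * f') := by
  obtain ⟨F, rfl, hF⟩ := h
  obtain ⟨F', rfl, hF'⟩ := h'
  refine ⟨F * F', by ring, (CB.mul hL hF hF').mono (by positivity) le_rfl fun t _ x => ?_⟩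
  have h1 := he.nonneg x
  have h2 := he.le_one x
  calc β * e x * (β' * e x) = β * β' * e x * e x := by ring
    _ ≤ β * β' * e x * 1 := mul_le_mul_of_nonneg_left h2 (by positivity)
    _ = _ := mul_one _

lemma OF.mul_CB (h : OF g L e k β f) (h' : CB (Icc 0 1) L k (fun _ _ => β') f') (hL : 0 ≤ L) :
    OF g (2 * L) e k (β * β') (f * f') := by
  obtain ⟨F, rfl, hF⟩ := h
  exact ⟨F * f', by ring, (CB.mul hL hF h').congr fun t x => by ring⟩

lemma OF.bound (h : OF g L e k β f) (hg : TB α A g) {t : ℝ} (ht : t ∈ Icc (0:ℝ) 1) (x : V3) :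
    |f t x| ≤ |g t 0| * (β * e x) := by
  obtain ⟨F, rfl, hF⟩ := h
  rw [mul_apply, abs_mul, hg.eq]
  exact mul_le_mul_of_nonneg_left (hF.bound t ht x) (abs_nonneg _)

lemma OF.toCB (h : OF g L e k β f) (hg : TB α A g) :
    CB (Icc 0 1) L k (fun t x => |g t 0| * (β * e x)) f := by
  obtain ⟨F, rfl, hF⟩ := h
  exact CB.mul_indep hg.D_eq (fun t _ x => (congrArg _ (hg.eq t x)).le) hF

lemma OF.Sm (h : OF g L e 3 β f) (hg : TB α A g) (he : Env ε' e) (hL : 1 ≤ L) (hA : 0 < A)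
    (hβ : 0 < β) : Sm (α * (β * ε')) (L ^ 3 * (A * β)) f := by
  refine Sm.of_CB hL (a := fun t => |g t 0|) (e := fun x => β * e x)
    (g.cont_time 0).abs (fun _ _ => abs_nonneg _) hg.sup hA hβ
    (he.int.const_mul β) (fun x => mul_nonneg hβ.le (he.nonneg x))
    (fun x => mul_le_of_le_one_right hβ.le (he.le_one x)) hg.int ?_ (h.toCB hg)
  rw [integral_const_mul]
  exact mul_le_mul_of_nonneg_left he.le hβ.le

lemma OF.Sm_mul {M : ℝ} (h : OF g L e 3 β f) (hu : HB (Icc 0 1) 3 M f') (hM : 0 < M)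
    (hg : TB α A g) (he : Env ε' e) (hL : 1 ≤ L) (hA : 0 < A) (hβ : 0 < β) :
    Fld.Sm (M * (α * β)) (64 * (M * (L ^ 3 * (A * β)))) (f' * f) := by
  have hc : CB (Icc 0 1) 1 3 (fun _ _ => L ^ 3 * (A * β)) f := by
    refine CB.unweight hL (by positivity) ((h.toCB hg).le (by positivity) fun t ht x => ?_)
    exact mul_le_mul (hg.sup t ht) (mul_le_of_le_one_right hβ.le (he.le_one x))
      (mul_nonneg hβ.le (he.nonneg x)) hA.le
  have h0 := Fld.Sm_mul hM (show 0 < L ^ 3 * (A * β) by positivity) hu hc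
  refine ⟨h0.pos, ?_, h0.hb⟩
  have hs : ∀ t ∈ Icc (0:ℝ) 1, ∫ x in cube, |(f' * f) t x| ≤ |g t 0| * β * M := fun t ht => by
    have h1 : ∫ x in cube, |f' t x| ≤ M := integral_abs_le_of_sq f' t hM (hu.bound t ht)
    calc ∫ x in cube, |(f' * f) t x| ≤ ∫ x in cube, |g t 0| * β * |f' t x| := by
          refine integral_mono (integrable_cube_abs _ _)
            ((integrable_cube_abs _ _).const_mul _) fun x => ?_
          rw [mul_apply, abs_mul, mul_comm]
          refine mul_le_mul_of_nonneg_right ((h.bound hg ht x).trans ?_) (abs_nonneg _)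
          exact mul_le_mul_of_nonneg_left (mul_le_of_le_one_right hβ.le (he.le_one x))
            (abs_nonneg _)
      _ ≤ _ := by
          rw [integral_const_mul]
          exact mul_le_mul_of_nonneg_left h1 (by positivity)
  calc N1 (f' * f) ≤ ∫ t in Icc (0:ℝ) 1, |g t 0| * β * M := by
        refine setIntegral_mono_on (integrable_slice_abs _) ?_ measurableSet_Icc hs
        exact ((((g.cont_time 0).abs.mul continuous_const).mul
          continuous_const).continuousOn).integrableOn_compact isCompact_Icc
    _ = (∫ t in Icc (0:ℝ) 1, |g t 0|) * β * M := by
        rw [integral_mul_const, integral_mul_const]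
    _ ≤ M * (α * β) := by
        have := mul_le_mul_of_nonneg_right hg.int (mul_nonneg hβ.le hM.le)
        linarith

end OF
/-- Monomials in the two large parameters. -/
def mo (Q X : ℝ) (a b : ℤ) : ℝ := Q ^ a * X ^ b

/-- Separation of the two large parameters. -/
structure Sc (Q X : ℝ) : Prop where
  Q_ge : 1000 ≤ Q
  X_ge : Q ^ 120 ≤ X

/-- Errors of the admissible size, with multiplicity `n`. -/
abbrev Ti (Q X n : ℝ) (f : Fld) : Prop := Sm (n * mo Q X (-5) 0) (n * mo Q X 0 7) f

namespace Sc
variable {Q X : ℝ} (S : Sc Q X)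
include S

lemma Q_pos : 0 < Q := by linarith [S.Q_ge]
lemma Q_one : 1 ≤ Q := by linarith [S.Q_ge]
lemma X_pos : 0 < X := (pow_pos S.Q_pos 120).trans_le S.X_ge
lemma Q_le_X : Q ≤ X := (le_self_pow₀ S.Q_one (by norm_num)).trans S.X_ge
lemma X_one : 1 ≤ X := S.Q_one.trans S.Q_le_X
lemma pos (a b : ℤ) : 0 < mo Q X a b := mul_pos (zpow_pos S.Q_pos _) (zpow_pos S.X_pos _)

lemma mul (a b a' b' : ℤ) : mo Q X a b * mo Q X a' b' = mo Q X (a + a') (b + b') := by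
  unfold mo
  rw [zpow_add₀ S.Q_pos.ne', zpow_add₀ S.X_pos.ne']; ring

lemma mul_assoc (c : ℝ) (a b a' b' : ℤ) :
    c * mo Q X a b * mo Q X a' b' = c * mo Q X (a + a') (b + b') := by
  rw [_root_.mul_assoc, S.mul]

lemma le {a b a' b' : ℤ} (hb : b ≤ b') (h : a ≤ a' + 120 * (b' - b)) :
    mo Q X a b ≤ mo Q X a' b' := by
  have e : mo Q X a' b' = mo Q X a' b * X ^ (b' - b) := by
    unfold mo
    rw [_root_.mul_assoc, ← zpow_add₀ S.X_pos.ne']; congr 2; ring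
  have h2 : Q ^ (120 * (b' - b)) ≤ X ^ (b' - b) := by
    obtain ⟨n, hn⟩ := Int.eq_ofNat_of_zero_le (sub_nonneg.2 hb)
    rw [hn, zpow_mul, zpow_natCast, zpow_natCast]
    exact pow_le_pow_left₀ (zpow_pos S.Q_pos _).le (by exact_mod_cast S.X_ge) n
  rw [e]
  refine le_trans ?_ (mul_le_mul_of_nonneg_left h2 (S.pos _ _).le)
  unfold mo
  rw [mul_right_comm, ← zpow_add₀ S.Q_pos.ne']
  exact mul_le_mul_of_nonneg_right (zpow_le_zpow_right₀ S.Q_one h) (zpow_pos S.X_pos _).le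

lemma const_le {c : ℝ} (hc : c ≤ 1000) {a b a' b' : ℤ} (hb : b ≤ b')
    (h : a + 1 ≤ a' + 120 * (b' - b)) : c * mo Q X a b ≤ mo Q X a' b' := by
  refine le_trans ?_ (S.le hb h)
  have e : mo Q X (a + 1) b = Q * mo Q X a b := by
    unfold mo; rw [zpow_add₀ S.Q_pos.ne', zpow_one]; ring
  rw [e]
  exact mul_le_mul_of_nonneg_right (hc.trans S.Q_ge) (S.pos _ _).le

lemma Q_eq : Q = mo Q X 1 0 := by simp [mo]
lemma X_eq : X = mo Q X 0 1 := by simp [mo]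
lemma one_eq : (1:ℝ) = mo Q X 0 0 := by simp [mo]

lemma pow (a b : ℤ) (n : ℕ) : mo Q X a b ^ n = mo Q X (n * a) (n * b) := by
  unfold mo; rw [mul_pow, ← zpow_natCast, ← zpow_natCast, ← zpow_mul, ← zpow_mul]
  congr 2 <;> ring

lemma ti {η K : ℝ} {f : Fld} (h : Sm η K f) (h1 : η ≤ mo Q X (-5) 0) (h2 : K ≤ mo Q X 0 7) :
    Ti Q X 1 f := by
  rw [Ti, one_mul, one_mul]; exact h.mono h1 h2

end Sc

section Ti
variable {Q X n n' : ℝ} {f f' : Fld}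
lemma Ti.add (h : Ti Q X n f) (h' : Ti Q X n' f') : Ti Q X (n + n') (f + f') := by
  rw [Ti, add_mul, add_mul]; exact Sm.add h h'
lemma Ti.sub (h : Ti Q X n f) (h' : Ti Q X n' f') : Ti Q X (n + n') (f - f') := by
  rw [Ti, add_mul, add_mul]; exact Sm.sub h h'
lemma Ti.ite (h : Ti Q X n f) (P : Prop) [Decidable P] : Ti Q X n (if P then f else 0) :=
  Sm.ite h P
lemma Ti.sum {ι : Type*} [Fintype ι] [Nonempty ι] {f : ι → Fld} (h : ∀ c, Ti Q X n (f c)) :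
    Ti Q X (Fintype.card ι * n) (∑ c, f c) := by
  rw [Ti, mul_assoc, mul_assoc]; exact Sm.sum h

/-- A field periodic in space, bounded independently of the oscillation. -/
lemma Sc.ti_CB (S : Sc Q X) {a : ℤ} (h : CB (Icc 0 1) Q 3 (fun _ _ => mo Q X a 0) f)
    (ha : a ≤ -5) : Ti Q X 1 f := by
  refine S.ti (Sm.of_const S.Q_one (S.pos _ _) h) (S.le le_rfl (by omega)) ?_
  nth_rw 1 [S.Q_eq]
  rw [S.pow, S.mul]
  exact S.le (by norm_num) (by norm_num; omega)
end Ti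

section
variable {Q X : ℝ} {g f : Fld} {e : V3 → ℝ}

lemma Sc.ti_OF (S : Sc Q X) {L : ℝ} {k : ℕ} {a b a1 b1 a2 b2 a3 : ℤ}
    (h : OF g L e k (mo Q X a b) f)
    (hL : 1 ≤ L) (hLX : L ≤ 4 * X) (hk : 3 ≤ k)
    (hg : TB (mo Q X a1 b1) (mo Q X a2 b2) g) (he : Env (mo Q X a3 0) e)
    (h1 : b1 + b ≤ 0) (h2 : a1 + (a + a3) ≤ -5 + 120 * (0 - (b1 + b)))
    (h3 : 3 + (b2 + b) ≤ 7) (h4 : a2 + a + 1 ≤ 120 * (7 - (3 + (b2 + b)))) : Ti Q X 1 f := by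
  have hL0 : 0 ≤ L := by linarith
  refine S.ti ((h.mono hL0 hLX he le_rfl hk).Sm hg he (hL.trans hLX) (S.pos _ _) (S.pos _ _))
    ?_ ?_
  · rw [S.mul, S.mul]; exact S.le (by omega) (by omega)
  · rw [mul_pow, S.mul]
    nth_rw 1 [S.X_eq]
    rw [S.pow, S.mul_assoc]
    exact S.const_le (by norm_num) (by norm_num; omega) (by norm_num; omega)

lemma Sc.D_OF (S : Sc Q X) {k : ℕ} {a b : ℤ} (h : OF g (2 * X) e (k + 1) (mo Q X a b) f)
    (hg : ∀ i, D i g = 0) (he : Env (mo Q X (-60) 0) e) (i : Fin 3) :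
    OF g (2 * X) e k (mo Q X (a + 1) (b + 1)) (D i f) := by
  have hX := S.X_pos
  refine (h.D hg i).mono (by positivity) le_rfl he ?_ le_rfl
  nth_rw 1 [S.X_eq]
  rw [S.mul_assoc]
  exact S.const_le (by norm_num) (by omega) (by omega)
end

namespace Blk

/-- The set where the shear flow of the block is concentrated. -/
def env (b : Blk) (x : V3) : ℝ := ind b.m (b.N * x b.l)

/-- Quantitative bounds for the fields of a block. -/
structure Est (b : Blk) (Q X δ p : ℝ) : Prop extends b.Good where
  sc : Sc Q X
  X_eq : b.N * b.m = X
  m_eq : b.m = Q ^ 60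
  N_ge : Q ^ 60 ≤ b.N
  tg : TB (mo Q X 1 (-1)) (mo Q X 1 1) b.g
  tdg : TB (mo Q X 21 1) (mo Q X 21 3) (Dt b.g)
  g_sq : ∫ t in Icc (0:ℝ) 1, b.g t 0 ^ 2 = 1
  g_pow : ∫ t in Icc (0:ℝ) 1, |b.g t 0| ^ p ≤ Q * X ^ (p - 2)
  h_abs : ∀ t x, |b.h t x| ≤ mo Q X (-19) 0
  he : Env (mo Q X (-60) 0) b.env
  slow : Slow Q δ b.st b.A b.B b.P
  φ_cb : CB (Icc 0 1) X 7 (fun _ x => Q * b.env x) b.φ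
  φ1_cb : CB (Icc 0 1) X 7 (fun _ x => Q * b.env x) b.φ1
  φ2_cb : CB (Icc 0 1) X 7 (fun _ x => Q * b.env x) b.φ2
  ψ_cb : CB (Icc 0 1) X 7 (fun _ _ => Q) b.ψ
  ψ1_cb : CB (Icc 0 1) X 7 (fun _ _ => Q) b.ψ1

namespace Est
variable {b : Blk} {Q X δ p : ℝ} (E : b.Est Q X δ p)
include E

lemma swap : b.swap.Est Q X δ p where
  toGood := E.toGood.swap
  sc := E.sc
  X_eq := E.X_eq
  m_eq := E.m_eq
  N_ge := E.N_ge
  tg := E.tg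
  tdg := E.tdg
  g_sq := E.g_sq
  g_pow := E.g_pow
  h_abs := E.h_abs
  he := E.he
  slow := by
    have h := E.slow
    exact { h with
      prod := (mul_comm _ _).trans h.prod
      A_cb := h.B_cb
      B_cb := h.A_cb
      Dt_A_cb := h.Dt_B_cb
      Dt_B_cb := h.Dt_A_cb
      A_sq := h.B_sq
      B_sq := h.A_sq }
  φ_cb := E.φ_cb
  φ1_cb := E.φ1_cb
  φ2_cb := E.φ2_cb
  ψ_cb := E.ψ_cb
  ψ1_cb := E.ψ1_cb

lemma sqrt_m : √b.m = mo Q X 30 0 := by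
  rw [E.m_eq, show Q ^ 60 = (Q ^ 30) ^ 2 by ring, Real.sqrt_sq (pow_pos E.sc.Q_pos _).le]
  simp [mo]

lemma coeff_eq : √b.m / (b.N * b.m) ^ 2 = mo Q X 30 (-2) := by
  rw [E.sqrt_m, E.X_eq]
  simp [mo, div_eq_mul_inv]

lemma N_inv : b.N⁻¹ = mo Q X 60 (-1) := by
  have h := E.N_pos
  have h' := E.m_pos
  have e := E.X_eq
  rw [E.m_eq] at e h'
  have hX := E.sc.X_pos
  have : mo Q X 60 (-1) = Q ^ 60 * X⁻¹ := by simp [mo]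
  have hQ := E.sc.Q_pos
  rw [this, ← e]; field_simp

/-- A slow field times an oscillating field. -/
lemma osc_CB {k : ℕ} {a b' a' : ℤ} {f φ : Fld} {e : V3 → ℝ} {ε' : ℝ} (he : Env ε' e)
    (hf : CB (Icc 0 1) Q k (fun _ _ => mo Q X a 0) f)
    (hφ : CB (Icc 0 1) X 7 (fun _ x => Q * e x) φ) (hk : k ≤ 7) {c : ℝ} {a'' : ℤ}
    (hc : |c| = mo Q X a' b') (ha : a + a' + 1 ≤ a'') :
    CB (Icc 0 1) (2 * X) k (fun _ x => mo Q X a'' b' * e x) (c • (f * φ)) := by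
  have S := E.sc
  have h1 := (CB.mul S.X_pos.le (hf.mono S.Q_pos.le S.Q_le_X fun _ _ _ => le_rfl)
    (hφ.of_le hk)).smul c
  refine h1.le (by linarith [S.X_pos]) fun t _ x => ?_
  rw [hc, ← mul_assoc, ← mul_assoc]
  refine mul_le_mul_of_nonneg_right ?_ (he.nonneg x)
  nth_rw 3 [S.Q_eq]
  rw [S.mul, S.mul]
  exact S.le (by omega) (by omega)

lemma slow_D {k : ℕ} {a : ℤ} {f : Fld} (hf : CB (Icc 0 1) Q (k + 1) (fun _ _ => mo Q X a 0) f)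
    (i : Fin 3) : CB (Icc 0 1) Q k (fun _ _ => mo Q X (a + 1) 0) (D i f) := by
  refine (hf.D i).congr fun t x => ?_
  nth_rw 1 [E.sc.Q_eq]
  rw [E.sc.mul, add_comm]; rfl

lemma slow_start {f : Fld} (hf : CB (Icc 0 1) Q 7 (fun _ _ => Q) f) :
    CB (Icc 0 1) Q 7 (fun _ _ => mo Q X 1 0) f := hf.congr fun _ _ => E.sc.Q_eq

lemma abs_coeff : |√b.m / (b.N * b.m) ^ 2| = mo Q X 30 (-2) := by
  rw [E.coeff_eq, abs_of_pos (E.sc.pos _ _)]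

lemma H_eq : b.H = b.g * ((√b.m / (b.N * b.m) ^ 2) • (b.A * b.φ)) := by
  rw [Blk.H, mul_smul_comm]

/-- The derivatives of the heat residual of the potential. -/
lemma D_Heat_H (k : Fin 3) : ∃ f1 f2, D k (Heat b.H) = f1 + f2 ∧
    OF b.g (2 * X) b.env 4 (mo Q X 36 1) f1 ∧
    OF (Dt b.g) (2 * X) b.env 4 (mo Q X 33 (-1)) f2 := by
  have S := E.sc
  set r := √b.m / (b.N * b.m) ^ 2
  have hF : CB (Icc 0 1) (2 * X) 7 (fun _ x => mo Q X 32 (-2) * b.env x) (r • (b.A * b.φ)) :=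
    E.osc_CB E.he (E.slow_start E.slow.A_cb) E.φ_cb le_rfl E.abs_coeff (by norm_num)
  have hD : OF b.g (2 * X) b.env 5 (mo Q X 35 0) (b.g * (r • (Dt b.A * b.φ) - Lap (r • (b.A * b.φ)))) := by
    have h1 : CB (Icc 0 1) (2 * X) 7 (fun _ x => mo Q X 32 (-2) * b.env x)
        (r • (Dt b.A * b.φ)) :=
      E.osc_CB E.he (E.slow_start E.slow.Dt_A_cb) E.φ_cb le_rfl E.abs_coeff (by norm_num)
    refine ⟨_, rfl, ((h1.of_le (by norm_num)).sub hF.Lap).le (by linarith [S.X_pos]) fun t _ x => ?_⟩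
    rw [← mul_assoc, ← add_mul]
    refine mul_le_mul_of_nonneg_right ?_ (E.he.nonneg x)
    have e1 : 3 * (2 * X) ^ 2 * mo Q X 32 (-2) = 12 * mo Q X 32 0 := by
      have := S.mul 0 1 32 (-2)
      have h2 : X ^ 2 * mo Q X 32 (-2) = mo Q X 32 0 := by
        nth_rw 1 [S.X_eq]; rw [S.pow, S.mul]; norm_num
      linear_combination 12 * h2
    have e2 := S.le (a := 32) (b := -2) (a' := 32) (b' := 0) (by norm_num) (by norm_num)
    have e3 := S.const_le (c := 13) (a := 32) (b := 0) (a' := 35) (b' := 0) (by norm_num)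
      (by norm_num) (by norm_num)
    linarith
  refine ⟨_, _, ?_, S.D_OF hD E.D_g E.he k,
    (S.D_OF ⟨_, rfl, hF⟩ E.tdg.D_eq E.he k).mono (by linarith [S.X_pos]) le_rfl E.he le_rfl
      (by norm_num)⟩
  rw [← map_add]
  congr 1
  rw [E.H_eq, Heat_mul_const E.D_g, Heat_eq, Dt.map_smul, Dt_mul, E.Dt_φ, mul_zero, zero_add,
    mul_comm b.φ]

lemma Ti_D_Heat_H (k : Fin 3) : Ti Q X 2 (D k (Heat b.H)) := by
  obtain ⟨f1, f2, e, h1, h2⟩ := E.D_Heat_H k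
  have S := E.sc
  have hX := S.X_one
  rw [e, show (2:ℝ) = 1 + 1 by norm_num]
  exact (S.ti_OF h1 (by linarith) (by linarith) (by norm_num) E.tg E.he (by norm_num)
    (by norm_num) (by norm_num) (by norm_num)).add
    (S.ti_OF h2 (by linarith) (by linarith) (by norm_num) E.tdg E.he (by norm_num)
    (by norm_num) (by norm_num) (by norm_num))

lemma Ti_shearT (x y : Fin 3) : Ti Q X 4 (shearT b.i b.l (Heat b.H) x y) := by
  unfold shearT
  rw [show (4:ℝ) = 2 + 2 by norm_num]
  exact Ti.ite ((Ti.ite (E.Ti_D_Heat_H _) _).sub (Ti.ite (E.Ti_D_Heat_H _) _)) _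

lemma OF_W : OF b.g (2 * X) b.env 7 (mo Q X 32 0) b.W := by
  refine ⟨√b.m • (b.A * b.φ2), by rw [Blk.W, mul_smul_comm], E.osc_CB E.he
    (E.slow_start E.slow.A_cb) E.φ2_cb le_rfl (a' := 30) ?_ (by norm_num)⟩
  rw [abs_of_nonneg (Real.sqrt_nonneg _), E.sqrt_m]

lemma abs_two_X (k : Fin 3) : |(if k = b.l then (2:ℝ) else 1) * (b.N * b.m)| ≤ 2 * X := by
  have hX := E.sc.X_pos
  rw [E.X_eq, abs_mul, abs_of_pos hX]
  refine mul_le_mul_of_nonneg_right ?_ hX.le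
  split_ifs <;> norm_num

lemma OF_rem (k : Fin 3) : OF b.g (2 * X) b.env 5 (mo Q X 35 (-1)) (b.rem k) := by
  have S := E.sc
  set r := √b.m / (b.N * b.m) ^ 2
  set c := (if k = b.l then (2:ℝ) else 1) * (b.N * b.m)
  have hA := E.slow_D (E.slow_start E.slow.A_cb) k
  have hA2 := E.slow_D (E.slow_D (E.slow_start E.slow.A_cb) b.l) k
  have h1 : CB (Icc 0 1) (2 * X) 5 (fun _ x => mo Q X 33 (-2) * b.env x) (r • (D k b.A * b.φ1)) :=
    E.osc_CB E.he (hA.of_le (by norm_num)) E.φ1_cb (by norm_num) E.abs_coeff (by norm_num)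
  have h2 : CB (Icc 0 1) (2 * X) 5 (fun _ x => mo Q X 34 (-2) * b.env x)
      (r • (D k (D b.l b.A) * b.φ)) :=
    E.osc_CB E.he hA2 E.φ_cb (by norm_num) E.abs_coeff (by norm_num)
  refine ⟨c • (r • (D k b.A * b.φ1)) + r • (D k (D b.l b.A) * b.φ), ?_,
    ((h1.smul c).add h2).le (by linarith [S.X_pos]) fun t _ x => ?_⟩
  · rw [Blk.rem]; ext t x
    simp only [smul_apply, mul_apply, add_apply]; ring
  · rw [← mul_assoc, ← add_mul]
    refine mul_le_mul_of_nonneg_right ?_ (E.he.nonneg x)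
    have e1 : X * mo Q X 33 (-2) = mo Q X 33 (-1) := by
      nth_rw 1 [S.X_eq]; rw [S.mul]; norm_num
    have e2 := mul_le_mul_of_nonneg_right (E.abs_two_X k) (S.pos 33 (-2)).le
    have e3 := S.le (a := 34) (b := -2) (a' := 33) (b' := -1) (by norm_num) (by norm_num)
    have e4 := S.const_le (c := 3) (a := 33) (b := -1) (a' := 35) (b' := -1) (by norm_num)
      (by norm_num) (by norm_num)
    linarith

lemma OF_shr (k : Fin 3) : OF b.g (2 * X) b.env 5 (mo Q X 36 (-1)) (b.shr k) := by
  have S := E.sc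
  have hX := S.X_pos
  refine (((E.OF_rem _).ite (by linarith) (S.pos _ _).le E.he _).sub
    ((E.OF_rem _).ite (by linarith) (S.pos _ _).le E.he _)).mono (by linarith) le_rfl E.he ?_ le_rfl
  rw [← two_mul]
  exact S.const_le (by norm_num) (by norm_num) (by norm_num)

lemma OF_sh (k : Fin 3) : OF b.g (2 * X) b.env 5 (mo Q X 33 0) (b.sh k) := by
  have S := E.sc
  have hX := S.X_pos
  rw [E.sh_eq]
  refine ((((E.OF_W).mono (by linarith) le_rfl E.he le_rfl (by norm_num)).ite (by linarith)
    (S.pos _ _).le E.he _).add (E.OF_shr k)).mono (by linarith) le_rfl E.he ?_ le_rfl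
  have e3 := S.le (a := 36) (b := -1) (a' := 32) (b' := 0) (by norm_num) (by norm_num)
  have e4 := S.const_le (c := 2) (a := 32) (b := 0) (a' := 33) (b' := 0) (by norm_num)
    (by norm_num) (by norm_num)
  linarith

/-- The square of the time profile. -/
lemma tgg : TB 1 (mo Q X 2 2) (b.g * b.g) where
  D_eq i := by simp [D_mul, E.D_g]
  eq t x := by rw [mul_apply, mul_apply, E.tg.eq]
  int := by
    refine (le_of_eq (integral_congr_ae (.of_forall fun t => ?_))).trans
      E.g_sq.le
    simp only [mul_apply]
    rw [abs_mul_self, sq]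
  sup t ht := by
    rw [mul_apply, abs_mul]
    refine (mul_le_mul (E.tg.sup t ht) (E.tg.sup t ht) (abs_nonneg _) (E.sc.pos _ _).le).trans ?_
    rw [E.sc.mul]; norm_num

lemma tgg' : TB (mo Q X 0 0) (mo Q X 2 2) (b.g * b.g) := by
  rw [← E.sc.one_eq]; exact E.tgg

lemma Ti_sq {f f' : Fld} {a a' b' : ℤ} (h : OF b.g (2 * X) b.env 5 (mo Q X a 0) f)
    (h' : OF b.g (2 * X) b.env 5 (mo Q X a' b') f') (hb : b' ≤ -1) (ha : a + a' ≤ 90) :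
    Ti Q X 1 (f * f') := by
  have S := E.sc
  have hX := S.X_one
  have := h.mul h' (by linarith) (S.pos _ _).le (S.pos _ _).le E.he
  rw [S.mul] at this
  exact S.ti_OF this (by linarith) (by linarith) (by norm_num) E.tgg' E.he (by omega) (by omega)
    (by omega) (by omega)

lemma N_inv_sq : (b.N ^ 2)⁻¹ = mo Q X 120 (-2) := by
  rw [← inv_pow, E.N_inv, E.sc.pow]; norm_num

lemma Ti_Kr (k : Fin 3) : Ti Q X 1 (b.Kr k) := by
  have S := E.sc
  have hX := S.X_one
  have hN := E.N_pos
  set r := (if k = b.l then (2:ℝ) else 1)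
  have hr : |r| ≤ 2 := by simp only [r]; split_ifs <;> norm_num
  have hA := E.slow_D (E.slow_start E.slow.st_cb) k
  have hA2 := E.slow_D (E.slow_D (E.slow_start E.slow.st_cb) b.l) k
  have hψ : ∀ {f}, CB (Icc 0 1) X 7 (fun _ _ => Q) f →
      CB (Icc 0 1) X 7 (fun _ _ => Q * (1:ℝ)) f := fun h => by simpa using h
  have h1 : CB (Icc 0 1) (2 * X) 5 (fun _ x => mo Q X 63 (-1) * 1) (b.N⁻¹ • (D k b.st * b.ψ1)) :=
    E.osc_CB Env.one (hA.of_le (by norm_num)) (hψ E.ψ1_cb) (by norm_num) (a' := 60)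
      (by rw [abs_of_pos (inv_pos.2 hN), E.N_inv]) (by norm_num)
  have h2 : CB (Icc 0 1) (2 * X) 5 (fun _ x => mo Q X 124 (-2) * 1)
      ((b.N ^ 2)⁻¹ • (D k (D b.l b.st) * b.ψ)) :=
    E.osc_CB Env.one hA2 (hψ E.ψ_cb) (by norm_num) (a' := 120)
      (by rw [abs_of_pos (by positivity), E.N_inv_sq]) (by norm_num)
  have h3 : OF (b.g * b.g) (2 * X) (fun _ => 1) 5 (mo Q X 70 (-1)) (b.Kr k) := by
    refine ⟨r • (b.N⁻¹ • (D k b.st * b.ψ1)) + (b.N ^ 2)⁻¹ • (D k (D b.l b.st) * b.ψ), ?_,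
      ((h1.smul r).add h2).le (by linarith) fun t _ x => ?_⟩
    · rw [Blk.Kr]; ext t x
      simp only [smul_apply, mul_apply, add_apply]
      field_simp; ring
    · have e2 := mul_le_mul_of_nonneg_right hr (S.pos 63 (-1)).le
      have e3 := S.le (a := 124) (b := -2) (a' := 63) (b' := -1) (by norm_num) (by norm_num)
      have e4 := S.const_le (c := 3) (a := 63) (b := -1) (a' := 70) (b' := -1) (by norm_num)
        (by norm_num) (by norm_num)
      linarith
  have he : Env (mo Q X 0 0) (fun _ => (1:ℝ)) := by rw [← S.one_eq]; exact Env.one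
  exact S.ti_OF h3 (by linarith) (by linarith) (by norm_num) E.tgg' he (by norm_num) (by norm_num)
    (by norm_num) (by norm_num)

lemma Ti_DDK {i j : Fin 3} (hi : i ≠ b.l) (hj : j ≠ b.l) : Ti Q X 1 (D i (D j b.K)) := by
  have S := E.sc
  have hX := S.X_one
  have hN := E.N_pos
  have hA2 := E.slow_D (E.slow_D (E.slow_start E.slow.st_cb) j) i
  have hψ : CB (Icc 0 1) X 7 (fun _ _ => Q * (1:ℝ)) b.ψ := by simpa using E.ψ_cb
  have h2 : CB (Icc 0 1) (2 * X) 5 (fun _ x => mo Q X 124 (-2) * 1)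
      ((b.N ^ 2)⁻¹ • (D i (D j b.st) * b.ψ)) :=
    E.osc_CB Env.one hA2 hψ (by norm_num) (a' := 120)
      (by rw [abs_of_pos (by positivity), E.N_inv_sq]) (by norm_num)
  have e : D i (D j b.K) = (b.g * b.g) * ((b.N ^ 2)⁻¹ • (D i (D j b.st) * b.ψ)) := by
    rw [Blk.K, E.D_smul_mul_const (E.tgg.D_eq j), E.D_smul_mul_const (E.tgg.D_eq i), D_mul,
      E.D_ψ, if_neg hj, mul_zero, zero_add, D_mul, E.D_ψ, if_neg hi]
    ext t x; simp only [smul_apply, mul_apply, add_apply, zero_apply]; ring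
  have he : Env (mo Q X 0 0) (fun _ => (1:ℝ)) := by rw [← S.one_eq]; exact Env.one
  rw [e]
  exact S.ti_OF ⟨_, rfl, h2⟩ (by linarith) (by linarith) (by norm_num) E.tgg' he (by norm_num)
    (by norm_num) (by norm_num) (by norm_num)

/-- Products of the function `h` with slow fields. -/
lemma h_mul {k : ℕ} {a a' : ℤ} {f : Fld} (hf : CB (Icc 0 1) Q k (fun _ _ => mo Q X a 0) f)
    (ha : a - 19 ≤ a') : CB (Icc 0 1) Q k (fun _ _ => mo Q X a' 0) (b.h * f) := by
  refine (CB.mul_indep E.D_h (a := fun _ => mo Q X (-19) 0) (fun t _ x => E.h_abs t x) hf).le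
    E.sc.Q_pos.le fun t _ x => ?_
  rw [E.sc.mul]
  exact E.sc.le (by norm_num) (by omega)

lemma slow_sub {k : ℕ} {a a' a'' : ℤ} {f f' : Fld}
    (hf : CB (Icc 0 1) Q k (fun _ _ => mo Q X a 0) f)
    (hf' : CB (Icc 0 1) Q k (fun _ _ => mo Q X a' 0) f') (h : a + 1 ≤ a'') (h' : a' + 1 ≤ a'') :
    CB (Icc 0 1) Q k (fun _ _ => mo Q X a'' 0) (f - f') := by
  refine (hf.sub hf').le E.sc.Q_pos.le fun t _ x => ?_
  have e1 := E.sc.const_le (c := 2) (a := a) (b := 0) (a' := a'') (b' := 0) (by norm_num)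
    le_rfl (by omega)
  have e2 := E.sc.const_le (c := 2) (a := a') (b := 0) (a' := a'') (b' := 0) (by norm_num)
    le_rfl (by omega)
  linarith

lemma slow_Lap {k : ℕ} {a : ℤ} {f : Fld} (hf : CB (Icc 0 1) Q (k + 2) (fun _ _ => mo Q X a 0) f) :
    CB (Icc 0 1) Q k (fun _ _ => mo Q X (a + 3) 0) (Lap f) := by
  refine hf.Lap.le E.sc.Q_pos.le fun t _ x => ?_
  nth_rw 1 [E.sc.Q_eq]
  rw [E.sc.pow, E.sc.mul_assoc]
  exact E.sc.const_le (by norm_num) (by norm_num) (by norm_num; omega)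

lemma slow_ite {k : ℕ} {a : ℤ} {f : Fld} (hf : CB (Icc 0 1) Q k (fun _ _ => mo Q X a 0) f)
    (P : Prop) [Decidable P] :
    CB (Icc 0 1) Q k (fun _ _ => mo Q X a 0) (if P then f else 0) := by
  split_ifs
  · exact hf
  · exact CB.of_zero E.sc.Q_pos.le fun _ _ _ => (E.sc.pos _ _).le

lemma Ti_tcS (i j : Fin 3) (x y : Fin 3) : Ti Q X 1 (tcS i j (b.h * Heat b.P) x y) := by
  have h1 : CB (Icc 0 1) Q 5 (fun _ _ => mo Q X 5 0) (Heat b.P) := by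
    rw [Heat_eq]
    exact E.slow_sub ((E.slow_start E.slow.Dt_P_cb).of_le (by norm_num))
      (E.slow_Lap (E.slow_start E.slow.P_cb)) (by norm_num) (by norm_num)
  have h2 : CB (Icc 0 1) Q 5 (fun _ _ => mo Q X (-14) 0) (b.h * Heat b.P) :=
    E.h_mul h1 (by norm_num)
  have h3 : ∀ i j, CB (Icc 0 1) Q 3 (fun _ _ => mo Q X (-12) 0) (D i (D j (b.h * Heat b.P))) :=
    fun i j => E.slow_D (E.slow_D h2 j) i
  refine E.sc.ti_CB (a := -11) ?_ (by norm_num)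
  unfold tcS
  exact E.slow_sub (E.slow_ite (h3 _ _) _) (E.slow_ite (h3 _ _) _) (by norm_num) (by norm_num)

lemma CB_tc (k : Fin 3) : CB (Icc 0 1) Q 4 (fun _ _ => mo Q X (-12) 0) (b.tc k) := by
  have h1 := E.slow_start E.slow.P_cb
  refine E.h_mul (a := 7) (E.slow_sub (E.slow_ite (E.slow_D (E.slow_Lap h1) _) _)
    (E.slow_D (E.slow_D (E.slow_D h1 _) _) _) (by norm_num) (by norm_num)) (by norm_num)

/-- The stress generated by the block is small. -/
lemma Ti_err (x y : Fin 3) : Ti Q X 16 (b.err x y) := by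
  have h5 := E.swap.OF_sh y
  have h6 := E.swap.OF_shr y
  rw [show (16:ℝ) = 4 + 4 + (1 + 1) + (1 + 1 + 1 + 1) + (1 + 1) by norm_num]
  refine ((((E.Ti_shearT x y).add (E.swap.Ti_shearT y x)).add
    ((E.Ti_tcS _ _ x y).add (E.Ti_tcS _ _ y x))).add
    ((((Ti.ite (Ti.ite (E.Ti_Kr _) _) _).sub (Ti.ite (Ti.ite (E.Ti_Kr _) _) _)).sub
      (Ti.ite (Ti.ite (E.Ti_Kr _) _) _)).add (Ti.ite (Ti.ite (E.Ti_DDK E.il E.jl) _) _))).add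
    ((Ti.ite (E.Ti_sq (E.OF_W.mono ?_ le_rfl E.he le_rfl (by norm_num)) h6 (by norm_num)
      (by norm_num)) _).add ?_)
  · linarith [E.sc.X_pos]
  · rw [mul_comm]
    exact E.Ti_sq h5 (E.OF_shr x) (by norm_num) (by norm_num)

end Est
end Blk
lemma env_ind {m : ℝ} (hm : 1 ≤ m) {N : ℕ} (hN : 1 ≤ N) (l : Fin 3) :
    Env (1 / m) fun x => ind m (N * x l) where
  int := by
    refine Measure.integrableOn_of_bounded (M := 1) ?_ ?_ ?_
    · rw [volume_cube]; simp
    · exact ((measurable_ind m).comp (by fun_prop)).aestronglyMeasurable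
    · refine .of_forall fun x => ?_
      rw [Real.norm_of_nonneg (ind_nonneg _ _)]
      exact ind_le_one _ _
  nonneg x := ind_nonneg _ _
  le_one x := ind_le_one _ _
  le := by
    rw [integral_cube_coord l (fun y => ind m (N * y))]
    exact integral_ind_scale hm hN

lemma exists_third (i j : Fin 3) : ∃ l : Fin 3, i ≠ l ∧ j ≠ l := by revert i j; decide

/-- A family of blocks with prescribed slow parts. -/
theorem exists_blocks {p : ℝ} (hp : 1 ≤ p) : ∃ C : ℝ, ∀ Q N : ℕ, C ≤ Q → 1000 ≤ Q → Q ^ 60 ≤ N →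
    ∀ (δ : ℝ) (st A B P : Fin 3 × Fin 3 → Fld),
    (∀ c, Slow Q δ (st c) (A c) (B c) (P c)) → ∃ b : Fin 3 × Fin 3 → Blk,
      (∀ c, (b c).Est Q (N * (Q:ℝ) ^ 60) δ p) ∧
      (∀ c, (b c).i = c.1 ∧ (b c).j = c.2 ∧ (b c).st = st c ∧ (b c).A = A c ∧ (b c).B = B c ∧
        (b c).P = P c) ∧ ∀ c c', c ≠ c' → (b c).g * (b c').g = 0 := by
  obtain ⟨f, hf, hf1⟩ := exists_profile
  obtain ⟨C0, hC0, hb0⟩ := hf.bounded_iter 7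
  obtain ⟨C1, hC1, hb1⟩ := hf.deriv.bounded_iter 7
  obtain ⟨C2, hC2, hb2⟩ := hf.deriv.deriv.bounded_iter 7
  have hf2 : IsProf (fun y => deriv (deriv f) y ^ 2) := by
    have := hf.deriv.deriv.mul hf.deriv.deriv
    simpa only [sq] using this
  obtain ⟨C3, hC3, hψ⟩ := exists_second_primitive hf2 (fun y => sq_nonneg _) hf1 7
  obtain ⟨C4, hC4, hts⟩ := exists_timeSys hp
  refine ⟨max C0 (max C1 (max C2 (max C3 C4))), fun Q N hQ hQ1 hN δ st A B P hs => ?_⟩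
  obtain ⟨h0, h1, h2, h3, h4⟩ : C0 ≤ (Q:ℝ) ∧ C1 ≤ (Q:ℝ) ∧ C2 ≤ (Q:ℝ) ∧ C3 ≤ (Q:ℝ) ∧ C4 ≤ (Q:ℝ) := by
    simpa [max_le_iff] using hQ
  have hQr : (1000:ℝ) ≤ Q := by exact_mod_cast hQ1
  have hQpos : (0:ℝ) < Q := by linarith
  have hNr : (Q:ℝ) ^ 60 ≤ N := by exact_mod_cast hN
  have hm : 1 ≤ (Q:ℝ) ^ 60 := one_le_pow₀ (by linarith)
  set X : ℝ := N * (Q:ℝ) ^ 60 with hX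
  have S : Sc (Q:ℝ) X := ⟨hQr, by
    rw [hX, show (Q:ℝ) ^ 120 = Q ^ 60 * Q ^ 60 by ring]
    exact mul_le_mul_of_nonneg_right hNr (by linarith)⟩
  have hX1 := S.X_one
  have hXs : √(X ^ 2) = X := Real.sqrt_sq (by linarith)
  have hν : 1 ≤ Q ^ 20 := one_le_pow₀ (by omega)
  have hN1 : 1 ≤ N := (one_le_pow₀ (by omega)).trans hN
  obtain ⟨g, h, T⟩ := hts (X ^ 2) (one_le_pow₀ hX1) (Q ^ 20) hν
  obtain ⟨ψ, pψ, eψ, bψ, bψ'⟩ := hψ _ hm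
  have pψ1 : IsPer (deriv ψ) := pψ.deriv
  choose l hl1 hl2 using exists_third
  have dψ : IsPer (deriv (deriv ψ)) := pψ1.deriv
  have hcb : ∀ {C : ℝ} {f : ℝ → ℝ} (l : Fin 3) (hf : IsProf f), C ≤ Q →
      (∀ j ≤ 7, ∀ y, |deriv^[j] f y| ≤ C) → CB (Icc 0 1) X 7
        (fun _ x => Q * ind ((Q:ℝ) ^ 60) (N * x l)) (osc l N (conc _ f) (conc_isPer hf hm)) :=
    fun l hf hC hb => (CB_osc_conc _ l N hm 7 hf hb).le (by linarith) fun t _ x =>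
      mul_le_mul_of_nonneg_right hC (ind_nonneg _ _)
  refine ⟨fun c => ⟨c.1, c.2, l c.1 c.2, N, (Q:ℝ) ^ 60, tf (g c) (T.smooth_g c),
    tf (h c) (T.smooth_h c), A c, B c, st c, P c,
    osc (l c.1 c.2) N (conc _ f) (conc_isPer hf hm),
    osc (l c.1 c.2) N (conc _ (deriv f)) (conc_isPer hf.deriv hm),
    osc (l c.1 c.2) N (conc _ (deriv (deriv f))) (conc_isPer hf.deriv.deriv hm),
    osc (l c.1 c.2) N ψ pψ, osc (l c.1 c.2) N (deriv ψ) pψ1,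
    osc (l c.1 c.2) N (deriv (deriv ψ)) dψ⟩, fun c => ?_, fun c => ⟨rfl, rfl, rfl, rfl, rfl, rfl⟩,
    fun c c' hc => ?_⟩
  · refine { (?_ : Blk.Good _) with
      sc := S
      X_eq := rfl
      m_eq := rfl
      N_ge := hNr
      tg := ⟨fun i => D_tf _ _ (T.smooth_g c), fun _ _ => rfl, ?_, fun t _ => ?_⟩
      tdg := ⟨fun i => ?_, fun t x => ?_, ?_, fun t _ => ?_⟩
      g_sq := T.int_sq c
      g_pow := ?_
      h_abs := fun t x => ?_
      he := ?_
      slow := hs c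
      φ_cb := hcb _ hf h0 hb0
      φ1_cb := hcb _ hf.deriv h1 hb1
      φ2_cb := hcb _ hf.deriv.deriv h2 hb2
      ψ_cb := (CB_osc _ _ N (by linarith) (by linarith) 7 pψ bψ).le (by linarith) fun _ _ _ => h3
      ψ1_cb := (CB_osc _ _ N (by linarith) (by linarith) 7 pψ1 bψ').le (by linarith)
        fun _ _ _ => h3 }
    · exact {
        N_pos := by show (0:ℝ) < N; exact_mod_cast hN1
        m_pos := by show (0:ℝ) < (Q:ℝ) ^ 60; linarith
        il := hl1 _ _
        jl := hl2 _ _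
        D_g := fun k => D_tf _ _ (T.smooth_g c)
        D_h := fun k => D_tf _ _ (T.smooth_h c)
        Dt_h := by
          ext t x
          rw [Dt_tf, T.deriv_h]
          simp [sq]
        prod := (hs c).prod
        pot := (hs c).pot
        D_φ := fun k => by
          rw [D_osc]
          split_ifs with h
          · ext t x
            simp only [smul_apply, osc_apply, deriv_conc hf hm]
            ring
          · rfl
        D_φ1 := fun k => by
          rw [D_osc]
          split_ifs with h
          · ext t x
            simp only [smul_apply, osc_apply, deriv_conc hf.deriv hm]
            ring
          · rfl
        Dt_φ := Dt_osc _ _ _ (conc_isPer hf hm)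
        D_ψ := fun k => D_osc _ _ _ _ pψ
        D_ψ1 := fun k => D_osc _ _ _ _ pψ1
        ψ2_eq := by
          ext t x
          simp only [sub_apply, smul_apply, mul_apply, osc_apply, one_apply, eψ, conc, sq] }
    · refine (T.int_abs c).trans ?_
      rw [hXs, div_eq_mul_inv]
      simp only [mo, zpow_one, zpow_neg]
      exact mul_le_mul_of_nonneg_right h4 (by positivity)
    · refine (T.abs_g c t).trans ?_
      rw [hXs]
      simp only [mo, zpow_one]
      exact mul_le_mul_of_nonneg_right h4 (by positivity)
    · rw [← D_Dt]; simp only [D_tf, map_zero]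
    · rw [Dt_tf, Dt_tf]
    · simp only [Dt_tf]
      refine (T.int_deriv c).trans ?_
      rw [hXs]
      have : mo (Q:ℝ) X 21 1 = Q * Q ^ 20 * X := by
        simp only [mo, zpow_one]; norm_cast; ring
      rw [this]; push_cast
      gcongr
    · rw [Dt_tf]
      refine (T.abs_deriv c t).trans ?_
      rw [hXs]
      have : mo (Q:ℝ) X 21 3 = Q * Q ^ 20 * X ^ 2 * X := by
        simp only [mo]; norm_cast; push_cast; ring
      rw [this]; push_cast
      gcongr
    · refine (T.int_rpow c).trans ?_
      rw [← Real.rpow_natCast X 2, ← Real.rpow_mul (by linarith)]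
      refine (mul_le_mul_of_nonneg_right h4 (by positivity)).trans (le_of_eq ?_)
      congr 2; push_cast; ring
    · refine (T.abs_h c t).trans ?_
      have e := S.const_le (c := 2) (a := -20) (b := 0) (a' := -19) (b' := 0) (by norm_num)
        (by norm_num) (by norm_num)
      refine le_trans (le_of_eq ?_) e
      rw [mo, zpow_zero, mul_one, show (-20:ℤ) = -((20:ℕ):ℤ) by norm_num, zpow_neg, zpow_natCast,
        div_eq_mul_inv, Nat.cast_pow]
    · have := env_ind hm hN1 (l c.1 c.2)
      have e : 1 / (Q:ℝ) ^ 60 = mo (Q:ℝ) X (-60) 0 := by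
        rw [mo, zpow_zero, mul_one, show (-60:ℤ) = -((60:ℕ):ℤ) by norm_num, zpow_neg,
          zpow_natCast, one_div]
      rw [e] at this
      exact this
  · ext t x
    simp only [mul_apply, tf_apply, zero_apply]
    exact T.disj c c' hc t

namespace Blk.Est
variable {b b' : Blk} {Q X δ p : ℝ} (E : b.Est Q X δ p)
include E

lemma Ti_mul_sh {f : Fld} (hf : HB (Icc 0 1) 3 Q f) (k : Fin 3) : Ti Q X 1 (f * b.sh k) := by
  have S := E.sc
  have hX := S.X_one
  have h := OF.Sm_mul ((E.OF_sh k).mono (by linarith) le_rfl E.he le_rfl (by norm_num)) hf S.Q_pos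
    E.tg E.he (by linarith) (S.pos _ _) (S.pos _ _)
  refine S.ti h ?_ ?_
  · rw [S.mul]
    nth_rw 1 [S.Q_eq]
    rw [S.mul]; exact S.le (by norm_num) (by norm_num)
  · rw [S.mul, mul_pow]
    have e : 64 * (Q * (2 ^ 3 * X ^ 3 * mo Q X (1 + 33) (1 + 0))) =
        512 * (Q * (X ^ 3 * mo Q X (1 + 33) (1 + 0))) := by ring
    rw [e]
    nth_rw 1 [S.Q_eq]
    nth_rw 2 [S.X_eq]
    rw [S.pow, S.mul, S.mul]
    exact S.const_le (by norm_num) (by norm_num) (by norm_num)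

lemma tc_one (k : Fin 3) : CB (Icc 0 1) 1 3 (fun _ _ => mo Q X (-9) 0) (b.tc k) := by
  have S := E.sc
  have h := ((E.CB_tc k).of_le (show 3 ≤ 4 by norm_num)).unweight S.Q_one (S.pos _ _).le
  refine h.le zero_le_one fun _ _ _ => ?_
  nth_rw 1 [S.Q_eq]
  rw [S.pow, S.mul]; norm_num

lemma tc_HB (k : Fin 3) : HB (Icc 0 1) 3 Q (b.tc k) := by
  have S := E.sc
  refine (E.tc_one k).toHB.mono (S.pos _ _).le ?_
  nth_rw 2 [S.Q_eq]
  exact S.le (by norm_num) (by norm_num)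

lemma Ti_mul_tc {f : Fld} (hf : HB (Icc 0 1) 3 Q f) (k : Fin 3) : Ti Q X 1 (f * b.tc k) := by
  have S := E.sc
  refine S.ti (Sm_mul S.Q_pos (S.pos _ _) hf (E.tc_one k)) ?_ ?_
  · nth_rw 1 [S.Q_eq]
    rw [S.mul]; exact S.le (by norm_num) (by norm_num)
  · nth_rw 1 [S.Q_eq]
    rw [S.mul]; exact S.const_le (by norm_num) (by norm_num) (by norm_num)

lemma Ti_sh_tc (E' : b'.Est Q X δ p) (k k' : Fin 3) : Ti Q X 1 (b.sh k * b'.tc k') := by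
  have S := E.sc
  have hX := S.X_one
  have h := OF.mul_CB ((E.OF_sh k).mono (by linarith) le_rfl E.he le_rfl (show 3 ≤ 5 by norm_num))
    (((E'.CB_tc k').of_le (show 3 ≤ 4 by norm_num)).mono S.Q_pos.le (L' := 2 * X)
      (by linarith [S.Q_le_X]) fun _ _ _ => le_rfl)
    (by linarith)
  rw [S.mul] at h
  exact S.ti_OF h (by linarith) (by linarith) (by norm_num) E.tg E.he (by norm_num) (by norm_num)
    (by norm_num) (by norm_num)

end Blk.Est

abbrev Ix := Fin 3 × Fin 3

/-- The oscillating part of the perturbation. -/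
def osh (b : Ix → Blk) (k : Fin 3) : Fld := ∑ c, (b c).sh k

/-- The temporal corrector. -/
def otc (b : Ix → Blk) (k : Fin 3) : Fld := ∑ c, (b c).tc k

/-- The family of swapped blocks. -/
def swp (b : Ix → Blk) (c : Ix) : Blk := (b c).swap

/-- The new stress. -/
def newS (b : Ix → Blk) (u z : Fin 3 → Fld) (E : Fin 3 → Fin 3 → Fld) (x y : Fin 3) : Fld :=
  E x y + (u x * (osh (swp b) y + otc (swp b) y) + (osh b x + otc b x) * z y
    + osh b x * otc (swp b) y + otc b x * (osh (swp b) y + otc (swp b) y) + ∑ c, (b c).err x y)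

section
variable {b : Ix → Blk} {Q X δ p : ℝ} (H : ∀ c, (b c).Est Q X δ p)
include H

lemma swp_est (c : Ix) : (swp b c).Est Q X δ p := (H c).swap

lemma Ti.mul_osh {f : Fld} (hf : HB (Icc 0 1) 3 Q f) (k : Fin 3) : Ti Q X 9 (f * osh b k) := by
  rw [osh, Finset.mul_sum]
  simpa using Ti.sum fun c => (H c).Ti_mul_sh hf k

lemma Ti.mul_otc {f : Fld} (hf : HB (Icc 0 1) 3 Q f) (k : Fin 3) : Ti Q X 9 (f * otc b k) := by
  rw [otc, Finset.mul_sum]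
  simpa using Ti.sum fun c => (H c).Ti_mul_tc hf k

lemma Ti.osh_mul_otc {b' : Ix → Blk} (H' : ∀ c, (b' c).Est Q X δ p) (k k' : Fin 3) :
    Ti Q X 81 (osh b k * otc b' k') := by
  rw [osh, otc, Finset.sum_mul]
  have := Ti.sum fun c => Ti.sum fun c' => (H c).Ti_sh_tc (H' c') k k'
  simp only [← Finset.mul_sum] at this
  norm_num at this
  exact this

lemma Ti.otc_mul_otc {b' : Ix → Blk} (H' : ∀ c, (b' c).Est Q X δ p) (k k' : Fin 3) :
    Ti Q X 81 (otc b k * otc b' k') := by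
  rw [otc, otc, Finset.sum_mul]
  have := Ti.sum fun c => Ti.sum fun c' => (H' c').Ti_mul_tc ((H c).tc_HB k) k'
  simp only [← Finset.mul_sum] at this
  norm_num at this
  exact this

/-- The new stress is small, up to the error of the first step. -/
lemma newS_sm {u z : Fin 3 → Fld} {E : Fin 3 → Fin 3 → Fld} {η K : ℝ} {x y : Fin 3}
    (hu : HB (Icc 0 1) 3 Q (u x)) (hz : HB (Icc 0 1) 3 Q (z y)) (hE : Sm η K (E x y)) :
    Sm (η + 423 * mo Q X (-5) 0) (K + 423 * mo Q X 0 7) (newS b u z E x y) := by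
  have H' := swp_est H
  rw [newS]
  refine hE.add ?_
  rw [show (423:ℝ) = 9 + 9 + (9 + 9) + 81 + (81 + 81) + 9 * 16 by norm_num]
  have e1 := (Ti.mul_osh H' hu y).add (Ti.mul_otc H' hu y)
  have e2 := (Ti.mul_osh H hz x).add (Ti.mul_otc H hz x)
  have e3 := Ti.osh_mul_otc H H' x y
  have e4 := (Ti.osh_mul_otc H' H y x).add (Ti.otc_mul_otc H H' x y)
  have e5 := Ti.sum fun c => (H c).Ti_err x y
  rw [← mul_add] at e1 e2
  rw [mul_comm (z y)] at e2
  rw [mul_comm (osh (swp b) y), ← mul_add] at e4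
  norm_num at e5
  have e5' : Ti Q X (9 * 16) (∑ c, (b c).err x y) := by norm_num; exact e5
  exact ((((e1.add e2).add e3).add e4).add e5')

end

lemma Blk.Good.sh_factor {b : Blk} (G : b.Good) (k : Fin 3) : ∃ F, b.sh k = b.g * F := by
  rw [G.sh_eq]
  have h : ∀ k, ∃ F, b.rem k = b.g * F := fun k => ⟨_, by rw [Blk.rem, ← mul_smul_comm]⟩
  obtain ⟨F1, h1⟩ := h b.l
  obtain ⟨F2, h2⟩ := h b.i
  refine ⟨(if k = b.i then √b.m • (b.A * b.φ2) else 0) +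
    ((if k = b.i then F1 else 0) - if k = b.l then F2 else 0), ?_⟩
  rw [Blk.shr, Blk.W, h1, h2, ← mul_smul_comm]
  simp only [mul_add, mul_sub, mul_ite, mul_zero]

/-- The system solved by the perturbed fields. -/
theorem newS_lin {b : Ix → Blk} (G : ∀ c, (b c).Good) (hi : ∀ c, (b c).i = c.1 ∧ (b c).j = c.2)
    (hd : ∀ c c', c ≠ c' → (b c).g * (b c').g = 0) {J : Set ℝ} {u z : Fin 3 → Fld} {p : Fld}
    {E s : Fin 3 → Fin 3 → Fld} (hs : ∀ c, (b c).st = s c.1 c.2)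
    (hL : Lin J u z p fun x y => s x y + E x y - u x * z y) :
    Lin J (u + (osh b + otc b)) (z + (osh (swp b) + otc (swp b)))
      (p + ∑ c, Dt (b c).h * D (b c).i (D (b c).j (b c).P))
      fun x y => newS b u z E x y -
        (u + (osh b + otc b)) x * (z + (osh (swp b) + otc (swp b))) y := by
  have h1 := hL.add (Lin.sum Finset.univ fun c _ => (G c).lin J)
  have e0 : ∀ x y, osh b x * osh (swp b) y = ∑ c, (b c).sh x * (b c).swap.sh y := fun x y => by
    rw [osh, osh, Finset.sum_mul]
    refine Finset.sum_congr rfl fun c _ => ?_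
    rw [Finset.mul_sum]
    refine Finset.sum_eq_single c (fun c' _ hc => ?_) (by simp)
    obtain ⟨F1, h1⟩ := (G c).sh_factor x
    obtain ⟨F2, h2⟩ := (G c').swap.sh_factor y
    rw [h1, swp, h2, show (b c').swap.g = (b c').g from rfl, mul_mul_mul_comm, hd c c' hc.symm,
      zero_mul]
  have e1 : ∀ x y, s x y = ∑ c, if x = (b c).i then (if y = (b c).j then (b c).st else 0) else 0 :=
    fun x y => by
      rw [Finset.sum_eq_single (x, y)]
      · simp [hi, hs]
      · rintro ⟨x', y'⟩ _ hc
        simp only [hi]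
        split_ifs with h h'
        · exact absurd (by rw [h, h']) hc
        · rfl
        · rfl
      · simp
  have e2 : ∀ x y, ∑ c, (b c).err x y = ∑ c, (b c).flux x y + s x y + osh b x * osh (swp b) y := by
    intro x y
    rw [e0, e1, ← Finset.sum_add_distrib, ← Finset.sum_add_distrib]
    exact Finset.sum_congr rfl fun c _ => ((G c).stress_eq x y).symm
  have eu : ∑ c, ((b c).sh + (b c).tc) = osh b + otc b := by
    rw [Finset.sum_add_distrib]; ext k; simp [osh, otc]
  have ez : ∑ c, ((b c).swap.sh + (b c).swap.tc) = osh (swp b) + otc (swp b) := by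
    rw [Finset.sum_add_distrib]; ext k; simp [osh, otc, swp]
  rw [eu, ez] at h1
  convert h1 using 1
  funext x y
  simp only [newS, e2, Pi.add_apply, Finset.sum_apply]
  ring

/-- The space-time integral. -/
def J1 (f : Fld) : ℝ := ∫ t in Icc (0:ℝ) 1, ∫ x in cube, f t x

lemma continuous_slice (f : Fld) : Continuous fun t => ∫ x in cube, f t x :=
  continuous_integral_cube f.continuous_uncurry

lemma J1_add (f g : Fld) : J1 (f + g) = J1 f + J1 g := by
  have hc (f : Fld) : IntegrableOn (fun t => ∫ x in cube, f t x) (Icc (0:ℝ) 1) :=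
    (continuous_slice f).continuousOn.integrableOn_compact isCompact_Icc
  rw [J1, J1, J1, ← integral_add (hc f) (hc g)]
  refine integral_congr_ae (.of_forall fun t => ?_)
  exact integral_add (integrable_cube (f.cont_space t)) (integrable_cube (g.cont_space t))

lemma J1_smul (c : ℝ) (f : Fld) : J1 (c • f) = c * J1 f := by
  rw [J1, J1, ← integral_const_mul]
  refine integral_congr_ae (.of_forall fun t => ?_)
  exact integral_const_mul _ _

lemma J1_le_N1 (f : Fld) : J1 f ≤ N1 f := by
  refine integral_mono ((continuous_slice f).continuousOn.integrableOn_compact isCompact_Icc)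
    (integrable_slice_abs f) fun t => ?_
  exact integral_mono (integrable_cube (f.cont_space t)) (integrable_cube_abs f t)
    fun x => le_abs_self _

lemma J1_D (i : Fin 3) (f : Fld) : J1 (D i f) = 0 := by simp [J1, integral_D]

lemma neg_J1_Dt_le {f : Fld} {B : ℝ} (h : ∀ t ∈ Icc (0:ℝ) 1, ∀ x, |f t x| ≤ B) :
    -J1 (Dt f) ≤ 2 * B := by
  have h0 := h 0 ⟨le_rfl, zero_le_one⟩
  have h1 := h 1 ⟨zero_le_one, le_rfl⟩
  have e : J1 (Dt f) = ∫ x in cube, (f 1 x - f 0 x) := by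
    rw [J1, integral_swap_compact isCompact_Icc isCompact_cube (Dt f).continuous_uncurry]
    refine integral_congr_ae (.of_forall fun x => ?_)
    dsimp only
    rw [← integral_Dt f 0 1 x, intervalIntegral.integral_of_le zero_le_one,
      integral_Icc_eq_integral_Ioc]
  have i1 : IntegrableOn (fun x => f 1 x - f 0 x) cube :=
    integrable_cube ((f.cont_space 1).sub (f.cont_space 0))
  rw [e, ← integral_neg]
  calc ∫ x in cube, -(f 1 x - f 0 x) ≤ ∫ _x in cube, 2 * B := by
        refine integral_mono i1.neg (integrable_cube continuous_const) fun x => ?_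
        have a1 := abs_le.1 (h0 x)
        have a2 := abs_le.1 (h1 x)
        simp only; linarith
    _ = 2 * B := by simp [volume_cube, Measure.real]

lemma N1_le_of_abs {f : Fld} {B : ℝ} (h : ∀ t ∈ Icc (0:ℝ) 1, ∀ x, |f t x| ≤ B) : N1 f ≤ B := by
  refine N1_le_of_slice fun t ht => ?_
  calc _ ≤ ∫ _x in cube, B := integral_mono (integrable_cube_abs _ _)
        (integrable_cube continuous_const) fun x => h t ht x
    _ = B := by simp [volume_cube, Measure.real]

lemma N1_le_add_const {f g : Fld} {δ : ℝ}
    (h : ∀ t ∈ Icc (0:ℝ) 1, ∀ x, |f t x| ≤ |g t x| + δ) : N1 f ≤ N1 g + δ := by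
  have e : N1 g + δ = ∫ t in Icc (0:ℝ) 1, ((∫ x in cube, |g t x|) + δ) := by
    rw [integral_add (integrable_slice_abs g) (continuous_const.continuousOn.integrableOn_compact
      isCompact_Icc)]
    simp [N1]
  rw [e]
  refine setIntegral_mono_on (integrable_slice_abs f) (((continuous_slice_abs g).add
    continuous_const).continuousOn.integrableOn_compact isCompact_Icc) measurableSet_Icc
    fun t ht => ?_
  calc ∫ x in cube, |f t x| ≤ ∫ x in cube, (|g t x| + δ) :=
        integral_mono (integrable_cube_abs _ _) ((integrable_cube_abs _ _).add
          (integrable_cube continuous_const)) fun x => h t ht x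
    _ = _ := by
        rw [integral_add (integrable_cube_abs _ _) (integrable_cube continuous_const)]
        simp [volume_cube, Measure.real]

namespace Blk.Est
variable {b : Blk} {Q X δ p : ℝ} (E : b.Est Q X δ p)
include E

/-- Decorrelation of the concentrated shear flow from the slow amplitude. -/
lemma J1_W_sq : J1 (b.W * b.W) ≤ N1 b.st + δ + mo Q X (-5) 0 := by
  have S := E.sc
  have hN := E.N_pos
  have hm := E.m_pos
  have hA := E.slow_start E.slow.A_cb
  have hAt := E.slow_start E.slow.Dt_A_cb
  have hAl := E.slow_D hA b.l
  have e : b.W * b.W = b.A * b.A + (-1:ℝ) • Dt (b.h * (b.A * b.A))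
      + (2:ℝ) • (b.h * (b.A * Dt b.A))
      + (b.N⁻¹ • D b.l (b.g * b.g * (b.A * b.A * b.ψ1))
        + (-(2 * b.N⁻¹)) • (b.g * b.g * (b.A * D b.l b.A * b.ψ1))) := by
    have h1 : b.W * b.W = b.g * b.g * (b.A * b.A) * (b.ψ2 + 1) := by
      rw [E.ψ2_eq, Blk.W]
      ext t x
      simp only [mul_apply, smul_apply, add_apply, sub_apply, one_apply]
      have := Real.mul_self_sqrt hm.le
      linear_combination (b.g t x * (b.A t x * b.φ2 t x)) ^ 2 * this
    have h2 : D b.l (b.g * b.g * (b.A * b.A * b.ψ1))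
        = b.g * b.g * (b.A * b.A * (b.N • b.ψ2)) + (2:ℝ) • (b.g * b.g * (b.A * D b.l b.A * b.ψ1)) := by
      rw [D_mul_const b.l (E.tgg.D_eq b.l), D_mul, D_mul, E.D_ψ1, if_pos rfl]
      ext t x; simp only [mul_apply, smul_apply, add_apply]; ring
    have h3 : Dt (b.h * (b.A * b.A)) = b.A * b.A - b.g * b.g * (b.A * b.A)
        + (2:ℝ) • (b.h * (b.A * Dt b.A)) := by
      rw [Dt_mul, Dt_mul, E.Dt_h]
      ext t x; simp only [mul_apply, smul_apply, add_apply, sub_apply, one_apply]; ring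
    rw [h1, h2, h3]
    ext t x; simp only [mul_apply, smul_apply, add_apply, sub_apply, one_apply]
    field_simp; ring
  have b1 : J1 (b.A * b.A) ≤ N1 b.st + δ := (J1_le_N1 _).trans (N1_le_add_const fun t _ x => by
    rw [mul_apply, ← sq, abs_sq]; exact E.slow.A_sq t x)
  have hb (t) (ht : t ∈ Icc (0:ℝ) 1) (x) {f f' : Fld} {a a' : ℤ} (h : |f t x| ≤ mo Q X a 0)
      (h' : |f' t x| ≤ mo Q X a' 0) : |(b.h * (f * f')) t x| ≤ mo Q X (-19 + (a + a')) 0 := by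
    rw [mul_apply, mul_apply, abs_mul, abs_mul]
    refine (mul_le_mul (E.h_abs t x) (mul_le_mul h h' (abs_nonneg _) (S.pos _ _).le)
      (by positivity) (S.pos _ _).le).trans ?_
    rw [S.mul, S.mul]; norm_num
  have b2 : J1 ((-1:ℝ) • Dt (b.h * (b.A * b.A))) ≤ 2 * mo Q X (-17) 0 := by
    rw [J1_smul, neg_one_mul]
    exact neg_J1_Dt_le fun t ht x => hb t ht x (hA.bound t ht x) (hA.bound t ht x)
  have b3 : J1 ((2:ℝ) • (b.h * (b.A * Dt b.A))) ≤ 2 * mo Q X (-17) 0 := by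
    rw [J1_smul]
    exact mul_le_mul_of_nonneg_left ((J1_le_N1 _).trans (N1_le_of_abs fun t ht x =>
      hb t ht x (hA.bound t ht x) (hAt.bound t ht x))) zero_le_two
  have b4 : N1 (b.g * b.g * (b.A * D b.l b.A * b.ψ1)) ≤ mo Q X 4 0 := by
    have := N1_le_prod (f := b.g * b.g * (b.A * D b.l b.A * b.ψ1))
      (a := fun t => |(b.g * b.g) t 0|) (e := fun _ => mo Q X 4 0)
      ((b.g * b.g).cont_time 0).abs (fun _ _ => abs_nonneg _)
      (integrable_cube continuous_const) fun t ht x => by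
        have h1 := hA.bound t ht x
        have h2 := hAl.bound t ht x
        have h3 := (E.ψ1_cb.bound t ht x)
        rw [S.Q_eq] at h3
        rw [mul_apply (b.g * b.g), abs_mul, E.tgg.eq, mul_apply (b.A * _), mul_apply b.A, abs_mul,
          abs_mul (b.A t x)]
        refine mul_le_mul_of_nonneg_left ((mul_le_mul (mul_le_mul h1 h2 (abs_nonneg _)
          (S.pos _ _).le) h3 (abs_nonneg _) (mul_pos (S.pos _ _) (S.pos _ _)).le).trans ?_)
          (by positivity)
        rw [S.mul, S.mul]; norm_num
    refine this.trans ?_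
    have h1 : (∫ _x in cube, mo Q X 4 0) = mo Q X 4 0 := by simp [volume_cube, Measure.real]
    rw [h1]
    exact mul_le_of_le_one_left (S.pos _ _).le E.tgg.int
  have b5 : J1 ((-(2 * b.N⁻¹)) • (b.g * b.g * (b.A * D b.l b.A * b.ψ1))) ≤ 2 * mo Q X (-17) 0 := by
    rw [neg_smul, ← smul_neg, J1_smul]
    have h1 := (J1_le_N1 _).trans ((N1_neg (b.g * b.g * (b.A * D b.l b.A * b.ψ1))).trans_le b4)
    refine (mul_le_mul_of_nonneg_left h1 (by positivity)).trans ?_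
    rw [E.N_inv, _root_.mul_assoc, S.mul]
    exact mul_le_mul_of_nonneg_left (S.le (by norm_num) (by norm_num)) zero_le_two
  have b6 : 6 * mo Q X (-17) 0 ≤ mo Q X (-5) 0 :=
    S.const_le (by norm_num) le_rfl (by norm_num)
  rw [e, J1_add, J1_add, J1_add, J1_add, J1_smul b.N⁻¹, J1_D, mul_zero, zero_add]
  linarith

end Blk.Est
/-- The space-time `L²` norm of a scalar field is at most `η`. -/
def L2b (η : ℝ) (f : Fld) : Prop :=
  0 ≤ η ∧ eLpNorm (fun q : ℝ × V3 => f q.1 q.2) 2 (μT.prod μc) ≤ ENNReal.ofReal η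

lemma aesm (f : Fld) : AEStronglyMeasurable (fun q : ℝ × V3 => f q.1 q.2) (μT.prod μc) :=
  f.cont.aestronglyMeasurable

lemma L2b.add {η η' : ℝ} {f f' : Fld} (h : L2b η f) (h' : L2b η' f') : L2b (η + η') (f + f') := by
  refine ⟨add_nonneg h.1 h'.1, (eLpNorm_add_le (aesm f) (aesm f') one_le_two).trans ?_⟩
  rw [ENNReal.ofReal_add h.1 h'.1]
  exact add_le_add h.2 h'.2

lemma L2b.of_J1 {η : ℝ} {f : Fld} (hη : 0 ≤ η) (h : J1 (f * f) ≤ η ^ 2) : L2b η f := by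
  refine ⟨hη, ?_⟩
  have : IsFiniteMeasure μT := by unfold μT; infer_instance
  have : IsFiniteMeasure μc := by
    unfold μc; exact isFiniteMeasure_restrict.2 isCompact_cube.measure_lt_top.ne
  have hi : Integrable (fun q : ℝ × V3 => f q.1 q.2 ^ 2) (μT.prod μc) := by
    rw [μT, μc, Measure.prod_restrict]
    exact (f.cont.pow 2).continuousOn.integrableOn_compact (isCompact_Icc.prod isCompact_cube)
  have hm : MemLp (fun q : ℝ × V3 => f q.1 q.2) 2 (μT.prod μc) :=
    (memLp_two_iff_integrable_sq (aesm f)).2 hi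
  rw [hm.eLpNorm_eq_integral_rpow_norm two_ne_zero (by simp)]
  refine ENNReal.ofReal_le_ofReal ?_
  have e : (∫ q : ℝ × V3, ‖f q.1 q.2‖ ^ ((2:ℝ≥0∞).toReal) ∂(μT.prod μc)) = J1 (f * f) := by
    have : ∀ q : ℝ × V3, ‖f q.1 q.2‖ ^ ((2:ℝ≥0∞).toReal) = f q.1 q.2 ^ 2 := fun q => by
      simp
    simp only [this]
    rw [integral_prod _ hi, J1, μT, μc]
    simp only [mul_apply, sq]
  rw [e]
  calc J1 (f * f) ^ ((2:ℝ≥0∞).toReal)⁻¹ ≤ (η ^ 2) ^ ((2:ℝ≥0∞).toReal)⁻¹ :=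
        Real.rpow_le_rpow (integral_nonneg fun t => integral_nonneg fun x => by
          simp only [mul_apply]; exact mul_self_nonneg _) h (by simp)
    _ = η := by
        rw [ENNReal.toReal_ofNat, ← one_div, ← Real.sqrt_eq_rpow, Real.sqrt_sq hη]

/-- Bounds for the `L²`, `L^p_tL^∞_x` and `L¹_tC^{1-ε}_x` norms of a scalar field. -/
structure Nb (p ε η : ℝ) (f : Fld) : Prop where
  l2 : L2b η f
  lp : ∃ G : ℝ → ℝ, Continuous G ∧ (∀ t ∈ Icc (0:ℝ) 1, ∀ x, |f t x| ≤ G t) ∧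
    eLpNorm G (ENNReal.ofReal p) μT ≤ ENNReal.ofReal η
  hol : ∃ H : ℝ → ℝ, Continuous H ∧ (∀ t ∈ Icc (0:ℝ) 1, ∀ x, |f t x| ≤ H t) ∧
    (∀ t ∈ Icc (0:ℝ) 1, ∀ x y, |f t x - f t y| ≤ H t * ‖x - y‖ ^ (1 - ε)) ∧
    ∫ t in Icc (0:ℝ) 1, H t ≤ η

lemma integrableOn_Icc {H : ℝ → ℝ} (h : Continuous H) : IntegrableOn H (Icc 0 1) :=
  h.continuousOn.integrableOn_compact isCompact_Icc

variable {p ε η η' : ℝ} {f f' : Fld}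

lemma Nb.add (hp : 1 ≤ p) (h : Nb p ε η f) (h' : Nb p ε η' f') : Nb p ε (η + η') (f + f') where
  l2 := h.l2.add h'.l2
  lp := by
    obtain ⟨G, c, b, e⟩ := h.lp
    obtain ⟨G', c', b', e'⟩ := h'.lp
    refine ⟨G + G', c.add c', fun t ht x =>
      (abs_add_le _ _).trans (add_le_add (b t ht x) (b' t ht x)), ?_⟩
    refine (eLpNorm_add_le c.aestronglyMeasurable c'.aestronglyMeasurable
      (ENNReal.one_le_ofReal.2 hp)).trans ?_
    rw [ENNReal.ofReal_add h.l2.1 h'.l2.1]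
    exact add_le_add e e'
  hol := by
    obtain ⟨G, c, b, d, e⟩ := h.hol
    obtain ⟨G', c', b', d', e'⟩ := h'.hol
    refine ⟨G + G', c.add c', fun t ht x =>
      (abs_add_le _ _).trans (add_le_add (b t ht x) (b' t ht x)), fun t ht x y => ?_, ?_⟩
    · have h1 := abs_add_le (f t x - f t y) (f' t x - f' t y)
      have h2 := d t ht x y
      have h3 := d' t ht x y
      rw [add_apply, add_apply, Pi.add_apply, add_mul]
      have : f t x + f' t x - (f t y + f' t y) = f t x - f t y + (f' t x - f' t y) := by ring
      rw [this]; linarith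
    · simp only [Pi.add_apply]
      rw [integral_add (integrableOn_Icc c) (integrableOn_Icc c')]
      exact add_le_add e e'

lemma Nb.mono (h : Nb p ε η f) (hη : η ≤ η') : Nb p ε η' f where
  l2 := ⟨h.l2.1.trans hη, h.l2.2.trans (ENNReal.ofReal_le_ofReal hη)⟩
  lp := by
    obtain ⟨G, c, b, e⟩ := h.lp
    exact ⟨G, c, b, e.trans (ENNReal.ofReal_le_ofReal hη)⟩
  hol := by
    obtain ⟨G, c, b, d, e⟩ := h.hol
    exact ⟨G, c, b, d, e.trans hη⟩

lemma Nb.neg (h : Nb p ε η f) : Nb p ε η (-f) where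
  l2 := ⟨h.l2.1, by
    have := h.l2.2
    rw [← eLpNorm_neg] at this
    exact this⟩
  lp := by simpa using h.lp
  hol := by
    obtain ⟨G, c, b, d, e⟩ := h.hol
    refine ⟨G, c, by simpa using b, fun t ht x y => ?_, e⟩
    have := d t ht x y
    rwa [← abs_neg, neg_sub, ← neg_sub_neg] at this

lemma Nb.sub (hp : 1 ≤ p) (h : Nb p ε η f) (h' : Nb p ε η' f') : Nb p ε (η + η') (f - f') := by
  rw [sub_eq_add_neg]; exact h.add hp h'.neg

lemma Nb.sum {ι : Type*} (hp : 1 ≤ p) (s : Finset ι) (hs : s.Nonempty) {f : ι → Fld}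
    {η : ι → ℝ} (h : ∀ c ∈ s, Nb p ε (η c) (f c)) : Nb p ε (∑ c ∈ s, η c) (∑ c ∈ s, f c) := by
  classical
  induction hs using Finset.Nonempty.cons_induction with
  | singleton a => simpa using h
  | cons a s ha hs ih =>
    rw [Finset.sum_cons, Finset.sum_cons]
    exact (h a (Finset.mem_cons_self a s)).add hp
      (ih fun c hc => h c (Finset.mem_cons_of_mem hc))

lemma holder_of_lipschitz {t A L : ℝ} (hL : 1 ≤ L) (hε : 0 ≤ ε) (hε1 : ε ≤ 1)
    (h0 : ∀ x, |f t x| ≤ A) (h1 : ∀ i x, |D i f t x| ≤ L * A) :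
    ∀ x y, |f t x - f t y| ≤ 3 * A * L ^ (1 - ε) * ‖x - y‖ ^ (1 - ε) := by
  intro x y
  have hA : 0 ≤ A := (abs_nonneg _).trans (h0 0)
  have hL0 : 0 ≤ L := by linarith
  rw [_root_.mul_assoc, ← Real.mul_rpow hL0 (norm_nonneg _)]
  set r := L * ‖x - y‖ with hr
  have hr0 : 0 ≤ r := by positivity
  have h2 : |f t x - f t y| ≤ 2 * A := by
    have := abs_sub (f t x) (f t y)
    linarith [h0 x, h0 y]
  have h3 : |f t x - f t y| ≤ 3 * A * r := by
    have e := path_eq f t x (x - y)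
    rw [show x - (x - y) = y from sub_sub_cancel x y] at e
    rw [e]
    have : ‖∫ r in Icc (0:ℝ) 1, ∑ l, (x - y) l * D l f t (x - r • (x - y))‖
        ≤ 3 * A * r * (volume : Measure ℝ).real (Icc (0:ℝ) 1) := by
      refine norm_setIntegral_le_of_norm_le_const (by simp) fun s _ => ?_
      calc ‖∑ l, (x - y) l * D l f t (x - s • (x - y))‖
          ≤ ∑ l, ‖(x - y) l * D l f t (x - s • (x - y))‖ := norm_sum_le _ _
        _ ≤ ∑ _l : Fin 3, ‖x - y‖ * (L * A) := Finset.sum_le_sum fun l _ => by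
            rw [norm_mul]
            exact mul_le_mul (norm_le_pi_norm (x - y) l) (h1 l _) (norm_nonneg _) (norm_nonneg _)
        _ = 3 * A * r := by simp [hr]; ring
    simpa using this
  rcases le_total 1 r with h | h
  · have := Real.one_le_rpow h (show 0 ≤ 1 - ε by linarith)
    nlinarith
  · have := Real.rpow_le_rpow_of_exponent_ge' hr0 h (show 0 ≤ 1 - ε by linarith)
      (show 1 - ε ≤ 1 by linarith)
    rw [Real.rpow_one] at this
    exact h3.trans (mul_le_mul_of_nonneg_left this (by positivity))

lemma Nb.of_CB {B : ℝ} (hB : 0 ≤ B) (hε : 0 ≤ ε) (hε1 : ε ≤ 1) (hp : 1 ≤ p) {k : ℕ}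
    (h : CB (Icc 0 1) 1 (k + 1) (fun _ _ => B) f) : Nb p ε (3 * B) f where
  l2 := L2b.of_J1 (by positivity) <| by
    refine (J1_le_N1 _).trans ((N1_le_of_abs (B := B ^ 2) fun t ht x => ?_).trans (by nlinarith))
    rw [mul_apply, abs_mul, sq]
    exact mul_le_mul (h.bound t ht x) (h.bound t ht x) (abs_nonneg _) hB
  lp := by
    refine ⟨fun _ => B, continuous_const, h.bound, ?_⟩
    refine (eLpNorm_le_of_ae_bound (C := B) (.of_forall fun _ => by
      rw [Real.norm_of_nonneg hB])).trans ?_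
    simp only [μT, Measure.restrict_apply_univ, Real.volume_Icc]
    simp only [sub_zero, ENNReal.ofReal_one, ENNReal.one_rpow, one_mul]
    exact ENNReal.ofReal_le_ofReal (by linarith)
  hol := by
    refine ⟨fun _ => 3 * B, continuous_const, fun t ht x => (h.bound t ht x).trans (by linarith),
      fun t ht x y => ?_, by simp⟩
    have := holder_of_lipschitz (f := f) (t := t) le_rfl hε hε1 (h.bound t ht)
      (fun i x => (h.D i).bound t ht x) x y
    simpa using this

/-- Hypotheses relating the intermittency scale to the slow scale. -/
structure Intm (Q X p ε : ℝ) : Prop where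
  p_ge : 1 ≤ p
  e_nonneg : 0 ≤ ε
  e_le : ε ≤ 1
  lp : Q ^ 40 ≤ X ^ (2 / p - 1)
  hol : Q ^ 40 ≤ X ^ ε

namespace Blk.Est
variable {b : Blk} {Q X δ p ε : ℝ} (E : b.Est Q X δ p) (I : Intm Q X p ε)
include E

lemma L2b_shr (k : Fin 3) : L2b (mo Q X (-5) 0) (b.shr k) := by
  have S := E.sc
  refine L2b.of_J1 (S.pos _ _).le ((J1_le_N1 _).trans ?_)
  have hX := S.X_one
  have h := (((E.OF_shr k).mul (E.OF_shr k) (by linarith) (S.pos _ _).le (S.pos _ _).le E.he).mono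
    (L' := 4 * X) (by linarith) (by linarith) E.he le_rfl (show 3 ≤ 5 by norm_num)).Sm E.tgg' E.he
    (by linarith) (S.pos _ _) (mul_pos (S.pos _ _) (S.pos _ _))
  refine h.n1.trans ?_
  rw [S.mul, S.mul, S.mul, S.pow]
  exact S.le (by norm_num) (by norm_num)

lemma L2b_W (hst : 0 ≤ N1 b.st + δ) :
    L2b (√(N1 b.st + δ + mo Q X (-5) 0)) b.W := by
  refine L2b.of_J1 (Real.sqrt_nonneg _) ?_
  rw [Real.sq_sqrt (by linarith [E.sc.pos (-5) 0])]
  exact E.J1_W_sq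

include I in
lemma Nb_sh (hst : 0 ≤ N1 b.st + δ) (k : Fin 3) :
    Nb p ε (√(N1 b.st + δ + mo Q X (-5) 0) + mo Q X (-5) 0) (b.sh k) := by
  have S := E.sc
  have hX := S.X_pos
  have hX1 := S.X_one
  have hp0 : 0 < p := by linarith [I.p_ge]
  have h := (E.OF_sh k).toCB E.tg
  have hQ := S.Q_pos
  have hbd : ∀ t x, |b.g t 0| * (mo Q X 33 0 * b.env x) ≤ |b.g t 0| * mo Q X 33 0 := fun t x =>
    mul_le_mul_of_nonneg_left (mul_le_of_le_one_right (S.pos _ _).le (E.he.le_one x))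
      (abs_nonneg _)
  have h33 : mo Q X 33 0 = Q ^ 33 := by simp only [mo, zpow_zero, mul_one]; norm_cast
  have h5 : mo Q X (-5) 0 = (Q ^ 5)⁻¹ := by
    simp only [mo, zpow_zero, mul_one, zpow_neg]; norm_cast
  have hs0 := Real.sqrt_nonneg (N1 b.st + δ + mo Q X (-5) 0)
  have h6 : 6 * (Q ^ 34 * (Q ^ 40)⁻¹) ≤ mo Q X (-5) 0 := by
    rw [h5, show Q ^ 34 * (Q ^ 40)⁻¹ = (Q ^ 5)⁻¹ * Q⁻¹ by field_simp, ← mul_assoc]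
    have : Q⁻¹ ≤ 1000⁻¹ := inv_anti₀ (by norm_num) S.Q_ge
    nlinarith [inv_pos.2 (pow_pos hQ 5)]
  constructor
  · by_cases hk : k = b.i
    · rw [E.sh_eq, if_pos hk]
      exact (E.L2b_W hst).add (E.L2b_shr k)
    · rw [E.sh_eq, if_neg hk, zero_add]
      have := E.L2b_shr k
      exact ⟨by linarith [this.1], this.2.trans (ENNReal.ofReal_le_ofReal (by linarith))⟩
  · refine ⟨fun t => |b.g t 0| * mo Q X 33 0, ((b.g.cont_time 0).abs.mul continuous_const),
      fun t ht x => (h.bound t ht x).trans (hbd t x), ?_⟩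
    have hc : Continuous fun t => |b.g t 0| * mo Q X 33 0 :=
      (b.g.cont_time 0).abs.mul continuous_const
    have : IsFiniteMeasure μT := by unfold μT; infer_instance
    have hm : MemLp (fun t => |b.g t 0| * mo Q X 33 0) (ENNReal.ofReal p) μT := by
      refine MemLp.of_bound (μ := μT) hc.aestronglyMeasurable (mo Q X 1 1 * mo Q X 33 0) ?_
      refine (ae_restrict_iff' measurableSet_Icc).2 (.of_forall fun t ht => ?_)
      rw [norm_mul, Real.norm_of_nonneg (S.pos _ _).le, Real.norm_of_nonneg (abs_nonneg _)]
      exact mul_le_mul_of_nonneg_right (E.tg.sup t ht) (S.pos _ _).le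
    rw [hm.eLpNorm_eq_integral_rpow_norm (by simpa using hp0) (by simp),
      ENNReal.toReal_ofReal hp0.le]
    refine ENNReal.ofReal_le_ofReal ?_
    have e : ∫ t, ‖|b.g t 0| * mo Q X 33 0‖ ^ p ∂μT
        = (∫ t in Icc (0:ℝ) 1, |b.g t 0| ^ p) * mo Q X 33 0 ^ p := by
      rw [← integral_mul_const]
      refine integral_congr_ae (.of_forall fun t => ?_)
      simp only
      rw [Real.norm_of_nonneg (mul_nonneg (abs_nonneg _) (S.pos _ _).le),
        Real.mul_rpow (abs_nonneg _) (S.pos _ _).le]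
    rw [e]
    have hpi : p⁻¹ ≤ 1 := inv_le_one_of_one_le₀ I.p_ge
    have h1 : ((∫ t in Icc (0:ℝ) 1, |b.g t 0| ^ p) * mo Q X 33 0 ^ p) ^ p⁻¹
        ≤ (Q * X ^ (p - 2) * mo Q X 33 0 ^ p) ^ p⁻¹ :=
      Real.rpow_le_rpow (mul_nonneg (integral_nonneg fun t => by positivity)
        (Real.rpow_nonneg (S.pos _ _).le _)) (mul_le_mul_of_nonneg_right E.g_pow
        (Real.rpow_nonneg (S.pos _ _).le _)) (by positivity)
    have h2 : (Q * X ^ (p - 2) * mo Q X 33 0 ^ p) ^ p⁻¹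
        = Q ^ p⁻¹ * (X ^ (2 / p - 1))⁻¹ * Q ^ 33 := by
      rw [Real.mul_rpow (by positivity) (Real.rpow_nonneg (S.pos _ _).le _),
        Real.mul_rpow hQ.le (by positivity), Real.rpow_rpow_inv (S.pos _ _).le hp0.ne', h33,
        ← Real.rpow_mul hX.le, ← Real.rpow_neg hX.le]
      congr 3; field_simp; ring
    have h3 : Q ^ p⁻¹ ≤ Q := by
      simpa using Real.rpow_le_rpow_of_exponent_le S.Q_one hpi
    have h4 : (X ^ (2 / p - 1))⁻¹ ≤ (Q ^ 40)⁻¹ := inv_anti₀ (by positivity) I.lp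
    calc _ ≤ Q ^ p⁻¹ * (X ^ (2 / p - 1))⁻¹ * Q ^ 33 := h1.trans h2.le
      _ ≤ Q * (Q ^ 40)⁻¹ * Q ^ 33 := by gcongr
      _ = Q ^ 34 * (Q ^ 40)⁻¹ := by ring
      _ ≤ _ := by
        have : 0 ≤ Q ^ 34 * (Q ^ 40)⁻¹ := by positivity
        linarith
  · refine ⟨fun t => |b.g t 0| * (6 * (Q ^ 33 * X ^ (1 - ε))),
      (b.g.cont_time 0).abs.mul continuous_const, fun t ht x => ?_, fun t ht x y => ?_, ?_⟩
    · refine ((h.bound t ht x).trans (hbd t x)).trans (mul_le_mul_of_nonneg_left ?_ (abs_nonneg _))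
      rw [h33]
      have : 1 ≤ X ^ (1 - ε) := Real.one_le_rpow hX1 (by linarith [I.e_le])
      nlinarith [pow_pos hQ 33]
    · have h1 := holder_of_lipschitz (f := b.sh k) (t := t) (A := |b.g t 0| * mo Q X 33 0)
        (L := 2 * X) (by linarith) I.e_nonneg I.e_le
        (fun x => (h.bound t ht x).trans (hbd t x))
        (fun i x => ((h.D i).bound t ht x).trans
          (mul_le_mul_of_nonneg_left (hbd t x) (by linarith))) x y
      refine h1.trans (mul_le_mul_of_nonneg_right ?_ (by positivity))
      rw [h33, Real.mul_rpow zero_le_two hX.le]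
      have h2 : (2:ℝ) ^ (1 - ε) ≤ 2 := by
        simpa using Real.rpow_le_rpow_of_exponent_le one_le_two
          (show 1 - ε ≤ 1 by linarith [I.e_nonneg])
      have h3 : 0 ≤ |b.g t 0| * Q ^ 33 * X ^ (1 - ε) := by positivity
      calc _ = 3 * (|b.g t 0| * Q ^ 33 * X ^ (1 - ε)) * 2 ^ (1 - ε) := by ring
        _ ≤ 3 * (|b.g t 0| * Q ^ 33 * X ^ (1 - ε)) * 2 := by gcongr
        _ = _ := by ring
    · rw [integral_mul_const]
      have h1 : mo Q X 1 (-1) = Q * X⁻¹ := by simp [mo]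
      have h2 := E.tg.int
      rw [h1] at h2
      have h3 : X ^ (1 - ε) = X * (X ^ ε)⁻¹ := by
        rw [Real.rpow_sub hX, Real.rpow_one, div_eq_mul_inv]
      calc _ ≤ Q * X⁻¹ * (6 * (Q ^ 33 * X ^ (1 - ε))) := by gcongr
        _ = 6 * (Q ^ 34 * (X ^ ε)⁻¹) := by rw [h3]; field_simp
        _ ≤ 6 * (Q ^ 34 * (Q ^ 40)⁻¹) := by
            gcongr; exact I.hol
        _ ≤ _ := by linarith

end Blk.Est
end Fld

namespace Fld

lemma exists_bound {J : Set ℝ} (hJ : IsCompact J) (f : Fld) :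
    ∃ B, 0 ≤ B ∧ ∀ t ∈ J, ∀ x, |f t x| ≤ B := by
  obtain ⟨C, hC⟩ := (hJ.prod isCompact_cube).exists_bound_of_continuousOn
    (f := fun q : ℝ × V3 => f q.1 q.2) f.smooth.continuous.continuousOn
  refine ⟨max C 0, le_max_right _ _, fun t ht x => ?_⟩
  have h := f.per t (fun i => Int.fract (x i)) (fun i => ⌊x i⌋)
  have h2 : ((fun i => Int.fract (x i)) + fun i => ((⌊x i⌋ : ℤ) : ℝ)) = x := by
    ext i; exact Int.fract_add_floor (x i)
  rw [h2] at h
  rw [show f t x = _ from h]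
  refine le_trans ?_ (le_max_left _ _)
  exact hC (t, fun i => Int.fract (x i))
    ⟨ht, fun i => Int.fract_nonneg _, fun i => (Int.fract_lt_one _).le⟩

lemma pi_norm_le_sum {v G : Fin 3 → ℝ} (h : ∀ k, |v k| ≤ G k) : ‖v‖ ≤ ∑ k, G k := by
  have h0 : ∀ k, 0 ≤ G k := fun k => (abs_nonneg _).trans (h k)
  refine (pi_norm_le_iff_of_nonneg (Finset.sum_nonneg fun k _ => h0 k)).2 fun k => ?_
  exact (h k).trans (Finset.single_le_sum (fun k _ => h0 k) (Finset.mem_univ k))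

/-- The difference quotient in the Hölder seminorm. -/
def hq (ε : ℝ) (g : V3 → V3) (q : V3 × V3) : ℝ :=
  if q.1 = q.2 then 0 else ‖g q.1 - g q.2‖ / ‖q.1 - q.2‖ ^ (1 - ε)

lemma hq_le {ε C : ℝ} {g : V3 → V3} (hC : 0 ≤ C)
    (h : ∀ x y, ‖g x - g y‖ ≤ C * ‖x - y‖ ^ (1 - ε)) (q : V3 × V3) : hq ε g q ≤ C := by
  unfold hq
  split_ifs with hne
  · exact hC
  · exact div_le_of_le_mul₀ (by positivity) hC (h _ _)

variable {p ε η : ℝ}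

lemma exists_holder_bound {J : Set ℝ} (hJ : IsCompact J) (hε : 0 ≤ ε) (hε1 : ε ≤ 1)
    (f : Fin 3 → Fld) : ∃ C, 0 ≤ C ∧ ∀ t ∈ J, (∀ x, ‖toV f t x‖ ≤ C) ∧
      ∀ x y, ‖toV f t x - toV f t y‖ ≤ C * ‖x - y‖ ^ (1 - ε) := by
  have key : ∀ k, ∃ C, 0 ≤ C ∧ ∀ t ∈ J, (∀ x, |f k t x| ≤ C) ∧
      ∀ x y, |f k t x - f k t y| ≤ C * ‖x - y‖ ^ (1 - ε) := by
    intro k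
    obtain ⟨B, hB, h0⟩ := exists_bound hJ (f k)
    choose B' hB' h1 using fun i => exists_bound hJ (D i (f k))
    set A := B + ∑ i, B' i
    have hs : 0 ≤ ∑ i, B' i := Finset.sum_nonneg fun i _ => hB' i
    have hA : 0 ≤ A := add_nonneg hB hs
    refine ⟨3 * A, by linarith, fun t ht => ⟨fun x => ?_, fun x y => ?_⟩⟩
    · have := h0 t ht x
      simp only [A] at *; linarith
    · have := holder_of_lipschitz (f := f k) (t := t) (A := A) (L := 1) le_rfl hε hε1
        (fun x => (h0 t ht x).trans (by simp only [A]; linarith))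
        (fun i x => (h1 i t ht x).trans ?_) x y
      · simpa using this
      · have := Finset.single_le_sum (fun k _ => hB' k) (Finset.mem_univ i)
        simp only [A]; linarith
  choose C hC h using key
  refine ⟨∑ k, C k, Finset.sum_nonneg fun k _ => hC k, fun t ht =>
    ⟨fun x => pi_norm_le_sum fun k => (h k t ht).1 x, fun x y => ?_⟩⟩
  rw [Finset.sum_mul]
  exact pi_norm_le_sum fun k => (h k t ht).2 x y

lemma bdd_sup (f : Fin 3 → Fld) (t : ℝ) : BddAbove (range fun x => ‖toV f t x‖) := by
  obtain ⟨C, -, h⟩ := exists_holder_bound (isCompact_singleton (x := t)) le_rfl zero_le_one f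
  exact ⟨C, by rintro _ ⟨x, rfl⟩; exact (h t rfl).1 x⟩

lemma bdd_hq (hε : 0 ≤ ε) (hε1 : ε ≤ 1) (f : Fin 3 → Fld) (t : ℝ) :
    BddAbove (range fun q => hq ε (toV f t) q) := by
  obtain ⟨C, hC, h⟩ := exists_holder_bound (isCompact_singleton (x := t)) hε hε1 f
  exact ⟨C, by rintro _ ⟨x, rfl⟩; exact hq_le hC (h t rfl).2 x⟩

lemma continuous_toV (f : Fin 3 → Fld) (x : V3) : Continuous fun t => toV f t x :=
  continuous_pi fun k => (f k).cont_time x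

lemma measurable_sup (f : Fin 3 → Fld) : Measurable fun t => ⨆ x, ‖toV f t x‖ :=
  (lowerSemicontinuous_ciSup (bdd_sup f) fun x =>
    (continuous_toV f x).norm.lowerSemicontinuous).measurable

lemma measurable_holder (hε : 0 ≤ ε) (hε1 : ε ≤ 1) (f : Fin 3 → Fld) :
    Measurable fun t => holderNorm (1 - ε) (toV f t) := by
  refine (measurable_sup f).add (lowerSemicontinuous_ciSup (bdd_hq hε hε1 f) fun q => ?_).measurable
  refine Continuous.lowerSemicontinuous ?_
  unfold hq
  split_ifs
  · exact continuous_const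
  · exact ((continuous_toV f _).sub (continuous_toV f _)).norm.div_const _

lemma holderNorm_le_add {g g' : V3 → V3} {H : ℝ} (hH : 0 ≤ H)
    (b1 : BddAbove (range fun x => ‖g x‖)) (b2 : BddAbove (range fun q => hq ε g q))
    (h1 : ∀ x, ‖g' x‖ ≤ ‖g x‖ + H)
    (h2 : ∀ x y, ‖g' x - g' y‖ ≤ ‖g x - g y‖ + H * ‖x - y‖ ^ (1 - ε)) :
    holderNorm (1 - ε) g' ≤ holderNorm (1 - ε) g + 2 * H := by
  have e1 : (⨆ x, ‖g' x‖) ≤ (⨆ x, ‖g x‖) + H :=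
    ciSup_le fun x => (h1 x).trans (by linarith [le_ciSup b1 x])
  have e2 : (⨆ q, hq ε g' q) ≤ (⨆ q, hq ε g q) + H := by
    refine ciSup_le fun q => ?_
    have := le_ciSup b2 q
    refine le_trans ?_ (add_le_add_left this H)
    simp only [hq]
    split_ifs with hne
    · linarith
    · have hp : 0 < ‖q.1 - q.2‖ ^ (1 - ε) := Real.rpow_pos_of_pos (norm_pos_iff.2 (sub_ne_zero.2 hne)) _
      rw [div_add' _ _ _ hp.ne']
      exact div_le_div_of_nonneg_right (h2 _ _) hp.le
  change (⨆ x, ‖g' x‖) + (⨆ q, hq ε g' q) ≤ (⨆ x, ‖g x‖) + (⨆ q, hq ε g q) + _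
  linarith

lemma closure_interior_cube : cube ⊆ closure (interior cube) := by
  have hc : Convex ℝ cube := convex_Icc 0 1
  have hi : (interior cube).Nonempty := by
    refine ⟨fun _ => 1 / 2, ?_⟩
    rw [cube, ← pi_univ_Icc, interior_pi_set finite_univ]
    intro i _
    simp only [interior_Icc]
    constructor <;> norm_num
  rw [hc.closure_interior_eq_closure_of_nonempty_interior hi]
  exact subset_closure

lemma LinfN_eq_sup (f : Fin 3 → Fld) (t : ℝ) : LinfN (toV f t) = ⨆ x, ‖toV f t x‖ := by
  have hb : ∀ x, ‖toV f t x‖ ≤ ⨆ x, ‖toV f t x‖ := fun x => le_ciSup (bdd_sup f t) x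
  have hs0 : 0 ≤ ⨆ x, ‖toV f t x‖ := (norm_nonneg _).trans (hb 0)
  have hle : eLpNorm (toV f t) ⊤ μc ≤ ENNReal.ofReal (⨆ x, ‖toV f t x‖) := by
    rw [eLpNorm_exponent_top]
    exact eLpNormEssSup_le_of_ae_bound (.of_forall hb)
  have hfin : eLpNorm (toV f t) ⊤ μc ≠ ⊤ := ne_top_of_le_ne_top ENNReal.ofReal_ne_top hle
  have hcont : Continuous (toV f t) := continuous_pi fun k => (f k).cont_space t
  refine le_antisymm (ENNReal.toReal_le_of_le_ofReal hs0 hle) (ciSup_le fun x => ?_)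
  set c := LinfN (toV f t)
  have hae : ∀ᵐ y ∂(volume.restrict cube), max ‖toV f t y‖ c = c := by
    have := ae_le_eLpNormEssSup (f := toV f t) (μ := μc)
    filter_upwards [this] with y hy
    refine max_eq_right ?_
    rw [← eLpNorm_exponent_top] at hy
    have := ENNReal.toReal_mono hfin hy
    simpa [c, LinfN, eLpNorm_exponent_top] using this
  have he := Measure.eqOn_of_ae_eq hae (hcont.norm.max continuous_const).continuousOn
    continuousOn_const closure_interior_cube
  have hx : toV f t x = toV f t (fun i => Int.fract (x i)) := by
    have h := toV_per f t (fun i => Int.fract (x i)) (fun i => ⌊x i⌋)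
    rwa [show ((fun i => Int.fract (x i)) + fun i => ((⌊x i⌋ : ℤ) : ℝ)) = x by
      ext i; exact Int.fract_add_floor (x i)] at h
  rw [hx]
  exact max_eq_right_iff.1 (he (x := fun i => Int.fract (x i))
    ⟨fun i => Int.fract_nonneg _, fun i => (Int.fract_lt_one _).le⟩)

lemma memLp_sup (hp : 1 ≤ p) (f : Fin 3 → Fld) :
    MemLp (fun t => ⨆ x, ‖toV f t x‖) (ENNReal.ofReal p) μT := by
  obtain ⟨C, hC, h⟩ := exists_holder_bound (isCompact_Icc (a := (0:ℝ)) (b := 1)) le_rfl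
    zero_le_one f
  have : IsFiniteMeasure μT := by unfold μT; infer_instance
  refine MemLp.of_bound (measurable_sup f).aestronglyMeasurable C ?_
  refine (ae_restrict_iff' measurableSet_Icc).2 (.of_forall fun t ht => ?_)
  rw [Real.norm_of_nonneg (Real.iSup_nonneg fun _ => norm_nonneg _)]
  exact ciSup_le (h t ht).1

lemma integrable_holder (hε : 0 ≤ ε) (hε1 : ε ≤ 1) (f : Fin 3 → Fld) :
    IntegrableOn (fun t => holderNorm (1 - ε) (toV f t)) (Icc 0 1) := by
  obtain ⟨C, hC, h⟩ := exists_holder_bound (isCompact_Icc (a := (0:ℝ)) (b := 1)) hε hε1 f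
  refine Measure.integrableOn_of_bounded (M := C + C) (by simp)
    (measurable_holder hε hε1 f).aestronglyMeasurable ?_
  refine (ae_restrict_iff' measurableSet_Icc).2 (.of_forall fun t ht => ?_)
  have h1 : 0 ≤ ⨆ x, ‖toV f t x‖ := Real.iSup_nonneg fun _ => norm_nonneg _
  have h2 : 0 ≤ ⨆ q, hq ε (toV f t) q := Real.iSup_nonneg fun q => by
    unfold hq; split_ifs <;> positivity
  change ‖(⨆ x, ‖toV f t x‖) + (⨆ q, hq ε (toV f t) q)‖ ≤ _
  rw [Real.norm_of_nonneg (by linarith)]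
  exact add_le_add (ciSup_le (h t ht).1) (ciSup_le (hq_le hC (h t ht).2))

lemma nLpLinf_add_le (hp : 1 ≤ p) {f d : Fin 3 → Fld} (hd : ∀ k, Nb p ε η (d k)) :
    nLpLinf p (toV (f + d)) ≤ nLpLinf p (toV f) + 3 * η := by
  have hη := (hd 0).l2.1
  choose G hG hb hn using fun k => (hd k).lp
  have h1 : eLpNorm (fun t => LinfN (toV (f + d) t)) (ENNReal.ofReal p) μT ≤
      eLpNorm (fun t => ⨆ x, ‖toV f t x‖) (ENNReal.ofReal p) μT + ENNReal.ofReal (3 * η) := by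
    have hc : ∀ k, AEStronglyMeasurable (G k) μT := fun k => (hG k).aestronglyMeasurable
    have hp' : 1 ≤ ENNReal.ofReal p := by simpa using ENNReal.ofReal_le_ofReal hp
    have h3 : eLpNorm (fun t => ∑ k, G k t) (ENNReal.ofReal p) μT ≤ ENNReal.ofReal (3 * η) := by
      have := eLpNorm_sum_le (s := Finset.univ) (fun k _ => hc k) hp'
      have e : (∑ k, G k) = fun t => ∑ k, G k t := by ext t; simp
      rw [e] at this
      refine this.trans ((Finset.sum_le_sum fun k _ => hn k).trans ?_)
      simp only [Finset.sum_const, Finset.card_univ, Fintype.card_fin, nsmul_eq_mul]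
      rw [ENNReal.ofReal_mul (by norm_num)]; simp
    refine le_trans ?_ ((eLpNorm_add_le (memLp_sup hp f).1
      (continuous_finsetSum _ fun k _ => hG k).aestronglyMeasurable hp').trans
      (add_le_add_right h3 _))
    refine eLpNorm_mono_ae ?_
    refine (ae_restrict_iff' measurableSet_Icc).2 (.of_forall fun t ht => ?_)
    rw [LinfN_eq_sup, Real.norm_of_nonneg (Real.iSup_nonneg fun _ => norm_nonneg _)]
    refine le_trans (ciSup_le fun x => ?_) (Real.le_norm_self _)
    have : toV (f + d) t x = toV f t x + toV d t x := rfl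
    rw [this]
    exact (norm_add_le _ _).trans (add_le_add (le_ciSup (bdd_sup f t) x)
      (pi_norm_le_sum fun k => hb k t ht x))
  have h2 := ENNReal.toReal_mono (ENNReal.add_ne_top.2 ⟨(memLp_sup hp f).eLpNorm_ne_top,
    ENNReal.ofReal_ne_top⟩) h1
  rw [ENNReal.toReal_add (memLp_sup hp f).eLpNorm_ne_top ENNReal.ofReal_ne_top,
    ENNReal.toReal_ofReal (by linarith)] at h2
  simpa only [nLpLinf, LinfN_eq_sup] using h2

lemma nL1C_add_le (hε : 0 ≤ ε) (hε1 : ε ≤ 1) {f d : Fin 3 → Fld} (hd : ∀ k, Nb p ε η (d k)) :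
    nL1C ε (toV (f + d)) ≤ nL1C ε (toV f) + 6 * η := by
  choose H hH hb hl hn using fun k => (hd k).hol
  have hi : ∀ k, IntegrableOn (H k) (Icc 0 1) := fun k => integrableOn_Icc (hH k)
  have hS : IntegrableOn (fun t => ∑ k, H k t) (Icc 0 1) := integrable_finsetSum _ fun k _ => hi k
  have hle : ∀ t ∈ Icc (0:ℝ) 1, holderNorm (1 - ε) (toV (f + d) t) ≤
      holderNorm (1 - ε) (toV f t) + 2 * ∑ k, H k t := by
    intro t ht
    have h0 : ∀ k, 0 ≤ H k t := fun k => (abs_nonneg _).trans (hb k t ht 0)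
    have e : ∀ x, toV (f + d) t x = toV f t x + toV d t x := fun x => rfl
    refine holderNorm_le_add (Finset.sum_nonneg fun k _ => h0 k) (bdd_sup f t)
      (bdd_hq hε hε1 f t) (fun x => ?_) (fun x y => ?_)
    · rw [e]
      exact (norm_add_le _ _).trans (add_le_add_right (pi_norm_le_sum fun k => hb k t ht x) _)
    · rw [e, e, add_sub_add_comm, Finset.sum_mul]
      exact (norm_add_le _ _).trans
        (add_le_add_right (pi_norm_le_sum fun k => hl k t ht x y) _)
  have h1 := setIntegral_mono_on (integrable_holder hε hε1 (f + d))
    ((integrable_holder hε hε1 f).add (hS.const_mul 2)) measurableSet_Icc hle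
  refine h1.trans ?_
  simp only [Pi.add_apply]
  rw [integral_add (integrable_holder hε hε1 f) (hS.const_mul 2), integral_const_mul,
    integral_finsetSum _ fun k _ => hi k]
  have : ∑ k, ∫ t in Icc (0:ℝ) 1, H k t ≤ 3 * η := by
    refine (Finset.sum_le_sum fun k _ => hn k).trans ?_
    simp
  simp only [nL1C]
  linarith

lemma aesm_toV (f : Fin 3 → Fld) :
    AEStronglyMeasurable (fun q : ℝ × V3 => toV f q.1 q.2) (μT.prod μc) :=
  (toV_smooth f).continuous.aestronglyMeasurable

lemma eLpNorm_toV_le {d : Fin 3 → Fld} (hd : ∀ k, L2b η (d k)) :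
    eLpNorm (fun q : ℝ × V3 => toV d q.1 q.2) 2 (μT.prod μc) ≤ ENNReal.ofReal (3 * η) := by
  have h := eLpNorm_sum_le (s := Finset.univ) (f := fun (k : Fin 3) (q : ℝ × V3) => |d k q.1 q.2|)
    (μ := μT.prod μc) (p := 2) (fun k _ => (aesm (d k)).norm) (by norm_num)
  have h2 : eLpNorm (fun q : ℝ × V3 => toV d q.1 q.2) 2 (μT.prod μc) ≤
      eLpNorm (∑ k : Fin 3, fun q : ℝ × V3 => |d k q.1 q.2|) 2 (μT.prod μc) := by
    refine eLpNorm_mono fun q => ?_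
    refine le_trans (pi_norm_le_sum (G := fun k => |d k q.1 q.2|) fun k => le_rfl) ?_
    rw [Finset.sum_apply]; exact Real.le_norm_self _
  refine h2.trans (h.trans ((Finset.sum_le_sum (g := fun _ => ENNReal.ofReal η)
    fun k _ => ?_).trans ?_))
  · exact (eLpNorm_norm (fun q : ℝ × V3 => d k q.1 q.2)).trans_le (hd k).2
  · simp only [Finset.sum_const, Finset.card_univ, Fintype.card_fin, nsmul_eq_mul]
    rw [ENNReal.ofReal_mul (by norm_num)]; simp

lemma nL2tx_add_le {f d : Fin 3 → Fld} (hd : ∀ k, Nb p ε η (d k)) :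
    nL2tx (toV (f + d)) ≤ nL2tx (toV f) + 3 * η := by
  have hη := (hd 0).l2.1
  have : IsFiniteMeasure μT := by unfold μT; infer_instance
  have : IsFiniteMeasure μc := 
    ⟨by rw [μc, Measure.restrict_apply_univ]; exact isCompact_cube.measure_lt_top⟩
  have hf : eLpNorm (fun q : ℝ × V3 => toV f q.1 q.2) 2 (μT.prod μc) ≠ ⊤ := by
    obtain ⟨C, hC, h⟩ := exists_holder_bound (isCompact_Icc (a := (0:ℝ)) (b := 1)) le_rfl
      zero_le_one f
    refine (MemLp.of_bound (aesm_toV f) C ?_).eLpNorm_ne_top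
    have h1 : ∀ᵐ q ∂(μT.prod μc), q ∈ Icc (0:ℝ) 1 ×ˢ cube := by
      rw [μT, μc, Measure.prod_restrict]
      exact ae_restrict_mem (measurableSet_Icc.prod measurableSet_Icc)
    filter_upwards [h1] with q hq using (h q.1 hq.1).1 q.2
  have h1 := (eLpNorm_add_le (aesm_toV f) (aesm_toV d) (by norm_num : (1:ℝ≥0∞) ≤ 2)).trans
    (add_le_add_right (eLpNorm_toV_le fun k => (hd k).l2) _)
  have h2 := ENNReal.toReal_mono (ENNReal.add_ne_top.2 ⟨hf, ENNReal.ofReal_ne_top⟩) h1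
  rw [ENNReal.toReal_add hf ENNReal.ofReal_ne_top, ENNReal.toReal_ofReal (by linarith)] at h2
  exact h2

end Fld

namespace Fld

/-- Iterated derivative along a list of directions. -/
def Dl : List (Fin 3) → Fld → Fld
  | [], f => f
  | i :: l, f => D i (Dl l f)

lemma D_Dl (i : Fin 3) : ∀ (l : List (Fin 3)) (f : Fld), D i (Dl l f) = Dl l (D i f)
  | [], _ => rfl
  | j :: l, f => by simp only [Dl]; rw [D_comm, D_Dl i l]

lemma Dl_apply (f : Fld) (t : ℝ) : ∀ l : List (Fin 3), (Dl l f) t = pdList l (f t)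
  | [] => rfl
  | i :: l => by rw [Dl, D_fun, Dl_apply f t l]; rfl

lemma HB_iff {J : Set ℝ} {M : ℝ} : ∀ {k : ℕ} {f : Fld}, HB J k M f ↔
    ∀ l : List (Fin 3), l.length ≤ k → ∀ t ∈ J, ∫ x in cube, Dl l f t x ^ 2 ≤ M ^ 2
  | 0, f => ⟨fun h l hl => by
      rw [List.length_eq_zero_iff.1 (Nat.le_zero.1 hl)]; exact h, fun h => h [] le_rfl⟩
  | k + 1, f => ⟨fun h l hl => by
      cases l with
      | nil => exact h.1
      | cons i l => rw [Dl, D_Dl]; exact HB_iff.1 (h.2 i) l (by simpa using hl),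
    fun h => ⟨h [] (Nat.zero_le _), fun i => HB_iff.2 fun l hl => by
      have := h (i :: l) (by simpa using hl)
      rwa [Dl, D_Dl] at this⟩⟩

lemma exists_HB (k : ℕ) : ∀ f : Fld, ∃ M, 0 ≤ M ∧ HB (Icc 0 1) k M f := by
  induction k with
  | zero =>
    intro f
    obtain ⟨B, hB, h⟩ := exists_bound (isCompact_Icc (a := (0:ℝ)) (b := 1)) f
    exact ⟨B, hB, CB.toHB (k := 0) h⟩
  | succ k ih =>
    intro f
    obtain ⟨B, hB, h⟩ := exists_bound (isCompact_Icc (a := (0:ℝ)) (b := 1)) f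
    choose M hM hi using fun i => ih (D i f)
    have hs : 0 ≤ ∑ i, M i := Finset.sum_nonneg fun i _ => hM i
    refine ⟨B + ∑ i, M i, by linarith, (CB.toHB (k := 0) h).mono hB (by linarith), fun i =>
      (hi i).mono (hM i) ?_⟩
    linarith [Finset.single_le_sum (fun k _ => hM k) (Finset.mem_univ i)]

lemma H3sq_le {M t : ℝ} {f : Fld} (h : HB (Icc 0 1) 3 M f) (ht : t ∈ Icc (0:ℝ) 1) :
    H3sq (f t) ≤ 40 * M ^ 2 := by
  have h1 : H3sq (f t) ≤ ∑ n ∈ Finset.range 4, ∑ α : Fin n → Fin 3, M ^ 2 := by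
    refine Finset.sum_le_sum fun n hn => Finset.sum_le_sum fun α _ => ?_
    rw [← Dl_apply]
    refine HB_iff.1 h _ ?_ t ht
    have := Finset.mem_range.1 hn
    simp only [List.length_ofFn]; omega
  refine h1.trans (le_of_eq ?_)
  simp [Finset.sum_range_succ]
  ring

lemma H3sq_nonneg (f : V3 → ℝ) : 0 ≤ H3sq f :=
  Finset.sum_nonneg fun _ _ => Finset.sum_nonneg fun _ _ => integral_nonneg fun _ => sq_nonneg _

lemma integral_le_H3sq (f : Fld) (t : ℝ) {l : List (Fin 3)} (hl : l.length ≤ 3) :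
    ∫ x in cube, Dl l f t x ^ 2 ≤ H3sq (f t) := by
  have h1 := Finset.single_le_sum (s := Finset.range 4)
    (f := fun n => ∑ α : Fin n → Fin 3, ∫ x in cube, (pdList (List.ofFn α) (f t) x) ^ 2)
    (fun _ _ => Finset.sum_nonneg fun _ _ => integral_nonneg fun _ => sq_nonneg _)
    (Finset.mem_range.2 (Nat.lt_succ_of_le hl))
  have h2 := Finset.single_le_sum (s := Finset.univ)
    (f := fun α : Fin l.length → Fin 3 => ∫ x in cube, (pdList (List.ofFn α) (f t) x) ^ 2)
    (fun _ _ => integral_nonneg fun _ => sq_nonneg _) (Finset.mem_univ l.get)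
  refine le_trans (le_of_eq ?_) (h2.trans h1)
  simp only [List.ofFn_get, Dl_apply]

lemma H3v_le {M t : ℝ} (hM : 0 ≤ M) {V : Fin 3 → Fld} (h : ∀ i, HB (Icc 0 1) 3 M (V i))
    (ht : t ∈ Icc (0:ℝ) 1) : H3v (toV V t) ≤ 11 * M := by
  refine Real.sqrt_le_iff.2 ⟨by positivity, ?_⟩
  refine (Finset.sum_le_sum fun i _ => H3sq_le (h i) ht).trans ?_
  simp; nlinarith [sq_nonneg M]

lemma H3m_le {M t : ℝ} (hM : 0 ≤ M) {V : Fin 3 → Fin 3 → Fld}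
    (h : ∀ i j, HB (Icc 0 1) 3 M (V i j)) (ht : t ∈ Icc (0:ℝ) 1) : H3m (toM V t) ≤ 19 * M := by
  refine Real.sqrt_le_iff.2 ⟨by positivity, ?_⟩
  refine (Finset.sum_le_sum fun i _ => Finset.sum_le_sum fun j _ => H3sq_le (h i j) ht).trans ?_
  simp; nlinarith [sq_nonneg M]

lemma nLinfH3v_le {M : ℝ} (hM : 0 ≤ M) {V : Fin 3 → Fld} (h : ∀ i, HB (Icc 0 1) 3 M (V i)) :
    nLinfH3v (toV V) ≤ 11 * M :=
  Real.iSup_le (fun t => H3v_le hM h t.2) (by positivity)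

lemma nLinfH3m_le {M : ℝ} (hM : 0 ≤ M) {V : Fin 3 → Fin 3 → Fld}
    (h : ∀ i j, HB (Icc 0 1) 3 M (V i j)) : nLinfH3m (toM V) ≤ 19 * M :=
  Real.iSup_le (fun t => H3m_le hM h t.2) (by positivity)

lemma HB_of_nLinfH3v (V : Fin 3 → Fld) (i : Fin 3) :
    HB (Icc 0 1) 3 (nLinfH3v (toV V)) (V i) := by
  choose M hM h using fun i => exists_HB 3 (V i)
  have hs : 0 ≤ ∑ i, M i := Finset.sum_nonneg fun i _ => hM i
  have hb : BddAbove (range fun t : Icc (0:ℝ) 1 => H3v (toV V t)) := by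
    refine ⟨11 * ∑ i, M i, ?_⟩
    rintro _ ⟨t, rfl⟩
    exact H3v_le hs (fun i => (h i).mono (hM i)
      (Finset.single_le_sum (fun k _ => hM k) (Finset.mem_univ i))) t.2
  refine HB_iff.2 fun l hl t ht => (integral_le_H3sq (V i) t hl).trans ?_
  have h1 : H3sq (V i t) ≤ ∑ i, H3sq (fun x => toV V t x i) :=
    Finset.single_le_sum (f := fun i => H3sq (fun x => toV V t x i))
      (fun i _ => H3sq_nonneg _) (Finset.mem_univ i)
  refine h1.trans ?_
  rw [← Real.sq_sqrt (Finset.sum_nonneg fun i _ => H3sq_nonneg _)]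
  exact pow_le_pow_left₀ (Real.sqrt_nonneg _) (le_ciSup hb ⟨t, ht⟩) 2

lemma HB_of_nLinfH3m (V : Fin 3 → Fin 3 → Fld) (i j : Fin 3) :
    HB (Icc 0 1) 3 (nLinfH3m (toM V)) (V i j) := by
  choose M hM h using fun q : Fin 3 × Fin 3 => exists_HB 3 (V q.1 q.2)
  have hs : 0 ≤ ∑ q, M q := Finset.sum_nonneg fun i _ => hM i
  have hb : BddAbove (range fun t : Icc (0:ℝ) 1 => H3m (toM V t)) := by
    refine ⟨19 * ∑ i, M i, ?_⟩
    rintro _ ⟨t, rfl⟩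
    exact H3m_le hs (fun i j => (h (i, j)).mono (hM (i, j))
      (Finset.single_le_sum (fun k _ => hM k) (Finset.mem_univ (i, j)))) t.2
  refine HB_iff.2 fun l hl t ht => (integral_le_H3sq (V i j) t hl).trans ?_
  have h1 : H3sq (V i j t) ≤ ∑ j, H3sq (fun x => toM V t x i j) :=
    Finset.single_le_sum (f := fun j => H3sq (fun x => toM V t x i j))
      (fun i _ => H3sq_nonneg _) (Finset.mem_univ j)
  have h2 : ∑ j, H3sq (fun x => toM V t x i j) ≤ ∑ i, ∑ j, H3sq (fun x => toM V t x i j) :=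
    Finset.single_le_sum (f := fun i => ∑ j, H3sq (fun x => toM V t x i j))
      (fun i _ => Finset.sum_nonneg fun j _ => H3sq_nonneg _) (Finset.mem_univ i)
  refine (h1.trans h2).trans ?_
  rw [← Real.sq_sqrt (Finset.sum_nonneg fun i _ => Finset.sum_nonneg fun j _ => H3sq_nonneg _)]
  exact pow_le_pow_left₀ (Real.sqrt_nonneg _) (le_ciSup hb ⟨t, ht⟩) 2

lemma continuous_toM (V : Fin 3 → Fin 3 → Fld) :
    Continuous (Function.uncurry fun t x => ‖toM V t x‖) :=
  ((toM_smooth V).continuous).norm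

lemma integrable_toM (V : Fin 3 → Fin 3 → Fld) (t : ℝ) :
    IntegrableOn (fun x => ‖toM V t x‖) cube :=
  ((continuous_toM V).comp (by fun_prop : Continuous fun x : V3 => (t, x))).continuousOn
    |>.integrableOn_compact isCompact_cube

lemma N1_le_nL1tx (V : Fin 3 → Fin 3 → Fld) (i j : Fin 3) : N1 (V i j) ≤ nL1tx (toM V) := by
  refine setIntegral_mono_on (integrable_slice_abs _)
    (integrableOn_Icc (continuous_integral_cube (continuous_toM V))) measurableSet_Icc
    fun t _ => setIntegral_mono_on (integrable_cube_abs _ t) (integrable_toM V t)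
      isCompact_cube.measurableSet fun x _ => ?_
  exact (norm_le_pi_norm (toM V t x i) j).trans (norm_le_pi_norm (toM V t x) i)

lemma nL1tx_le {η : ℝ} {V : Fin 3 → Fin 3 → Fld} (h : ∀ i j, N1 (V i j) ≤ η) :
    nL1tx (toM V) ≤ 9 * η := by
  have h1 : nL1tx (toM V) ≤ ∫ t in Icc (0:ℝ) 1, ∑ i, ∑ j, ∫ x in cube, |V i j t x| := by
    refine setIntegral_mono_on
      (integrableOn_Icc (continuous_integral_cube (continuous_toM V)))
      (integrable_finsetSum _ fun i _ => integrable_finsetSum _ fun j _ =>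
        integrable_slice_abs _) measurableSet_Icc fun t _ => ?_
    simp only [← integral_finsetSum Finset.univ fun j _ => integrable_cube_abs _ t]
    rw [← integral_finsetSum _ fun i _ => integrable_finsetSum _ fun j _ =>
      integrable_cube_abs (V i j) t]
    refine setIntegral_mono_on (integrable_toM V t) (integrable_finsetSum _ fun i _ =>
      integrable_finsetSum _ fun j _ => integrable_cube_abs (V i j) t)
      isCompact_cube.measurableSet fun x _ => ?_
    have h0 : ∀ i, 0 ≤ ∑ j, |V i j t x| := fun i => Finset.sum_nonneg fun j _ => abs_nonneg _
    refine (pi_norm_le_iff_of_nonneg (Finset.sum_nonneg fun i _ => h0 i)).2 fun i =>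
      le_trans ?_ (Finset.single_le_sum (fun i _ => h0 i) (Finset.mem_univ i))
    exact (pi_norm_le_iff_of_nonneg (h0 i)).2 fun j =>
      Finset.single_le_sum (f := fun j => |V i j t x|) (fun j _ => abs_nonneg _)
        (Finset.mem_univ j)
  refine h1.trans ?_
  rw [integral_finsetSum _ fun i _ => integrable_finsetSum _ fun j _ => integrable_slice_abs _]
  simp only [integral_finsetSum Finset.univ fun j _ => integrable_slice_abs _]
  refine (Finset.sum_le_sum fun i _ => Finset.sum_le_sum fun j _ => h i j).trans ?_
  simp; linarith

lemma Sm.smul {η K : ℝ} {f : Fld} (h : Sm η K f) {c : ℝ} (hc : |c| ≤ 1) : Sm η K (c • f) := by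
  refine ⟨h.pos, le_trans (N1_mono fun t _ x => ?_) h.n1, ?_⟩
  · rw [smul_apply, abs_mul]
    exact mul_le_of_le_one_left (abs_nonneg _) hc
  · rw [Algebra.smul_def]
    exact h.hb.mul_time (fun i => (D i).map_algebraMap c) fun t _ x => hc

lemma sm_symTF {η K : ℝ} {S : Fin 3 → Fin 3 → Fld} (h : ∀ i j, Sm η K (S i j)) (i j : Fin 3) :
    Sm (5 * η) (5 * K) (symTF S i j) := by
  have h1 := ((h i j).add (h j i)).smul (c := 1 / 2) (by norm_num [abs_of_pos])
  have h2 := ((Sm.sum fun k => h k k).smul (c := 1 / 3) (by norm_num [abs_of_pos])).ite (i = j)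
  refine (h1.sub h2).mono ?_ ?_ <;> simp <;> linarith

lemma sm_skewP {η K : ℝ} {S : Fin 3 → Fin 3 → Fld} (h : ∀ i j, Sm η K (S i j)) (i j : Fin 3) :
    Sm (2 * η) (2 * K) (skewP S i j) :=
  (((h i j).sub (h j i)).smul (c := 1 / 2) (by norm_num [abs_of_pos])).mono
    (by linarith) (by linarith)

/-- Smallness of all stress components yields the stress estimates. -/
lemma stress_le {η K : ℝ} {S : Fin 3 → Fin 3 → Fld} (h : ∀ i j, Sm η K (S i j)) :
    nL1tx (toM (symTF S)) + nL1tx (toM (skewP S)) ≤ 63 * η ∧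
    nLinfH3m (toM (symTF S)) + nLinfH3m (toM (skewP S)) ≤ 133 * K := by
  have hK := (h 0 0).pos
  have a1 := nL1tx_le fun i j => (sm_symTF h i j).n1
  have a2 := nL1tx_le fun i j => (sm_skewP h i j).n1
  have b1 := nLinfH3m_le (by positivity) fun i j => (sm_symTF h i j).hb
  have b2 := nLinfH3m_le (by positivity) fun i j => (sm_skewP h i j).hb
  constructor <;> linarith

lemma Blk.sh_zero {b : Blk} {t : ℝ} (h : ∀ x, b.A t x = 0) (k : Fin 3) (x : V3) :
    b.sh k t x = 0 := by
  have h0 : ∀ x, b.H t x = 0 := fun x => by simp [Blk.H, h]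
  have h2 : ∀ i j x, D i (D j b.H) t x = 0 := fun i j =>
    D_zero_of_time (D_zero_of_time h0 j) i
  simp only [Blk.sh, shear, sub_apply]
  split_ifs <;> simp [h2]

lemma Blk.tc_zero {b : Blk} {t : ℝ} (h : ∀ x, b.P t x = 0) (k : Fin 3) (x : V3) :
    b.tc k t x = 0 := by
  have h2 : ∀ i j x, D i (D j b.P) t x = 0 := fun i j =>
    D_zero_of_time (D_zero_of_time h j) i
  have h3 : ∀ i j k x, D i (D j (D k b.P)) t x = 0 := fun i j k =>
    D_zero_of_time (h2 j k) i
  have hl : ∀ i x, D i (Lap b.P) t x = 0 := fun i => D_zero_of_time (fun x => by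
    simp [Lap_eq, h2]) i
  simp only [Blk.tc, tcX, mul_apply, sub_apply]
  split_ifs <;> simp [hl, h3]

section
variable {b : Ix → Blk} {Q X δ p ε η : ℝ} (H : ∀ c, (b c).Est Q X δ p)
include H

lemma Nb_perturb (I : Intm Q X p ε) (hst : ∀ c, N1 (b c).st ≤ η) (hδ : 0 < δ)
    (hQ : mo Q X (-5) 0 ≤ δ) (hδ1 : 100 ^ 2 * δ ≤ 1) (k : Fin 3) :
    Nb p ε (9 * √(η + 2 * δ) + 36 * δ) ((osh b + otc b) k) := by
  have S := (H 0).sc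
  have h9 : mo Q X (-9) 0 ≤ δ := (S.le (by norm_num) (by norm_num)).trans hQ
  have h1 : ∀ c, Nb p ε (√(η + 2 * δ) + δ) ((b c).sh k) := fun c =>
    ((H c).Nb_sh I (by linarith [N1_nonneg (b c).st]) k).mono
      (add_le_add (Real.sqrt_le_sqrt (by linarith [hst c])) hQ)
  have h2 : ∀ c, Nb p ε (3 * δ) ((b c).tc k) := fun c =>
    (Nb.of_CB (S.pos _ _).le I.e_nonneg I.e_le I.p_ge ((H c).tc_one k)).mono (by linarith)
  have a1 := Nb.sum I.p_ge Finset.univ Finset.univ_nonempty fun c _ => h1 c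
  have a2 := Nb.sum I.p_ge Finset.univ Finset.univ_nonempty fun c _ => h2 c
  refine (a1.add I.p_ge a2).mono (le_of_eq ?_)
  simp; ring

lemma HB_perturb (k : Fin 3) : HB (Icc 0 1) 3 (18 * mo Q X 0 7) ((osh b + otc b) k) := by
  have S := (H 0).sc
  have h1 : HB (Icc 0 1) 3 Q 1 := (CB.toHB (CB.of_indep (M := fun _ _ => (1:ℝ)) zero_le_one
    D_one fun t _ x => by simp)).mono zero_le_one S.Q_one
  have a := (Ti.mul_osh H h1 k).add (Ti.mul_otc H h1 k)
  rw [one_mul, one_mul] at a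
  exact a.hb.mono a.pos.le (by linarith)

end

theorem LowHyp.exists_next {p ε : ℝ} (hp : 1 ≤ p) (hε : 0 ≤ ε) (hε1 : ε ≤ 1) :
    ∃ C : ℝ, ∀ lam n : ℕ, C ≤ lam → 60 ≤ n → 40 ≤ n * (2 / p - 1) → 40 ≤ n * ε →
    ∀ (u z : Fin 3 → Fld) (P : Fld) (S : Fin 3 → Fin 3 → Fld) (χ : Fld),
    LowHyp lam u z P S (χ * χ) → (∀ i, D i χ = 0) → (∀ t x, |χ t x| ≤ 1) →
    (∀ t ∈ Icc (0:ℝ) 1, ∀ x, |Dt χ t x| ≤ (lam:ℝ) ^ 16) →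
    ∀ η, (∀ a b, N1 (S a b) ≤ η) →
    ∃ (du dz : Fin 3 → Fld) (P' : Fld) (S' : Fin 3 → Fin 3 → Fld),
      Lin (Ioo 0 1) (u + du) (z + dz) P' (fun x y => S' x y - (u + du) x * (z + dz) y) ∧
      (∀ x y, Sm (2 * (lam:ℝ) ^ (-4:ℤ)) (500 * ((lam:ℝ) ^ (1500 * (n + 60))) ^ 7) (S' x y)) ∧
      (∀ k, HB (Icc 0 1) 3 (500 * ((lam:ℝ) ^ (1500 * (n + 60))) ^ 7) ((u + du) k) ∧
        HB (Icc 0 1) 3 (500 * ((lam:ℝ) ^ (1500 * (n + 60))) ^ 7) ((z + dz) k)) ∧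
      (∀ k, Nb p ε (10 * √(η + 2 * (lam:ℝ) ^ (-4:ℤ))) (du k) ∧
        Nb p ε (10 * √(η + 2 * (lam:ℝ) ^ (-4:ℤ))) (dz k)) ∧
      ∀ t, (∀ x, χ t x = 0) → ∀ k x, du k t x = 0 ∧ dz k t x = 0 := by
  obtain ⟨C, hC⟩ := exists_blocks hp
  refine ⟨C, fun lam n hCl hn hnp hnε u z P S χ H hD h1 hDt η hη => ?_⟩
  have hlam := H.lam_ge
  have hΛ : (1000:ℝ) ≤ lam := by exact_mod_cast hlam
  have hΛ0 : (0:ℝ) < lam := by linarith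
  obtain ⟨u1, z1, p1, s, E, Qc, L⟩ := H.step_low
  choose A B hsl hAB using fun c : Ix => exists_slow hlam
    ((L.s_cb c.1 c.2).of_le (by norm_num)) ((L.Dt_s_cb c.1 c.2).of_le (by norm_num))
    ((L.pot_cb c.1 c.2).of_le (by norm_num)) ((L.Dt_pot_cb c.1 c.2).of_le (by norm_num))
    (L.pot c.1 c.2) hD h1 hDt
  obtain ⟨Q, hQ⟩ : ∃ Q : ℕ, Q = lam ^ 1500 := ⟨_, rfl⟩
  have hQr : (Q:ℝ) = (lam:ℝ) ^ 1500 := by rw [hQ]; push_cast; rfl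
  have hlQ : lam ≤ Q := hQ ▸ Nat.le_self_pow (by norm_num) _
  have hlQ' : (lam:ℝ) ≤ Q := by exact_mod_cast hlQ
  have hQ1 : (1:ℝ) ≤ Q := by linarith
  rw [← hQr] at hsl
  obtain ⟨b, hE, hb, hg⟩ := hC Q (Q ^ n) (hCl.trans hlQ') (hlam.trans hlQ)
    (Nat.pow_le_pow_right (by omega) hn) _ (fun c => χ * χ * s c.1 c.2) A B
    (fun c => Qc c.1 c.2) hsl
  obtain ⟨X, hX⟩ : ∃ X : ℝ, X = ((Q ^ n : ℕ) : ℝ) * (Q:ℝ) ^ 60 := ⟨_, rfl⟩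
  rw [← hX] at hE
  have hXe : X = (lam:ℝ) ^ (1500 * (n + 60)) := by
    rw [hX, Nat.cast_pow, ← pow_add, hQr, ← pow_mul]
  rw [← hXe]
  have Sx := (hE 0).sc
  have hX1 := Sx.X_one
  have hX0 := Sx.X_pos
  have hQn : (Q:ℝ) ^ n ≤ X := by
    rw [hX, Nat.cast_pow]
    exact le_mul_of_one_le_right (by positivity) (one_le_pow₀ hQ1)
  have hrp : ∀ r : ℝ, 0 ≤ r → 40 ≤ n * r → (Q:ℝ) ^ 40 ≤ X ^ r := fun r hr h => by
    calc (Q:ℝ) ^ 40 = (Q:ℝ) ^ (40:ℝ) := by norm_cast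
      _ ≤ (Q:ℝ) ^ (n * r) := Real.rpow_le_rpow_of_exponent_le hQ1 h
      _ = ((Q:ℝ) ^ n) ^ r := by rw [Real.rpow_mul (by positivity), Real.rpow_natCast]
      _ ≤ X ^ r := Real.rpow_le_rpow (by positivity) hQn hr
  have hn0 : (0:ℝ) < n := by exact_mod_cast (by omega : 0 < n)
  have I : Intm Q X p ε := ⟨hp, hε, hε1, hrp _ (by by_contra hh; nlinarith) hnp, hrp _ hε hnε⟩
  have hmo5 : mo Q X (-5) 0 ≤ (lam:ℝ) ^ (-5:ℤ) := by
    simp only [mo, zpow_zero, mul_one, zpow_neg]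
    exact inv_anti₀ (by positivity) (by
      exact_mod_cast Nat.pow_le_pow_left hlQ 5)
  have hl5 : 1000 * (lam:ℝ) ^ (-5:ℤ) ≤ (lam:ℝ) ^ (-4:ℤ) :=
    const_mul_zpow_le (by linarith) hΛ (by norm_num)
  have hp5 : 0 < (lam:ℝ) ^ (-5:ℤ) := by positivity
  set δ := (lam:ℝ) ^ (-4:ℤ) with hδ
  have hδ0 : 0 < δ := by positivity
  have hδl : (1000:ℝ) ^ 4 * δ ≤ 1 := by
    rw [hδ, zpow_neg, ← div_eq_mul_inv, div_le_one (by positivity)]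
    exact pow_le_pow_left₀ (by norm_num) hΛ 4
  have hst : ∀ c, N1 (b c).st ≤ η := fun c => by
    rw [(hb c).2.2.1]; exact (L.n1 c.1 c.2).trans (hη c.1 c.2)
  have hη0 : 0 ≤ η := (N1_nonneg _).trans (hη 0 0)
  have hsq : 40 * δ ≤ √(η + 2 * δ) := Real.le_sqrt_of_sq_le (by nlinarith)
  have hmoX : mo Q X 0 7 = X ^ 7 := by simp only [mo, zpow_zero, one_mul]; norm_cast
  have h78 : (lam:ℝ) ^ (-78:ℤ) ≤ δ := zpow_le_zpow_right₀ (by linarith) (by norm_num)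
  have h7Q : (lam:ℝ) ^ 7 + 1 ≤ Q := by
    rw [hQr]
    have : (lam:ℝ) ^ 8 ≤ (lam:ℝ) ^ 1500 := pow_le_pow_right₀ (by linarith) (by norm_num)
    have : (1:ℝ) ≤ (lam:ℝ) ^ 7 := one_le_pow₀ (by linarith)
    nlinarith
  have hX7 : X ≤ X ^ 7 := le_self_pow₀ hX1 (by norm_num)
  have hQX := Sx.Q_le_X
  have hHB : ∀ {f g : Fld}, HB (Icc 0 1) 3 ((lam:ℝ) ^ 7) f →
      CB (Icc 0 1) 1 3 (fun _ _ => (lam:ℝ) ^ (-78:ℤ)) (g - f) → HB (Icc 0 1) 3 Q g := by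
    intro f g hf hd
    have := hf.add' (hd.toHB.mono (by positivity) (show _ ≤ (1:ℝ) by linarith))
      (by positivity) one_pos
    rw [add_sub_cancel] at this
    exact this.mono (by positivity) h7Q
  have hu1 := fun k => hHB (H.hu k) (L.diff_u k)
  have hz1 := fun k => hHB (H.hz k) (L.diff_z k)
  obtain ⟨P', hL⟩ : ∃ P', Lin (Ioo 0 1) (u1 + (osh b + otc b))
      (z1 + (osh (swp b) + otc (swp b))) P' (fun x y => newS b u1 z1 E x y -
        (u1 + (osh b + otc b)) x * (z1 + (osh (swp b) + otc (swp b))) y) :=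
    ⟨_, newS_lin (fun c => (hE c).toGood) (fun c => ⟨(hb c).1, (hb c).2.1⟩) hg
    (s := fun x y => χ * χ * s x y) (fun c => (hb c).2.2.1) L.lin⟩
  have hE' : ∀ c, (swp b c).Est Q X δ p := swp_est hE
  have fin : ∀ {f f1 : Fin 3 → Fld} {b' : Ix → Blk}, (∀ c, (b' c).Est Q X δ p) →
      (∀ c, N1 (b' c).st ≤ η) →
      (∀ i, CB (Icc 0 1) 1 3 (fun _ _ => (lam:ℝ) ^ (-78:ℤ)) (f1 i - f i)) → ∀ k,
      Nb p ε (10 * √(η + 2 * δ)) ((f1 + (osh b' + otc b') - f) k) := by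
    intro f f1 b' hb' hs hd k
    have a1 := Nb_perturb hb' I hs hδ0 (by linarith) (by linarith) k
    have a2 := Nb.of_CB (by positivity) hε hε1 hp (hd k)
    have := (a2.add hp a1).mono (show _ ≤ 10 * √(η + 2 * δ) by linarith)
    rwa [show f1 k - f k + (osh b' + otc b') k = (f1 + (osh b' + otc b') - f) k by
      simp only [Pi.add_apply, Pi.sub_apply]; ring] at this
  have finH : ∀ {f1 : Fin 3 → Fld} {b' : Ix → Blk}, (∀ c, (b' c).Est Q X δ p) →
      (∀ k, HB (Icc 0 1) 3 Q (f1 k)) → ∀ k,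
      HB (Icc 0 1) 3 (500 * X ^ 7) ((f1 + (osh b' + otc b')) k) := by
    intro f1 b' hb' hf k
    have := (hf k).add' (HB_perturb hb' k) (by linarith) (by rw [hmoX]; positivity)
    rw [hmoX] at this
    exact this.mono (by positivity) (by linarith)
  refine ⟨u1 + (osh b + otc b) - u, z1 + (osh (swp b) + otc (swp b)) - z, P',
    newS b u1 z1 E, ?_, fun x y => ?_, fun k => ?_, fun k => ⟨fin hE hst L.diff_u k,
    fin hE' hst L.diff_z k⟩, fun t ht k x => ?_⟩
  · rw [add_sub_cancel, add_sub_cancel]; exact hL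
  · have := newS_sm hE (hu1 x) (hz1 y) (L.err x y)
    rw [hmoX] at this
    refine this.mono (by linarith) ?_
    have : (lam:ℝ) ^ 400 ≤ Q := by
      rw [hQr]; exact pow_le_pow_right₀ (by linarith) (by norm_num)
    linarith
  · rw [add_sub_cancel, add_sub_cancel]
    exact ⟨finH hE hu1 k, finH hE' hz1 k⟩
  · have ht2 : ∀ x, (χ * χ) t x = 0 := fun x => by simp [ht x]
    have hA : ∀ c x, (b c).A t x = 0 := fun c x => by
      rw [(hb c).2.2.2.1]; exact (hAB c t ht x).1
    have hB : ∀ c x, (b c).B t x = 0 := fun c x => by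
      rw [(hb c).2.2.2.2.1]; exact (hAB c t ht x).2
    have hP : ∀ c x, (b c).P t x = 0 := fun c x => by
      rw [(hb c).2.2.2.2.2]; exact L.pot_zero _ _ t ht2 x
    have hB' : ∀ c x, (swp b c).A t x = 0 := hB
    have hP' : ∀ c x, (swp b c).P t x = 0 := hP
    simp only [Pi.add_apply, Pi.sub_apply, add_apply, sub_apply, osh, otc, sum_apply,
      Blk.sh_zero (hA _), Blk.sh_zero (hB' _), Blk.tc_zero (hP _), Blk.tc_zero (hP' _),
      L.eq_u k t ht2 x, L.eq_z k t ht2 x]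
    simp

lemma gamP_bP {p ε : ℝ} (hp1 : 1 ≤ p) (hp2 : p < 2) (hε : 0 < ε) :
    0 < gamP p ε ∧ gamP p ε ≤ 1 / 24 ∧ gamP p ε ≤ 2 / p - 1 ∧ gamP p ε ≤ ε ∧
      bP p ε = 262144 / gamP p ε := by
  have h : 4 / (3 * p) - 2 / 3 = 2 / 3 * (2 / p - 1) := by field_simp; ring
  have h1 : 0 < 2 / p - 1 := by rw [sub_pos, lt_div_iff₀] <;> linarith
  refine ⟨by simp only [gamP, h, lt_min_iff]; refine ⟨?_, ?_, ?_⟩ <;> positivity,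
    (min_le_right _ _).trans (min_le_right _ _), ?_, ?_, ?_⟩
  · have : gamP p ε ≤ _ := min_le_left _ _
    rw [h] at this; linarith
  · have : gamP p ε ≤ 2 * ε / 3 := (min_le_right _ _).trans (min_le_left _ _)
    linarith
  · simp only [bP, C₀, sigP]; field_simp; norm_num

set_option maxHeartbeats 400000 in
lemma exists_param {p ε : ℝ} (hp1 : 1 ≤ p) (hp2 : p < 2) (hε : 0 < ε) (K : ℝ) :
    ∃ n a₀ : ℕ, 60 ≤ n ∧ 40 ≤ n * (2 / p - 1) ∧ 40 ≤ n * ε ∧ ∀ a : ℕ, a₀ ≤ a → ∀ q,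
      ∃ l : ℕ, lamP a p ε q = l ∧ K ≤ l ∧ 66500 ≤ l ∧ 4 * (l:ℝ) ≤ lamP a p ε (q + 1) ∧
        66500 * ((l:ℝ) ^ (1500 * (n + 60))) ^ 7 ≤ lamP a p ε (q + 1) ^ (6:ℝ) ∧
        230400 * (delP a p ε (q + 1) * (l:ℝ) ^ (-(6 * alpP p ε)) + 2 * (l:ℝ) ^ (-4:ℤ)) ≤
          delP a p ε (q + 1) ∧
        126 * (l:ℝ) ^ (-4:ℤ) ≤
          delP a p ε (q + 1 + 1) * lamP a p ε (q + 1) ^ (-(6 * alpP p ε)) := by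
  obtain ⟨h0, h24, hg, hgε, hb⟩ := gamP_bP hp1 hp2 hε
  set g := gamP p ε
  set b := bP p ε with hbd
  have hb1 : 1000 ≤ b := by rw [hb, le_div_iff₀ h0]; linarith
  have hb0 : 0 < b := by linarith
  have hβ : betP p ε = 1 / b ^ 3 := rfl
  set β := betP p ε
  have hβ0 : 0 < β := by rw [hβ]; positivity
  have hα : 6 * alpP p ε = 3 / 8 * β := by simp only [alpP, β]; ring
  have hn1 := Nat.le_ceil (60 / g)
  have hn2 := Nat.ceil_lt_add_one (show 0 ≤ 60 / g by positivity)
  generalize ⌈60 / g⌉₊ = n at *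
  rw [div_le_iff₀ h0] at hn1
  have hn0 : (60:ℝ) ≤ n := by nlinarith only [hn1, h24, (Nat.cast_nonneg n : (0:ℝ) ≤ n)]
  have hnb : 24000 * ((n:ℝ) + 60) ≤ b * 6 := by
    have : 24 ≤ 1 / g := by rw [le_div_iff₀ h0]; linarith
    rw [hb, div_eq_mul_one_div]
    rw [div_eq_mul_one_div] at hn2
    linarith
  refine ⟨n, ⌈K⌉₊ + 66500 + ⌈(460800:ℝ) ^ (1 / (3 / 8 * β))⌉₊, by exact_mod_cast hn0,
    by linarith [mul_le_mul_of_nonneg_left hg (by linarith : (0:ℝ) ≤ n)],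
    by linarith [mul_le_mul_of_nonneg_left hgε (by linarith : (0:ℝ) ≤ n)], fun a ha q => ?_⟩
  have ha' : (⌈K⌉₊ + 66500 + ⌈(460800:ℝ) ^ (1 / (3 / 8 * β))⌉₊ : ℝ) ≤ a := by exact_mod_cast ha
  have hK := Nat.le_ceil K
  have hB := Nat.le_ceil ((460800:ℝ) ^ (1 / (3 / 8 * β)))
  have hB0 : 0 ≤ (460800:ℝ) ^ (1 / (3 / 8 * β)) := by positivity
  have hK0 : (0:ℝ) ≤ ⌈K⌉₊ := by positivity
  have ha1 : (66500:ℝ) ≤ a := by linarith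
  have hax : ∀ k, (a:ℝ) ≤ (a:ℝ) ^ b ^ k := fun k =>
    Real.self_le_rpow_of_one_le (by linarith) (one_le_pow₀ (by linarith))
  have hlo : ∀ k, (a:ℝ) ^ b ^ k ≤ lamP a p ε k := fun k => Int.le_ceil _
  have hup : ∀ k, lamP a p ε k ≤ ((a:ℝ) ^ b ^ k) ^ (2:ℝ) := fun k => by
    have h1 : lamP a p ε k < (a:ℝ) ^ b ^ k + 1 := Int.ceil_lt_add_one _
    have := hax k
    rw [Real.rpow_two]; nlinarith only [h1, this, ha1]
  have hL1 : ∀ k, 1 ≤ lamP a p ε k := fun k => by linarith [hax k, hlo k]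
  have hstep : ∀ k, (a:ℝ) ^ b ^ (k + 1) = ((a:ℝ) ^ b ^ k) ^ b := fun k => by
    rw [pow_succ, Real.rpow_mul (by positivity)]
  obtain ⟨l, hl⟩ : ∃ l : ℕ, lamP a p ε q = l := by
    have : 0 ≤ ⌈(a:ℝ) ^ b ^ q⌉ := Int.ceil_nonneg (by positivity)
    exact ⟨⌈(a:ℝ) ^ b ^ q⌉.toNat, by
      simp only [lamP]; exact_mod_cast (Int.toNat_of_nonneg this).symm⟩
  have h1 := hlo q
  have h2 := hup q
  have h3 := hlo (q + 1)
  have h4 := hup (q + 1)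
  have h5 := hup (q + 1 + 1)
  have h6 := hax q
  rw [hstep] at h3 h4
  rw [hstep, hstep] at h5
  rw [hl] at h1 h2
  have hal : (a:ℝ) ≤ l := h6.trans h1
  set x := (a:ℝ) ^ b ^ q
  have hx1 : 1 ≤ x := by linarith
  have hx0 : 0 ≤ x := by linarith
  rw [← Real.rpow_mul hx0, ← Real.rpow_mul hx0] at h5
  rw [← Real.rpow_mul hx0] at h4
  have hl0 : (0:ℝ) < l := by linarith
  have hδ : ∀ k, lamP a p ε k ^ (-(2 * β)) ≤ delP a p ε k := fun k => by
    have := Real.one_le_rpow (hL1 2) (show 0 ≤ 3 * β by positivity)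
    exact le_mul_of_one_le_left (by have := hL1 k; positivity) this
  have hlow : ∀ {k : ℕ} {s r : ℝ}, 0 ≤ r → lamP a p ε k ≤ x ^ s →
      x ^ (-(s * r)) ≤ lamP a p ε k ^ (-r) := fun {k s r} hr h => by
    rw [← mul_neg, Real.rpow_mul hx0]
    exact Real.rpow_le_rpow_of_nonpos (by linarith [hL1 k]) h (by linarith)
  have hlx : 1 / (l:ℝ) ≤ x ^ (-1:ℝ) := by
    rw [Real.rpow_neg_one, one_div]; exact inv_anti₀ (by linarith) h1
  have hl4 : 10 ^ 6 * (l:ℝ) ^ (-4:ℤ) ≤ 1 / l := by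
    rw [le_div_iff₀ hl0, zpow_neg, mul_assoc, ← div_eq_inv_mul, mul_div_assoc', div_le_one (by positivity)]
    have : (66500:ℝ) ≤ l := by linarith
    have : (66500:ℝ) ^ 3 ≤ l ^ 3 := by gcongr
    have h4 : (l:ℝ) ^ (4:ℤ) = l ^ 3 * l := by norm_cast
    rw [h4]; nlinarith only [this, hl0]
  have hb2 : b * b * β = 1 / b := by rw [hβ]; field_simp
  have hb3 : b * β = 1 / b / b := by rw [hβ]; field_simp
  have hb4 : 1 / b ≤ 1 / 1000 := one_div_le_one_div_of_le (by norm_num) hb1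
  have hb5 : 1 / b / b ≤ 1 / b := div_le_self (by positivity) (by linarith)
  have hβ1 : b * 2 * (2 * β) ≤ 1 := by linarith
  have hβ2 : b * b * 2 * (2 * β) + b * 2 * (3 / 8 * β) ≤ 1 := by linarith
  refine ⟨l, hl, by linarith, by exact_mod_cast ha1.trans hal, ?_, ?_, ?_, ?_⟩
  · have : x ^ (3:ℝ) ≤ x ^ b := Real.rpow_le_rpow_of_exponent_le hx1 (by linarith)
    have h3' : x ^ (3:ℝ) = x ^ 3 := by norm_cast
    rw [Real.rpow_two] at h2
    rw [h3'] at this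
    have h5 : 4 * x ^ 2 ≤ x ^ 3 := by rw [pow_succ x 2, mul_comm]; gcongr; linarith
    linarith
  · obtain ⟨m, hm⟩ : ∃ m, m = 1500 * (n + 60) := ⟨_, rfl⟩
    rw [← hm]
    calc 66500 * ((l:ℝ) ^ m) ^ 7 ≤ (l:ℝ) ^ m * ((l:ℝ) ^ m) ^ 7 := by
          gcongr
          exact (show (66500:ℝ) ≤ l by linarith).trans
            (le_self_pow₀ (by linarith) (by omega))
      _ = (l:ℝ) ^ (8 * m) := by ring
      _ ≤ (x ^ (2:ℝ)) ^ (8 * m) := by gcongr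
      _ = x ^ (24000 * ((n:ℝ) + 60)) := by
          rw [← Real.rpow_natCast, ← Real.rpow_mul hx0, hm]; push_cast; congr 1; ring
      _ ≤ x ^ (b * 6) := Real.rpow_le_rpow_of_exponent_le hx1 hnb
      _ = (x ^ b) ^ (6:ℝ) := Real.rpow_mul hx0 _ _
      _ ≤ _ := by gcongr
  · have hd1 : (l:ℝ) ^ (-(3 / 8 * β)) ≤ 1 / 460800 := by
      have hc : 0 < 3 / 8 * β := by positivity
      rw [Real.rpow_neg hl0.le, ← one_div]
      refine one_div_le_one_div_of_le (by norm_num) ?_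
      calc (460800:ℝ) = ((460800:ℝ) ^ (1 / (3 / 8 * β))) ^ (3 / 8 * β) := by
            rw [← Real.rpow_mul (by norm_num), one_div_mul_cancel hc.ne', Real.rpow_one]
        _ ≤ _ := Real.rpow_le_rpow hB0 (by linarith) hc.le
    have hd2 : 1 / (l:ℝ) ≤ delP a p ε (q + 1) := hlx.trans
      ((Real.rpow_le_rpow_of_exponent_le hx1 (by linarith)).trans
        ((hlow (by positivity) h4).trans (hδ _)))
    have hd0 : 0 < delP a p ε (q + 1) := lt_of_lt_of_le (by positivity) hd2
    rw [hα]
    linarith [mul_le_mul_of_nonneg_left hd1 hd0.le]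
  · rw [hα]
    have := mul_le_mul ((hlow (by positivity) h5).trans (hδ _))
      (hlow (r := 3 / 8 * β) (by positivity) h4) (by positivity)
      ((by have := hL1 (q + 1 + 1); positivity : 0 ≤ lamP a p ε (q + 1 + 1) ^ (-(2 * β))).trans
        (hδ _))
    rw [← Real.rpow_add (by linarith)] at this
    have h7 := hlx.trans ((Real.rpow_le_rpow_of_exponent_le hx1 (by linarith)).trans this)
    have : 0 < (l:ℝ) ^ (-4:ℤ) := by positivity
    linarith

lemma Nb.smul {p ε η c : ℝ} {f : Fld} (h : Nb p ε η f) (hc : |c| ≤ 1) : Nb p ε η (c • f) where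
  l2 := ⟨h.l2.1, (eLpNorm_mono fun q => by
    simpa [abs_mul] using mul_le_of_le_one_left (abs_nonneg (f q.1 q.2)) hc).trans h.l2.2⟩
  lp := by
    obtain ⟨G, a, b, d⟩ := h.lp
    exact ⟨G, a, fun t ht x => by
      simpa [abs_mul] using (mul_le_of_le_one_left (abs_nonneg _) hc).trans (b t ht x), d⟩
  hol := by
    obtain ⟨G, a, b, d, e⟩ := h.hol
    refine ⟨G, a, fun t ht x => by
      simpa [abs_mul] using (mul_le_of_le_one_left (abs_nonneg _) hc).trans (b t ht x),
      fun t ht x y => ?_, e⟩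
    rw [smul_apply, smul_apply, ← mul_sub, abs_mul]
    exact (mul_le_of_le_one_left (abs_nonneg _) hc).trans (d t ht x y)

lemma norms_add_le {p ε η : ℝ} (hp : 1 ≤ p) (hε : 0 ≤ ε) (hε1 : ε ≤ 1) {f d g e : Fin 3 → Fld}
    (hd : ∀ k, Nb p ε η (d k)) (he : ∀ k, Nb p ε η (e k)) :
    (nL2tx (toV (f + d)) + nL2tx (toV (g + e))) + (nLpLinf p (toV (f + d)) +
      nLpLinf p (toV (g + e))) + (nL1C ε (toV (f + d)) + nL1C ε (toV (g + e))) ≤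
    (nL2tx (toV f) + nL2tx (toV g)) + (nLpLinf p (toV f) + nLpLinf p (toV g)) +
      (nL1C ε (toV f) + nL1C ε (toV g)) + 24 * η := by
  linarith [nL2tx_add_le hd (f := f), nL2tx_add_le he (f := g), nLpLinf_add_le hp hd (f := f),
    nLpLinf_add_le hp he (f := g), nL1C_add_le hε hε1 hd (f := f), nL1C_add_le hε hε1 he (f := g)]

lemma norms_le {p ε η : ℝ} (hp : 1 ≤ p) (hε : 0 ≤ ε) (hε1 : ε ≤ 1) {d e : Fin 3 → Fld}
    (hd : ∀ k, Nb p ε η (d k)) (he : ∀ k, Nb p ε η (e k)) :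
    (nL2tx (toV d) + nL2tx (toV e)) + (nLpLinf p (toV d) + nLpLinf p (toV e)) +
      (nL1C ε (toV d) + nL1C ε (toV e)) ≤ 24 * η := by
  have := norms_add_le hp hε hε1 hd he (f := 0) (g := 0)
  have h0 : toV 0 = fun _ _ => 0 := rfl
  have h1 : LinfN (fun _ : V3 => (0 : V3)) = 0 := by simp only [LinfN, eLpNorm_zero', toReal_zero]
  have h2 : nLpLinf p (toV 0) = 0 := by simp [h0, h1, nLpLinf]
  have h3 : nL2tx (toV 0) = 0 := by simp [h0, nL2tx]
  have h4 : nL1C ε (toV 0) = 0 := by simp [h0, nL1C, holderNorm]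
  simpa [h2, h3, h4] using this

lemma nLinfH3v_nonneg (v : ℝ → V3 → V3) : 0 ≤ nLinfH3v v :=
  Real.iSup_nonneg fun _ => Real.sqrt_nonneg _

lemma nLinfH3m_nonneg (v : ℝ → V3 → Mat3) : 0 ≤ nLinfH3m v :=
  Real.iSup_nonneg fun _ => Real.sqrt_nonneg _

lemma HB_comb {l a b : ℝ} (hl : 2 ≤ l) (ha : 0 ≤ a) (hb : 0 ≤ b) (h : a + b ≤ l ^ (6:ℝ))
    {f g : Fld} (hf : HB (Icc 0 1) 3 a f) (hg : HB (Icc 0 1) 3 b g) :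
    HB (Icc 0 1) 3 (l ^ 7) (f + g) ∧ HB (Icc 0 1) 3 (l ^ 7) (f - g) := by
  have h6 : l ^ (6:ℝ) = l ^ 6 := by norm_cast
  rw [h6] at h
  have hf := hf.mono ha (show a ≤ l ^ 6 by linarith)
  have hg := hg.mono hb (show b ≤ l ^ 6 by linarith)
  have h0 : 0 < l ^ 6 := by positivity
  have h7 : l ^ 6 + l ^ 6 ≤ l ^ 7 := by rw [pow_succ l 6]; nlinarith
  refine ⟨(hf.add' hg h0 h0).mono (by positivity) h7, ?_⟩
  rw [sub_eq_add_neg]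
  exact (hf.add' hg.neg h0 h0).mono (by positivity) h7

end Fld

/-- **main iteration proposition.** Given smooth MHD solutions
`(v⁽¹⁾,b⁽¹⁾)` and `(v⁽²⁾,b⁽²⁾)` and a smooth solution of the relaxed MHD system at level
`q` satisfying the inductive estimates and agreeing with `(v⁽¹⁾,b⁽¹⁾)` on `[0,2T+2τ_q]`
and with `(v⁽²⁾,b⁽²⁾)` on `[3T−τ_q,1]`, there is a smooth relaxed solution at level `q+1`
with the same initial data, the inductive estimates at level `q+1`, the corresponding
gluing property, and the difference bound `δ_{q+1}^{1/2}`. -/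
theorem convex_integration_iteration
    (p ε T : ℝ) (hp1 : 1 ≤ p) (hp2 : p < 2) (hε1 : 0 < ε) (hε2 : ε < 1)
    (hT1 : 0 < T) (hT2 : T ≤ 1 / 4) :
    ∃ a₀ : ℕ, ∀ a : ℕ, a₀ ≤ a →
    ∀ q : ℕ, 1 ≤ q →
    ∀ (v1 b1 v2 b2 : ℝ → V3 → V3) (pr1 pr2 : ℝ → V3 → ℝ),
      IsSmoothMHDOn (Icc (0:ℝ) 1) v1 b1 pr1 →
      IsSmoothMHDOn (Icc (0:ℝ) 1) v2 b2 pr2 →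
      (∫ x in cube, v1 0 x) = 0 → (∫ x in cube, b1 0 x) = 0 →
      (∫ x in cube, v2 0 x) = 0 → (∫ x in cube, b2 0 x) = 0 →
    ∀ (vq bq : ℝ → V3 → V3) (pq : ℝ → V3 → ℝ) (Rq Mq : ℝ → V3 → Mat3),
      IsSmoothRelaxed vq bq pq Rq Mq →
      IterEst p ε a q vq bq Rq Mq →
      (∀ t ∈ Icc (0:ℝ) (2 * T + 2 * tauP T a p ε q), ∀ x,
        vq t x = v1 t x ∧ bq t x = b1 t x) →
      (∀ t ∈ Icc (3 * T - tauP T a p ε q) 1, ∀ x,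
        vq t x = v2 t x ∧ bq t x = b2 t x) →
      ∃ (v' b' : ℝ → V3 → V3) (p' : ℝ → V3 → ℝ) (R' M' : ℝ → V3 → Mat3),
        IsSmoothRelaxed v' b' p' R' M' ∧
        v' 0 = vq 0 ∧ b' 0 = bq 0 ∧
        IterEst p ε a (q + 1) v' b' R' M' ∧
        (∀ t ∈ Icc (0:ℝ) (2 * T + 2 * tauP T a p ε (q + 1)), ∀ x,
          v' t x = v1 t x ∧ b' t x = b1 t x) ∧
        (∀ t ∈ Icc (3 * T - tauP T a p ε (q + 1)) 1, ∀ x,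
          v' t x = v2 t x ∧ b' t x = b2 t x) ∧
        (nL2tx (fun t x => v' t x - vq t x) + nL2tx (fun t x => b' t x - bq t x))
          + (nLpLinf p (fun t x => v' t x - vq t x)
              + nLpLinf p (fun t x => b' t x - bq t x))
          + (nL1C ε (fun t x => v' t x - vq t x) + nL1C ε (fun t x => b' t x - bq t x))
          ≤ Real.sqrt (delP a p ε (q + 1)) := by
  open Fld in
  obtain ⟨C, hC1, hG⟩ := exists_glue
  obtain ⟨K, hN⟩ := LowHyp.exists_next hp1 hε1.le hε2.le
  obtain ⟨n, a₀, hn, hnp, hnε, hpar⟩ := exists_param hp1 hp2 hε1 (|K| + 2 * C / T)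
  refine ⟨a₀, fun a ha q hq v1 b1 v2 b2 pr1 pr2 h1 h2 _ _ _ _ vq bq pq Rq Mq hR hI hl hr => ?_⟩
  obtain ⟨l, hql, hK, hl1, hL4, hX, hD, hS⟩ := hpar a ha q
  obtain ⟨V, B, P, R, M, rfl, rfl, -, rfl, rfl, LV⟩ := lin_of_relaxed hR
  obtain ⟨V1, B1, P1, rfl, rfl, L1⟩ := lin_of_mhd h1
  obtain ⟨V2, B2, P2, rfl, rfl, L2⟩ := lin_of_mhd h2
  obtain ⟨hI1, hI2, hI3, hI4⟩ := hI
  have hl1' : (66500:ℝ) ≤ l := by exact_mod_cast hl1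
  have hl0 : (0:ℝ) < l := by linarith
  have hτ : tauP T a p ε q = T / (l:ℝ) ^ 15 := by
    rw [tauP, hql, Real.rpow_neg hl0.le, div_eq_mul_inv]; norm_cast
  have hτ' : tauP T a p ε (q + 1) ≤ T / (l:ℝ) ^ 15 / 4 := by
    rw [tauP, Real.rpow_neg (by linarith), ← div_eq_mul_inv, div_div]
    have : (l:ℝ) ^ 15 * 4 ≤ (4 * (l:ℝ)) ^ 15 := by
      rw [mul_pow, mul_comm]; gcongr; norm_num
    have h15 : lamP a p ε (q + 1) ^ (15:ℝ) = lamP a p ε (q + 1) ^ 15 := by norm_cast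
    rw [h15]
    exact div_le_div_of_nonneg_left hT1.le (by positivity)
      (this.trans (pow_le_pow_left₀ (by positivity) hL4 15))
  rw [hτ] at hl hr
  have hτ8 : T / (l:ℝ) ^ 15 ≤ T / 8 := div_le_div_of_nonneg_left hT1.le (by norm_num)
    ((show (8:ℝ) ≤ l by linarith).trans (le_self_pow₀ (by linarith) (by norm_num)))
  have hτ0 : 0 < T / (l:ℝ) ^ 15 := by positivity
  have hCl : 2 * (C / (T / (l:ℝ) ^ 15)) ≤ (l:ℝ) ^ 16 := by
    have : 2 * C / T ≤ l := by linarith [abs_nonneg K]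
    calc 2 * (C / (T / (l:ℝ) ^ 15)) = 2 * C / T * (l:ℝ) ^ 15 := by field_simp
      _ ≤ l * (l:ℝ) ^ 15 := by gcongr
      _ = _ := by ring
  have hCτ : 0 < C / (T / (l:ℝ) ^ 15) := by positivity
  rw [hql] at hI2 hI3 hI4
  obtain ⟨θ, p', χ, hL, hθD, hθ1, hθ0, hχD, hχ0, hχ1, hχt, hχθ, hχl, hχr⟩ :=
    hG T (T / (l:ℝ) ^ 15) hT1 hτ0 hτ8 (V + B) (V - B) (V1 + B1) (V1 - B1) (V2 + B2) (V2 - B2)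
      P P1 P2 (fun i j => R i j + M i j) (fun t ht => LV t (Ioo_subset_Icc_self ht))
      (fun t ht => L1 t (Ioo_subset_Icc_self ht)) (fun t ht => L2 t (Ioo_subset_Icc_self ht))
      (fun t ht i x => by
        have := hl t ht x
        have e1 : V i t x = V1 i t x := congrFun this.1 i
        have e2 : B i t x = B1 i t x := congrFun this.2 i
        simp [e1, e2])
      (fun t ht i x => by
        have := hr t ht x
        have e1 : V i t x = V2 i t x := congrFun this.1 i
        have e2 : B i t x = B2 i t x := congrFun this.2 i
        simp [e1, e2])
  generalize hτe : T / (l:ℝ) ^ 15 = τ at *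
  have hχa : ∀ t x, |χ t x| ≤ 1 := fun t x => by rw [abs_of_nonneg (hχ0 t x)]; exact hχ1 t x
  have hHv := fun i => HB_comb (by linarith) (nLinfH3v_nonneg _) (nLinfH3v_nonneg _) hI2
    (HB_of_nLinfH3v V i) (HB_of_nLinfH3v B i)
  have H : LowHyp l (V + B) (V - B) p' (fun i j => θ * (R i j + M i j)) (χ * χ) := by
    refine ⟨by omega, hL, fun i => (hHv i).1, fun i => (hHv i).2, fun i j => ?_,
      fun i j t ht x => ?_, fun i => by simp [D_mul, hχD], fun t x => ?_, fun t _ x => ?_,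
      fun t ht x => ?_, fun i j => by rw [← mul_assoc, hχθ]⟩
    · exact (HB_comb (by linarith) (nLinfH3m_nonneg _) (nLinfH3m_nonneg _) hI3
        (HB_of_nLinfH3m R i j) (HB_of_nLinfH3m M i j)).1.mul_time hθD fun t _ x => hθ1 t x
    · simp [hθ0 t (by linarith) x]
    · rw [mul_apply, abs_mul]; exact mul_le_one₀ (hχa t x) (abs_nonneg _) (hχa t x)
    · rw [Dt_mul, add_apply, mul_apply, ← two_mul, abs_mul, abs_mul, abs_two]
      have := mul_le_mul (hχa t x) (hχt t x) (abs_nonneg _) zero_le_one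
      linarith
    · simp [hχr t (by linarith) x]
  obtain ⟨du, dz, P', S', hLin, hSm, hHB, hNb, hz⟩ := hN l n
    (by linarith [le_abs_self K, show 0 ≤ 2 * C / T by positivity]) hn hnp hnε _ _ _ _ χ H hχD hχa
    (fun t _ x => (hχt t x).trans (by linarith))
    (delP a p ε (q + 1) * (l:ℝ) ^ (-(6 * alpP p ε))) (fun i j => by
      refine (N1_mono fun t _ x => ?_).trans ((N1_add_le (R i j) (M i j)).trans
        ((add_le_add (N1_le_nL1tx R i j) (N1_le_nL1tx M i j)).trans hI4))
      rw [mul_apply, abs_mul]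
      exact mul_le_of_le_one_left (abs_nonneg _) (hθ1 t x))
  obtain ⟨p'', hRel⟩ := relaxed_of_lin _ _ _ _ hLin
  have hh : |(1/2:ℝ)| ≤ 1 := by norm_num [abs_of_pos]
  have hs : 480 * √(delP a p ε (q + 1) * (l:ℝ) ^ (-(6 * alpP p ε)) + 2 * (l:ℝ) ^ (-4:ℤ)) ≤
      √(delP a p ε (q + 1)) := by
    refine Real.le_sqrt_of_sq_le ?_
    have hδ0 : 0 ≤ delP a p ε (q + 1) := by
      have h0 : ∀ k, 0 ≤ lamP a p ε k := fun k => 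
        Int.cast_nonneg (Int.ceil_nonneg (by positivity))
      exact mul_nonneg (Real.rpow_nonneg (h0 _) _) (Real.rpow_nonneg (h0 _) _)
    rw [mul_pow, Real.sq_sqrt (by positivity)]
    linarith
  generalize √(delP a p ε (q + 1) * (l:ℝ) ^ (-(6 * alpP p ε)) + 2 * (l:ℝ) ^ (-4:ℤ)) = s at *
  have hX1 : (1:ℝ) ≤ ((l:ℝ) ^ (1500 * (n + 60))) ^ 7 :=
    one_le_pow₀ (one_le_pow₀ (by linarith))
  generalize ((l:ℝ) ^ (1500 * (n + 60))) ^ 7 = X at *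
  have hdV : ∀ k, Nb p ε (20 * s) (((1/2:ℝ) • (du + dz)) k) := fun k =>
    (((hNb k).1.add hp1 (hNb k).2).mono (by linarith)).smul hh
  have hdB : ∀ k, Nb p ε (20 * s) (((1/2:ℝ) • (du - dz)) k) := fun k =>
    (((hNb k).1.sub hp1 (hNb k).2).mono (by linarith)).smul hh
  have hb3 := nLinfH3v_le (by linarith) fun k => HB.mul_time (h := algebraMap ℝ Fld (1/2))
    (fun i => (D i).map_algebraMap _) (fun t _ x => hh)
    ((hHB k).1.add' (hHB k).2 (by linarith) (by linarith))
  have hb4 := nLinfH3v_le (by linarith) fun k => HB.mul_time (h := algebraMap ℝ Fld (1/2))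
    (fun i => (D i).map_algebraMap _) (fun t _ x => hh)
    ((hHB k).1.add' (hHB k).2.neg (by linarith) (by linarith))
  simp only [← sub_eq_add_neg, ← Algebra.smul_def] at hb3 hb4
  have ev : (1/2:ℝ) • ((V + B + du) + (V - B + dz)) = V + (1/2:ℝ) • (du + dz) := by module
  have eb : (1/2:ℝ) • ((V + B + du) - (V - B + dz)) = B + (1/2:ℝ) • (du - dz) := by module
  have hv3 : nLinfH3v (toV (V + (1/2:ℝ) • (du + dz))) ≤ 11 * (500 * X + 500 * X) := by rw [← ev]; exact hb3
  have hb3' : nLinfH3v (toV (B + (1/2:ℝ) • (du - dz))) ≤ 11 * (500 * X + 500 * X) := by rw [← eb]; exact hb4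
  rw [ev, eb] at hRel
  generalize hdVe : (1/2:ℝ) • (du + dz) = dV at *
  generalize hdBe : (1/2:ℝ) • (du - dz) = dB at *
  have hz' : ∀ t, (∀ x, χ t x = 0) → ∀ x, toV (V + dV) t x = toV V t x ∧
      toV (B + dB) t x = toV B t x := fun t ht x => by
    have h := fun k => hz t ht k x
    subst hdVe hdBe
    constructor <;> funext k <;> simp [toV, h k]
  obtain ⟨hs1, hs2⟩ := stress_le hSm
  refine ⟨_, _, _, _, _, hRel, funext fun x => (hz' 0 (hχl 0 (by linarith)) x).1,
    funext fun x => (hz' 0 (hχl 0 (by linarith)) x).2, ⟨?_, ?_, ?_, ?_⟩,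
    fun t ht x => ?_, fun t ht x => ?_, ?_⟩
  · rw [Finset.sum_Icc_succ_top (by omega)]
    have := norms_add_le hp1 hε1.le hε2.le hdV hdB (f := V) (g := B)
    linarith
  · linarith
  · linarith
  · linarith
  · have := hz' t (hχl t (by linarith [ht.2])) x
    rw [this.1, this.2]
    exact hl t ⟨ht.1, by linarith [ht.2]⟩ x
  · have := hz' t (hχr t (by linarith [ht.1])) x
    rw [this.1, this.2]
    exact hr t ⟨by linarith [ht.1], ht.2⟩ x
  · have e : ∀ f d : Fin 3 → Fld, (fun t x => toV (f + d) t x - toV f t x) = toV d :=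
      fun f d => by funext t x k; simp [toV]
    rw [e, e]
    have := norms_le hp1 hε1.le hε2.le hdV hdB
    linarith

end
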